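/- The reflection arrangement of the complex reflection group G₂₇ is free with exponents {{1, 19, 25}} but is not inductively free. -/

import Mathlib

open Module Matrix
open scoped Classical

namespace Arrgt

variable {K : Type*} [Field K]

/-- A (central) hyperplane arrangement in `K^n`: a finite set of kernels of
nonzero linear forms. -/
structure Arrangement (K : Type*) [Field K] (n : ℕ) where
  hyperplanes : Finset (Submodule K (Fin n → K))
  isHyp : ∀ H ∈ hyperplanes, ∃ f : (Fin n → K) →ₗ[K] K, f ≠ 0 ∧ H = LinearMap.ker f

/-- The deletion `A \ {H}`. -/
noncomputable def Arrangement.delete {n : ℕ} (A : Arrangement K n) (H : Submodule K (Fin n → K)) :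
    Arrangement K n :=
  ⟨A.hyperplanes.erase H, fun H' hH' => A.isHyp H' (Finset.mem_of_mem_erase hH')⟩

/-- The empty arrangement of rank `n`. -/
def emptyArr (K : Type*) [Field K] (n : ℕ) : Arrangement K n := ⟨∅, by simp⟩

/-- The linear polynomial in `K[x_1,...,x_n]` attached to a linear form. -/
noncomputable def linPoly {n : ℕ} (f : (Fin n → K) →ₗ[K] K) : MvPolynomial (Fin n) K :=
  ∑ i, MvPolynomial.C (f (Pi.single i 1)) * MvPolynomial.X i

/-- `Q` is a defining polynomial of the arrangement `A`: a product of linear forms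
whose kernels are exactly the hyperplanes of `A`. -/
def IsDefiningPoly {n : ℕ} (A : Arrangement K n) (Q : MvPolynomial (Fin n) K) : Prop :=
  ∃ α : Submodule K (Fin n → K) → ((Fin n → K) →ₗ[K] K),
    (∀ H ∈ A.hyperplanes, α H ≠ 0 ∧ LinearMap.ker (α H) = H) ∧
    Q = ∏ H ∈ A.hyperplanes, linPoly (α H)

/-- Evaluation of a derivation at the polynomial `Q`, as a linear map. -/
noncomputable def evalDer {n : ℕ} (Q : MvPolynomial (Fin n) K) :
    Derivation K (MvPolynomial (Fin n) K) (MvPolynomial (Fin n) K) →ₗ[MvPolynomial (Fin n) K]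
      MvPolynomial (Fin n) K where
  toFun θ := θ Q
  map_add' _ _ := rfl
  map_smul' _ _ := rfl

/-- The module `D(A) = {θ : θ(Q) ∈ Q·S}` of `A`-derivations (for a chosen defining
polynomial `Q`). -/
noncomputable def DerModule {n : ℕ} (Q : MvPolynomial (Fin n) K) :
    Submodule (MvPolynomial (Fin n) K)
      (Derivation K (MvPolynomial (Fin n) K) (MvPolynomial (Fin n) K)) :=
  Submodule.comap (evalDer Q) (Ideal.span {Q})

/-- `A` is a free arrangement: `D(A)` is a free module over `S = K[x_1,...,x_n]`. -/
def IsFree {n : ℕ} (A : Arrangement K n) : Prop :=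
  ∃ Q, IsDefiningPoly A Q ∧ Module.Free (MvPolynomial (Fin n) K) (DerModule Q)

/-- A nonzero derivation is homogeneous of polynomial degree `p` if all its
coefficients are homogeneous of degree `p`. -/
def IsHomogeneousDer {n : ℕ}
    (θ : Derivation K (MvPolynomial (Fin n) K) (MvPolynomial (Fin n) K)) (p : ℕ) : Prop :=
  θ ≠ 0 ∧ ∀ i, (θ (MvPolynomial.X i)).IsHomogeneous p

/-- `A` is free with exponents the multiset `e`: `D(A)` has a homogeneous basis whose
polynomial degrees form the multiset `e`. -/
def HasExponents {n : ℕ} (A : Arrangement K n) (e : Multiset ℕ) : Prop :=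
  ∃ Q, IsDefiningPoly A Q ∧
    ∃ (l : List ℕ) (b : Basis (Fin l.length) (MvPolynomial (Fin n) K) (DerModule Q)),
      (l : Multiset ℕ) = e ∧ ∀ i : Fin l.length, IsHomogeneousDer ((b i : DerModule Q) :
        Derivation K (MvPolynomial (Fin n) K) (MvPolynomial (Fin n) K)) (l.get i)

/-- `B` is (a model, via a linear identification `H ≅ K^n`, of) the restriction `A^H`. -/
def IsRestriction {n : ℕ} (A : Arrangement K (n + 1)) (H : Submodule K (Fin (n + 1) → K))
    (B : Arrangement K n) : Prop :=
  ∃ e : H ≃ₗ[K] (Fin n → K),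
    B.hyperplanes = (A.hyperplanes.erase H).image
      (fun H' => Submodule.map (e : H →ₗ[K] (Fin n → K)) (H'.comap H.subtype))

variable (K) in
/-- The class of inductively free arrangements. -/
inductive InductivelyFree : {n : ℕ} → Arrangement K n → Prop
  | empty (n : ℕ) : InductivelyFree (emptyArr K n)
  | add {n : ℕ} (A : Arrangement K (n + 1)) (H : Submodule K (Fin (n + 1) → K))
      (hH : H ∈ A.hyperplanes) (B : Arrangement K n) (hB : IsRestriction A H B)
      (e' e'' : Multiset ℕ)
      (h1 : InductivelyFree (A.delete H)) (h2 : InductivelyFree B)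
      (h3 : HasExponents (A.delete H) e') (h4 : HasExponents B e'')
      (h5 : e'' ≤ e') : InductivelyFree A

variable (K) in
/-- The class of recursively free arrangements. -/
inductive RecursivelyFree : {n : ℕ} → Arrangement K n → Prop
  | empty (n : ℕ) : RecursivelyFree (emptyArr K n)
  | add {n : ℕ} (A : Arrangement K (n + 1)) (H : Submodule K (Fin (n + 1) → K))
      (hH : H ∈ A.hyperplanes) (B : Arrangement K n) (hB : IsRestriction A H B)
      (e' e'' : Multiset ℕ)
      (h1 : RecursivelyFree (A.delete H)) (h2 : RecursivelyFree B)
      (h3 : HasExponents (A.delete H) e') (h4 : HasExponents B e'')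
      (h5 : e'' ≤ e') : RecursivelyFree A
  | del {n : ℕ} (A : Arrangement K (n + 1)) (H : Submodule K (Fin (n + 1) → K))
      (hH : H ∈ A.hyperplanes) (B : Arrangement K n) (hB : IsRestriction A H B)
      (e e'' : Multiset ℕ)
      (h1 : RecursivelyFree A) (h2 : RecursivelyFree B)
      (h3 : HasExponents A e) (h4 : HasExponents B e'')
      (h5 : e'' ≤ e) : RecursivelyFree (A.delete H)

/-- The intersection lattice of a set of hyperplanes: all intersections of finite
subsets (including the ambient space `⊤` as the empty intersection). -/
def setLattice {n : ℕ} (𝓐 : Set (Submodule K (Fin n → K))) : Set (Submodule K (Fin n → K)) :=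
  {X | ∃ s : Finset (Submodule K (Fin n → K)), ↑s ⊆ 𝓐 ∧ X = s.inf id}

/-- The intersection lattice of an arrangement. -/
def Arrangement.lattice {n : ℕ} (A : Arrangement K n) : Set (Submodule K (Fin n → K)) :=
  setLattice (↑A.hyperplanes)

/-- The linear form `x ↦ ∑ v i * x i` attached to a normal vector `v`. -/
noncomputable def lf {n : ℕ} (v : Fin n → K) : (Fin n → K) →ₗ[K] K :=
  ∑ i, v i • LinearMap.proj i

lemma lf_single {n : ℕ} (v : Fin n → K) (j : Fin n) : lf v (Pi.single j 1) = v j := by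
  simp [lf, Pi.single_apply, mul_ite, Finset.sum_ite_eq']

lemma lf_ne_zero {n : ℕ} {v : Fin n → K} (hv : v ≠ 0) : lf v ≠ 0 := by
  intro h
  apply hv
  funext j
  have := congrArg (fun f : (Fin n → K) →ₗ[K] K => f (Pi.single j 1)) h
  simpa [lf_single] using this

/-- The hyperplane `v^⊥` with normal vector `v`. -/
noncomputable def perp {n : ℕ} (v : Fin n → K) : Submodule K (Fin n → K) :=
  LinearMap.ker (lf v)

/-- Build an arrangement from a finite set of nonzero normal vectors. -/
noncomputable def mkArr {n : ℕ} (vs : Finset (Fin n → K)) (h : (0 : Fin n → K) ∉ vs) :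
    Arrangement K n :=
  ⟨vs.image perp, by
    intro H hH
    obtain ⟨v, hv, rfl⟩ := Finset.mem_image.mp hH
    exact ⟨lf v, lf_ne_zero (fun h0 => h (h0 ▸ hv)), rfl⟩⟩

end Arrgt

open Arrgt

/-- The fixed subspace of an invertible matrix acting on `ℂ³`. -/
noncomputable def fixedSp (g : GL (Fin 3) ℂ) : Submodule ℂ (Fin 3 → ℂ) :=
  LinearMap.ker (Matrix.toLin' ((g : Matrix (Fin 3) (Fin 3) ℂ) - 1))

/-- A (complex, possibly non-involutive) reflection: a nonidentity element whose fixed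
space is a hyperplane. -/
def IsReflection (g : GL (Fin 3) ℂ) : Prop :=
  g ≠ 1 ∧ Module.finrank ℂ (fixedSp g) = 2

set_option linter.unusedSectionVars false

/-- Complex `3 × 3` matrices. -/
abbrev M3 := Matrix (Fin 3) (Fin 3) ℂ

lemma exists_diagonalization {M : M3} {n : ℕ} (hn : n ≠ 0) (h : M ^ n = 1) :
    ∃ (P Q : M3) (d : Fin 3 → ℂ), P * Q = 1 ∧ Q * P = 1 ∧ M = P * diagonal d * Q ∧
      ∀ i, d i ^ n = 1 := by
  set s : Module.End ℂ (Fin 3 → ℂ) := toLin' M with hs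
  have hpow : s ^ n = 1 := by
    rw [hs, ← toLin'_pow, h, toLin'_one]; rfl
  have hss : s.IsSemisimple := by
    apply Module.End.isSemisimple_of_squarefree_aeval_eq_zero (p := Polynomial.X ^ n - 1)
    · apply Polynomial.Separable.squarefree
      have := Polynomial.separable_X_pow_sub_C (F := ℂ) (n := n) 1 (by exact_mod_cast hn) one_ne_zero
      simpa using this
    · simp [hpow]
  let eigenDecomp := DirectSum.isInternal_submodule_of_iSupIndep_of_iSup_eq_top
    s.eigenspaces_iSupIndep hss.iSup_eigenspace_eq_top
  let I := (ν : ℂ) × Fin (finrank ℂ (s.eigenspace ν))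
  let v : Basis I ℂ (Fin 3 → ℂ) := eigenDecomp.collectedBasis fun μ ↦ finBasis ℂ (s.eigenspace μ)
  have hI : Fintype I := FiniteDimensional.fintypeBasisIndex v
  have hsv (i : I) : s (v i) = i.1 • v i :=
    Module.End.mem_eigenspace_iff.mp (eigenDecomp.collectedBasis_mem _ i)
  have hc : Fintype.card I = 3 := by
    have := finrank_eq_card_basis v
    simp at this; exact this.symm
  let e : I ≃ Fin 3 := Fintype.equivFinOfCardEq hc
  let b : Basis (Fin 3) ℂ (Fin 3 → ℂ) := v.reindex e
  let d : Fin 3 → ℂ := fun i => (e.symm i).1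
  have hb (i) : s (b i) = d i • b i := by simp [b, d, hsv]
  let P : M3 := (Pi.basisFun ℂ (Fin 3)).toMatrix b
  let Q : M3 := b.toMatrix (Pi.basisFun ℂ (Fin 3))
  have hPQ : P * Q = 1 := Basis.toMatrix_mul_toMatrix_flip _ _
  have hQP : Q * P = 1 := Basis.toMatrix_mul_toMatrix_flip _ _
  have hMP : M * P = P * diagonal d := by
    ext i j
    have := congrFun (hb j) i
    simp only [hs, toLin'_apply, mulVec, dotProduct, Pi.smul_apply, smul_eq_mul] at this
    rw [mul_diagonal, mul_apply]
    simp only [P, Basis.toMatrix_apply, Pi.basisFun_repr]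
    rw [this, mul_comm]
  refine ⟨P, Q, d, hPQ, hQP, ?_, fun i => ?_⟩
  · rw [← hMP, mul_assoc, hPQ, mul_one]
  · have h1 : ∀ k, (s ^ k) (b i) = d i ^ k • b i := by
      intro k
      induction k with
      | zero => simp
      | succ k ih => rw [pow_succ', Module.End.mul_apply, ih, map_smul, hb, smul_smul, pow_succ]
    have h2 := h1 n
    rw [hpow] at h2
    have h3 : (d i ^ n - 1) • b i = 0 := by
      rw [sub_smul, ← h2]; simp
    rcases smul_eq_zero.mp h3 with h | h
    · exact sub_eq_zero.mp h
    · exact absurd h (b.ne_zero i)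

lemma conj_eq_inv_of_pow {z : ℂ} {n : ℕ} (hn : n ≠ 0) (h : z ^ n = 1) :
    (starRingEnd ℂ) z = z⁻¹ := by
  rw [Complex.inv_def]
  have : ‖z‖ = 1 := Complex.norm_eq_one_of_pow_eq_one h hn
  rw [Complex.normSq_eq_norm_sq, this]; simp

lemma trace_conjugate {P Q : M3} (h : Q * P = 1) (D : M3) : trace (P * D * Q) = trace D := by
  rw [trace_mul_comm, ← mul_assoc, h, one_mul]

lemma trace_inv_of_pow {M N : M3} {n : ℕ} (hn : n ≠ 0) (h : M ^ n = 1) (hMN : M * N = 1) :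
    trace N = (starRingEnd ℂ) (trace M) := by
  obtain ⟨P, Q, d, hPQ, hQP, hM, hd⟩ := exists_diagonalization hn h
  have hd0 : ∀ i, d i ≠ 0 := fun i h0 => by
    have := hd i; rw [h0, zero_pow hn] at this; exact zero_ne_one this
  have hN : N = P * diagonal (fun i => (d i)⁻¹) * Q := by
    have h1 : (P * diagonal (fun i => (d i)⁻¹) * Q) * M = 1 := by
      rw [hM]
      calc _ = P * (diagonal (fun i => (d i)⁻¹) * ((Q * P) * diagonal d)) * Q := by
            simp only [mul_assoc]
        _ = 1 := by
            rw [hQP, one_mul, diagonal_mul_diagonal]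
            simp only [inv_mul_cancel₀ (hd0 _)]
            rw [show diagonal (fun _ : Fin 3 => (1:ℂ)) = 1 from diagonal_one, mul_one, hPQ]
    calc N = ((P * diagonal (fun i => (d i)⁻¹) * Q) * M) * N := by rw [h1, one_mul]
      _ = _ := by rw [mul_assoc _ M N, hMN, mul_one]
  rw [hN, hM, trace_conjugate hQP, trace_conjugate hQP, trace_diagonal, trace_diagonal, map_sum]
  exact Finset.sum_congr rfl fun i _ => (conj_eq_inv_of_pow hn (hd i)).symm

section
variable {G : Type*} [Group G] [Finite G] (ρ : G →* M3)

/-- The squared absolute value of the character. -/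
noncomputable def nf (g : G) : ℝ := Complex.normSq (trace (ρ g))

/-- Every matrix commuting with the image of `ρ` is scalar. -/
def Schur (ρ : G →* M3) : Prop :=
  ∀ M : M3, (∀ g, ρ g * M = M * ρ g) → ∃ c : ℂ, M = c • (1 : M3)

lemma rho_pow_card (g : G) : ρ g ^ Nat.card G = 1 := by
  rw [← map_pow, pow_card_eq_one', map_one]

lemma trace_inv (g : G) : trace (ρ g⁻¹) = (starRingEnd ℂ) (trace (ρ g)) :=
  trace_inv_of_pow (n := Nat.card G) Nat.card_pos.ne' (rho_pow_card ρ g)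
    (by rw [← map_mul, mul_inv_cancel, map_one])

lemma nf_nonneg (g : G) : 0 ≤ nf ρ g := Complex.normSq_nonneg _

lemma nf_cast (g : G) : (nf ρ g : ℂ) = trace (ρ g) * trace (ρ g⁻¹) := by
  rw [trace_inv, Complex.mul_conj]; rfl

lemma nf_conj (x g : G) : nf ρ (x * g * x⁻¹) = nf ρ g := by
  unfold nf
  rw [map_mul, map_mul, trace_conjugate]
  rw [← map_mul, inv_mul_cancel, map_one]

lemma trace_rho_conj (x g : G) : trace (ρ (x * g * x⁻¹)) = trace (ρ g) := by
  rw [map_mul, map_mul, trace_conjugate]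
  rw [← map_mul, inv_mul_cancel, map_one]

lemma nf_one : nf ρ 1 = 9 := by
  simp [nf, Complex.normSq]; norm_num

lemma sum_nf [Fintype G] (hS : Schur ρ) : ∑ g, nf ρ g = Nat.card G := by
  have key : ∀ i j : Fin 3, ∑ g, ρ g i i * ρ g⁻¹ j j = if i = j then (Nat.card G : ℂ) / 3 else 0 := by
    intro i j
    set A : M3 := ∑ g, ρ g * single i j 1 * ρ g⁻¹ with hA
    obtain ⟨c, hc⟩ := hS A (by
      intro x
      rw [hA, Finset.mul_sum, Finset.sum_mul]
      refine Fintype.sum_equiv (Equiv.mulLeft x) _ _ fun g => ?_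
      simp only [Equiv.coe_mulLeft, _root_.mul_inv_rev, map_mul, mul_assoc]
      rw [← map_mul ρ x⁻¹ x, inv_mul_cancel, map_one, mul_one])
    have e1 : ∑ g, ρ g i i * ρ g⁻¹ j j = A i j := by
      rw [hA, Matrix.sum_apply]
      refine Finset.sum_congr rfl fun g _ => ?_
      rw [mul_assoc, mul_apply]
      simp [mul_apply, single, Finset.sum_ite_eq, ite_and]
    have e2 : trace A = if i = j then (Nat.card G : ℂ) else 0 := by
      rw [hA, trace_sum]
      have : ∀ g, trace (ρ g * single i j 1 * ρ g⁻¹) = if i = j then (1:ℂ) else 0 := by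
        intro g
        rw [trace_conjugate (by rw [← map_mul, inv_mul_cancel, map_one])]
        split_ifs with h
        · subst h; simp
        · exact trace_single_eq_of_ne _ _ _ h
      simp only [this]
      split_ifs <;> simp
    have e3 : 3 * c = if i = j then (Nat.card G : ℂ) else 0 := by
      rw [← e2, hc]; simp; ring
    rw [e1, hc]
    by_cases hij : i = j
    · subst hij; simp at e3 ⊢; rw [← e3]; ring
    · simp [hij]
  have : ((∑ g, nf ρ g : ℝ) : ℂ) = (Nat.card G : ℂ) := by
    push_cast
    simp only [nf_cast, trace, diag, Finset.sum_mul_sum]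
    rw [Finset.sum_comm]
    simp_rw [Finset.sum_comm (s := Finset.univ (α := G)), key]
    simp
    ring
  exact_mod_cast this

/-- The sum of a character of a finite group is a natural multiple of its order. -/
lemma sum_trace [Fintype G] : ∃ k : ℕ, ∑ g, trace (ρ g) = (Nat.card G : ℂ) * k := by
  set A : M3 := ∑ g, ρ g with hA
  have hn : (Nat.card G : ℂ) ≠ 0 := by exact_mod_cast Nat.card_pos.ne'
  have h1 : ∀ x, ρ x * A = A := by
    intro x
    rw [hA, Finset.mul_sum]
    refine Fintype.sum_equiv (Equiv.mulLeft x) _ _ fun g => ?_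
    simp
  have h2 : A * A = (Nat.card G : ℂ) • A := by
    conv_lhs => rw [hA, Finset.sum_mul]
    simp only [← hA, h1]
    simp [← Nat.cast_smul_eq_nsmul ℂ]
  set E : M3 := (Nat.card G : ℂ)⁻¹ • A with hE
  have h3 : IsIdempotentElem E := by
    unfold IsIdempotentElem
    rw [hE, smul_mul_smul_comm, h2, smul_smul]
    congr 1; field_simp
  have h4 : IsIdempotentElem (toLin' E) := by
    unfold IsIdempotentElem
    rw [Module.End.mul_eq_comp, ← toLin'_mul, h3]
  refine ⟨finrank ℂ (LinearMap.range (toLin' E)), ?_⟩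
  have h5 := (LinearMap.isProj_range_iff_isIdempotentElem _).mpr h4
  have h6 := LinearMap.IsProj.trace h5
  rw [trace_toLin'_eq] at h6
  rw [← trace_sum, ← hA, ← h6, hE, trace_smul, smul_eq_mul]
  field_simp
end

lemma card_modEq_fixed {α : Type*} [Finite α] (f : α → α) {p n : ℕ} [Fact p.Prime]
    (hf : f^[p ^ n] = id) : Nat.card α ≡ Nat.card {x // f x = x} [MOD p] := by
  have := Fintype.ofFinite α
  have h := Equiv.Perm.card_fixedPoints_modEq (α := α) (f := (f : Function.End α)) (p := p) (n := n)
    hf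
  rw [Nat.card_eq_fintype_card, Nat.card_eq_fintype_card]
  refine h.trans ?_
  have e : Fintype.card (Function.fixedPoints f) = Fintype.card {x // f x = x} :=
    Fintype.card_congr (Equiv.refl _)
  exact congrArg (· % p) e

section
variable {G : Type*} [Group G] [Finite G]

/-- The order of the centralizer of `t`. -/
noncomputable def cc (t : G) : ℕ := Nat.card (Subgroup.centralizer {t})

lemma mem_cen {t x : G} : x ∈ Subgroup.centralizer {t} ↔ t * x = x * t := by
  simp [Subgroup.mem_centralizer_iff]

lemma card_modEq_commuting {p n : ℕ} [Fact p.Prime] {g : G} (hg : g ^ p ^ n = 1) (S : Finset G)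
    (hS : ∀ s ∈ S, g * s * g⁻¹ ∈ S) :
    S.card ≡ (S.filter fun s => g * s = s * g).card [MOD p] := by
  let f : S → S := fun s => ⟨g * s * g⁻¹, hS s s.2⟩
  have hf : ∀ k (s : S), ((f^[k] s : S) : G) = g ^ k * s * (g ^ k)⁻¹ := by
    intro k
    induction k with
    | zero => simp
    | succ k ih =>
      intro s
      rw [Function.iterate_succ_apply', pow_succ']
      simp only [f, ih]
      group
  have h := card_modEq_fixed (p := p) (n := n) f (by
    funext s; apply Subtype.ext; rw [hf, hg]; simp)
  rw [Nat.card_eq_fintype_card, Fintype.card_coe] at h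
  refine h.trans (congrArg (· % p) ?_)
  rw [← Fintype.card_coe, ← Nat.card_eq_fintype_card]
  refine Nat.card_congr ⟨fun s => ⟨s.1, ?_⟩, fun s => ⟨⟨s.1, ?_⟩, ?_⟩, ?_, ?_⟩
  · have := congrArg Subtype.val s.2
    simp only [f] at this
    exact Finset.mem_filter.mpr ⟨s.1.2, mul_inv_eq_iff_eq_mul.mp this⟩
  · exact (Finset.mem_filter.mp s.2).1
  · apply Subtype.ext
    exact mul_inv_eq_iff_eq_mul.mpr (Finset.mem_filter.mp s.2).2
  · intro; rfl
  · intro; rfl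

lemma card_conj_eq_le [Fintype G] (t d : G) :
    (Finset.univ.filter fun w : G => w * t * w⁻¹ = d).card ≤ cc t := by
  rcases (Finset.univ.filter fun w : G => w * t * w⁻¹ = d).eq_empty_or_nonempty with h | ⟨w₁, h₁⟩
  · rw [h]; simp
  · have h₁ := (Finset.mem_filter.mp h₁).2
    have : cc t = (Finset.univ.filter fun w : G => t * w = w * t).card := by
      unfold cc
      rw [Nat.card_eq_fintype_card, Fintype.card_subtype]
      congr 1; ext; simp [mem_cen]
    rw [this]
    apply Finset.card_le_card_of_injOn (fun w => w₁⁻¹ * w)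
    · intro w hw
      have hw := (Finset.mem_filter.mp (Finset.mem_coe.mp hw)).2
      simp only [Finset.coe_filter, Finset.mem_univ, true_and, Set.mem_ofPred_eq]
      have e1 : w * t = w₁ * t * w₁⁻¹ * w := by rw [h₁, ← hw]; group
      rw [mul_assoc, e1]; group
    · intro a _ b _ h; exact mul_left_cancel h

/-- Averaging bound for a class function over a set whose fusion is controlled by `t`. -/
lemma card_mul_sum_le [Fintype G] (f : G → ℝ) (hf0 : ∀ g, 0 ≤ f g)
    (hf : ∀ x g, f (x * g * x⁻¹) = f g) (Ω S D : Finset G) (t : G)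
    (hS : ∀ x, ∀ s ∈ Ω, x * s * x⁻¹ ∈ S)
    (hD : ∀ y ∈ Ω, ∀ x, x * y * x⁻¹ ∈ Ω → x * t * x⁻¹ ∈ D) :
    (Nat.card G : ℝ) * ∑ y ∈ Ω, f y ≤ D.card * cc t * ∑ s ∈ S, f s := by
  have h1 : (Nat.card G : ℝ) * ∑ y ∈ Ω, f y = ∑ y ∈ Ω, ∑ x : G, f (x * y * x⁻¹) := by
    simp [hf, Finset.mul_sum, Nat.card_eq_fintype_card]
  have h2 : ∀ y ∈ Ω, ∑ x : G, f (x * y * x⁻¹) =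
      ∑ s ∈ S, ∑ x : G, if x * y * x⁻¹ = s then f s else 0 := by
    intro y hy
    rw [Finset.sum_comm]
    refine Finset.sum_congr rfl fun x _ => ?_
    rw [Finset.sum_ite_eq, if_pos (hS x y hy)]
  rw [h1, Finset.sum_congr rfl h2, Finset.sum_comm, Finset.mul_sum]
  refine Finset.sum_le_sum fun s hs => ?_
  have h3 : ∑ y ∈ Ω, ∑ x : G, (if x * y * x⁻¹ = s then f s else 0) =
      (Finset.univ.filter fun x : G => x⁻¹ * s * x ∈ Ω).card * f s := by
    rw [Finset.sum_comm, Finset.card_filter, Nat.cast_sum, Finset.sum_mul]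
    refine Finset.sum_congr rfl fun x _ => ?_
    have : ∀ y, (x * y * x⁻¹ = s) ↔ (x⁻¹ * s * x = y) := by
      intro y; constructor
      · rintro rfl; group
      · rintro rfl; group
    simp only [this, Finset.sum_ite_eq]
    split_ifs <;> simp
  rw [h3]
  refine mul_le_mul_of_nonneg_right ?_ (hf0 s)
  rcases (Finset.univ.filter fun x : G => x⁻¹ * s * x ∈ Ω).eq_empty_or_nonempty with h | ⟨x₀, h₀⟩
  · rw [h]; simp; positivity
  have h₀ := (Finset.mem_filter.mp h₀).2
  have h4 : (Finset.univ.filter fun x : G => x⁻¹ * s * x ∈ Ω).card ≤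
      (D.biUnion fun d => Finset.univ.filter fun w : G => w * t * w⁻¹ = d).card := by
    apply Finset.card_le_card_of_injOn (fun x => x⁻¹ * x₀)
    · intro x hx
      have hx := (Finset.mem_filter.mp (Finset.mem_coe.mp hx)).2
      simp only [Finset.coe_biUnion, Finset.coe_filter, Finset.mem_univ, true_and,
        Set.mem_iUnion, Set.mem_ofPred_eq, Finset.mem_coe]
      refine ⟨_, hD _ h₀ (x⁻¹ * x₀) ?_, rfl⟩
      convert hx using 1
      group
    · intro a _ b _ h
      exact inv_injective (mul_right_cancel h)
  have h5 : (D.biUnion fun d => Finset.univ.filter fun w : G => w * t * w⁻¹ = d).card ≤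
      D.card * cc t := Finset.card_biUnion_le_card_mul _ _ _ fun d _ => card_conj_eq_le t d
  exact_mod_cast h4.trans h5

end

instance fact_prime_five : Fact (Nat.Prime 5) := ⟨by norm_num⟩

section
variable {G : Type*} [Group G] [Finite G]

lemma card_filter_mem (Q : Subgroup G) [Fintype G] :
    (Finset.univ.filter fun x => x ∈ Q).card = Nat.card Q := by
  rw [Nat.card_eq_fintype_card, Fintype.card_subtype]

lemma card_subgroup_modEq {p n : ℕ} [Fact p.Prime] {g : G} (hg : g ^ p ^ n = 1) (Q : Subgroup G)
    (hQ : ∀ q ∈ Q, g * q * g⁻¹ ∈ Q) :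
    Nat.card Q ≡ Nat.card (Q ⊓ Subgroup.centralizer {g} : Subgroup G) [MOD p] := by
  have := Fintype.ofFinite G
  have h := card_modEq_commuting hg (Finset.univ.filter fun x => x ∈ Q) (by simpa using hQ)
  rw [card_filter_mem] at h
  refine h.trans (congrArg (· % p) ?_)
  rw [← card_filter_mem, Finset.filter_filter]
  congr 1
  ext x; simp [mem_cen]

open scoped Pointwise in
lemma exists_invariant_sylow (K : Subgroup G) [K.Normal] {p q n : ℕ} [Fact p.Prime] [Fact q.Prime]
    (hK : ¬ q ∣ Nat.card K) {g : G} (hg : g ^ q ^ n = 1) :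
    ∃ Q : Subgroup G, Q ≤ K ∧ Nat.card Q = p ^ (Nat.card K).factorization p ∧
      ∀ x ∈ Q, g * x * g⁻¹ ∈ Q := by
  let φ : MulAut K := MulAut.conjNormal g
  let f : Sylow p K → Sylow p K := fun P => φ • P
  have hf : f^[q ^ n] = id := by
    have : ∀ k P, f^[k] P = φ ^ k • P := by
      intro k
      induction k with
      | zero => simp
      | succ k ih => intro P; rw [Function.iterate_succ_apply', ih, pow_succ', mul_smul]
    funext P
    rw [this, ← map_pow, hg]; simp
  have h := card_modEq_fixed f hf
  have h1 : ¬ q ∣ Nat.card (Sylow p K) := fun hd =>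
    hK (hd.trans ((Sylow.card_dvd_index (default : Sylow p K)).trans (Subgroup.index_dvd_card _)))
  have h2 : Nat.card {x // f x = x} ≠ 0 := by
    intro h0
    rw [h0] at h
    exact h1 ((Nat.modEq_zero_iff_dvd).mp h)
  obtain ⟨⟨P, hP⟩, -⟩ := Nat.card_ne_zero.mp h2
  refine ⟨(P : Subgroup K).map K.subtype, Subgroup.map_subtype_le _, ?_, ?_⟩
  · rw [Nat.card_congr ((P : Subgroup K).equivMapOfInjective K.subtype K.subtype_injective).toEquiv.symm]
    exact P.card_eq_multiplicity
  · rintro _ ⟨x, hx, rfl⟩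
    refine ⟨φ x, ?_, by simp [φ]⟩
    have hx' : φ • x ∈ φ • (P : Subgroup K) := Subgroup.smul_mem_pointwise_smul _ _ _ hx
    have e : (φ • (P : Subgroup K)) = P := congrArg (fun R : Sylow p K => (R : Subgroup K)) hP
    rw [e] at hx'
    exact hx'

lemma sq_eq_one_eigen {M : M3} (h : M ^ 2 = 1) (h1 : M ≠ 1) (h2 : M ≠ -1) :
    trace M = 1 ∨ trace M = -1 := by
  obtain ⟨P, Q, d, hPQ, hQP, hM, hd⟩ := exists_diagonalization two_ne_zero h
  have hd' : ∀ i, d i = 1 ∨ d i = -1 := fun i => mul_self_eq_one_iff.mp (by rw [← sq]; exact hd i)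
  have e1 : ¬ (d 0 = 1 ∧ d 1 = 1 ∧ d 2 = 1) := by
    rintro ⟨a, b, c⟩
    apply h1
    have : d = fun _ => 1 := by funext i; fin_cases i <;> simp [a, b, c]
    rw [hM, this, diagonal_one, mul_one, hPQ]
  have e2 : ¬ (d 0 = -1 ∧ d 1 = -1 ∧ d 2 = -1) := by
    rintro ⟨a, b, c⟩
    apply h2
    have : diagonal d = -1 := by
      ext i j; fin_cases i <;> fin_cases j <;> simp [a, b, c]
    rw [hM, this, mul_neg, mul_one, neg_mul, hPQ]
  rw [hM, trace_conjugate hQP, trace_diagonal, Fin.sum_univ_three]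
  rcases hd' 0 with a | a <;> rcases hd' 1 with b | b <;> rcases hd' 2 with c | c <;>
    simp_all

variable (ρ : G →* M3) (hρ : Function.Injective ρ)
include hρ

lemma five_centralizes_two_group {g : G} (hg : g ^ 5 = 1) (Q : Subgroup G) (hQ : Nat.card Q = 16)
    (hinv : ∀ x ∈ Q, g * x * g⁻¹ ∈ Q) : Q ≤ Subgroup.centralizer {g} := by
  have := Fintype.ofFinite G
  have key : ∀ R : Subgroup G, R ≤ Q → R ≠ ⊥ → (∀ x ∈ R, g * x * g⁻¹ ∈ R) →
      Q ⊓ Subgroup.centralizer {g} = ⊥ → R = Q := by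
    intro R hR hR1 hRi hb
    have h := card_subgroup_modEq (p := 5) (n := 1) (by simpa using hg) R hRi
    have h0 : R ⊓ Subgroup.centralizer {g} = ⊥ :=
      le_bot_iff.mp ((inf_le_inf_right _ hR).trans hb.le)
    rw [h0, Subgroup.card_bot] at h
    have hd : Nat.card R ∣ 2 ^ 4 := by
      have := Subgroup.card_dvd_of_le hR; rw [hQ] at this; exact this
    obtain ⟨k, hk, hk'⟩ := (Nat.dvd_prime_pow Nat.prime_two).mp hd
    have hne : Nat.card R ≠ 1 := fun h => hR1 (Subgroup.card_eq_one.mp h)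
    have : Nat.card R = 16 := by
      rw [hk'] at h hne ⊢
      clear hk'
      interval_cases k <;>
        first | rfl | exact absurd rfl hne | exact absurd h (by decide)
    exact Subgroup.eq_of_le_of_card_ge hR (by rw [this, hQ])
  have hd := Subgroup.card_dvd_of_le (inf_le_left : Q ⊓ Subgroup.centralizer {g} ≤ Q)
  have h := card_subgroup_modEq (p := 5) (n := 1) (by simpa using hg) Q hinv
  rw [hQ] at hd h
  obtain ⟨k, hk, hk'⟩ := (Nat.dvd_prime_pow Nat.prime_two).mp (show _ ∣ 2 ^ 4 from hd)
  rw [hk'] at h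
  have hk4 : k = 4 ∨ k = 0 := by
    clear hk'
    interval_cases k <;>
      first | exact Or.inl rfl | exact Or.inr rfl | exact absurd h (by decide)
  rcases hk4 with rfl | rfl
  · have := Subgroup.eq_of_le_of_card_ge (inf_le_left : Q ⊓ Subgroup.centralizer {g} ≤ Q)
      (by rw [hk', hQ]; norm_num)
    exact inf_eq_left.mp this
  exfalso
  have hbot : Q ⊓ Subgroup.centralizer {g} = ⊥ := Subgroup.card_eq_one.mp (by rw [hk', pow_zero])
  have hfix : ∀ x ∈ Q, g * x = x * g → x = 1 := by
    intro x hx hc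
    have : x ∈ Q ⊓ Subgroup.centralizer {g} := ⟨hx, mem_cen.mpr hc⟩
    rw [hbot] at this; exact Subgroup.mem_bot.mp this
  have hp : IsPGroup 2 Q := IsPGroup.of_card (n := 4) (by rw [hQ]; norm_num)
  have hnt : Nontrivial Q := by
    apply (Finite.one_lt_card_iff_nontrivial).mp; rw [hQ]; norm_num
  -- `Q` is abelian
  have hcenter := hp.center_nontrivial
  have hZ : (Subgroup.center Q).map Q.subtype = Q := by
    apply key _ (Subgroup.map_subtype_le _) _ _ hbot
    · intro h
      have h2 := (Subgroup.map_eq_bot_iff_of_injective _ Q.subtype_injective).mp h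
      exact (Subgroup.nontrivial_iff_ne_bot _).mp hcenter h2
    · rintro _ ⟨x, hx, rfl⟩
      refine ⟨⟨g * x * g⁻¹, hinv _ x.2⟩, ?_, rfl⟩
      apply Subgroup.mem_center_iff.mpr
      intro y
      have hy : g⁻¹ * y * g ∈ Q := by
        have e : g⁻¹ = g ^ 4 := by
          rw [inv_eq_iff_mul_eq_one, ← pow_succ']; exact hg
        have : ∀ k : ℕ, g ^ k * y * (g ^ k)⁻¹ ∈ Q := by
          intro k
          induction k with
          | zero => simp
          | succ k ih =>
            have := hinv _ ih
            rw [pow_succ']; convert this using 1; group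
        have h4 := this 4
        rw [← e, inv_inv] at h4; exact h4
      have := congrArg Subtype.val (Subgroup.mem_center_iff.mp hx ⟨_, hy⟩)
      simp only [Subgroup.coe_mul] at this
      apply Subtype.ext
      simp only [Subgroup.coe_mul]
      calc (y : G) * (g * x * g⁻¹) = g * (g⁻¹ * y * g * x) * g⁻¹ := by group
        _ = _ := by rw [this]; group
  have hcomm : ∀ x ∈ Q, ∀ y ∈ Q, x * y = y * x := by
    intro x hx y hy
    rw [← hZ] at hx
    obtain ⟨x', hx', rfl⟩ := hx
    exact (congrArg Subtype.val (Subgroup.mem_center_iff.mp hx' ⟨y, hy⟩)).symm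
  let R : Subgroup G :=
    { carrier := {x | x ∈ Q ∧ x ^ 2 = 1}
      one_mem' := ⟨Q.one_mem, one_pow _⟩
      mul_mem' := by
        rintro a b ⟨ha, ha'⟩ ⟨hb, hb'⟩
        exact ⟨Q.mul_mem ha hb, by rw [(show Commute a b from hcomm _ ha _ hb).mul_pow, ha', hb', one_mul]⟩
      inv_mem' := by
        rintro a ⟨ha, ha'⟩
        exact ⟨Q.inv_mem ha, by rw [inv_pow, ha', inv_one]⟩ }
  have hR : R = Q := by
    apply key R (fun x hx => hx.1) _ _ hbot
    · obtain ⟨x, hx⟩ := exists_prime_orderOf_dvd_card' (G := Q) 2 (by rw [hQ]; norm_num)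
      intro hb
      have : (x : G) ∈ R := ⟨x.2, by
        have := pow_orderOf_eq_one x
        rw [hx] at this; exact congrArg Subtype.val this⟩
      rw [hb] at this
      have : x = 1 := Subtype.ext (Subgroup.mem_bot.mp this)
      rw [this, orderOf_one] at hx
      norm_num at hx
    · rintro x ⟨hx, hx'⟩
      refine ⟨hinv x hx, ?_⟩
      rw [conj_pow, hx']; simp
  have hsq : ∀ x ∈ Q, x ^ 2 = 1 := by
    intro x hx; rw [← hR] at hx; exact hx.2
  have htr : ∀ x ∈ Q, x ≠ 1 → trace (ρ x) = 1 ∨ trace (ρ x) = -1 := by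
    intro x hx hx1
    apply sq_eq_one_eigen
    · rw [← map_pow, hsq x hx, map_one]
    · intro h; exact hx1 (hρ (by rw [h, map_one]))
    · intro h
      apply hx1
      apply hfix x hx
      apply hρ
      rw [map_mul, map_mul, h]; simp
  let A := Finset.univ.filter fun x : G => x ∈ Q ∧ x ≠ 1 ∧ trace (ρ x) = 1
  let B := Finset.univ.filter fun x : G => x ∈ Q ∧ x ≠ 1 ∧ trace (ρ x) = -1
  have hA : A.card ≡ 0 [MOD 5] := by
    have h := card_modEq_commuting (p := 5) (n := 1) (by simpa using hg) A (by
      intro s hs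
      obtain ⟨-, h1, h2, h3⟩ := Finset.mem_filter.mp hs
      refine Finset.mem_filter.mpr ⟨Finset.mem_univ _, hinv s h1, ?_, ?_⟩
      · intro h; apply h2; rwa [conj_eq_one_iff] at h
      · rw [trace_rho_conj, h3])
    rwa [Finset.filter_eq_empty_iff.mpr (by
      intro s hs hc
      obtain ⟨-, h1, h2, h3⟩ := Finset.mem_filter.mp hs
      exact h2 (hfix s h1 hc)), Finset.card_empty] at h
  obtain ⟨k, hk⟩ := sum_trace (ρ.comp Q.subtype)
  have hQs : ∑ x : Q, trace ((ρ.comp Q.subtype) x) =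
      ∑ x ∈ Finset.univ.filter (fun x : G => x ∈ Q), trace (ρ x) := by
    exact (Finset.sum_subtype (Finset.univ.filter fun x : G => x ∈ Q) (by simp) (fun x => trace (ρ x))).symm
  have hun : (Finset.univ.filter fun x : G => x ∈ Q) = {1} ∪ (A ∪ B) := by
    ext x
    simp only [A, B, Finset.mem_filter, Finset.mem_univ, true_and, Finset.mem_union,
      Finset.mem_singleton]
    constructor
    · intro hx
      by_cases h1 : x = 1
      · exact Or.inl h1
      · rcases htr x hx h1 with h | h
        · exact Or.inr (Or.inl ⟨hx, h1, h⟩)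
        · exact Or.inr (Or.inr ⟨hx, h1, h⟩)
    · rintro (rfl | h | h)
      · exact Q.one_mem
      · exact h.1
      · exact h.1
  have hAB : Disjoint A B := by
    rw [Finset.disjoint_filter]
    rintro x - ⟨-, -, h⟩ ⟨-, -, h'⟩
    rw [h] at h'; norm_num at h'
  have h1AB : Disjoint {1} (A ∪ B) := by
    simp [A, B]
  have hcard : 16 = 1 + (A.card + B.card) := by
    rw [← hQ, ← card_filter_mem, hun, Finset.card_union_of_disjoint h1AB,
      Finset.card_union_of_disjoint hAB, Finset.card_singleton]
  have hsum : ((3 : ℂ) + (A.card - B.card)) = 16 * k := by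
    have : Nat.card Q = 16 := hQ
    rw [this, hQs, hun, Finset.sum_union h1AB, Finset.sum_union hAB] at hk
    rw [Finset.sum_congr rfl (fun x hx => (Finset.mem_filter.mp hx).2.2.2 : ∀ x ∈ A, _ = (1:ℂ)),
      Finset.sum_congr rfl (fun x hx => (Finset.mem_filter.mp hx).2.2.2 : ∀ x ∈ B, _ = (-1:ℂ))] at hk
    simp at hk
    rw [← hk]; ring
  have hsum' : 3 + A.card = 16 * k + B.card := by
    have : ((3 + A.card : ℕ) : ℂ) = ((16 * k + B.card : ℕ) : ℂ) := by
      push_cast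
      linear_combination hsum
    exact_mod_cast this
  unfold Nat.ModEq at hA
  omega

/-- An element of order five is central as soon as a normal subgroup of order dividing `432`
has index dividing `5`. -/
lemma five_central (K : Subgroup G) [K.Normal] (hK : Nat.card K ∣ 432)
    (hG : Nat.card G ∣ 5 * Nat.card K) {g : G} (hg : g ^ 5 = 1) (x : G) : g * x = x * g := by
  by_cases hg1 : g = 1
  · simp [hg1]
  have h5 : ¬ 5 ∣ Nat.card K := fun h => by
    have := h.trans hK; norm_num at this
  have hpart : ∀ p, (p = 2 ∨ p = 3) →
      p ^ (Nat.card K).factorization p ∣ cc g := by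
    intro p hp
    have hpp : Fact p.Prime := ⟨by rcases hp with rfl | rfl <;> norm_num⟩
    obtain ⟨Q, hQK, hQc, hQi⟩ := exists_invariant_sylow (p := p) (n := 1) K h5 (by simpa using hg)
    rw [← hQc]
    apply Subgroup.card_dvd_of_le
    have hd := Subgroup.card_dvd_of_le (inf_le_left : Q ⊓ Subgroup.centralizer {g} ≤ Q)
    have hm := card_subgroup_modEq (p := 5) (n := 1) (by simpa using hg) Q hQi
    have hle : p ^ (Nat.card K).factorization p ∣ 432 := (Nat.ordProj_dvd _ _).trans hK
    generalize (Nat.card K).factorization p = a at hQc hle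
    by_cases h16 : Nat.card Q = 16
    · exact five_centralizes_two_group ρ hρ hg Q h16 hQi
    suffices h : Nat.card Q = Nat.card (Q ⊓ Subgroup.centralizer {g} : Subgroup G) from
      inf_eq_left.mp (Subgroup.eq_of_le_of_card_ge inf_le_left h.le)
    rw [hQc] at hd hm h16 ⊢
    obtain ⟨k, hk, hk'⟩ := (Nat.dvd_prime_pow hpp.out).mp hd
    rw [hk'] at hm ⊢
    rcases hp with rfl | rfl
    · have ha : a ≤ 4 := by
        by_contra hcon
        have h : 2 ^ 5 ∣ 432 := (pow_dvd_pow 2 (by omega : 5 ≤ a)).trans hle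
        norm_num at h
      clear hQi hQK
      interval_cases a <;> interval_cases k <;>
        first | rfl | exact absurd rfl h16 | exact absurd hm (by decide)
    · have ha : a ≤ 3 := by
        by_contra hcon
        have h : 3 ^ 4 ∣ 432 := (pow_dvd_pow 3 (by omega : 4 ≤ a)).trans hle
        norm_num at h
      clear hQi hQK
      interval_cases a <;> interval_cases k <;>
        first | rfl | exact absurd rfl h16 | exact absurd hm (by decide)
  have ho : orderOf g = 5 := orderOf_eq_prime hg hg1
  have h5d : 5 ∣ cc g := by
    have : Subgroup.zpowers g ≤ Subgroup.centralizer {g} := by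
      rw [Subgroup.zpowers_le]; exact mem_cen.mpr rfl
    have := Subgroup.card_dvd_of_le this
    rwa [Nat.card_zpowers, ho] at this
  have hKd : Nat.card K ∣ cc g := by
    have h0 : Nat.card K ≠ 0 := Nat.card_pos.ne'
    have hc0 : cc g ≠ 0 := Nat.card_pos.ne'
    rw [← Nat.factorization_prime_le_iff_dvd h0 hc0]
    intro p hp
    by_cases hp' : p = 2 ∨ p = 3
    · exact (hp.pow_dvd_iff_le_factorization hc0).mp (hpart p hp')
    · rw [Nat.factorization_eq_zero_of_not_dvd]
      · exact Nat.zero_le _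
      · intro h
        have : p ∣ 2 ^ 4 * 3 ^ 3 := h.trans (by norm_num; exact hK)
        rcases (Nat.Prime.dvd_mul hp).mp this with h | h
        · exact hp' (Or.inl ((Nat.prime_dvd_prime_iff_eq hp Nat.prime_two).mp (hp.dvd_of_dvd_pow h)))
        · exact hp' (Or.inr ((Nat.prime_dvd_prime_iff_eq hp Nat.prime_three).mp (hp.dvd_of_dvd_pow h)))
  have hcop : Nat.Coprime 5 (Nat.card K) := (Nat.Prime.coprime_iff_not_dvd (by norm_num)).mpr h5
  have hGd : Nat.card G ∣ cc g := hG.trans (hcop.mul_dvd_of_dvd_of_dvd h5d hKd)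
  have htop : Subgroup.centralizer {g} = ⊤ :=
    Subgroup.eq_top_of_card_eq _ (Nat.dvd_antisymm (Subgroup.card_subgroup_dvd_card _) hGd)
  have : x ∈ Subgroup.centralizer {g} := htop ▸ Subgroup.mem_top x
  exact mem_cen.mp this
end

/-- Conjugate of a matrix representation by a change of basis. -/
def conjRep {G : Type*} [Group G] (ρ : G →* M3) (P Q : M3) (hPQ : P * Q = 1) (hQP : Q * P = 1) :
    G →* M3 where
  toFun x := Q * ρ x * P
  map_one' := by rw [map_one, mul_one, hQP]
  map_mul' x y := by
    rw [map_mul]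
    calc Q * (ρ x * ρ y) * P = Q * ρ x * 1 * ρ y * P := by simp only [mul_assoc, one_mul]
      _ = _ := by rw [← hPQ]; simp only [mul_assoc]

section
variable {G : Type*} [Group G] (ρ : G →* M3) (P Q : M3) (hPQ : P * Q = 1) (hQP : Q * P = 1)

lemma conjRep_apply (x : G) : conjRep ρ P Q hPQ hQP x = Q * ρ x * P := rfl

lemma conjRep_of_eq {x : G} {D : M3} (h : ρ x = P * D * Q) : conjRep ρ P Q hPQ hQP x = D := by
  rw [conjRep_apply, h]
  calc Q * (P * D * Q) * P = (Q * P) * D * (Q * P) := by simp only [mul_assoc]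
    _ = D := by rw [hQP, one_mul, mul_one]

lemma conjRep_eq (x : G) : ρ x = P * conjRep ρ P Q hPQ hQP x * Q := by
  rw [conjRep_apply]
  calc ρ x = 1 * ρ x * 1 := by simp
    _ = (P * Q) * ρ x * (P * Q) := by rw [hPQ]
    _ = _ := by simp only [mul_assoc]

lemma conjRep_injective (hρ : Function.Injective ρ) :
    Function.Injective (conjRep ρ P Q hPQ hQP) := fun x y h => hρ (by
  rw [conjRep_eq ρ P Q hPQ hQP, conjRep_eq ρ P Q hPQ hQP y, h])

lemma conjRep_schur (hS : Schur ρ) : Schur (conjRep ρ P Q hPQ hQP) := by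
  intro M hM
  obtain ⟨c, hc⟩ := hS (P * M * Q) (by
    intro x
    rw [conjRep_eq ρ P Q hPQ hQP x]
    set D := conjRep ρ P Q hPQ hQP x
    calc P * D * Q * (P * M * Q) = P * D * (Q * P) * M * Q := by simp only [mul_assoc]
      _ = P * (D * M) * Q := by rw [hQP]; simp only [mul_assoc, one_mul]
      _ = P * (M * 1 * D) * Q := by rw [hM, mul_one]
      _ = _ := by rw [← hQP]; simp only [mul_assoc])
  refine ⟨c, ?_⟩
  calc M = (Q * P) * M * (Q * P) := by rw [hQP]; simp
    _ = Q * (P * M * Q) * P := by simp only [mul_assoc]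
    _ = c • 1 := by rw [hc, mul_smul_comm, mul_one, smul_mul_assoc, hQP]

lemma conjRep_trace (x : G) : trace (conjRep ρ P Q hPQ hQP x) = trace (ρ x) := by
  rw [conjRep_apply, trace_conjugate hPQ]

lemma conjRep_det (x : G) : det (conjRep ρ P Q hPQ hQP x) = det (ρ x) := by
  have h : det P * det Q = 1 := by rw [← det_mul, hPQ, det_one]
  rw [conjRep_apply, det_mul, det_mul]
  linear_combination det (ρ x) * h
end

lemma pow_two_ne_one_of_five {a : ℂ} (h5 : a ^ 5 = 1) (h : a ≠ 1) : a ^ 2 ≠ 1 := fun h2 => by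
  apply h
  have : (a ^ 2) ^ 2 * a = 1 := by rw [← h5]; ring
  rwa [h2, one_pow, one_mul] at this

section
variable {G : Type*} [Group G] [Finite G] (ρ : G →* M3) (hρ : Function.Injective ρ)
include hρ

lemma five_central_of_char (hG : Nat.card G ∣ 2160) (φ : G →* ℂ) {g : G} (hg : g ^ 5 = 1)
    (hφ : φ g ≠ 1) {y : G} (hy : y ^ 5 = 1) (x : G) : y * x = x * y := by
  let ψ : G →* ℂˣ := (φ.toHomUnits) ^ 432
  have hψ5 : ∀ x, ψ x ^ 5 = 1 := by
    intro x
    have h1 : x ^ 2160 = 1 := by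
      obtain ⟨m, hm⟩ := hG
      rw [hm, pow_mul, pow_card_eq_one', one_pow]
    simp only [ψ, MonoidHom.pow_apply, ← pow_mul]
    norm_num
    rw [← map_pow, h1, map_one]
  have hψg : ψ g ≠ 1 := by
    intro h
    have h5 : φ g ^ 5 = 1 := by rw [← map_pow, hg, map_one]
    have h2 : φ g ^ 432 = 1 := by
      have := congrArg Units.val h
      simpa [ψ] using this
    apply pow_two_ne_one_of_five h5 hφ
    calc φ g ^ 2 = (φ g ^ 5) ^ 86 * φ g ^ 2 := by rw [h5]; simp
      _ = φ g ^ 432 := by ring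
      _ = 1 := h2
  have hr : ψ.range ≤ rootsOfUnity 5 ℂ := by
    rintro _ ⟨x, rfl⟩
    exact (mem_rootsOfUnity 5 _).mpr (hψ5 x)
  have hi : ψ.ker.index ∣ 5 := by
    rw [Subgroup.index_ker]
    have := Subgroup.card_dvd_of_le hr
    have h5 : Nat.card (rootsOfUnity 5 ℂ) = 5 := Complex.card_rootsOfUnity 5
    rwa [h5] at this
  have hi5 : ψ.ker.index = 5 := by
    rcases (Nat.dvd_prime (by norm_num)).mp hi with h | h
    · exfalso
      rw [Subgroup.index_eq_one] at h
      apply hψg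
      have : g ∈ ψ.ker := h ▸ Subgroup.mem_top g
      exact this
    · exact h
  have hc := ψ.ker.card_mul_index
  rw [hi5] at hc
  apply five_central ρ hρ ψ.ker _ _ hy
  · apply Nat.dvd_of_mul_dvd_mul_right (k := 5) (by norm_num)
    rw [hc]; exact hG
  · rw [← hc, mul_comm]
omit hρ

lemma mem_zpowers_of_normalizes (hG : Nat.card G ∣ 2160) {g h : G} (hg : g ^ 5 = 1) (hg1 : g ≠ 1)
    (hh : h ^ 5 = 1) (hn : ∀ k : ℤ, ∃ m : ℤ, h * g ^ k * h⁻¹ = g ^ m) : ∃ k : ℕ, h = g ^ k := by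
  have ho : orderOf g = 5 := orderOf_eq_prime hg hg1
  have hc : Nat.card (Subgroup.zpowers g) = 5 := by rw [Nat.card_zpowers, ho]
  let S : Sylow 5 G := Sylow.ofCard (Subgroup.zpowers g) (by
    rw [hc]
    have h1 : (Nat.card G).factorization 5 = 1 := by
      apply le_antisymm
      · by_contra hcon
        have : 5 ^ 2 ∣ 2160 := ((Nat.Prime.pow_dvd_iff_le_factorization (by norm_num)
          Nat.card_pos.ne').mpr (by omega)).trans hG
        norm_num at this
      · apply (Nat.Prime.pow_dvd_iff_le_factorization (by norm_num) Nat.card_pos.ne').mp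
        rw [pow_one, ← hc]
        exact Subgroup.card_subgroup_dvd_card _
    rw [h1, pow_one])
  have hS : (S : Subgroup G) = Subgroup.zpowers g := rfl
  have hp : IsPGroup 5 (Subgroup.zpowers h) := by
    rintro ⟨_, m, rfl⟩
    refine ⟨1, Subtype.ext ?_⟩
    simp only [Subgroup.coe_pow, Subgroup.coe_one]
    rw [pow_one, ← zpow_natCast, ← _root_.zpow_mul, mul_comm, _root_.zpow_mul, zpow_natCast, hh, _root_.one_zpow]
  have hmem : h ∈ Subgroup.zpowers h ⊓ Subgroup.normalizer (Subgroup.zpowers g : Set G) := by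
    refine ⟨Subgroup.mem_zpowers h, ?_⟩
    have hinv : ∀ y, y ∈ Subgroup.zpowers g → h * y * h⁻¹ ∈ Subgroup.zpowers g := by
      rintro _ ⟨k, rfl⟩
      obtain ⟨m, hm⟩ := hn k
      exact ⟨m, hm.symm⟩
    have hpw : ∀ j : ℕ, ∀ y, y ∈ Subgroup.zpowers g → h ^ j * y * (h ^ j)⁻¹ ∈ Subgroup.zpowers g := by
      intro j
      induction j with
      | zero => simp
      | succ j ih =>
        intro y hy
        have := hinv _ (ih y hy)
        rw [pow_succ']; convert this using 1; group
    refine Subgroup.mem_normalizer_iff.mpr fun y => ?_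
    refine ⟨hinv y, fun hy => ?_⟩
    have h4 := hpw 4 _ hy
    convert h4 using 1
    have : h ^ 4 = h⁻¹ := by rw [eq_inv_iff_mul_eq_one, ← pow_succ]; exact hh
    rw [this]; group
  have := IsPGroup.inf_normalizer_sylow hp S
  have h2 : h ∈ Subgroup.zpowers g := (this.le hmem).2
  rw [← mem_powers_iff_mem_zpowers] at h2
  obtain ⟨k, hk⟩ := h2
  exact ⟨k, hk.symm⟩

/-- The stabilizer of the line spanned by `u`. -/
def lineStab (ρ : G →* M3) (u : Fin 3 → ℂ) : Subgroup G where
  carrier := {x | ∃ c : ℂ, ρ x *ᵥ u = c • u}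
  one_mem' := ⟨1, by simp⟩
  mul_mem' := by
    rintro a b ⟨c, hc⟩ ⟨d, hd⟩
    exact ⟨d * c, by rw [map_mul, ← mulVec_mulVec, hd, mulVec_smul, hc, smul_smul]⟩
  inv_mem' := by
    rintro a ⟨c, hc⟩
    refine ⟨c⁻¹, ?_⟩
    have h1 : ρ a⁻¹ *ᵥ (ρ a *ᵥ u) = u := by
      rw [mulVec_mulVec, ← map_mul, inv_mul_cancel, map_one, one_mulVec]
    rw [hc, mulVec_smul] at h1
    by_cases h0 : c = 0
    · rw [h0, zero_smul] at h1; rw [← h1]; simp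
    · conv_rhs => rw [← h1]
      rw [smul_smul, inv_mul_cancel₀ h0, one_smul]

/-- The eigenvalue character on the stabilizer of a line. -/
noncomputable def lineChar (ρ : G →* M3) (u : Fin 3 → ℂ) (j : Fin 3) (hj : u j ≠ 0) :
    lineStab ρ u →* ℂ where
  toFun x := (ρ x *ᵥ u) j / u j
  map_one' := by simp [div_self hj]
  map_mul' := by
    rintro ⟨a, c, hc⟩ ⟨b, d, hd⟩
    have e : ρ (a * b) *ᵥ u = (c * d) • u := by
      rw [map_mul, ← mulVec_mulVec, hd, mulVec_smul, hc, smul_smul, mul_comm]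
    simp only [Subgroup.coe_mul, e, hc, hd, Pi.smul_apply, smul_eq_mul]
    field_simp

/-- A matrix which is conjugate to `diag(1,1,δ)` with `δ ≠ 1`. -/
def Refl (M : M3) : Prop :=
  ∃ (P Q : M3) (δ : ℂ), P * Q = 1 ∧ Q * P = 1 ∧ δ ≠ 1 ∧ M = P * diagonal ![1, 1, δ] * Q

include hρ

lemma det_five (hG : Nat.card G = 2160) (hS : Schur ρ)
    (hgen : Subgroup.closure {r | Refl (ρ r)} = ⊤) {w : G} (hw : w ^ 5 = 1) : det (ρ w) = 1 := by
  have key : ∀ x : G, det (ρ x) ^ 432 = 1 := by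
    intro x
    have hx : x ∈ Subgroup.closure {r | Refl (ρ r)} := hgen ▸ Subgroup.mem_top x
    induction hx using Subgroup.closure_induction with
    | one => simp
    | mul a b _ _ ha hb => rw [map_mul, det_mul, mul_pow, ha, hb, one_mul]
    | inv a _ ha =>
      have h : det (ρ a) * det (ρ a⁻¹) = 1 := by
        rw [← det_mul, ← map_mul, mul_inv_cancel, map_one, det_one]
      calc det (ρ a⁻¹) ^ 432 = (det (ρ a)) ^ 432 * det (ρ a⁻¹) ^ 432 := by rw [ha, one_mul]
        _ = 1 := by rw [← mul_pow, h, one_pow]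
    | mem r hr =>
      obtain ⟨P, Q, δ, hPQ, hQP, hδ, hM⟩ := hr
      by_contra hne
      have h5 : (r ^ 432) ^ 5 = 1 := by
        rw [← pow_mul, show 432 * 5 = Nat.card G by rw [hG], pow_card_eq_one']
      have hdet : det (ρ (r ^ 432)) ≠ 1 := by rwa [map_pow, det_pow]
      have hcen := five_central_of_char ρ hρ (hG ▸ dvd_rfl) (detMonoidHom.comp ρ) h5 hdet h5
      obtain ⟨c, hc⟩ := hS (ρ (r ^ 432)) (fun x => by rw [← map_mul, ← map_mul, hcen])
      have hpow : ρ (r ^ 432) = P * diagonal ![1, 1, δ ^ 432] * Q := by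
        have : ∀ k, ρ (r ^ k) = P * diagonal ![1, 1, δ ^ k] * Q := by
          intro k
          induction k with
          | zero =>
            have : diagonal ![1, 1, δ ^ 0] = (1 : M3) := by
              ext i j; fin_cases i <;> fin_cases j <;> simp
            rw [this, mul_one, hPQ, pow_zero, map_one]
          | succ k ih =>
            rw [pow_succ, map_mul, ih, hM]
            calc _ = P * (diagonal ![1, 1, δ ^ k] * (Q * P) * diagonal ![1, 1, δ]) * Q := by
                  simp only [mul_assoc]
              _ = _ := by
                rw [hQP, mul_one, diagonal_mul_diagonal]
                congr 3
                funext i; fin_cases i <;> simp [pow_succ]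
        exact this 432
      have hD : diagonal ![1, 1, δ ^ 432] = c • (1 : M3) := by
        calc _ = (Q * P) * diagonal ![1, 1, δ ^ 432] * (Q * P) := by rw [hQP]; simp
          _ = Q * (P * diagonal ![1, 1, δ ^ 432] * Q) * P := by simp only [mul_assoc]
          _ = _ := by rw [← hpow, hc, mul_smul_comm, mul_one, smul_mul_assoc, hQP]
      have h0 := congrFun (congrFun hD 0) 0
      simp at h0
      apply hdet
      rw [hc, ← h0]; simp
  have h1 := key w
  have h5 : det (ρ w) ^ 5 = 1 := by rw [← det_pow, ← map_pow, hw, map_one, det_one]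
  by_contra hne
  apply pow_two_ne_one_of_five h5 hne
  calc det (ρ w) ^ 2 = (det (ρ w) ^ 5) ^ 86 * det (ρ w) ^ 2 := by rw [h5]; simp
    _ = det (ρ w) ^ 432 := by ring
    _ = 1 := h1
end

lemma exists_third (i j : Fin 3) (h : i ≠ j) :
    ∃ k, k ≠ i ∧ k ≠ j ∧ ∀ l, l = i ∨ l = j ∨ l = k := by
  revert i j; decide

lemma prod_three {i j k : Fin 3} (hij : i ≠ j) (hki : k ≠ i) (hkj : k ≠ j) (f : Fin 3 → ℂ) :
    ∏ l, f l = f i * f j * f k := by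
  have h : (Finset.univ : Finset (Fin 3)) = {i, j, k} := by
    revert i j k; decide
  rw [h, Finset.prod_insert (by simp [hij, hki.symm]), Finset.prod_pair hkj.symm, mul_assoc]

lemma exists_two_relations (v w : (Fin 3 → ℂ) →ₗ[ℂ] ℂ) : ∃ u, u ≠ 0 ∧ v u = 0 ∧ w u = 0 := by
  let L : (Fin 3 → ℂ) →ₗ[ℂ] (Fin 2 → ℂ) := LinearMap.pi ![v, w]
  have h : LinearMap.ker L ≠ ⊥ := LinearMap.ker_ne_bot_of_finrank_lt (by simp)
  obtain ⟨u, hu, hu0⟩ := (Submodule.ne_bot_iff _).mp h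
  refine ⟨u, hu0, ?_, ?_⟩
  · exact congrFun (LinearMap.mem_ker.mp hu) 0
  · exact congrFun (LinearMap.mem_ker.mp hu) 1

lemma diagonal_pow_eq_one {d : Fin 3 → ℂ} {n : ℕ} (h : (diagonal d : M3) ^ n = 1) (i : Fin 3) :
    d i ^ n = 1 := by
  rw [diagonal_pow] at h
  have := congrFun (congrFun h i) i
  simpa using this

lemma orderOf_five {a : ℂ} (h5 : a ^ 5 = 1) (h : a ≠ 1) : orderOf a = 5 := orderOf_eq_prime h5 h

lemma residues_distinct (a b c : Fin 5) (hab : a ≠ b) (hac : a ≠ c) (hbc : b ≠ c)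
    (h : (a.1 + b.1 + c.1) % 5 = 0) :
    (a.1 = 0 ∧ (b.1 + c.1) % 5 = 0) ∨ (b.1 = 0 ∧ (a.1 + c.1) % 5 = 0) ∨
      (c.1 = 0 ∧ (a.1 + b.1) % 5 = 0) := by
  revert a b c; decide

lemma fifth_roots {d : Fin 3 → ℂ} (hd : ∀ i, d i ^ 5 = 1) (hinj : ∀ i j, i ≠ j → d i ≠ d j)
    (hp : ∏ i, d i = 1) : ∃ (σ : Equiv.Perm (Fin 3)) (z : ℂ), z ^ 5 = 1 ∧ z ≠ 1 ∧
      d ∘ σ = ![1, z, z⁻¹] := by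
  have hξ := Complex.isPrimitiveRoot_exp 5 (by norm_num)
  set ξ := Complex.exp (2 * Real.pi * Complex.I / (5 : ℕ)) with hξd
  have hex : ∀ i, ∃ k : Fin 5, ξ ^ k.1 = d i := fun i => by
    obtain ⟨k, hk, hk'⟩ := hξ.eq_pow_of_pow_eq_one (hd i)
    exact ⟨⟨k, hk⟩, hk'⟩
  choose k hk using hex
  have hkinj : ∀ i j, i ≠ j → k i ≠ k j := fun i j hij h => hinj i j hij (by rw [← hk, ← hk, h])
  have hsum : ((k 0).1 + (k 1).1 + (k 2).1) % 5 = 0 := by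
    rw [Fin.prod_univ_three, ← hk, ← hk, ← hk, ← pow_add, ← pow_add] at hp
    exact Nat.mod_eq_zero_of_dvd (hξ.dvd_of_pow_eq_one _ hp)
  have fin : ∀ i j l : Fin 3, i ≠ j → j ≠ l → i ≠ l → (k i).1 = 0 →
      ((k j).1 + (k l).1) % 5 = 0 → d i = 1 ∧ d j ≠ 1 ∧ d l = (d j)⁻¹ := by
    intro i j l hij hjl hil h0 hs
    have hi : d i = 1 := by rw [← hk, h0, pow_zero]
    refine ⟨hi, fun h => hinj i j hij (by rw [hi, h]), ?_⟩
    apply eq_inv_of_mul_eq_one_left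
    rw [← hk, ← hk, ← pow_add]
    obtain ⟨m, hm⟩ := Nat.dvd_of_mod_eq_zero hs
    rw [add_comm, hm, pow_mul, hξ.pow_eq_one, one_pow]
  rcases residues_distinct _ _ _ (hkinj 0 1 (by decide)) (hkinj 0 2 (by decide))
    (hkinj 1 2 (by decide)) hsum with ⟨h0, hs⟩ | ⟨h0, hs⟩ | ⟨h0, hs⟩
  · obtain ⟨a, b, c⟩ := fin 0 1 2 (by decide) (by decide) (by decide) h0 hs
    exact ⟨1, d 1, hd 1, b, by funext i; fin_cases i <;> simp [a, c]⟩
  · obtain ⟨a, b, c⟩ := fin 1 0 2 (by decide) (by decide) (by decide) h0 hs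
    exact ⟨Equiv.swap 0 1, d 0, hd 0, b, by
      funext i; fin_cases i
      · simp [a]
      · simp
      · simp [c, Equiv.swap_apply_of_ne_of_ne (show (2 : Fin 3) ≠ 0 by decide) (show (2 : Fin 3) ≠ 1 by decide)]⟩
  · obtain ⟨a, b, c⟩ := fin 2 1 0 (by decide) (by decide) (by decide) h0 (by rwa [add_comm])
    exact ⟨Equiv.swap 0 2, d 1, hd 1, b, by
      funext i; fin_cases i
      · simp [a]
      · simp [Equiv.swap_apply_of_ne_of_ne (show (1 : Fin 3) ≠ 0 by decide) (show (1 : Fin 3) ≠ 2 by decide)]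
      · simp [c]⟩

section
variable {G : Type*} [Group G] [Finite G] (ρ : G →* M3) (hρ : Function.Injective ρ)
include hρ

lemma five_distinct_of_diagonal (hG : Nat.card G = 2160) (hS : Schur ρ)
    {g : G} (hg : g ^ 5 = 1) (hg1 : g ≠ 1) (hdet : det (ρ g) = 1) {d : Fin 3 → ℂ}
    (hd : ρ g = diagonal d) {i j : Fin 3} (hij : i ≠ j) : d i ≠ d j := by
  intro hdij
  obtain ⟨k, hki, hkj, hall⟩ := exists_third i j hij
  have hd5 : ∀ l, d l ^ 5 = 1 := diagonal_pow_eq_one (by rw [← hd, ← map_pow, hg, map_one])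
  rw [hd, det_diagonal, prod_three hij hki hkj, ← hdij] at hdet
  have ha : d i ≠ 1 := by
    intro h1
    apply hg1
    apply hρ
    rw [map_one, hd, ← diagonal_one]
    congr 1
    funext l
    rcases hall l with rfl | rfl | rfl
    · exact h1
    · rw [← hdij, h1]
    · rw [h1] at hdet; simpa using hdet
  have hcen : ∀ x, g * x = x * g := by
    intro x
    obtain ⟨u, hu0, huk, huk'⟩ := exists_two_relations (LinearMap.proj k)
      (LinearMap.proj k ∘ₗ (ρ x⁻¹).mulVecLin)
    simp at huk huk'
    have hMu : ∀ y : Fin 3 → ℂ, y k = 0 → ρ g *ᵥ y = d i • y := by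
      intro y hy
      rw [hd]
      funext l
      rw [mulVec_diagonal, Pi.smul_apply, smul_eq_mul]
      rcases hall l with rfl | rfl | rfl
      · rfl
      · rw [hdij]
      · rw [hy]; simp
    have hg' : ρ (x * g * x⁻¹) *ᵥ u = d i • u := by
      rw [map_mul, map_mul, ← mulVec_mulVec, ← mulVec_mulVec, hMu _ huk', mulVec_smul, mulVec_mulVec,
        ← map_mul, mul_inv_cancel, map_one, one_mulVec]
    obtain ⟨l, hl⟩ := Function.ne_iff.mp hu0
    let H := lineStab ρ u
    let gH : H := ⟨g, d i, hMu u huk⟩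
    let gH' : H := ⟨x * g * x⁻¹, d i, hg'⟩
    have hg5 : gH ^ 5 = 1 := Subtype.ext hg
    have hg5' : gH' ^ 5 = 1 := Subtype.ext (by
      change (x * g * x⁻¹) ^ 5 = 1
      rw [conj_pow, hg]; simp)
    have hχ : lineChar ρ u l hl gH = d i := by
      change (ρ g *ᵥ u) l / u l = d i
      rw [hMu u huk, Pi.smul_apply, smul_eq_mul, mul_div_cancel_right₀ _ hl]
    have hχ' : lineChar ρ u l hl gH' = d i := by
      change (ρ (x * g * x⁻¹) *ᵥ u) l / u l = d i
      rw [hg', Pi.smul_apply, smul_eq_mul, mul_div_cancel_right₀ _ hl]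
    have hH : Nat.card H ∣ 2160 := hG ▸ Subgroup.card_subgroup_dvd_card H
    have hcomm := five_central_of_char (ρ.comp H.subtype) (hρ.comp H.subtype_injective) hH
      (lineChar ρ u l hl) hg5 (by rw [hχ]; exact ha) hg5'
    have hgH1 : gH ≠ 1 := fun h => hg1 (congrArg Subtype.val h)
    obtain ⟨m, hm⟩ := mem_zpowers_of_normalizes hH hg5 hgH1 hg5' (fun k => ⟨k, by
      rw [mul_inv_eq_iff_eq_mul]
      exact ((show Commute gH' gH from hcomm gH).zpow_right k).eq⟩)
    have hm1 : d i ^ m = d i ^ 1 := by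
      rw [pow_one]; conv_rhs => rw [← hχ', hm, map_pow, hχ]
    have hm2 : m ≡ 1 [MOD 5] := by
      have h : d i ^ (m + 4) = 1 := by rw [pow_add, hm1, ← pow_add, hd5]
      have h5 := orderOf_dvd_of_pow_eq_one h
      rw [orderOf_five (hd5 i) ha] at h5
      unfold Nat.ModEq; omega
    have hgm : gH ^ m = gH ^ 1 := by
      rw [pow_eq_pow_iff_modEq, orderOf_eq_prime hg5 hgH1]; exact hm2
    rw [hgm, pow_one] at hm
    have := congrArg Subtype.val hm
    change x * g * x⁻¹ = g at this
    rw [mul_inv_eq_iff_eq_mul] at this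
    exact this.symm
  obtain ⟨c, hc⟩ := hS (ρ g) (fun x => by rw [← map_mul, ← map_mul, hcen])
  rw [hd] at hc
  have h1 := congrFun (congrFun hc i) i
  have h2 := congrFun (congrFun hc k) k
  simp at h1 h2
  rw [h2, ← h1] at hdet
  apply ha
  have h5 := hd5 i
  calc d i = (d i * d i * d i) ^ 2 / d i ^ 5 := by
        have : d i ≠ 0 := fun h => by rw [h] at h5; norm_num at h5
        field_simp
    _ = 1 := by rw [hdet, h5]; simp

lemma five_eigen (hG : Nat.card G = 2160) (hS : Schur ρ)
    {g : G} (hg : g ^ 5 = 1) (hg1 : g ≠ 1) (hdet : det (ρ g) = 1) :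
    ∃ (P Q : M3) (z : ℂ), P * Q = 1 ∧ Q * P = 1 ∧ z ^ 5 = 1 ∧ z ≠ 1 ∧
      ρ g = P * diagonal ![1, z, z⁻¹] * Q := by
  obtain ⟨P, Q, d, hPQ, hQP, hM, hd5⟩ := exists_diagonalization (M := ρ g) (n := 5) (by norm_num)
    (by rw [← map_pow, hg, map_one])
  have hD := conjRep_of_eq ρ P Q hPQ hQP hM
  have hdet' : det (conjRep ρ P Q hPQ hQP g) = 1 := by rw [conjRep_det, hdet]
  obtain ⟨σ, z, hz5, hz1, hσ⟩ := fifth_roots hd5 (fun i j hij =>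
    five_distinct_of_diagonal _ (conjRep_injective ρ P Q hPQ hQP hρ) hG (conjRep_schur ρ P Q hPQ hQP hS)
      hg hg1 hdet' hD hij) (by rw [hD, det_diagonal] at hdet'; exact hdet')
  refine ⟨P.submatrix id σ, Q.submatrix σ id, z, ?_, ?_, hz5, hz1, ?_⟩
  · rw [submatrix_mul_equiv, hPQ, submatrix_id_id]
  · rw [← submatrix_mul Q P σ id σ Function.bijective_id, hQP, submatrix_one_equiv]
  · rw [hM, ← hσ, ← submatrix_diagonal_equiv, submatrix_mul_equiv, submatrix_mul_equiv, submatrix_id_id]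
end

section
variable {G : Type*} [Group G] [Finite G]

lemma sum_filter_subgroup [Fintype G] (B : Subgroup G) {R : Type*} [AddCommMonoid R] (f : G → R) :
    ∑ x ∈ Finset.univ.filter (· ∈ B), f x = ∑ x : B, f x := by
  rw [← Finset.sum_subtype (Finset.univ.filter (· ∈ B)) (p := fun x => x ∈ B) (by simp)]

/-- The `i`-th diagonal entry as a character of a subgroup acting diagonally. -/
def diagChar (ρ : G →* M3) (B : Subgroup G) (hB : ∀ x ∈ B, ∃ d, ρ x = diagonal d) (i : Fin 3) :
    B →* ℂ where
  toFun x := ρ x i i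
  map_one' := by simp
  map_mul' x y := by
    obtain ⟨d, hd⟩ := hB x x.2
    obtain ⟨e, he⟩ := hB y y.2
    rw [Subgroup.coe_mul, map_mul, hd, he, diagonal_mul_diagonal]
    simp

/-- The ratio of two diagonal entries as a character of a subgroup acting diagonally. -/
def ratioChar (ρ : G →* M3) (B : Subgroup G) (hB : ∀ x ∈ B, ∃ d, ρ x = diagonal d) (i j : Fin 3) :
    B →* ℂ where
  toFun x := diagChar ρ B hB i x * diagChar ρ B hB j x⁻¹
  map_one' := by simp
  map_mul' x y := by simp only [_root_.mul_inv_rev, map_mul]; ring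

lemma sum_ratioChar (ρ : G →* M3) (B : Subgroup G) [Fintype B]
    (hB : ∀ x ∈ B, ∃ d, ρ x = diagonal d) (i j : Fin 3) :
    ∑ x, ratioChar ρ B hB i j x = ((if ratioChar ρ B hB i j = 1 then (Nat.card B : ℝ) else 0 : ℝ) : ℂ) := by
  split_ifs with h
  · rw [h]; simp
  · rw [sum_hom_units_eq_zero _ h]; simp

lemma sum_nf_eq_ratio (ρ : G →* M3) (B : Subgroup G) [Fintype G]
    (hB : ∀ x ∈ B, ∃ d, ρ x = diagonal d) :
    ∑ x ∈ Finset.univ.filter (· ∈ B), nf ρ x =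
      ∑ i : Fin 3, ∑ j : Fin 3, if ratioChar ρ B hB i j = 1 then (Nat.card B : ℝ) else 0 := by
  rw [sum_filter_subgroup]
  apply Complex.ofReal_injective
  rw [Complex.ofReal_sum, Complex.ofReal_sum]
  simp_rw [Complex.ofReal_sum, ← sum_ratioChar, nf_cast]
  calc ∑ x : B, trace (ρ x) * trace (ρ (x : G)⁻¹)
      = ∑ x : B, ∑ i, ∑ j, ratioChar ρ B hB i j x := Finset.sum_congr rfl fun x _ => by
        simp only [trace, Finset.sum_mul_sum]
        rfl
    _ = _ := by
        rw [Finset.sum_comm]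
        exact Finset.sum_congr rfl fun i _ => Finset.sum_comm

lemma ratioChar_apply_of_eq {ρ : G →* M3} {B : Subgroup G} (hB : ∀ x ∈ B, ∃ d, ρ x = diagonal d)
    {t : G} (ht : t ∈ B) {d : Fin 3 → ℂ} (hd : ρ t = diagonal d) (i j : Fin 3) :
    ratioChar ρ B hB i j ⟨t, ht⟩ * d j = d i := by
  have h : ratioChar ρ B hB i j ⟨t, ht⟩ = ρ t i i * ρ t⁻¹ j j := rfl
  have h1 : ρ t⁻¹ j j * d j = 1 := by
    obtain ⟨e, he⟩ := hB t⁻¹ (B.inv_mem ht)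
    have : ρ t⁻¹ * ρ t = 1 := by rw [← map_mul, inv_mul_cancel, map_one]
    rw [he, hd, diagonal_mul_diagonal] at this
    have := congrFun (congrFun this j) j
    rw [he]; simpa using this
  rw [h, mul_assoc, h1, mul_one, hd, diagonal_apply_eq]

lemma ratioChar_self {ρ : G →* M3} {B : Subgroup G} (hB : ∀ x ∈ B, ∃ d, ρ x = diagonal d)
    (i : Fin 3) : ratioChar ρ B hB i i = 1 := by
  ext x
  exact (map_mul (diagChar ρ B hB i) x x⁻¹).symm.trans (by simp)

/-- The elements of `B` are simultaneously diagonalised by `P`. -/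
def DiagOn (ρ : G →* M3) (B : Subgroup G) (P Q : M3) : Prop :=
  P * Q = 1 ∧ Q * P = 1 ∧ ∀ x ∈ B, ∃ d, ρ x = P * diagonal d * Q

lemma nf_conjRep (ρ : G →* M3) (P Q : M3) (hPQ : P * Q = 1) (hQP : Q * P = 1) (x : G) :
    nf (conjRep ρ P Q hPQ hQP) x = nf ρ x := by
  unfold nf; rw [conjRep_trace]

variable {ρ : G →* M3} {B : Subgroup G} {P Q : M3}

lemma DiagOn.conjRep (h : DiagOn ρ B P Q) : ∀ x ∈ B, ∃ d, conjRep ρ P Q h.1 h.2.1 x = diagonal d :=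
  fun x hx => by
    obtain ⟨d, hd⟩ := h.2.2 x hx
    exact ⟨d, conjRep_of_eq ρ P Q h.1 h.2.1 hd⟩

lemma DiagOn.mono (h : DiagOn ρ B P Q) {A : Subgroup G} (hA : A ≤ B) : DiagOn ρ A P Q :=
  ⟨h.1, h.2.1, fun x hx => h.2.2 x (hA hx)⟩

lemma DiagOn.comm (hρ : Function.Injective ρ) (h : DiagOn ρ B P Q) {x y : G} (hx : x ∈ B)
    (hy : y ∈ B) : x * y = y * x := by
  obtain ⟨d, hd⟩ := h.conjRep x hx
  obtain ⟨e, he⟩ := h.conjRep y hy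
  apply conjRep_injective ρ P Q h.1 h.2.1 hρ
  rw [map_mul, map_mul, hd, he, diagonal_mul_diagonal, diagonal_mul_diagonal]
  congr 1; funext i; ring

lemma DiagOn.sum_nf_separated [Fintype G] (h : DiagOn ρ B P Q)
    (hsep : ∀ i j, i ≠ j → ∃ t ∈ B, ∃ d, ρ t = P * diagonal d * Q ∧ d i ≠ d j) :
    ∑ x ∈ Finset.univ.filter (· ∈ B), nf ρ x = 3 * Nat.card B := by
  rw [← Finset.sum_congr rfl fun x _ => nf_conjRep ρ P Q h.1 h.2.1 x, sum_nf_eq_ratio _ B h.conjRep]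
  have key : ∀ i j, (ratioChar _ B h.conjRep i j = 1) ↔ i = j := fun i j =>
    ⟨fun hr => by
      by_contra hij
      obtain ⟨t, ht, d, hd, hne⟩ := hsep i j hij
      have := ratioChar_apply_of_eq h.conjRep ht (conjRep_of_eq ρ P Q h.1 h.2.1 hd) i j
      rw [hr] at this
      exact hne (by simpa using this.symm), fun hij => by subst hij; exact ratioChar_self _ i⟩
  simp [key]

lemma DiagOn.sum_nf_distinct [Fintype G] (h : DiagOn ρ B P Q) {t : G} (ht : t ∈ B) {d : Fin 3 → ℂ}
    (hd : ρ t = P * diagonal d * Q) (hinj : Function.Injective d) :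
    ∑ x ∈ Finset.univ.filter (· ∈ B), nf ρ x = 3 * Nat.card B :=
  h.sum_nf_separated fun _ _ hij => ⟨t, ht, d, hd, hinj.ne hij⟩

lemma DiagOn.sum_nf_le [Fintype G] (h : DiagOn ρ B P Q) {t : G} (ht : t ∈ B)
    (hn : ∀ c : ℂ, ρ t ≠ c • 1) :
    ∑ x ∈ Finset.univ.filter (· ∈ B), nf ρ x ≤ 5 * Nat.card B := by
  rw [← Finset.sum_congr rfl fun x _ => nf_conjRep ρ P Q h.1 h.2.1 x, sum_nf_eq_ratio _ B h.conjRep]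
  obtain ⟨d, hd⟩ := h.2.2 t ht
  have key : ∀ i j, (if ratioChar _ B h.conjRep i j = 1 then (Nat.card B : ℝ) else 0) ≤
      (if d i = d j then (Nat.card B : ℝ) else 0) := fun i j => by
    split_ifs with hr hij
    · exact le_rfl
    · exfalso; apply hij
      have := ratioChar_apply_of_eq h.conjRep ht (conjRep_of_eq ρ P Q h.1 h.2.1 hd) i j
      rw [hr] at this
      simpa using this.symm
    · exact Nat.cast_nonneg _
    · exact le_rfl
  refine (Finset.sum_le_sum fun i _ => Finset.sum_le_sum fun j _ => key i j).trans ?_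
  have hne : ¬ (d 0 = d 1 ∧ d 1 = d 2) := by
    rintro ⟨h1, h2⟩
    apply hn (d 0)
    have : d = fun _ => d 0 := by
      funext i; fin_cases i
      · rfl
      · exact h1.symm
      · exact (h1.trans h2).symm
    rw [hd, this, show (diagonal fun _ => d 0 : M3) = d 0 • 1 by
      rw [smul_one_eq_diagonal], mul_smul_comm, mul_one, smul_mul_assoc, h.1]
  have hB : (0 : ℝ) ≤ Nat.card B := Nat.cast_nonneg _
  simp only [Fin.sum_univ_three, if_true]
  simp only [eq_comm (a := d 1) (b := d 0), eq_comm (a := d 2) (b := d 0),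
    eq_comm (a := d 2) (b := d 1)]
  by_cases h01 : d 0 = d 1 <;> by_cases h12 : d 1 = d 2 <;> by_cases h02 : d 0 = d 2
  · exact absurd ⟨h01, h12⟩ hne
  · exact absurd ⟨h01, h12⟩ hne
  · exact absurd (h01.symm.trans h02) h12
  · simp only [h01, h12, if_true, if_false]; linarith
  · exact absurd (h02.trans h12.symm) h01
  · simp only [h12, h02, if_true, if_false]; linarith
  all_goals
    have h21 : ¬ d 2 = d 1 := fun h => h12 h.symm
    simp only [h01, h12, h21, h02, if_true, if_false]; linarith

end

lemma commute_diagonal {M : M3} {d : Fin 3 → ℂ} (hd : Function.Injective d)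
    (h : diagonal d * M = M * diagonal d) : M = diagonal fun i => M i i := by
  ext i j
  by_cases hij : i = j
  · subst hij; simp
  · rw [diagonal_apply_ne _ hij]
    have := congrFun (congrFun h i) j
    rw [diagonal_mul, mul_diagonal] at this
    have h2 : (d i - d j) * M i j = 0 := by linear_combination this
    exact (mul_eq_zero.mp h2).resolve_left (sub_ne_zero.mpr (hd.ne hij))

lemma five_cyclotomic {z : ℂ} (h5 : z ^ 5 = 1) (h1 : z ≠ 1) : 1 + z + z ^ 2 + z ^ 3 + z ^ 4 = 0 := by
  have : (z - 1) * (1 + z + z ^ 2 + z ^ 3 + z ^ 4) = 0 := by linear_combination h5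
  exact (mul_eq_zero.mp this).resolve_left (sub_ne_zero.mpr h1)

lemma five_inv {z : ℂ} (h5 : z ^ 5 = 1) : z⁻¹ = z ^ 4 :=
  (eq_inv_of_mul_eq_one_left (by linear_combination h5)).symm

lemma five_injective {z : ℂ} (h5 : z ^ 5 = 1) (h1 : z ≠ 1) :
    Function.Injective (![1, z, z⁻¹] : Fin 3 → ℂ) := by
  have h0 : z ≠ 0 := fun h => by rw [h] at h5; norm_num at h5
  have h4 : z ^ 4 ≠ 1 := fun h => h1 (by linear_combination h5 - z * h)
  have h3 : z ^ 4 ≠ z := fun h => h1 (by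
    have h3 : z ^ 3 = 1 := mul_left_cancel₀ h0 (by linear_combination h)
    linear_combination (z ^ 3 + 1) * h3 - z * h5)
  rw [five_inv h5]
  intro i j hij
  fin_cases i <;> fin_cases j <;> simp at hij ⊢ <;>
    first
    | exact h1 hij
    | exact h1 hij.symm
    | exact h4 hij
    | exact h4 hij.symm
    | exact h3 hij
    | exact h3 hij.symm

section
variable {G : Type*} [Group G] [Finite G]

/-- An element with eigenvalues `1, z, z⁻¹` for a primitive fifth root of unity `z`. -/
def Five (ρ : G →* M3) (g : G) : Prop :=
  ∃ (P Q : M3) (z : ℂ), P * Q = 1 ∧ Q * P = 1 ∧ z ^ 5 = 1 ∧ z ≠ 1 ∧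
      ρ g = P * diagonal ![1, z, z⁻¹] * Q

variable {ρ : G →* M3} {g : G}

lemma diagonal_of_commute {P Q : M3} (hPQ : P * Q = 1) (hQP : Q * P = 1) {d : Fin 3 → ℂ}
    (hd : Function.Injective d) (hg : ρ g = P * diagonal d * Q) {x : G} (hx : g * x = x * g) :
    ∃ e, ρ x = P * diagonal e * Q := by
  have h := congrArg (conjRep ρ P Q hPQ hQP) hx
  rw [map_mul, map_mul, conjRep_of_eq ρ P Q hPQ hQP hg] at h
  exact ⟨_, by rw [← commute_diagonal hd h]; exact conjRep_eq ρ P Q hPQ hQP x⟩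

lemma diagOn_centralizer {P Q : M3} (hPQ : P * Q = 1) (hQP : Q * P = 1) {d : Fin 3 → ℂ}
    (hd : Function.Injective d) (hg : ρ g = P * diagonal d * Q) :
    DiagOn ρ (Subgroup.centralizer {g}) P Q :=
  ⟨hPQ, hQP, fun _ hx => diagonal_of_commute hPQ hQP hd hg (mem_cen.mp hx)⟩

lemma Five.pow_five (hρ : Function.Injective ρ) (h : Five ρ g) : g ^ 5 = 1 := by
  obtain ⟨P, Q, z, hPQ, hQP, h5, h1, hg⟩ := h
  apply conjRep_injective ρ P Q hPQ hQP hρ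
  rw [map_pow, conjRep_of_eq ρ P Q hPQ hQP hg, map_one, diagonal_pow, ← diagonal_one]
  congr 1
  funext i
  fin_cases i <;> simp [h5]

lemma Five.trace_pow (h : Five ρ g) : ∃ z : ℂ, z ^ 5 = 1 ∧ z ≠ 1 ∧
    ∀ k : ℕ, trace (ρ (g ^ k)) = 1 + z ^ k + z ^ (4 * k) := by
  obtain ⟨P, Q, z, hPQ, hQP, h5, h1, hg⟩ := h
  refine ⟨z, h5, h1, fun k => ?_⟩
  rw [← conjRep_trace ρ P Q hPQ hQP, map_pow, conjRep_of_eq ρ P Q hPQ hQP hg, diagonal_pow,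
    trace_diagonal, Fin.sum_univ_three, five_inv h5]
  simp [pow_mul]

lemma Five.ne_one (h : Five ρ g) : g ≠ 1 := by
  rintro rfl
  obtain ⟨P, Q, z, hPQ, hQP, h5, h1, hg⟩ := h
  have := conjRep_of_eq ρ P Q hPQ hQP hg
  rw [map_one, ← diagonal_one, diagonal_eq_diagonal_iff] at this
  exact h1 (by simpa using (this 1).symm)

lemma Five.cen_comm (hρ : Function.Injective ρ) (h : Five ρ g) {x y : G} (hx : g * x = x * g)
    (hy : g * y = y * g) : x * y = y * x := by
  obtain ⟨P, Q, z, hPQ, hQP, h5, h1, hg⟩ := h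
  exact (diagOn_centralizer hPQ hQP (five_injective h5 h1) hg).comm hρ (mem_cen.mpr hx) (mem_cen.mpr hy)

lemma pow_mod_five (hg : g ^ 5 = 1) (k : ℕ) : g ^ k = g ^ (k % 5) := by
  conv_lhs => rw [← Nat.mod_add_div k 5, pow_add, pow_mul, hg, one_pow, mul_one]

lemma zpow_eq_pow_five (hg : g ^ 5 = 1) {y : G} (hy : y ∈ Subgroup.zpowers g) :
    y = 1 ∨ y = g ∨ y = g ^ 2 ∨ y = g ^ 3 ∨ y = g ^ 4 := by
  obtain ⟨k, rfl⟩ := mem_powers_iff_mem_zpowers.mpr hy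
  change g ^ k = 1 ∨ g ^ k = g ∨ g ^ k = g ^ 2 ∨ g ^ k = g ^ 3 ∨ g ^ k = g ^ 4
  rw [pow_mod_five hg]
  have : k % 5 < 5 := Nat.mod_lt _ (by norm_num)
  interval_cases k % 5 <;> simp

lemma five_inv_eq (hg : g ^ 5 = 1) : g⁻¹ = g ^ 4 :=
  (eq_inv_of_mul_eq_one_left (by rw [← pow_succ, hg])).symm

lemma Five.conj_eq (hρ : Function.Injective ρ) (h : Five ρ g) {x : G}
    (hx : x * g * x⁻¹ ∈ Subgroup.zpowers g) : x * g * x⁻¹ = g ∨ x * g * x⁻¹ = g⁻¹ := by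
  have hg := h.pow_five hρ
  obtain ⟨z, h5, h1, ht⟩ := h.trace_pow
  have t1 : trace (ρ (x * g * x⁻¹)) = 1 + z + z ^ 4 := by
    rw [trace_rho_conj]; simpa using ht 1
  have h4 := five_cyclotomic h5 h1
  have bad : z + z ^ 4 ≠ z ^ 2 + z ^ 3 := fun hb => by
    have h0 : z ≠ 0 := fun h => by rw [h] at h5; norm_num at h5
    have h2 : z * ((z - 1) ^ 2 * (z + 1)) = 0 := by linear_combination hb
    rcases mul_eq_zero.mp h2 with h | h
    · exact h0 h
    · rcases mul_eq_zero.mp h with h | h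
      · exact h1 (by have := pow_eq_zero_iff (n := 2) (by norm_num) |>.mp h; linear_combination this)
      · have : z = -1 := by linear_combination h
        rw [this] at h5; norm_num at h5
  rcases zpow_eq_pow_five hg hx with e | e | e | e | e
  · exact absurd (conj_eq_one_iff.mp e) h.ne_one
  · exact Or.inl e
  · exfalso; rw [e, ht 2] at t1
    exact bad (by norm_num at t1; linear_combination -t1 + z ^ 3 * h5)
  · exfalso; rw [e, ht 3] at t1
    exact bad (by norm_num at t1; linear_combination -t1 + (z ^ 7 + z ^ 2) * h5)
  · right; rw [e, five_inv_eq hg]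

lemma Five.exists_not_normalizes (hρ : Function.Injective ρ) (hS : Schur ρ) (h : Five ρ g) :
    ∃ x, x * g * x⁻¹ ∉ Subgroup.zpowers g := by
  by_contra! hall
  have hc := fun x => h.conj_eq hρ (hall x)
  obtain ⟨c, hc⟩ := hS (ρ g + ρ g⁻¹) (fun x => by
    have key : x * g = g * x ∧ x * g⁻¹ = g⁻¹ * x ∨ x * g = g⁻¹ * x ∧ x * g⁻¹ = g * x := by
      rcases hc x with e | e
      · rw [mul_inv_eq_iff_eq_mul] at e
        exact Or.inl ⟨e, ((show Commute x g from e).inv_right).eq⟩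
      · have e' : x * g⁻¹ * x⁻¹ = g := by rw [← conj_inv, e, inv_inv]
        rw [mul_inv_eq_iff_eq_mul] at e e'
        exact Or.inr ⟨e, e'⟩
    rw [mul_add, add_mul, ← map_mul, ← map_mul, ← map_mul, ← map_mul]
    rcases key with ⟨a, b⟩ | ⟨a, b⟩
    · rw [a, b]
    · rw [a, b, add_comm])
  obtain ⟨P, Q, z, hPQ, hQP, h5, h1, hg⟩ := h
  have hg4 : ρ g⁻¹ = ρ g ^ 4 := by
    rw [five_inv_eq (Five.pow_five hρ ⟨P, Q, z, hPQ, hQP, h5, h1, hg⟩), map_pow]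
  rw [hg4] at hc
  have hc2 : diagonal ![1, z, z⁻¹] + diagonal ![1, z, z⁻¹] ^ 4 = c • (1 : M3) := by
    have e := conjRep_of_eq ρ P Q hPQ hQP hg
    rw [← e, ← map_pow, conjRep_apply, conjRep_apply, ← add_mul, ← mul_add, map_pow, hc]
    rw [mul_smul_comm, mul_one, smul_mul_assoc, hQP]
  rw [diagonal_pow, diagonal_add, smul_one_eq_diagonal, diagonal_eq_diagonal_iff] at hc2
  have e0 := hc2 0
  have e1 := hc2 1
  simp at e0 e1
  apply h1
  have h4 := five_cyclotomic h5 h1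
  have e2 : z + z ^ 4 = 2 := by linear_combination e1 - e0
  have : (z - 1) ^ 2 = 0 := by linear_combination z * e2 - h5
  have := pow_eq_zero_iff (n := 2) (by norm_num) |>.mp this
  linear_combination this

lemma card_conj_class [Fintype G] (t : G) :
    (Finset.univ.filter fun x => IsConj t x).card * cc t = Nat.card G := by
  have h := MulAction.card_orbit_mul_card_stabilizer_eq_card_group (ConjAct G) t
  rw [← Nat.card_eq_fintype_card, ← Nat.card_eq_fintype_card, ← Nat.card_eq_fintype_card,
    ← Subgroup.nat_card_centralizer_nat_card_stabilizer] at h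
  rw [show Nat.card (ConjAct G) = Nat.card G from rfl] at h
  rw [← h, cc]
  congr 1
  rw [Nat.card_eq_card_finite_toFinset (Set.toFinite (MulAction.orbit (ConjAct G) t))]
  congr 1
  ext x
  rw [Set.Finite.mem_toFinset, ConjAct.mem_orbit_conjAct]
  rw [Finset.mem_filter_univ, isConj_comm]

lemma card_five (hg : g ^ 5 = 1) (hg1 : g ≠ 1)
    (hc : ∀ x, x * g * x⁻¹ ∈ Subgroup.zpowers g → x * g * x⁻¹ = g ∨ x * g * x⁻¹ = g⁻¹)
    (hn : ∃ n, n * g * n⁻¹ = g⁻¹) {m : ℕ} (hG : Nat.card G = 5 * m) (hm : ¬ 5 ∣ m) :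
    Nat.card G = 2 * cc g * Nat.card (Sylow 5 G) := by
  have := fact_prime_five
  have ho : orderOf g = 5 := orderOf_eq_prime hg hg1
  let P : Sylow 5 G := Sylow.ofCard (Subgroup.zpowers g) (by
    rw [Nat.card_zpowers, ho, hG, Nat.factorization_mul (by norm_num) (by rintro rfl; simp at hm)]
    simp [Nat.Prime.factorization (show Nat.Prime 5 by norm_num),
      Nat.factorization_eq_zero_of_not_dvd hm])
  rw [Sylow.card_eq_index_normalizer P]
  have hP : (P : Set G) = (Subgroup.zpowers g : Set G) := rfl
  set N := Subgroup.normalizer (P : Set G) with hN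
  have hmem : ∀ x, x ∈ N ↔ x * g * x⁻¹ = g ∨ x * g * x⁻¹ = g⁻¹ := by
    intro x
    constructor
    · intro hx
      exact hc x ((Subgroup.mem_normalizer_iff.mp hx g).mp (Subgroup.mem_zpowers g))
    · intro hx
      have hz : Subgroup.zpowers (x * g * x⁻¹) = Subgroup.zpowers g := by
        rcases hx with e | e
        · rw [e]
        · rw [e, Subgroup.zpowers_inv]
      refine Subgroup.mem_normalizer_iff.mpr fun y => ?_
      change y ∈ Subgroup.zpowers g ↔ x * y * x⁻¹ ∈ Subgroup.zpowers g
      conv_rhs => rw [← hz]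
      rw [Subgroup.mem_zpowers_iff, Subgroup.mem_zpowers_iff]
      refine exists_congr fun k => ?_
      rw [conj_zpow]
      constructor
      · rintro rfl; rfl
      · intro e; exact mul_left_cancel (mul_right_cancel e)
  have hle : Subgroup.centralizer {g} ≤ N := fun x hx => (hmem x).mpr (Or.inl (by
    rw [mul_inv_eq_iff_eq_mul]; exact (mem_cen.mp hx).symm))
  have hidx : ((Subgroup.centralizer {g}).subgroupOf N).index = 2 := by
    rw [Subgroup.index_eq_two_iff]
    obtain ⟨n, hn⟩ := hn
    refine ⟨⟨n, (hmem n).mpr (Or.inr hn)⟩, fun b => ?_⟩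
    rw [Subgroup.mem_subgroupOf, Subgroup.mem_subgroupOf, mem_cen, mem_cen]
    have hb := (hmem b).mp b.2
    have hgi : g⁻¹ ≠ g := fun h => hg1 (by
      have h2 : g ^ 2 = 1 := by rw [pow_two]; nth_rewrite 1 [← h]; simp
      calc g = g ^ 5 * (g ^ 2)⁻¹ * (g ^ 2)⁻¹ := by group
        _ = 1 := by rw [hg, h2]; simp)
    have e1 : ∀ y : G, g * y = y * g ↔ y * g * y⁻¹ = g := fun y => by
      rw [mul_inv_eq_iff_eq_mul, eq_comm]
    rw [e1, e1]
    have e2 : ((b * ⟨n, (hmem n).mpr (Or.inr hn)⟩ : N) : G) * g *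
        ((b * ⟨n, (hmem n).mpr (Or.inr hn)⟩ : N) : G)⁻¹ = ((b : G) * g * (b : G)⁻¹)⁻¹ := by
      change b * n * g * (b * n)⁻¹ = _
      rw [conj_inv, ← hn]; group
    rw [e2]
    rcases hb with e | e
    · rw [e]; exact Or.inr ⟨rfl, hgi⟩
    · rw [e, inv_inv]; exact Or.inl ⟨rfl, hgi⟩
  have h1 := Subgroup.card_mul_index ((Subgroup.centralizer {g}).subgroupOf N)
  rw [hidx, Nat.card_congr (Subgroup.subgroupOfEquivOfLe hle).toEquiv] at h1
  have h2 := Subgroup.card_mul_index N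
  rw [← h2, ← h1]
  unfold cc; ring

end

section
variable {G : Type*} [Group G] [Finite G] {ρ : G →* M3}

/-- The determinant character. -/
noncomputable def detChar (ρ : G →* M3) : G →* ℂ := detMonoidHom.comp ρ

lemma mem_ker_detChar {x : G} : x ∈ (detChar ρ).ker ↔ det (ρ x) = 1 := Iff.rfl

lemma exists_five (hG : 5 ∣ Nat.card G) : ∃ g : G, g ^ 5 = 1 ∧ g ≠ 1 := by
  have := fact_prime_five
  obtain ⟨g, hg⟩ := exists_prime_orderOf_dvd_card' 5 hG
  exact ⟨g, by rw [← hg, pow_orderOf_eq_one], fun h => by rw [h, orderOf_one] at hg; norm_num at hg⟩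

lemma dvd_card_five {g : G} (hg : g ^ 5 = 1) (hg1 : g ≠ 1) : 5 ∣ Nat.card G := by
  have := fact_prime_five
  rw [← orderOf_eq_prime hg hg1]; exact orderOf_dvd_natCard g

/-- The Sylow subgroup generated by an element of order five. -/
noncomputable def sylowFive {g : G} (hg : g ^ 5 = 1) (hg1 : g ≠ 1) {m : ℕ} (hG : Nat.card G = 5 * m)
    (hm : ¬ 5 ∣ m) : Sylow 5 G :=
  have := fact_prime_five
  Sylow.ofCard (p := 5) (Subgroup.zpowers g) (by
    rw [Nat.card_zpowers, orderOf_eq_prime hg hg1, hG,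
      Nat.factorization_mul (by norm_num) (by rintro rfl; simp at hm)]
    simp [Nat.Prime.factorization (show Nat.Prime 5 by norm_num),
      Nat.factorization_eq_zero_of_not_dvd hm])

lemma exists_inverting (hρ : Function.Injective ρ) (hG : Nat.card G = 2160) (hS : Schur ρ) {g : G}
    (h : Five ρ g) (hdet : det (ρ g) = 1) : ∃ n, det (ρ n) = 1 ∧ n * g * n⁻¹ = g⁻¹ := by
  by_contra! hno
  have := fact_prime_five
  have hg := h.pow_five hρ
  set K := (detChar ρ).ker with hK
  let gK : K := ⟨g, hdet⟩
  have hgK : gK ^ 5 = 1 := Subtype.ext hg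
  have hgK1 : gK ≠ 1 := fun e => h.ne_one (congrArg Subtype.val e)
  have hKd : Nat.card K ∣ 2160 := hG ▸ Subgroup.card_subgroup_dvd_card K
  obtain ⟨m, hm⟩ := dvd_card_five hgK hgK1
  have hm432 : m ∣ 432 := by
    rw [hm] at hKd
    exact Nat.dvd_of_mul_dvd_mul_left (by norm_num : 0 < 5) hKd
  have hm5 : ¬ 5 ∣ m := fun h5 => by have := h5.trans hm432; norm_num at this
  let P := sylowFive hgK hgK1 hm hm5
  have hP : Subgroup.normalizer (P : Set K) ≤ Subgroup.centralizer (P : Set K) := by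
    intro x hx
    have hxg : x * gK * x⁻¹ ∈ Subgroup.zpowers gK :=
      (Subgroup.mem_normalizer_iff.mp hx gK).mp (Subgroup.mem_zpowers gK)
    have hxg' : (x : G) * g * (x : G)⁻¹ ∈ Subgroup.zpowers g := by
      obtain ⟨k, hk⟩ := hxg
      exact ⟨k, congrArg Subtype.val hk⟩
    have hxx : x * gK * x⁻¹ = gK := by
      rcases h.conj_eq hρ hxg' with e | e
      · exact Subtype.ext e
      · exact absurd e (hno x x.2)
    rw [mul_inv_eq_iff_eq_mul] at hxx
    rw [Subgroup.mem_centralizer_iff]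
    rintro y ⟨k, rfl⟩
    exact ((show Commute x gK from hxx).zpow_right k).symm.eq
  have hcomp := MonoidHom.ker_transferSylow_isComplement' P hP
  set C := (MonoidHom.transferSylow P hP).ker
  have hcard := hcomp.card_mul_card
  have hPc : Nat.card (P : Subgroup K) = 5 := by
    change Nat.card (Subgroup.zpowers gK) = 5
    rw [Nat.card_zpowers, orderOf_eq_prime hgK hgK1]
  rw [hPc, hm] at hcard
  have hCm : Nat.card C = m := by omega
  have hcen := five_central (ρ.comp K.subtype) (hρ.comp K.subtype_injective) C (hCm ▸ hm432)
    (by rw [hm, hCm]) hgK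
  obtain ⟨x, hx⟩ := h.exists_not_normalizes hρ hS
  apply hx
  have hxK : x * g * x⁻¹ ∈ K := (inferInstance : K.Normal).conj_mem g hdet x
  have hcomm : g * (x * g * x⁻¹) = x * g * x⁻¹ * g := congrArg Subtype.val (hcen ⟨_, hxK⟩)
  obtain ⟨k, hk⟩ := mem_zpowers_of_normalizes (hG ▸ dvd_rfl) hg h.ne_one (h := x * g * x⁻¹)
    (by rw [conj_pow, hg]; simp) (fun k => ⟨k, by
      rw [mul_inv_eq_iff_eq_mul]
      exact ((show Commute (x * g * x⁻¹) g from hcomm.symm).zpow_right k).eq⟩)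
  rw [hk]; exact Subgroup.npow_mem_zpowers g k

end

section
variable {G : Type*} [Group G] [Finite G] {ρ : G →* M3}

/-- An element acting as a scalar. -/
def Scal (ρ : G →* M3) (x : G) : Prop := ∃ c : ℂ, ρ x = c • (1 : M3)

/-- The subgroup of elements acting as scalars. -/
def scalars (ρ : G →* M3) : Subgroup G where
  carrier := {x | Scal ρ x}
  one_mem' := ⟨1, by simp⟩
  mul_mem' := by
    rintro x y ⟨c, hc⟩ ⟨d, hd⟩
    exact ⟨c * d, by rw [map_mul, hc, hd, smul_mul_smul_comm, one_mul]⟩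
  inv_mem' := by
    rintro x ⟨c, hc⟩
    have h : ρ x * ρ x⁻¹ = 1 := by rw [← map_mul, mul_inv_cancel, map_one]
    rw [hc, smul_mul_assoc, one_mul] at h
    have hc0 : c ≠ 0 := fun h0 => by
      rw [h0, zero_smul] at h
      exact zero_ne_one h
    exact ⟨c⁻¹, by rw [← h, smul_smul, inv_mul_cancel₀ hc0, one_smul]⟩

lemma Scal.commute (hρ : Function.Injective ρ) {x : G} (h : Scal ρ x) (y : G) : x * y = y * x := by
  obtain ⟨c, hc⟩ := h
  apply hρ
  rw [map_mul, map_mul, hc]; simp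

/-- The elements of the centralizer of `g` killed by `432`. -/
def fivePrimePart (ρ : G →* M3) (hρ : Function.Injective ρ) {g : G} (h : Five ρ g) : Subgroup G where
  carrier := {x | g * x = x * g ∧ x ^ 432 = 1}
  one_mem' := by simp
  mul_mem' := by
    rintro x y ⟨hx, hx'⟩ ⟨hy, hy'⟩
    refine ⟨by rw [← mul_assoc, hx, mul_assoc, hy, mul_assoc], ?_⟩
    rw [(show Commute x y from h.cen_comm hρ hx hy).mul_pow, hx', hy', one_mul]
  inv_mem' := by
    rintro x ⟨hx, hx'⟩
    exact ⟨((show Commute g x from hx).inv_right).eq, by rw [inv_pow, hx', inv_one]⟩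

lemma Five.pow_mem_zpowers (hρ : Function.Injective ρ) (hG : Nat.card G ∣ 2160) {g : G}
    (h : Five ρ g) {x : G} (hx : g * x = x * g) : x ^ 432 ∈ Subgroup.zpowers g := by
  have hc : Commute (x ^ 432) g := ((show Commute g x from hx).symm.pow_left 432)
  obtain ⟨k, hk⟩ := mem_zpowers_of_normalizes hG (h.pow_five hρ) h.ne_one (h := x ^ 432)
    (by rw [← pow_mul]; obtain ⟨m, hm⟩ := hG
        rw [show 432 * 5 = 2160 by norm_num, hm, pow_mul, pow_card_eq_one', one_pow])
    (fun k => ⟨k, by rw [mul_inv_eq_iff_eq_mul]; exact (hc.zpow_right k).eq⟩)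
  rw [hk]; exact Subgroup.npow_mem_zpowers g k

lemma Five.cc_eq (hρ : Function.Injective ρ) (hG : Nat.card G ∣ 2160) {g : G} (h : Five ρ g) :
    cc g = 5 * Nat.card (fivePrimePart ρ hρ h) := by
  have hg := h.pow_five hρ
  let f : Subgroup.centralizer {g} →* G :=
    { toFun := fun x => (x : G) ^ 432
      map_one' := by simp
      map_mul' := fun x y => by
        rw [Subgroup.coe_mul, (show Commute (x : G) y from
          h.cen_comm hρ (mem_cen.mp x.2) (mem_cen.mp y.2)).mul_pow] }
  have hr : f.range = Subgroup.zpowers g := by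
    apply le_antisymm
    · rintro _ ⟨x, rfl⟩
      exact h.pow_mem_zpowers hρ hG (mem_cen.mp x.2)
    · rw [Subgroup.zpowers_le]
      refine ⟨⟨g ^ 3, mem_cen.mpr (by group)⟩, ?_⟩
      change (g ^ 3) ^ 432 = g
      rw [← pow_mul, pow_mod_five hg]; simp
  have hk : f.ker.map (Subgroup.centralizer {g}).subtype = fivePrimePart ρ hρ h := by
    ext x
    constructor
    · rintro ⟨y, hy, rfl⟩
      exact ⟨mem_cen.mp y.2, hy⟩
    · rintro ⟨hx, hx'⟩
      exact ⟨⟨x, mem_cen.mpr hx⟩, hx', rfl⟩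
  have h1 := Subgroup.card_mul_index f.ker
  rw [Subgroup.index_ker, hr, Nat.card_zpowers, show orderOf g = 5 from
    have := fact_prime_five; orderOf_eq_prime hg h.ne_one] at h1
  rw [← hk, Subgroup.card_map_of_injective (Subgroup.subtype_injective _), cc, ← h1, mul_comm]

lemma exists_conj_mem_zpowers {g h : G} (hg : g ^ 5 = 1) (hg1 : g ≠ 1) (hh : h ^ 5 = 1) (hh1 : h ≠ 1)
    {m : ℕ} (hG : Nat.card G = 5 * m) (hm : ¬ 5 ∣ m) : ∃ k, k * h * k⁻¹ ∈ Subgroup.zpowers g := by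
  have := fact_prime_five
  obtain ⟨k, hk⟩ := MulAction.exists_smul_eq G (sylowFive hh hh1 hG hm) (sylowFive hg hg1 hG hm)
  refine ⟨k, ?_⟩
  have hz : h ∈ sylowFive hh hh1 hG hm := Subgroup.mem_zpowers h
  have : k * h * k⁻¹ ∈ sylowFive hg hg1 hG hm := by
    rw [← hk]
    exact ⟨h, hz, rfl⟩
  exact this

lemma Five.decompose (hρ : Function.Injective ρ) (hG : Nat.card G ∣ 2160) {g : G} (h : Five ρ g)
    {x : G} (hx : g * x = x * g) :
    ∃ (k : ℕ) (a : G), x = g ^ k * a ∧ g * a = a * g ∧ a ^ 432 = 1 := by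
  have hg := h.pow_five hρ
  obtain ⟨k, hk⟩ := mem_powers_iff_mem_zpowers.mpr (h.pow_mem_zpowers hρ hG hx)
  change g ^ k = x ^ 432 at hk
  have hc : Commute g x := hx
  refine ⟨3 * k, (g ^ (3 * k))⁻¹ * x, by group, ?_, ?_⟩
  · exact ((((Commute.refl g).pow_right (3 * k)).inv_right).mul_right hc).eq
  · rw [((hc.pow_left (3 * k)).inv_left).mul_pow, ← hk, inv_pow, ← pow_mul,
      show 3 * k * 432 = 5 * (259 * k) + k by ring, pow_add, pow_mul, hg, one_pow, one_mul,
      inv_mul_cancel]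

/-- The elements of order prime to five have bounded contribution unless they are scalars. -/
lemma Five.omega [Fintype G] (hρ : Function.Injective ρ) (hG : Nat.card G ∣ 2160) {g : G} (h : Five ρ g) :
    (Nat.card G : ℝ) * (15 * Nat.card (fivePrimePart ρ hρ h) -
        ∑ x ∈ Finset.univ.filter (· ∈ fivePrimePart ρ hρ h), nf ρ x) ≤
      10 * Nat.card (fivePrimePart ρ hρ h) * ∑ x ∈ Finset.univ.filter (fun x => x ^ 432 ≠ 1), nf ρ x := by
  have hg := h.pow_five hρ
  have hcc := h.cc_eq hρ hG
  have hsum : ∑ x ∈ Finset.univ.filter (· ∈ Subgroup.centralizer {g}), nf ρ x = 3 * cc g := by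
    obtain ⟨P, Q, z, hPQ, hQP, h5, h1, hd⟩ := h
    exact (diagOn_centralizer hPQ hQP (five_injective h5 h1) hd).sum_nf_distinct
      (mem_cen.mpr rfl) hd (five_injective h5 h1)
  set Ω := (Finset.univ.filter (· ∈ Subgroup.centralizer {g})).filter fun x => x ^ 432 ≠ 1 with hΩ
  have hsplit := Finset.sum_filter_add_sum_filter_not
    (Finset.univ.filter (· ∈ Subgroup.centralizer {g})) (fun x => x ^ 432 ≠ 1) (nf ρ)
  have hA' : ((Finset.univ.filter (· ∈ Subgroup.centralizer {g})).filter fun x => ¬ x ^ 432 ≠ 1) =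
      Finset.univ.filter (· ∈ fivePrimePart ρ hρ h) := by
    ext x
    simp only [Finset.mem_filter, Finset.mem_univ, true_and, not_not, mem_cen]
    rfl
  rw [hA', hsum, hcc] at hsplit
  have key := card_mul_sum_le (nf ρ) (nf_nonneg ρ) (nf_conj ρ) Ω
    (Finset.univ.filter (fun x => x ^ 432 ≠ 1)) {g, g⁻¹} g
    (fun x s hs => by
      rw [Finset.mem_filter] at hs ⊢
      refine ⟨Finset.mem_univ _, fun e => hs.2 ?_⟩
      rw [conj_pow] at e
      exact conj_eq_one_iff.mp e)
    (fun y hy x hxy => by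
      simp only [hΩ, Finset.mem_filter, Finset.mem_univ, true_and, mem_cen] at hy hxy
      obtain ⟨k, hk⟩ := h.pow_mem_zpowers hρ hG hy.1
      have h2 := h.pow_mem_zpowers hρ hG hxy.1
      rw [conj_pow] at h2
      have hgy : g ∈ Subgroup.zpowers (y ^ 432) := by
        have hy5 : (y ^ 432) ∈ Subgroup.zpowers g := h.pow_mem_zpowers hρ hG hy.1
        have := fact_prime_five
        have hle : Subgroup.zpowers (y ^ 432) = Subgroup.zpowers g := by
          apply Subgroup.eq_of_le_of_card_ge (Subgroup.zpowers_le.mpr hy5)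
          rw [Nat.card_zpowers, Nat.card_zpowers, orderOf_eq_prime hg h.ne_one,
            orderOf_eq_prime (p := 5) (by rw [← hk]; change (g ^ k) ^ 5 = 1; rw [← zpow_natCast, zpow_comm, zpow_natCast, hg, _root_.one_zpow]) hy.2]
        rw [hle]; exact Subgroup.mem_zpowers g
      obtain ⟨l, hl⟩ := hgy
      have hx : x * g * x⁻¹ ∈ Subgroup.zpowers g := by
        have e : x * g * x⁻¹ = (x * y ^ 432 * x⁻¹) ^ l := by
          rw [conj_zpow, show (y ^ 432) ^ l = g from hl]
        rw [e]
        exact Subgroup.zpow_mem _ h2 l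
      rw [Finset.mem_insert, Finset.mem_singleton]
      exact h.conj_eq hρ hx)
  rw [hcc, Finset.card_pair (fun e => by
    have h2 : g ^ 2 = 1 := by rw [pow_two]; nth_rewrite 1 [e]; simp
    exact h.ne_one (by
      calc g = g ^ 5 * (g ^ 2)⁻¹ * (g ^ 2)⁻¹ := by group
        _ = 1 := by rw [hg, h2]; simp))] at key
  push_cast at key hsplit
  have e1 : ∑ y ∈ Ω, nf ρ y = 15 * Nat.card (fivePrimePart ρ hρ h) -
        ∑ x ∈ Finset.univ.filter (· ∈ fivePrimePart ρ hρ h), nf ρ x := by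
    rw [hΩ]; linarith
  rw [e1] at key
  linarith

end

section
variable {G : Type*} [Group G] [Finite G] {ρ : G →* M3}

lemma smul_one_pow (c : ℂ) (n : ℕ) : (c • (1 : M3)) ^ n = c ^ n • (1 : M3) := by
  rw [smul_pow, one_pow]

lemma smul_one_inj {c d : ℂ} (h : c • (1 : M3) = d • (1 : M3)) : c = d := by
  have := congrFun (congrFun h 0) 0
  simpa using this

lemma det_smul_one (c : ℂ) : det (c • (1 : M3)) = c ^ 3 := by
  rw [det_smul, det_one, mul_one]; rfl

lemma nf_scal {x : G} (h : Scal ρ x) : nf ρ x = 9 := by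
  obtain ⟨c, hc⟩ := h
  have h1 : ρ x * ρ x⁻¹ = 1 := by rw [← map_mul, mul_inv_cancel, map_one]
  rw [hc, smul_mul_assoc, one_mul] at h1
  have h2 := congrArg trace h1
  have : ((nf ρ x : ℝ) : ℂ) = ((9 : ℝ) : ℂ) := by
    rw [nf_cast, hc, trace_smul, smul_eq_mul, trace_one]
    rw [trace_smul, smul_eq_mul, trace_one] at h2
    simp only [Fintype.card_fin] at h2 ⊢
    push_cast at h2 ⊢
    linear_combination 3 * h2
  exact_mod_cast this

lemma Five.primePart_scal (hρ : Function.Injective ρ) (hG : Nat.card G ∣ 2160) (hS : Schur ρ) {g : G}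
    (h : Five ρ g) {x : G} (hx : x ∈ fivePrimePart ρ hρ h) : Scal ρ x := by
  by_contra hns
  have := Fintype.ofFinite G
  have hom := h.omega hρ hG
  have hle : ∑ x ∈ Finset.univ.filter (· ∈ fivePrimePart ρ hρ h), nf ρ x ≤
      5 * Nat.card (fivePrimePart ρ hρ h) := by
    obtain ⟨P, Q, z, hPQ, hQP, h5, h1, hd⟩ := id h
    exact ((diagOn_centralizer hPQ hQP (five_injective h5 h1) hd).mono
      (fun y (hy : y ∈ fivePrimePart ρ hρ h) => mem_cen.mpr (show g * y = y * g ∧ y ^ 432 = 1 from hy).1)).sum_nf_le hx (fun c hc => hns ⟨c, hc⟩)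
  have hall : ∑ x ∈ Finset.univ.filter (fun x : G => x ^ 432 ≠ 1), nf ρ x ≤ Nat.card G - 9 := by
    rw [← sum_nf ρ hS, ← Finset.sum_erase_add _ _ (Finset.mem_univ (1 : G)), nf_one, add_sub_cancel_right]
    apply Finset.sum_le_sum_of_subset_of_nonneg
    · intro y hy
      rw [Finset.mem_filter] at hy
      exact Finset.mem_erase.mpr ⟨fun e => hy.2 (by rw [e, one_pow]), hy.1⟩
    · intros; exact nf_nonneg _ _
  have hpos : (0 : ℝ) < Nat.card (fivePrimePart ρ hρ h) := Nat.cast_pos.mpr Nat.card_pos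
  have hposG : (0 : ℝ) < Nat.card G := Nat.cast_pos.mpr Nat.card_pos
  nlinarith [mul_le_mul_of_nonneg_left hle hposG.le, mul_le_mul_of_nonneg_left hall hpos.le]

lemma Five.five_sum [Fintype G] (hρ : Function.Injective ρ) (hG : Nat.card G ∣ 2160) (hS : Schur ρ) {g : G}
    (h : Five ρ g) :
    3 * (Nat.card G : ℝ) ≤ 5 * ∑ x ∈ Finset.univ.filter (fun x => x ^ 432 ≠ 1), nf ρ x := by
  have hom := h.omega hρ hG
  rw [Finset.sum_congr rfl (fun x hx => nf_scal (h.primePart_scal hρ hG hS (Finset.mem_filter.mp hx).2)),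
    Finset.sum_const, card_filter_mem] at hom
  have hpos : (0 : ℝ) < Nat.card (fivePrimePart ρ hρ h) := Nat.cast_pos.mpr Nat.card_pos
  rw [nsmul_eq_mul] at hom
  have : (Nat.card (fivePrimePart ρ hρ h) : ℝ) * (3 * (Nat.card G : ℝ)) ≤ Nat.card (fivePrimePart ρ hρ h) *
      (5 * ∑ x ∈ Finset.univ.filter (fun x => x ^ 432 ≠ 1), nf ρ x) := by linarith
  exact le_of_mul_le_mul_left this hpos

lemma primePart_eq_scalars (hρ : Function.Injective ρ) (hG : Nat.card G ∣ 2160) (hS : Schur ρ)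
    (hdet : ∀ w : G, w ^ 5 = 1 → det (ρ w) = 1) {g : G} (h : Five ρ g) :
    fivePrimePart ρ hρ h = scalars ρ := by
  apply le_antisymm
  · intro x hx; exact h.primePart_scal hρ hG hS hx
  · intro x hx
    refine ⟨(hx.commute hρ g).symm, ?_⟩
    have h5 : (x ^ 432) ^ 5 = 1 := by
      rw [← pow_mul]; obtain ⟨m, hm⟩ := hG
      rw [show 432 * 5 = 2160 by norm_num, hm, pow_mul, pow_card_eq_one', one_pow]
    obtain ⟨c, hc⟩ := (scalars ρ).pow_mem hx 432
    have h3 := hdet _ h5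
    rw [hc, det_smul_one] at h3
    have hc5 : c ^ 5 = 1 := by
      have := congrArg ρ h5
      rw [map_pow, hc, map_one, smul_one_pow] at this
      exact smul_one_inj (this.trans (one_smul ℂ _).symm)
    have hc1 : c = 1 := by linear_combination (-c) * hc5 + (c ^ 3 + 1) * h3
    apply hρ
    rw [hc, hc1, map_one, one_smul]

lemma Five.frattini (hρ : Function.Injective ρ) (hG : Nat.card G = 2160) (hS : Schur ρ) {g : G}
    (h : Five ρ g) (hdet : det (ρ g) = 1) (w : G) : ∃ a, Scal ρ a ∧ det (ρ w) = det (ρ a) := by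
  have hG' : Nat.card G ∣ 2160 := hG ▸ dvd_rfl
  have hg := h.pow_five hρ
  set K := (detChar ρ).ker with hK
  let gK : K := ⟨g, hdet⟩
  let hKe : K := ⟨w * g * w⁻¹, (inferInstance : K.Normal).conj_mem g hdet w⟩
  have hgK : gK ^ 5 = 1 := Subtype.ext hg
  have hgK1 : gK ≠ 1 := fun e => h.ne_one (congrArg Subtype.val e)
  have hKd : Nat.card K ∣ 2160 := hG ▸ Subgroup.card_subgroup_dvd_card K
  obtain ⟨m, hm⟩ := dvd_card_five hgK hgK1
  have hm432 : m ∣ 432 := by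
    rw [hm] at hKd
    exact Nat.dvd_of_mul_dvd_mul_left (by norm_num : 0 < 5) hKd
  have hm5 : ¬ 5 ∣ m := fun h5 => by have := h5.trans hm432; norm_num at this
  obtain ⟨k, hk⟩ := exists_conj_mem_zpowers (h := hKe) hgK hgK1 (Subtype.ext (by
      change (w * g * w⁻¹) ^ 5 = 1; rw [conj_pow, hg]; simp)) (fun e => h.ne_one (by
      have : w * g * w⁻¹ = 1 := congrArg Subtype.val e
      exact conj_eq_one_iff.mp this)) hm hm5
  have hx : ((k : G) * w) * g * ((k : G) * w)⁻¹ ∈ Subgroup.zpowers g := by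
    obtain ⟨l, hl⟩ := hk
    refine ⟨l, (congrArg Subtype.val hl).trans ?_⟩
    change (k : G) * (w * g * w⁻¹) * (k : G)⁻¹ = _
    group
  have hkd : det (ρ (k : G)) = 1 := k.2
  obtain ⟨x, hxd, hxc⟩ : ∃ x, det (ρ x) = det (ρ w) ∧ x * g * x⁻¹ = g := by
    rcases h.conj_eq hρ hx with e | e
    · exact ⟨k * w, by rw [map_mul, det_mul, hkd, one_mul], e⟩
    · obtain ⟨n, hnd, hn⟩ := exists_inverting hρ hG hS h hdet
      refine ⟨n * (k * w), by rw [map_mul, map_mul, det_mul, det_mul, hkd, hnd, one_mul, one_mul], ?_⟩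
      calc n * (k * w) * g * (n * (k * w))⁻¹ = n * ((k * w) * g * (k * w)⁻¹) * n⁻¹ := by group
        _ = g := by rw [e, ← conj_inv, hn, inv_inv]
  obtain ⟨j, a, hja, hag, ha⟩ := h.decompose hρ hG' (x := x) (by
    rw [mul_inv_eq_iff_eq_mul] at hxc; exact hxc.symm)
  refine ⟨a, h.primePart_scal hρ hG' hS ⟨hag, ha⟩, ?_⟩
  rw [← hxd, hja, map_mul, det_mul, map_pow, det_pow, hdet, one_pow, one_mul]

lemma Five.card_scalars (hρ : Function.Injective ρ) (hG : Nat.card G = 2160) (hS : Schur ρ) {g : G}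
    (h : Five ρ g) (hdet : det (ρ g) = 1) (hcc : cc g = 5 * Nat.card (scalars ρ)) :
    Nat.card (scalars ρ) = 1 ∨ Nat.card (scalars ρ) = 6 ∨ Nat.card (scalars ρ) = 36 := by
  have := fact_prime_five
  have hg := h.pow_five hρ
  obtain ⟨n, -, hn⟩ := exists_inverting hρ hG hS h hdet
  have hG5 : Nat.card G = 5 * 432 := hG
  have h1 := card_five hg h.ne_one (fun x hx => h.conj_eq hρ hx) ⟨n, hn⟩ hG5 (by norm_num)
  have h2 := card_sylow_modEq_one 5 G
  have h3 : Nat.card (Sylow 5 G) ≠ 1 := by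
    intro h1
    obtain ⟨x, hx⟩ := h.exists_not_normalizes hρ hS
    apply hx
    have : Subsingleton (Sylow 5 G) := (Nat.card_eq_one_iff_unique.mp h1).1
    exact (Sylow.normal_of_subsingleton (sylowFive hg h.ne_one hG5 (by norm_num))).conj_mem g
      (Subgroup.mem_zpowers g) x
  rw [hG, hcc] at h1
  set s := Nat.card (Sylow 5 G)
  set z := Nat.card (scalars ρ)
  have h4 : z * s = 216 := by nlinarith
  have hz : z ∈ Nat.divisors 216 := Nat.mem_divisors.mpr ⟨⟨s, h4.symm⟩, by norm_num⟩
  unfold Nat.ModEq at h2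
  have hd : Nat.divisors 216 = {1, 2, 3, 4, 6, 8, 9, 12, 18, 24, 27, 36, 54, 72, 108, 216} := by decide +kernel
  rw [hd] at hz
  simp only [Finset.mem_insert, Finset.mem_singleton] at hz
  rcases hz with e | e | e | e | e | e | e | e | e | e | e | e | e | e | e | e <;> rw [e] at h4 ⊢ <;> omega

end

section
variable {G : Type*} [Group G] [Finite G] {ρ : G →* M3}

lemma refl_pow {r : G} {P Q : M3} {δ : ℂ} (hPQ : P * Q = 1) (hQP : Q * P = 1)
    (hr : ρ r = P * diagonal ![1, 1, δ] * Q) (k : ℕ) : ρ (r ^ k) = P * diagonal ![1, 1, δ ^ k] * Q := by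
  induction k with
  | zero =>
    have : diagonal ![1, 1, δ ^ 0] = (1 : M3) := by
      ext i j; fin_cases i <;> fin_cases j <;> simp
    rw [this, mul_one, hPQ, pow_zero, map_one]
  | succ k ih =>
    rw [pow_succ, map_mul, ih, hr]
    calc _ = P * (diagonal ![1, 1, δ ^ k] * (Q * P) * diagonal ![1, 1, δ]) * Q := by
          simp only [mul_assoc]
      _ = _ := by
        rw [hQP, mul_one, diagonal_mul_diagonal]
        congr 3
        funext i; fin_cases i <;> simp [pow_succ]

lemma refl_trace {r : G} {P Q : M3} {δ : ℂ} (hQP : Q * P = 1)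
    (hr : ρ r = P * diagonal ![1, 1, δ] * Q) : trace (ρ r) = 2 + δ := by
  rw [hr, trace_conjugate hQP, trace_diagonal, Fin.sum_univ_three]
  simp; norm_num

lemma refl_det {r : G} {P Q : M3} {δ : ℂ} (hPQ : P * Q = 1)
    (hr : ρ r = P * diagonal ![1, 1, δ] * Q) : det (ρ r) = δ := by
  have : det P * det Q = 1 := by rw [← det_mul, hPQ, det_one]
  rw [hr, det_mul, det_mul, det_diagonal, Fin.prod_univ_three]
  simp only [cons_val]
  linear_combination δ * this

lemma refl_not_scal {r : G} {P Q : M3} {δ : ℂ} (hQP : Q * P = 1) (hδ : δ ≠ 1)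
    (hr : ρ r = P * diagonal ![1, 1, δ] * Q) : ¬ Scal ρ r := by
  rintro ⟨c, hc⟩
  have hD : diagonal ![1, 1, δ] = c • (1 : M3) := by
    calc _ = (Q * P) * diagonal ![1, 1, δ] * (Q * P) := by rw [hQP]; simp
      _ = Q * (P * diagonal ![1, 1, δ] * Q) * P := by simp only [mul_assoc]
      _ = _ := by rw [← hr, hc, mul_smul_comm, mul_one, smul_mul_assoc, hQP]
  have h0 := congrFun (congrFun hD 0) 0
  have h2 := congrFun (congrFun hD 2) 2
  simp at h0 h2
  exact hδ (h2.trans h0.symm)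

lemma exists_scalar {n : ℕ} (hρ : Function.Injective ρ) (hn : Nat.card (scalars ρ) = n) {c : ℂ}
    (hc : c ^ n = 1) : ∃ a, ρ a = c • (1 : M3) := by
  have := Fintype.ofFinite (scalars ρ)
  have hn0 : 0 < n := hn ▸ Nat.card_pos
  let f : scalars ρ → ℂ := fun x => ρ x 0 0
  have hf : ∀ x : scalars ρ, ρ (x : G) = f x • (1 : M3) := by
    rintro ⟨x, c, hc⟩
    have : f ⟨x, c, hc⟩ = c := by change ρ x 0 0 = c; rw [hc]; simp
    rw [this]; exact hc
  have hinj : Function.Injective f := by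
    intro x y h
    apply Subtype.ext; apply hρ
    rw [hf x, hf y, h]
  have hsub : Finset.univ.image f ⊆ (Polynomial.nthRoots n (1 : ℂ)).toFinset := by
    intro z hz
    obtain ⟨x, -, rfl⟩ := Finset.mem_image.mp hz
    rw [Multiset.mem_toFinset, Polynomial.mem_nthRoots hn0]
    have h1 : x ^ n = 1 := by rw [← hn, pow_card_eq_one']
    have h2 : ρ ((x : G) ^ n) = 1 := by
      rw [← Subgroup.coe_pow, h1, Subgroup.coe_one, map_one]
    rw [map_pow, hf, smul_one_pow] at h2
    exact smul_one_inj (h2.trans (one_smul ℂ _).symm)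
  have heq := Finset.eq_of_subset_of_card_le hsub (by
    rw [Finset.card_image_of_injective _ hinj, Finset.card_univ, ← Nat.card_eq_fintype_card, hn]
    exact (Multiset.toFinset_card_le _).trans (Polynomial.card_nthRoots n 1))
  have hmem : c ∈ Finset.univ.image f := by
    rw [heq, Multiset.mem_toFinset, Polynomial.mem_nthRoots hn0, hc]
  obtain ⟨x, -, rfl⟩ := Finset.mem_image.mp hmem
  exact ⟨x, hf x⟩

lemma scal_pow_card {a : G} {c : ℂ} (ha : ρ a = c • (1 : M3)) :
    c ^ Nat.card (scalars ρ) = 1 := by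
  have h1 : (⟨a, c, ha⟩ : scalars ρ) ^ Nat.card (scalars ρ) = 1 := pow_card_eq_one'
  have h2 : ρ (a ^ Nat.card (scalars ρ)) = 1 := by
    rw [show a ^ Nat.card (scalars ρ) = 1 from congrArg Subtype.val h1, map_one]
  rw [map_pow, ha, smul_one_pow] at h2
  exact smul_one_inj (h2.trans (one_smul ℂ _).symm)

lemma det_pow_eq_one (hgen : Subgroup.closure {r | Refl (ρ r)} = ⊤) {n : ℕ}
    (h : ∀ r, Refl (ρ r) → det (ρ r) ^ n = 1) (x : G) : det (ρ x) ^ n = 1 := by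
  have hx : x ∈ Subgroup.closure {r | Refl (ρ r)} := hgen ▸ Subgroup.mem_top x
  induction hx using Subgroup.closure_induction with
  | one => simp
  | mul a b _ _ ha hb => rw [map_mul, det_mul, mul_pow, ha, hb, one_mul]
  | inv a _ ha =>
    have h : det (ρ a) * det (ρ a⁻¹) = 1 := by
      rw [← det_mul, ← map_mul, mul_inv_cancel, map_one, det_one]
    calc det (ρ a⁻¹) ^ n = (det (ρ a)) ^ n * det (ρ a⁻¹) ^ n := by rw [ha, one_mul]
      _ = 1 := by rw [← mul_pow, h, one_pow]
  | mem r hr => exact h r hr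

lemma exists_refl (hG : Nat.card G = 2160) (hgen : Subgroup.closure {r | Refl (ρ r)} = ⊤) :
    ∃ r, Refl (ρ r) := by
  by_contra! h
  rw [show {r | Refl (ρ r)} = ∅ from Set.eq_empty_of_forall_notMem h, Subgroup.closure_empty] at hgen
  have := Subgroup.card_top (G := G)
  rw [← hgen, hG, Subgroup.card_bot] at this
  norm_num at this

lemma card_scalars_ne_one (hG : Nat.card G = 2160)
    (hgen : Subgroup.closure {r | Refl (ρ r)} = ⊤)
    (hfr : ∀ w, ∃ a, Scal ρ a ∧ det (ρ w) = det (ρ a)) : Nat.card (scalars ρ) ≠ 1 := by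
  intro h1
  obtain ⟨r, P, Q, δ, hPQ, hQP, hδ, hr⟩ := exists_refl hG hgen
  obtain ⟨a, ⟨c, hc⟩, ha⟩ := hfr r
  have := scal_pow_card hc
  rw [h1, pow_one] at this
  rw [refl_det hPQ hr, hc, det_smul_one, this, one_pow] at ha
  exact hδ ha

lemma card_scalars_ne_thirtysix (hG : Nat.card G = 2160) (hρ : Function.Injective ρ) (hS : Schur ρ)
    (hgen : Subgroup.closure {r | Refl (ρ r)} = ⊤) {g : G} (h5 : Five ρ g)
    (hfive : ∀ w : G, w ^ 5 = 1 → w ≠ 1 → Five ρ w)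
    (hfr : ∀ w, ∃ a, Scal ρ a ∧ det (ρ w) = det (ρ a)) : Nat.card (scalars ρ) ≠ 36 := by
  intro h36
  have hG' : Nat.card G ∣ 2160 := hG ▸ dvd_rfl
  obtain ⟨r, P, Q, δ, hPQ, hQP, hr, hδ6⟩ : ∃ (r : G) (P Q : M3) (δ : ℂ), P * Q = 1 ∧ Q * P = 1 ∧
      ρ r = P * diagonal ![1, 1, δ] * Q ∧ δ ^ 6 ≠ 1 := by
    by_contra! hno
    have hall := det_pow_eq_one (n := 6) hgen (fun r ⟨P, Q, δ, hPQ, hQP, hδ, hr⟩ => by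
      rw [refl_det hPQ hr]; exact hno r P Q δ hPQ hQP hr)
    have hprim := Complex.isPrimitiveRoot_exp 36 (by norm_num)
    obtain ⟨a, ha⟩ := exists_scalar hρ h36 hprim.pow_eq_one
    have := hall a
    rw [ha, det_smul_one, ← pow_mul] at this
    have := (hprim.dvd_of_pow_eq_one _ this)
    norm_num at this
  have hδ12 : δ ^ 12 = 1 := by
    obtain ⟨a, ⟨c, hc⟩, ha⟩ := hfr r
    rw [refl_det hPQ hr, hc, det_smul_one] at ha
    have := scal_pow_card hc
    rw [h36] at this
    rw [ha, ← pow_mul, this]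
  have he : (δ ^ 3) ^ 2 = -1 := by
    have : (δ ^ 6 - 1) * (δ ^ 6 + 1) = 0 := by linear_combination hδ12
    have := (mul_eq_zero.mp this).resolve_left (sub_ne_zero.mpr hδ6)
    linear_combination this
  set e := δ ^ 3 with hedef
  set h := r ^ 3 with hh
  have hρh : ρ h = P * diagonal ![1, 1, e] * Q := refl_pow hPQ hQP hr 3
  have hh4 : h ^ 4 = 1 := by
    apply hρ
    rw [refl_pow hPQ hQP hρh 4, show e ^ 4 = 1 by linear_combination (e ^ 2 - 1) * he, map_one]
    have : diagonal ![1, 1, 1] = (1 : M3) := by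
      ext i j; fin_cases i <;> fin_cases j <;> simp
    rw [this, mul_one, hPQ]
  have hh432 : h ^ 432 = 1 := by rw [show 432 = 4 * 108 by norm_num, pow_mul, hh4, one_pow]
  have he1 : e ≠ 1 := fun e1 => by rw [e1] at he; norm_num at he
  have htr := refl_trace hQP hρh
  have htr0 : (2 : ℂ) + e ≠ 0 := by
    intro h0
    have : (5 : ℂ) = 0 := by linear_combination (2 - e) * h0 + he
    norm_num at this
  have hnfh : nf ρ h = 5 := by
    have hinv : h⁻¹ = h ^ 3 := (eq_inv_of_mul_eq_one_left (by rw [← pow_succ, hh4])).symm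
    have : ((nf ρ h : ℝ) : ℂ) = ((5 : ℝ) : ℂ) := by
      rw [nf_cast, hinv, htr, refl_trace hQP (refl_pow hPQ hQP hρh 3)]
      push_cast
      linear_combination (e ^ 2 + 2 * e - 1) * he
    exact_mod_cast this
  have hcc : cc h ≤ 432 := by
    have hd : cc h ∣ 2160 := (Subgroup.card_subgroup_dvd_card _).trans hG'
    have hn5 : ¬ 5 ∣ cc h := by
      intro h5
      obtain ⟨⟨w, hw⟩, hw5, hw1⟩ := exists_five (G := Subgroup.centralizer {h}) h5
      have hw1' : w ≠ 1 := fun e => hw1 (Subtype.ext e)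
      have hwF := hfive w (congrArg Subtype.val hw5) hw1'
      exact refl_not_scal hQP he1 hρh (hwF.primePart_scal hρ hG' hS (x := h)
        ⟨(mem_cen.mp hw).symm, hh432⟩)
    have hcop : Nat.Coprime (cc h) 5 :=
      ((Nat.Prime.coprime_iff_not_dvd (by norm_num)).mpr hn5).symm
    exact Nat.le_of_dvd (by norm_num) (hcop.dvd_of_dvd_mul_left (n := 432) (by simpa using hd))
  have := Fintype.ofFinite G
  set Ω := (Finset.univ.filter (· ∈ scalars ρ)).image (· * h) with hΩ
  have hinjΩ : Set.InjOn (· * h) (Finset.univ.filter (· ∈ scalars ρ) : Finset G) :=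
    fun a _ b _ hab => mul_right_cancel hab
  have hsumΩ : ∑ y ∈ Ω, nf ρ y = 180 := by
    rw [hΩ, Finset.sum_image hinjΩ, Finset.sum_congr rfl (g := fun _ => (5 : ℝ)), Finset.sum_const,
      card_filter_mem, h36]
    · norm_num
    · intro a ha
      obtain ⟨c, hc⟩ := (Finset.mem_filter.mp ha).2
      have h9 := nf_scal ⟨c, hc⟩
      unfold nf at h9 hnfh ⊢
      rw [map_mul, hc, smul_mul_assoc, one_mul, trace_smul, smul_eq_mul, map_mul, hnfh]
      rw [hc, trace_smul, smul_eq_mul, map_mul, trace_one] at h9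
      simp [Complex.normSq_apply] at h9 ⊢
      linarith
  have key := card_mul_sum_le (nf ρ) (nf_nonneg ρ) (nf_conj ρ) Ω
    (Finset.univ.filter (fun x => x ^ 432 = 1)) {h} h
    (fun x s hs => by
      obtain ⟨a, ha, rfl⟩ := Finset.mem_image.mp hs
      have ha := (Finset.mem_filter.mp ha).2
      rw [Finset.mem_filter]
      refine ⟨Finset.mem_univ _, ?_⟩
      have ha36 : a ^ 36 = 1 := by
        have : (⟨a, ha⟩ : scalars ρ) ^ 36 = 1 := by rw [← h36, pow_card_eq_one']
        exact congrArg Subtype.val this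
      rw [conj_pow, (show Commute a h from Scal.commute hρ ha h).mul_pow, hh432,
        show 432 = 36 * 12 by norm_num, pow_mul, ha36]
      simp)
    (fun y hy x hxy => by
      obtain ⟨a, ha, rfl⟩ := Finset.mem_image.mp hy
      obtain ⟨b, hb, hb'⟩ := Finset.mem_image.mp hxy
      have ha := (Finset.mem_filter.mp ha).2
      have hb := (Finset.mem_filter.mp hb).2
      have hab : x * h * x⁻¹ = a⁻¹ * b * h := by
        have hax := Scal.commute hρ ((scalars ρ).inv_mem ha) x
        calc x * h * x⁻¹ = (x * a⁻¹) * (a * h) * x⁻¹ := by group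
          _ = a⁻¹ * (x * (a * h) * x⁻¹) := by rw [← hax]; group
          _ = _ := by rw [← hb']; simp only [mul_assoc]
      obtain ⟨c, hc⟩ := (scalars ρ).mul_mem ((scalars ρ).inv_mem ha) hb
      have ht := trace_rho_conj (ρ := ρ) x h
      rw [hab, map_mul, hc, smul_mul_assoc, one_mul, trace_smul, smul_eq_mul, htr] at ht
      have hc1 : c = 1 := mul_right_cancel₀ htr0 (by rw [ht, one_mul])
      have : a⁻¹ * b = 1 := hρ (by rw [hc, hc1, map_one, one_smul])
      rw [Finset.mem_singleton, hab, this, one_mul])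
  rw [hsumΩ, hG, Finset.card_singleton] at key
  have hsum := h5.five_sum hρ hG' hS
  have hall := sum_nf ρ hS
  rw [← Finset.sum_filter_add_sum_filter_not Finset.univ (fun x : G => x ^ 432 = 1)] at hall
  rw [hG] at hall hsum
  have hccR : (cc h : ℝ) ≤ 432 := by exact_mod_cast hcc
  push_cast at *
  have hS0 : ∑ x ∈ Finset.univ.filter (fun x : G => x ^ 432 = 1), nf ρ x ≤ 864 := by
    linarith
  have hS1 : (0 : ℝ) ≤ ∑ x ∈ Finset.univ.filter (fun x : G => x ^ 432 = 1), nf ρ x :=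
    Finset.sum_nonneg fun _ _ => nf_nonneg _ _
  nlinarith

end

section
variable {G : Type*} [Group G] [Finite G] {ρ : G →* M3}

/-- The properties of the three-dimensional representation of the triple cover of the alternating
group of degree six which are used below. -/
structure Valentiner (ρ : G →* M3) : Prop where
  inj : Function.Injective ρ
  card : Nat.card G = 1080
  schur : Schur ρ
  det_eq : ∀ x, det (ρ x) = 1
  five : ∀ g : G, g ^ 5 = 1 → g ≠ 1 → Five ρ g
  inverting : ∀ g : G, g ^ 5 = 1 → g ≠ 1 → ∃ n, n * g * n⁻¹ = g⁻¹
  cube_scalar : ∃ c : G, ∃ ω : ℂ, ω ^ 2 + ω + 1 = 0 ∧ ρ c = ω • (1 : M3)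
  card_scalars : Nat.card (scalars ρ) = 3

lemma card_scalars_eq (hρ : Function.Injective ρ) (hG : Nat.card G = 2160) (hS : Schur ρ)
    (hgen : Subgroup.closure {r | Refl (ρ r)} = ⊤) :
    Nat.card (scalars ρ) = 6 ∧ (∀ g : G, g ^ 5 = 1 → g ≠ 1 → Five ρ g) ∧
      ∀ w, ∃ a, Scal ρ a ∧ det (ρ w) = det (ρ a) := by
  have hdet : ∀ w : G, w ^ 5 = 1 → det (ρ w) = 1 := fun w hw => det_five ρ hρ hG hS hgen hw
  have hfive : ∀ g : G, g ^ 5 = 1 → g ≠ 1 → Five ρ g := fun g hg hg1 =>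
    five_eigen ρ hρ hG hS hg hg1 (hdet g hg)
  obtain ⟨g, hg, hg1⟩ := exists_five (G := G) (by rw [hG]; norm_num)
  have h := hfive g hg hg1
  have hfr := fun w => h.frattini hρ hG hS (hdet g hg) w
  refine ⟨?_, hfive, hfr⟩
  have hcc : cc g = 5 * Nat.card (scalars ρ) := by
    rw [h.cc_eq hρ (hG ▸ dvd_rfl), primePart_eq_scalars hρ (hG ▸ dvd_rfl) hS hdet h]
  rcases h.card_scalars hρ hG hS (hdet g hg) hcc with e | e | e
  · exact absurd e (card_scalars_ne_one hG hgen hfr)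
  · exact e
  · exact absurd e (card_scalars_ne_thirtysix hG hρ hS hgen h hfive hfr)

/-- The restriction of the representation to the kernel of the determinant. -/
noncomputable def evenRep (ρ : G →* M3) : (detChar ρ).ker →* M3 := ρ.comp (detChar ρ).ker.subtype

lemma evenRep_apply (x : (detChar ρ).ker) : evenRep ρ x = ρ x := rfl

lemma det_sq (hρ : Function.Injective ρ) (hG : Nat.card G = 2160) (hS : Schur ρ)
    (hgen : Subgroup.closure {r | Refl (ρ r)} = ⊤) (w : G) : det (ρ w) = 1 ∨ det (ρ w) = -1 := by
  obtain ⟨h6, -, hfr⟩ := card_scalars_eq hρ hG hS hgen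
  obtain ⟨a, ⟨c, hc⟩, ha⟩ := hfr w
  have := scal_pow_card hc
  rw [h6] at this
  rw [ha, hc, det_smul_one]
  have : (c ^ 3 - 1) * (c ^ 3 + 1) = 0 := by linear_combination this
  rcases mul_eq_zero.mp this with h | h
  · exact Or.inl (sub_eq_zero.mp h)
  · exact Or.inr (eq_neg_of_add_eq_zero_left h)

lemma exists_neg_one (hρ : Function.Injective ρ) (hG : Nat.card G = 2160) (hS : Schur ρ)
    (hgen : Subgroup.closure {r | Refl (ρ r)} = ⊤) : ∃ m, ρ m = -1 := by
  obtain ⟨h6, -, -⟩ := card_scalars_eq hρ hG hS hgen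
  obtain ⟨m, hm⟩ := exists_scalar hρ h6 (c := -1) (by norm_num)
  exact ⟨m, by rw [hm, neg_smul, one_smul]⟩

lemma valentiner_evenRep (hρ : Function.Injective ρ) (hG : Nat.card G = 2160) (hS : Schur ρ)
    (hgen : Subgroup.closure {r | Refl (ρ r)} = ⊤) : Valentiner (evenRep ρ) := by
  obtain ⟨h6, hfive, hfr⟩ := card_scalars_eq hρ hG hS hgen
  have hdet : ∀ w : G, w ^ 5 = 1 → det (ρ w) = 1 := fun w hw => det_five ρ hρ hG hS hgen hw
  have hsq := det_sq hρ hG hS hgen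
  obtain ⟨m, hm⟩ := exists_neg_one hρ hG hS hgen
  have hdm : det (ρ m) = -1 := by rw [hm, det_neg, det_one]; norm_num
  have hmm : ∀ w, det (ρ (w * m)) = - det (ρ w) := fun w => by
    rw [map_mul, det_mul, hdm, mul_neg_one]
  have h5' : ∀ g : (detChar ρ).ker, g ^ 5 = 1 → g ≠ 1 → Five (evenRep ρ) g := fun g hg hg1 =>
    hfive g (congrArg Subtype.val hg) (fun e => hg1 (Subtype.ext e))
  refine ⟨hρ.comp Subtype.val_injective, ?_, ?_, fun x => x.2, h5', ?_, ?_, ?_⟩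
  · have h2 : (detChar ρ).ker.index = 2 := by
      rw [Subgroup.index_eq_two_iff]
      refine ⟨m, fun b => ?_⟩
      rw [mem_ker_detChar, mem_ker_detChar, hmm]
      rcases hsq b with e | e <;> rw [e] <;> unfold Xor <;> norm_num
    have := Subgroup.card_mul_index (detChar ρ).ker
    rw [h2, hG] at this
    omega
  · intro M hM
    apply hS
    intro x
    rcases hsq x with e | e
    · exact hM ⟨x, e⟩
    · have := hM ⟨x * m, by rw [mem_ker_detChar, hmm, e, neg_neg]⟩
      simpa [evenRep_apply, hm] using this
  · rintro g hg hg1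
    obtain ⟨n, hn, hng⟩ := exists_inverting hρ hG hS (h5' g hg hg1) g.2
    exact ⟨⟨n, hn⟩, Subtype.ext hng⟩
  · have hprim := Complex.isPrimitiveRoot_exp 3 (by norm_num)
    set ω := Complex.exp (2 * Real.pi * Complex.I / (3 : ℕ)) with hω
    have h3 := hprim.pow_eq_one
    obtain ⟨c, hc⟩ := exists_scalar hρ h6 (c := ω) (by linear_combination (ω ^ 3 + 1) * h3)
    refine ⟨⟨c, by rw [mem_ker_detChar, hc, det_smul_one, h3]⟩, ω, ?_, hc⟩
    have : (ω - 1) * (ω ^ 2 + ω + 1) = 0 := by linear_combination h3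
    exact (mul_eq_zero.mp this).resolve_left (sub_ne_zero.mpr (hprim.ne_one (by norm_num)))
  · let f : scalars (evenRep ρ) → scalars ρ := fun x => ⟨x.1.1, x.2⟩
    have hinj : Function.Injective f := fun x y h => Subtype.ext (Subtype.ext (congrArg (fun z => z.1) h))
    let F : scalars (evenRep ρ) →* scalars ρ := ⟨⟨f, rfl⟩, fun _ _ => rfl⟩
    have hr2 : F.range.index = 2 := by
      rw [Subgroup.index_eq_two_iff]
      refine ⟨⟨m, -1, by rw [hm, neg_smul, one_smul]⟩, fun b => ?_⟩
      have hmem : ∀ b : scalars ρ, b ∈ F.range ↔ det (ρ b) = 1 := fun b =>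
        ⟨fun ⟨x, hx⟩ => hx ▸ x.1.2, fun hb => ⟨⟨⟨b, hb⟩, b.2⟩, rfl⟩⟩
      rw [hmem, hmem, Subgroup.coe_mul, hmm]
      rcases hsq b with e | e <;> rw [e] <;> unfold Xor <;> norm_num
    have h1 := Subgroup.card_mul_index F.range
    rw [hr2, h6, Nat.card_congr (MonoidHom.ofInjective (f := F) hinj).toEquiv.symm] at h1
    omega

end

namespace Valentiner
variable {G : Type*} [Group G] [Finite G] {ρ : G →* M3}

lemma dvd_card (hV : Valentiner ρ) : Nat.card G ∣ 2160 := by rw [hV.card]; norm_num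

lemma pow_scalar (hV : Valentiner ρ) {a : G} (ha : Scal ρ a) : a ^ 3 = 1 := by
  have : (⟨a, ha⟩ : scalars ρ) ^ 3 = 1 := by rw [← hV.card_scalars, pow_card_eq_one']
  exact congrArg Subtype.val this

lemma pow_card (hV : Valentiner ρ) (x : G) : x ^ 1080 = 1 := by
  rw [← hV.card, pow_card_eq_one']

lemma decompose (hV : Valentiner ρ) {g x : G} (hg : g ^ 5 = 1) (hg1 : g ≠ 1) (hx : g * x = x * g) :
    ∃ (k : ℕ) (a : G), k < 5 ∧ x = g ^ k * a ∧ Scal ρ a := by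
  have h := hV.five g hg hg1
  obtain ⟨k, a, hk, hag, ha⟩ := h.decompose hV.inj hV.dvd_card hx
  exact ⟨k % 5, a, Nat.mod_lt _ (by norm_num), by rw [← pow_mod_five hg, hk],
    h.primePart_scal hV.inj hV.dvd_card hV.schur ⟨hag, ha⟩⟩

lemma cc_five (hV : Valentiner ρ) {g : G} (hg : g ^ 5 = 1) (hg1 : g ≠ 1) : cc g = 15 := by
  have h := hV.five g hg hg1
  rw [h.cc_eq hV.inj hV.dvd_card,
    primePart_eq_scalars hV.inj hV.dvd_card hV.schur (fun w _ => hV.det_eq w) h, hV.card_scalars]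

lemma five_ne {g : G} (hg : g ^ 5 = 1) (hg1 : g ≠ 1) : g ^ 2 ≠ 1 ∧ g ^ 3 ≠ 1 ∧ g ^ 4 ≠ 1 := by
  refine ⟨fun h => hg1 ?_, fun h => hg1 ?_, fun h => hg1 ?_⟩
  · calc g = g ^ 5 * (g ^ 2)⁻¹ * (g ^ 2)⁻¹ := by group
      _ = 1 := by rw [hg, h]; simp
  · calc g = (g ^ 3) ^ 2 * (g ^ 5)⁻¹ := by group
      _ = 1 := by rw [hg, h]; simp
  · calc g = g ^ 5 * (g ^ 4)⁻¹ := by group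
      _ = 1 := by rw [hg, h]; simp

lemma card_five_class [Fintype G] (hV : Valentiner ρ) {g : G} (hg : g ^ 5 = 1) (hg1 : g ≠ 1) :
    (Finset.univ.filter fun x => IsConj g x).card = 72 := by
  have := card_conj_class g
  rw [hV.cc_five hg hg1, hV.card] at this
  omega

lemma card_fives [Fintype G] (hV : Valentiner ρ) :
    (Finset.univ.filter fun x : G => x ^ 5 = 1 ∧ x ≠ 1).card = 144 := by
  obtain ⟨g, hg, hg1⟩ := exists_five (G := G) (by rw [hV.card]; norm_num)
  obtain ⟨h2, h3, h4⟩ := five_ne hg hg1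
  have hg2 : (g ^ 2) ^ 5 = 1 := by rw [← pow_mul, mul_comm, pow_mul, hg, one_pow]
  have hunion : (Finset.univ.filter fun x : G => x ^ 5 = 1 ∧ x ≠ 1) =
      (Finset.univ.filter fun x => IsConj g x) ∪ (Finset.univ.filter fun x => IsConj (g ^ 2) x) := by
    ext x
    simp only [Finset.mem_filter, Finset.mem_univ, true_and, Finset.mem_union]
    constructor
    · rintro ⟨hx, hx1⟩
      obtain ⟨k, hk⟩ := exists_conj_mem_zpowers hg hg1 hx hx1 (m := 216) (by rw [hV.card]) (by norm_num)
      have hxc : IsConj (k * x * k⁻¹) x := (isConj_iff.mpr ⟨k, rfl⟩).symm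
      obtain ⟨n, hn⟩ := hV.inverting g hg hg1
      have hinv : ∀ j : ℕ, IsConj (g ^ j) (g ^ j)⁻¹ := fun j =>
        isConj_iff.mpr ⟨n, by rw [← conj_pow, hn, inv_pow]⟩
      rcases zpow_eq_pow_five hg hk with e | e | e | e | e <;> rw [e] at hxc
      · exact absurd (isConj_one_right.mp hxc) hx1
      · exact Or.inl hxc
      · exact Or.inr hxc
      · right
        refine IsConj.trans (hinv 2) ?_
        rwa [show (g ^ 2)⁻¹ = g ^ 3 by rw [inv_eq_iff_mul_eq_one, ← pow_add, hg]]
      · left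
        refine IsConj.trans (by simpa using hinv 1) ?_
        rwa [five_inv_eq hg]
    · rintro (hx | hx) <;> obtain ⟨k, rfl⟩ := isConj_iff.mp hx
      · exact ⟨by rw [conj_pow, hg]; simp, fun e => hg1 (conj_eq_one_iff.mp e)⟩
      · exact ⟨by rw [conj_pow, hg2]; simp, fun e => h2 (conj_eq_one_iff.mp e)⟩
  rw [hunion, Finset.card_union_of_disjoint, hV.card_five_class hg hg1, hV.card_five_class hg2 h2]
  rw [Finset.disjoint_left]
  intro x hx hx'
  have hc := (Finset.mem_filter.mp hx).2.trans (Finset.mem_filter.mp hx').2.symm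
  obtain ⟨k, hk⟩ := isConj_iff.mp hc
  rcases (hV.five g hg hg1).conj_eq hV.inj (x := k) (by rw [hk]; exact Subgroup.npow_mem_zpowers g 2)
    with e | e
  · rw [hk, pow_two] at e
    exact hg1 (mul_eq_left.mp e)
  · rw [hk] at e
    exact h3 (by rw [pow_succ, e, inv_mul_cancel])

lemma exists_inverting_involution (hV : Valentiner ρ) {g : G} (hg : g ^ 5 = 1) (hg1 : g ≠ 1) :
    ∃ v, v ^ 2 = 1 ∧ v ≠ 1 ∧ v * g * v⁻¹ = g⁻¹ ∧
      ∀ w, w ^ 2 = 1 → w * g * w⁻¹ = g⁻¹ → ∃ j < 5, w = v * g ^ j := by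
  obtain ⟨n, hn⟩ := hV.inverting g hg hg1
  obtain ⟨h2, h3, h4⟩ := five_ne hg hg1
  have hnn : g * n ^ 2 = n ^ 2 * g := by
    have : n ^ 2 * g * (n ^ 2)⁻¹ = g := by
      calc n ^ 2 * g * (n ^ 2)⁻¹ = n * (n * g * n⁻¹) * n⁻¹ := by rw [pow_two]; group
        _ = g := by rw [hn, ← conj_inv, hn, inv_inv]
    rw [mul_inv_eq_iff_eq_mul] at this
    exact this.symm
  have hpow : ∀ {n : G}, n * g * n⁻¹ = g⁻¹ → ∀ k : ℕ, n * g ^ k = (g ^ k)⁻¹ * n := by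
    intro n hn k
    rw [← mul_inv_eq_iff_eq_mul, ← conj_pow, hn, inv_pow]
  have key : ∀ n : G, n * g * n⁻¹ = g⁻¹ → ∀ k a, k < 5 → n ^ 2 = g ^ k * a → Scal ρ a → n ^ 2 = a := by
    intro n hn k a hk5 hk ha
    have e : n * (g ^ k * a) = g ^ k * a * n := by rw [← hk]; group
    rw [← mul_assoc, hpow hn, mul_assoc, mul_assoc, ← ha.commute hV.inj n,  ← mul_assoc, ← mul_assoc] at e
    have e1 : (g ^ k)⁻¹ = g ^ k := by
      have := mul_right_cancel e
      exact mul_right_cancel this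
    have e2 : g ^ k = 1 := by
      have e3 : g ^ k * g ^ k = 1 := by nth_rewrite 1 [← e1]; exact inv_mul_cancel _
      have e4 : (g ^ k) ^ 5 = 1 := by rw [← pow_mul, mul_comm, pow_mul, hg, one_pow]
      calc g ^ k = (g ^ k) ^ 5 * (g ^ k * g ^ k)⁻¹ * (g ^ k * g ^ k)⁻¹ := by group
        _ = 1 := by rw [e3, e4]; simp
    rw [hk, e2, one_mul]
  obtain ⟨k, a, hk5, hk, ha⟩ := hV.decompose hg hg1 hnn
  have hn2 := key n hn k a hk5 hk ha
  have hv : n ^ 3 * g * (n ^ 3)⁻¹ = g⁻¹ := by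
    calc n ^ 3 * g * (n ^ 3)⁻¹ = n * (n ^ 2 * g * (n ^ 2)⁻¹) * n⁻¹ := by group
      _ = g⁻¹ := by rw [← hnn, mul_inv_cancel_right, hn]
  have hv2 : (n ^ 3) ^ 2 = 1 := by rw [← pow_mul, mul_comm, pow_mul, hn2, hV.pow_scalar ha]
  refine ⟨n ^ 3, hv2, ?_, hv, ?_⟩
  · intro e
    rw [e] at hv
    simp only [one_mul, inv_one, mul_one] at hv
    exact h2 (by rw [pow_two]; nth_rewrite 1 [hv]; exact inv_mul_cancel g)
  · intro w hw2 hw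
    have hcomm : g * ((n ^ 3)⁻¹ * w) = (n ^ 3)⁻¹ * w * g := by
      have e1 : w * g = g⁻¹ * w := by rw [← hw]; group
      have e2 : (n ^ 3)⁻¹ * g⁻¹ = g * (n ^ 3)⁻¹ := by rw [← hv]; group
      rw [mul_assoc, e1, ← mul_assoc, ← mul_assoc, e2]
    obtain ⟨j, b, hj, hjb, hb⟩ := hV.decompose hg hg1 hcomm
    have hwj : w = n ^ 3 * g ^ j * b := by
      rw [mul_assoc, ← hjb]; group
    have hb2 : b ^ 2 = 1 := by
      have e3 : (n ^ 3 * g ^ j) ^ 2 = 1 := by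
        rw [pow_two, ← mul_assoc, hpow hv, mul_assoc _ (n ^ 3) (n ^ 3), ← pow_two, hv2, mul_one]
        group
      rw [hwj, (show Commute b (n ^ 3 * g ^ j) from hb.commute hV.inj _).symm.mul_pow, e3, one_mul] at hw2
      exact hw2
    have hb1 : b = 1 := by
      calc b = b ^ 3 * (b ^ 2)⁻¹ := by group
        _ = 1 := by rw [hV.pow_scalar hb, hb2]; simp
    exact ⟨j, hj, by rw [hwj, hb1, mul_one]⟩

lemma card_inverting [Fintype G] (hV : Valentiner ρ) {g : G} (hg : g ^ 5 = 1) (hg1 : g ≠ 1) :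
    (Finset.univ.filter fun w : G => w ^ 2 = 1 ∧ w * g * w⁻¹ = g⁻¹).card = 5 := by
  obtain ⟨v, hv2, hv1, hv, hall⟩ := hV.exists_inverting_involution hg hg1
  have := fact_prime_five
  have hord : orderOf g = 5 := orderOf_eq_prime hg hg1
  have : (Finset.univ.filter fun w : G => w ^ 2 = 1 ∧ w * g * w⁻¹ = g⁻¹) =
      (Finset.range 5).image (fun j => v * g ^ j) := by
    ext w
    simp only [Finset.mem_filter, Finset.mem_univ, true_and, Finset.mem_image, Finset.mem_range]
    constructor
    · rintro ⟨h1, h2⟩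
      obtain ⟨j, hj, rfl⟩ := hall w h1 h2
      exact ⟨j, hj, rfl⟩
    · rintro ⟨j, hj, rfl⟩
      have hpow : v * g ^ j = (g ^ j)⁻¹ * v := by
        rw [← mul_inv_eq_iff_eq_mul, ← conj_pow, hv, inv_pow]
      refine ⟨?_, ?_⟩
      · rw [pow_two, ← mul_assoc]
        nth_rewrite 1 [hpow]
        rw [mul_assoc _ v v, ← pow_two, hv2]; group
      · calc v * g ^ j * g * (v * g ^ j)⁻¹ = v * g * v⁻¹ := by group
          _ = g⁻¹ := hv
  rw [this, Finset.card_image_of_injOn, Finset.card_range]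
  intro i hi j hj hij
  exact pow_injOn_Iio_orderOf (by rw [hord]; simpa using hi) (by rw [hord]; simpa using hj)
    (mul_left_cancel hij)

/-- The number of ordered pairs of involutions whose product has order five. -/
lemma card_pairs [Fintype G] (hV : Valentiner ρ) :
    (Finset.univ.filter fun p : G × G => p.1 ^ 2 = 1 ∧ p.2 ^ 2 = 1 ∧ (p.1 * p.2) ^ 5 = 1 ∧
      p.1 * p.2 ≠ 1).card = 720 := by
  have : (Finset.univ.filter fun p : G × G => p.1 ^ 2 = 1 ∧ p.2 ^ 2 = 1 ∧ (p.1 * p.2) ^ 5 = 1 ∧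
      p.1 * p.2 ≠ 1).card = ((Finset.univ.filter fun x : G => x ^ 5 = 1 ∧ x ≠ 1).sigma
        fun g => Finset.univ.filter fun w : G => w ^ 2 = 1 ∧ w * g * w⁻¹ = g⁻¹).card := by
    refine Finset.card_bij' (fun p _ => ⟨p.1 * p.2, p.1⟩) (fun q _ => (q.2, q.2⁻¹ * q.1)) ?_ ?_ ?_ ?_
    · rintro ⟨a, b⟩ h
      simp only [Finset.mem_filter, Finset.mem_univ, true_and, Finset.mem_sigma] at h ⊢
      obtain ⟨ha, hb, h5, h1⟩ := h
      refine ⟨⟨h5, h1⟩, ha, ?_⟩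
      rw [pow_two] at ha hb
      rw [_root_.mul_inv_rev, inv_eq_of_mul_eq_one_left ha, inv_eq_of_mul_eq_one_left hb, ← mul_assoc, ha, one_mul]
    · rintro ⟨g, w⟩ h
      simp only [Finset.mem_filter, Finset.mem_univ, true_and, Finset.mem_sigma] at h ⊢
      obtain ⟨⟨h5, h1⟩, hw, hg⟩ := h
      refine ⟨hw, ?_, by rwa [mul_inv_cancel_left], by rwa [mul_inv_cancel_left]⟩
      rw [pow_two] at hw ⊢
      have hwi := inv_eq_of_mul_eq_one_left hw
      rw [hwi] at hg ⊢
      rw [← mul_assoc, hg, inv_mul_cancel]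
    · rintro ⟨a, b⟩ h; simp
    · rintro ⟨g, w⟩ h; simp
  rw [this, Finset.card_sigma, Finset.sum_congr rfl (fun g hg =>
    hV.card_inverting (Finset.mem_filter.mp hg).2.1 (Finset.mem_filter.mp hg).2.2), Finset.sum_const,
    hV.card_fives]
  rfl

lemma le_card_involutions [Fintype G] (hV : Valentiner ρ) :
    28 ≤ (Finset.univ.filter fun x : G => x ^ 2 = 1 ∧ x ≠ 1).card := by
  set I := Finset.univ.filter fun x : G => x ^ 2 = 1 ∧ x ≠ 1 with hI
  have hle : 720 ≤ I.offDiag.card := by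
    rw [← hV.card_pairs]
    apply Finset.card_le_card
    rintro ⟨a, b⟩ h
    simp only [Finset.mem_filter, Finset.mem_univ, true_and, Finset.mem_offDiag, hI] at h ⊢
    obtain ⟨ha, hb, h5, h1⟩ := h
    obtain ⟨h2, -, -⟩ := five_ne h5 h1
    refine ⟨⟨ha, ?_⟩, ⟨hb, ?_⟩, ?_⟩
    · rintro rfl; simp [hb] at h2
    · rintro rfl; simp [ha] at h2
    · rintro rfl; rw [← pow_two] at h1; exact h1 hb
  rw [Finset.offDiag_card] at hle
  by_contra! hlt
  have : I.card * I.card - I.card ≤ 27 * 27 - 27 := by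
    interval_cases I.card <;> norm_num
  omega

end Valentiner

section
variable {G : Type*} [Group G] [Finite G] {ρ : G →* M3}

/-- An element acting with three distinct eigenvalues. -/
def Regular (ρ : G →* M3) (t : G) : Prop :=
  ∃ (P Q : M3) (d : Fin 3 → ℂ), P * Q = 1 ∧ Q * P = 1 ∧ Function.Injective d ∧
    ρ t = P * diagonal d * Q

lemma Regular.comm (hρ : Function.Injective ρ) {t : G} (h : Regular ρ t) {x y : G}
    (hx : t * x = x * t) (hy : t * y = y * t) : x * y = y * x := by
  obtain ⟨P, Q, d, hPQ, hQP, hd, ht⟩ := h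
  exact (diagOn_centralizer hPQ hQP hd ht).comm hρ (mem_cen.mpr hx) (mem_cen.mpr hy)

lemma scal_of_const {x : G} {P Q : M3} (hPQ : P * Q = 1) {d : Fin 3 → ℂ}
    (h : ρ x = P * diagonal d * Q) (h01 : d 0 = d 1) (h12 : d 1 = d 2) : Scal ρ x := by
  refine ⟨d 0, ?_⟩
  have : d = fun _ => d 0 := by
    funext i; fin_cases i
    · rfl
    · exact h01.symm
    · exact (h01.trans h12).symm
  rw [h, this, show (diagonal fun _ => d 0 : M3) = d 0 • 1 by
    rw [smul_one_eq_diagonal], mul_smul_comm, mul_one, smul_mul_assoc, hPQ]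

lemma injective_fin_three {d : Fin 3 → ℂ} (h01 : d 0 ≠ d 1) (h02 : d 0 ≠ d 2) (h12 : d 1 ≠ d 2) :
    Function.Injective d := by
  intro i j hij
  fin_cases i <;> fin_cases j <;> simp_all [eq_comm]

lemma det_of_diag {x : G} {P Q : M3} (hPQ : P * Q = 1) {d : Fin 3 → ℂ}
    (h : ρ x = P * diagonal d * Q) : det (ρ x) = d 0 * d 1 * d 2 := by
  have : det P * det Q = 1 := by rw [← det_mul, hPQ, det_one]
  rw [h, det_mul, det_mul, det_diagonal, Fin.prod_univ_three]
  linear_combination (d 0 * d 1 * d 2) * this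

lemma trace_of_diag {x : G} {P Q : M3} (hQP : Q * P = 1) {d : Fin 3 → ℂ}
    (h : ρ x = P * diagonal d * Q) : trace (ρ x) = d 0 + d 1 + d 2 := by
  rw [h, trace_conjugate hQP, trace_diagonal, Fin.sum_univ_three]

lemma pow_of_diag {x : G} {P Q : M3} (hPQ : P * Q = 1) (hQP : Q * P = 1) {d : Fin 3 → ℂ}
    (h : ρ x = P * diagonal d * Q) (n : ℕ) : ρ (x ^ n) = P * diagonal (fun i => d i ^ n) * Q := by
  induction n with
  | zero => simp [hPQ]
  | succ n ih =>
    rw [pow_succ, map_mul, ih, h]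
    calc _ = P * (diagonal (fun i => d i ^ n) * (Q * P) * diagonal d) * Q := by
          simp only [mul_assoc]
      _ = _ := by rw [hQP, mul_one, diagonal_mul_diagonal]; simp only [pow_succ]

lemma diag_inj {P Q : M3} (hQP : Q * P = 1) {d e : Fin 3 → ℂ}
    (h : P * diagonal d * Q = P * diagonal e * Q) : d = e := by
  apply diagonal_injective
  calc diagonal d = (Q * P) * diagonal d * (Q * P) := by rw [hQP]; simp
    _ = Q * (P * diagonal d * Q) * P := by simp only [mul_assoc]
    _ = (Q * P) * diagonal e * (Q * P) := by rw [h]; simp only [mul_assoc]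
    _ = diagonal e := by rw [hQP]; simp

lemma pow_eq_one_of_diag {x : G} {P Q : M3} (hPQ : P * Q = 1) (hQP : Q * P = 1) {d : Fin 3 → ℂ}
    (h : ρ x = P * diagonal d * Q) {n : ℕ} (hx : x ^ n = 1) (i : Fin 3) : d i ^ n = 1 := by
  have h1 := pow_of_diag hPQ hQP h n
  rw [hx, map_one] at h1
  have h2 : P * diagonal (fun _ => (1 : ℂ)) * Q = P * diagonal (fun i => d i ^ n) * Q := by
    rw [← h1]; simp [hPQ]
  exact (congrFun (diag_inj hQP h2) i).symm

lemma Scal.of_conj {x k : G} (h : Scal ρ (k * x * k⁻¹)) : Scal ρ x := by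
  obtain ⟨c, hc⟩ := h
  refine ⟨c, ?_⟩
  have hk : ρ k⁻¹ * ρ k = 1 := by rw [← map_mul, inv_mul_cancel, map_one]
  calc ρ x = ρ k⁻¹ * ρ (k * x * k⁻¹) * ρ k := by
        rw [← map_mul, ← map_mul]; congr 1; group
    _ = c • 1 := by rw [hc, mul_smul_comm, mul_one, smul_mul_assoc, hk]

lemma Regular.conj {t : G} (h : Regular ρ t) (k : G) : Regular ρ (k * t * k⁻¹) := by
  obtain ⟨P, Q, d, hPQ, hQP, hd, ht⟩ := h
  have hk : ρ k⁻¹ * ρ k = 1 := by rw [← map_mul, inv_mul_cancel, map_one]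
  have hk' : ρ k * ρ k⁻¹ = 1 := by rw [← map_mul, mul_inv_cancel, map_one]
  refine ⟨ρ k * P, Q * ρ k⁻¹, d, ?_, ?_, hd, ?_⟩
  · calc _ = ρ k * (P * Q) * ρ k⁻¹ := by simp only [mul_assoc]
      _ = 1 := by rw [hPQ, mul_one, hk']
  · calc _ = Q * (ρ k⁻¹ * ρ k) * P := by simp only [mul_assoc]
      _ = 1 := by rw [hk, mul_one, hQP]
  · rw [map_mul, map_mul, ht]; simp only [mul_assoc]

/-- An element with a regular power is regular. -/
lemma Regular.of_pow {t : G} {n : ℕ} (h : Regular ρ (t ^ n)) : Regular ρ t := by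
  obtain ⟨P, Q, d, hPQ, hQP, hd, ht⟩ := h
  obtain ⟨e, he⟩ := diagonal_of_commute hPQ hQP hd ht (x := t) (by rw [← pow_succ, ← pow_succ'])
  refine ⟨P, Q, e, hPQ, hQP, fun i j hij => hd ?_, he⟩
  have h1 := diag_inj hQP (ht.symm.trans (pow_of_diag hPQ hQP he n))
  rw [congrFun h1 i, congrFun h1 j, hij]

end

namespace Valentiner
variable {G : Type*} [Group G] [Finite G] {ρ : G →* M3}

lemma regular_of_cube (hV : Valentiner ρ) {t : G} (ht : t ^ 3 = 1) (hns : ¬ Scal ρ t) :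
    Regular ρ t := by
  obtain ⟨P, Q, d, hPQ, hQP, hM, hd⟩ := exists_diagonalization (M := ρ t) (n := 3) (by norm_num)
    (by rw [← map_pow, ht, map_one])
  have hdet := det_of_diag hPQ hM
  rw [hV.det_eq] at hdet
  have h0 := hd 0
  have h1 := hd 1
  have h2 := hd 2
  refine ⟨P, Q, d, hPQ, hQP, injective_fin_three ?_ ?_ ?_, hM⟩ <;> intro h <;> apply hns <;>
    apply scal_of_const hPQ hM
  · exact h
  · rw [h] at hdet; linear_combination d 1 * hdet + d 2 * h1
  · rw [h]; rw [h] at hdet; linear_combination d 2 * hdet + d 1 * h2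
  · rw [h] at hdet; linear_combination (-d 2) * hdet - d 1 * h2
  · rw [← h] at hdet; linear_combination (-d 1) * hdet - d 0 * h1
  · exact h

lemma card_cube_le (hV : Valentiner ρ) {t : G} (ht : Regular ρ t) [Fintype G] :
    (Finset.univ.filter fun y : G => t * y = y * t ∧ y ^ 3 = 1 ∧ ¬ Scal ρ y).card ≤ 6 := by
  obtain ⟨P, Q, d, hPQ, hQP, hd, htd⟩ := id ht
  set U := Finset.univ.filter fun y : G => t * y = y * t ∧ y ^ 3 = 1 with hU
  have hR : (Polynomial.nthRoots 3 (1 : ℂ)).toFinset.card ≤ 3 :=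
    (Multiset.toFinset_card_le _).trans (Polynomial.card_nthRoots 3 1)
  have hentry : ∀ {y : G} {e : Fin 3 → ℂ}, ρ y = P * diagonal e * Q → ∀ i, (Q * ρ y * P) i i = e i := by
    intro y e he i
    rw [he, show Q * (P * diagonal e * Q) * P = (Q * P) * diagonal e * (Q * P) by
      simp only [mul_assoc], hQP]
    simp
  have hU9 : U.card ≤ 9 := by
    calc U.card ≤ ((Polynomial.nthRoots 3 (1 : ℂ)).toFinset ×ˢ
          (Polynomial.nthRoots 3 (1 : ℂ)).toFinset).card := by
          apply Finset.card_le_card_of_injOn (fun y => ((Q * ρ y * P) 0 0, (Q * ρ y * P) 1 1))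
          · intro y hy
            obtain ⟨hyt, hy3⟩ := (Finset.mem_filter.mp hy).2
            obtain ⟨e, he⟩ := diagonal_of_commute hPQ hQP hd htd hyt
            simp only [Finset.coe_product, Set.mem_prod, Finset.mem_coe, Multiset.mem_toFinset]
            rw [Polynomial.mem_nthRoots (by norm_num), Polynomial.mem_nthRoots (by norm_num),
              hentry he, hentry he]
            exact ⟨pow_eq_one_of_diag hPQ hQP he hy3 0, pow_eq_one_of_diag hPQ hQP he hy3 1⟩
          · intro y hy z hz hyz
            obtain ⟨hyt, hy3⟩ := (Finset.mem_filter.mp hy).2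
            obtain ⟨hzt, hz3⟩ := (Finset.mem_filter.mp hz).2
            obtain ⟨e, he⟩ := diagonal_of_commute hPQ hQP hd htd hyt
            obtain ⟨f, hf⟩ := diagonal_of_commute hPQ hQP hd htd hzt
            simp only [Prod.mk.injEq] at hyz
            rw [hentry he, hentry hf, hentry he, hentry hf] at hyz
            have h1 := det_of_diag hPQ he
            have h2 := det_of_diag hPQ hf
            rw [hV.det_eq] at h1 h2
            have hef : e = f := by
              funext i
              fin_cases i
              · exact hyz.1
              · exact hyz.2
              · change e 2 = f 2
                rw [hyz.1, hyz.2] at h1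
                have h0 : f 0 * f 1 ≠ 0 := left_ne_zero_of_mul (h2 ▸ one_ne_zero)
                exact mul_left_cancel₀ h0 (h1.symm.trans h2)
            apply hV.inj
            rw [he, hf, hef]
      _ ≤ 9 := by rw [Finset.card_product]; nlinarith
  have hsub : (Finset.univ.filter fun y : G => Scal ρ y) ⊆ U := by
    intro y hy
    have := (Finset.mem_filter.mp hy).2
    exact Finset.mem_filter.mpr ⟨Finset.mem_univ _, (this.commute hV.inj t).symm, hV.pow_scalar this⟩
  have h3 : (Finset.univ.filter fun y : G => Scal ρ y).card = 3 := by
    rw [← hV.card_scalars]; exact card_filter_mem (scalars ρ)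
  have heq : (Finset.univ.filter fun y : G => t * y = y * t ∧ y ^ 3 = 1 ∧ ¬ Scal ρ y) =
      U \ (Finset.univ.filter fun y : G => Scal ρ y) := by
    ext y
    simp only [hU, Finset.mem_filter, Finset.mem_univ, true_and, Finset.mem_sdiff, and_assoc]
  rw [heq, Finset.card_sdiff_of_subset hsub, h3]
  omega

/-- The elements of the centralizer whose eighth power is a scalar. -/
lemma exists_scalPart (hV : Valentiner ρ) {t : G} (ht : Regular ρ t) :
    ∃ A : Subgroup G, ∀ y, y ∈ A ↔ t * y = y * t ∧ Scal ρ (y ^ 8) := by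
  refine ⟨⟨⟨⟨{y | t * y = y * t ∧ Scal ρ (y ^ 8)}, ?_⟩, ?_⟩, ?_⟩, fun y => Iff.rfl⟩
  · rintro x y ⟨hx, hx'⟩ ⟨hy, hy'⟩
    refine ⟨((show Commute t x from hx).mul_right hy).eq, ?_⟩
    rw [(show Commute x y from ht.comm hV.inj hx hy).mul_pow]
    exact (scalars ρ).mul_mem hx' hy'
  · exact ⟨by simp, by rw [one_pow]; exact (scalars ρ).one_mem⟩
  · rintro x ⟨hx, hx'⟩
    refine ⟨((show Commute t x from hx).inv_right).eq, ?_⟩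
    rw [inv_pow]; exact (scalars ρ).inv_mem hx'

end Valentiner

section
variable {G : Type*} [Group G] [Finite G] {ρ : G →* M3}

lemma nf_scal_mul {a : G} (ha : Scal ρ a) (v : G) : nf ρ (a * v) = nf ρ v := by
  have h9 := nf_scal ha
  obtain ⟨c, hc⟩ := ha
  unfold nf at h9 ⊢
  rw [hc, trace_smul, smul_eq_mul, Complex.normSq_mul, trace_one] at h9
  have : Complex.normSq c = 1 := by
    norm_num [Complex.normSq_ofNat] at h9
    linarith
  rw [map_mul, hc, smul_mul_assoc, one_mul, trace_smul, smul_eq_mul, Complex.normSq_mul, this,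
    one_mul]

lemma pow_eq_one_of_gcd {x : G} {m n : ℕ} (h : x ^ m = 1) (h' : x ^ n = 1) :
    x ^ Nat.gcd m n = 1 :=
  orderOf_dvd_iff_pow_eq_one.mp
    (Nat.dvd_gcd (orderOf_dvd_of_pow_eq_one h) (orderOf_dvd_of_pow_eq_one h'))

end

namespace Valentiner
variable {G : Type*} [Group G] [Finite G] {ρ : G →* M3}

lemma trace_involution (hV : Valentiner ρ) {v : G} (hv : v ^ 2 = 1) (hv1 : v ≠ 1) :
    trace (ρ v) = -1 := by
  obtain ⟨P, Q, d, hPQ, hQP, hM, hd⟩ := exists_diagonalization (M := ρ v) (n := 2) (by norm_num)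
    (by rw [← map_pow, hv, map_one])
  have hdet := det_of_diag hPQ hM
  rw [hV.det_eq] at hdet
  rw [trace_of_diag hQP hM]
  rcases mul_self_eq_one_iff.mp ((sq _).symm.trans (hd 0)) with h0 | h0 <;>
  rcases mul_self_eq_one_iff.mp ((sq _).symm.trans (hd 1)) with h1 | h1 <;>
  rcases mul_self_eq_one_iff.mp ((sq _).symm.trans (hd 2)) with h2 | h2 <;>
  rw [h0, h1, h2] at hdet ⊢ <;> norm_num at hdet <;> norm_num
  exfalso
  apply hv1
  apply hV.inj
  rw [hM, map_one, show d = fun _ => 1 by funext i; fin_cases i <;> assumption, diagonal_one,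
    mul_one, hPQ]

lemma nf_involution (hV : Valentiner ρ) {v : G} (hv : v ^ 2 = 1) (hv1 : v ≠ 1) : nf ρ v = 1 := by
  unfold nf; rw [hV.trace_involution hv hv1]; simp

lemma exists_five_sum (hV : Valentiner ρ) [Fintype G] :
    648 ≤ ∑ x ∈ Finset.univ.filter (fun x : G => ¬ x ^ 432 = 1), nf ρ x := by
  obtain ⟨g, hg, hg1⟩ := exists_five (G := G) (by rw [hV.card]; norm_num)
  have := (hV.five g hg hg1).five_sum hV.inj hV.dvd_card hV.schur
  rw [hV.card] at this
  push_cast at this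
  linarith

lemma le_sum_scal_two (hV : Valentiner ρ) [Fintype G] :
    111 ≤ ∑ x ∈ Finset.univ.filter (fun x : G => x ^ 432 = 1 ∧ Scal ρ (x ^ 8)), nf ρ x := by
  set Z := Finset.univ.filter fun x : G => Scal ρ x with hZ
  set I := Finset.univ.filter fun x : G => x ^ 2 = 1 ∧ x ≠ 1 with hI
  have hZ3 : Z.card = 3 := by
    rw [← hV.card_scalars]; exact card_filter_mem (scalars ρ)
  have key : ∀ a ∈ Z, ∀ v : G, v ^ 2 = 1 → (a * v) ^ 3 = v := by
    intro a ha v hv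
    have ha := (Finset.mem_filter.mp ha).2
    rw [(show Commute a v from ha.commute hV.inj v).mul_pow, hV.pow_scalar ha, one_mul, pow_succ, hv,
      one_mul]
  have hmem : ∀ a ∈ Z, ∀ v : G, v ^ 2 = 1 → (a * v) ^ 432 = 1 ∧ Scal ρ ((a * v) ^ 8) := by
    intro a ha v hv
    have ha := (Finset.mem_filter.mp ha).2
    have hc : Commute a v := ha.commute hV.inj v
    have hv' : ∀ k, v ^ (2 * k) = 1 := fun k => by rw [pow_mul, hv, one_pow]
    refine ⟨?_, ?_⟩
    · rw [hc.mul_pow, hv' 216, pow_mul a 3 144, hV.pow_scalar ha, one_pow, one_mul]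
    · rw [hc.mul_pow, hv' 4, mul_one]; exact (scalars ρ).pow_mem ha 8
  have hdisj : Disjoint Z ((Z ×ˢ I).image fun p => p.1 * p.2) := by
    rw [Finset.disjoint_left]
    intro x hx hx'
    obtain ⟨⟨a, v⟩, hp, rfl⟩ := Finset.mem_image.mp hx'
    obtain ⟨ha, hv⟩ := Finset.mem_product.mp hp
    obtain ⟨-, hv, hv1⟩ := Finset.mem_filter.mp hv
    apply hv1
    have := key a ha v hv
    rwa [hV.pow_scalar (Finset.mem_filter.mp hx).2, eq_comm] at this
  have hinj : Set.InjOn (fun p : G × G => p.1 * p.2) (Z ×ˢ I : Finset (G × G)) := by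
    rintro ⟨a, v⟩ h ⟨b, w⟩ h' e
    obtain ⟨ha, hv⟩ := Finset.mem_product.mp h
    obtain ⟨hb, hw⟩ := Finset.mem_product.mp h'
    have h1 := key a ha v (Finset.mem_filter.mp hv).2.1
    have h2 := key b hb w (Finset.mem_filter.mp hw).2.1
    have e : a * v = b * w := e
    have : v = w := by rw [← h1, ← h2, e]
    subst this
    rw [mul_right_cancel e]
  calc (111 : ℝ) ≤ ∑ x ∈ Z ∪ (Z ×ˢ I).image (fun p => p.1 * p.2), nf ρ x := by
        rw [Finset.sum_union hdisj, Finset.sum_image hinj,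
          Finset.sum_congr rfl (fun x (hx : x ∈ Z) => nf_scal (Finset.mem_filter.mp hx).2),
          Finset.sum_congr rfl (fun p (hp : p ∈ Z ×ˢ I) => show nf ρ (p.1 * p.2) = 1 by
            obtain ⟨ha, hv⟩ := Finset.mem_product.mp hp
            obtain ⟨-, hv, hv1⟩ := Finset.mem_filter.mp hv
            rw [nf_scal_mul (Finset.mem_filter.mp ha).2, hV.nf_involution hv hv1])]
        rw [Finset.sum_const, Finset.sum_const, Finset.card_product, hZ3]
        have : (28 : ℝ) ≤ I.card := by exact_mod_cast hV.le_card_involutions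
        simp only [nsmul_eq_mul, Nat.cast_mul]; push_cast; linarith
    _ ≤ _ := by
        apply Finset.sum_le_sum_of_subset_of_nonneg
        · intro x hx
          rw [Finset.mem_filter]
          refine ⟨Finset.mem_univ _, ?_⟩
          rcases Finset.mem_union.mp hx with hx | hx
          · simpa using hmem x hx 1 (one_pow 2)
          · obtain ⟨p, hp, rfl⟩ := Finset.mem_image.mp hx
            obtain ⟨ha, hv⟩ := Finset.mem_product.mp hp
            exact hmem _ ha _ (Finset.mem_filter.mp hv).2.1
        · intros; exact nf_nonneg _ _

/-- Elements commuting with a nonscalar element of order prime to five have order prime to five. -/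
lemma pow_of_commute (hV : Valentiner ρ) {t x : G} (ht : t ^ 432 = 1) (hns : ¬ Scal ρ t)
    (hx : t * x = x * t) : x ^ 432 = 1 := by
  by_contra h
  have h5 : (x ^ 432) ^ 5 = 1 := by
    rw [← pow_mul, show 432 * 5 = 1080 * 2 from rfl, pow_mul, hV.pow_card, one_pow]
  have hc : Commute (x ^ 432) t := (show Commute t x from hx).symm.pow_left 432
  exact hns ((hV.five _ h5 h).primePart_scal hV.inj hV.dvd_card hV.schur ⟨hc, ht⟩)

lemma false_of_scalPart_sum_le (hV : Valentiner ρ) [Fintype G]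
    (H : ∀ s : G, s ^ 27 = 1 → ¬ Scal ρ s → Regular ρ s) {t : G} (ht : t ^ 3 = 1)
    (hns : ¬ Scal ρ t) {A : Subgroup G} (hA : ∀ y, y ∈ A ↔ t * y = y * t ∧ Scal ρ (y ^ 8))
    (hsum : ∑ x ∈ Finset.univ.filter (· ∈ A), nf ρ x ≤ cc t) : False := by
  have htR := hV.regular_of_cube ht hns
  have ht432 : t ^ 432 = 1 := by rw [show 432 = 3 * 144 from rfl, pow_mul, ht, one_pow]
  obtain ⟨P, Q, d, hPQ, hQP, hd, htd⟩ := id htR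
  have hB := (diagOn_centralizer (ρ := ρ) hPQ hQP hd htd).sum_nf_distinct (mem_cen.mpr rfl) htd hd
  set Ω := Finset.univ.filter fun y : G => t * y = y * t ∧ ¬ Scal ρ (y ^ 8) with hΩ
  set S := Finset.univ.filter fun x : G => x ^ 432 = 1 ∧ ¬ Scal ρ (x ^ 8) with hS
  set D := Finset.univ.filter fun y : G => t * y = y * t ∧ y ^ 3 = 1 ∧ ¬ Scal ρ y with hD
  have hconj : ∀ (x y : G) (n : ℕ), (x * y * x⁻¹) ^ n = x * y ^ n * x⁻¹ := fun x y n => conj_pow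
  have hBsplit : ∑ x ∈ Finset.univ.filter (· ∈ Subgroup.centralizer {t}), nf ρ x =
      ∑ x ∈ Finset.univ.filter (· ∈ A), nf ρ x + ∑ x ∈ Ω, nf ρ x := by
    rw [← Finset.sum_filter_add_sum_filter_not (Finset.univ.filter (· ∈ Subgroup.centralizer {t}))
      (fun x => Scal ρ (x ^ 8)), Finset.filter_filter, Finset.filter_filter]
    congr 1 <;> apply Finset.sum_congr _ (fun _ _ => rfl) <;> ext x <;>
      simp only [hΩ, Finset.mem_filter, Finset.mem_univ, true_and, hA, mem_cen]
  have h1 := card_mul_sum_le (nf ρ) (nf_nonneg ρ) (nf_conj ρ) Ω S D t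
    (by
      intro x s hs
      obtain ⟨-, hst, hs8⟩ := Finset.mem_filter.mp hs
      refine Finset.mem_filter.mpr ⟨Finset.mem_univ _, ?_, ?_⟩
      · rw [hconj, hV.pow_of_commute ht432 hns hst, mul_one, mul_inv_cancel]
      · rw [hconj]; exact fun h => hs8 h.of_conj)
    (by
      intro y hy x hxy
      obtain ⟨-, hyt, hy8⟩ := Finset.mem_filter.mp hy
      obtain ⟨-, hyt', hy8'⟩ := Finset.mem_filter.mp hxy
      have h27 : (y ^ 8) ^ 27 = 1 := by
        rw [← pow_mul]
        exact pow_eq_one_of_gcd (hV.pow_of_commute ht432 hns hyt) (hV.pow_card y)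
      have hR := (H _ h27 hy8).conj x
      rw [← hconj] at hR
      refine Finset.mem_filter.mpr ⟨Finset.mem_univ _, ?_, ?_, ?_⟩
      · apply hR.comm hV.inj
        · exact ((show Commute t (x * y * x⁻¹) from hyt').symm.pow_left 8)
        · have : Commute y t := (show Commute t y from hyt).symm
          exact (this.conj x).pow_left 8
      · rw [hconj, ht, mul_one, mul_inv_cancel]
      · exact fun h => hns h.of_conj)
  have hD6 : (D.card : ℝ) ≤ 6 := by exact_mod_cast hV.card_cube_le htR
  have h5 := (hV.exists_five_sum)
  have hlow := hV.le_sum_scal_two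
  have htot := sum_nf (ρ := ρ) hV.schur
  rw [hV.card] at htot h1
  rw [← Finset.sum_filter_add_sum_filter_not Finset.univ (fun x : G => x ^ 432 = 1),
    ← Finset.sum_filter_add_sum_filter_not (Finset.univ.filter (fun x : G => x ^ 432 = 1))
      (fun x : G => Scal ρ (x ^ 8)), Finset.filter_filter, Finset.filter_filter] at htot
  have hcc : (0 : ℝ) < cc t := Nat.cast_pos.mpr Nat.card_pos
  have hSn : 0 ≤ ∑ s ∈ S, nf ρ s := Finset.sum_nonneg fun _ _ => nf_nonneg _ _
  have hB' : ∑ x ∈ Finset.univ.filter (· ∈ Subgroup.centralizer {t}), nf ρ x = 3 * (cc t : ℝ) := hB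
  have h2 : (1080 : ℝ) * (2 * cc t) ≤ 6 * cc t * ∑ s ∈ S, nf ρ s := by
    calc (1080 : ℝ) * (2 * cc t) ≤ 1080 * ∑ x ∈ Ω, nf ρ x := by linarith
      _ ≤ D.card * cc t * ∑ s ∈ S, nf ρ s := by exact_mod_cast h1
      _ ≤ _ := by gcongr
  have h3 : (360 : ℝ) ≤ ∑ s ∈ S, nf ρ s := by
    by_contra! h
    nlinarith
  push_cast at htot
  linarith

end Valentiner

lemma fact_prime_three : Fact (Nat.Prime 3) := ⟨by norm_num⟩

namespace Valentiner
variable {G : Type*} [Group G] [Finite G] {ρ : G →* M3}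

/-- A nontrivial central scalar element generates all scalars. -/
lemma scal_mem_zpowers (hV : Valentiner ρ) {a b : G} (ha : Scal ρ a) (ha1 : a ≠ 1)
    (hb : Scal ρ b) : b ∈ Subgroup.zpowers a := by
  have := fact_prime_three
  have h := mem_zpowers_of_prime_card (p := 3) (g := (⟨a, ha⟩ : scalars ρ)) (g' := ⟨b, hb⟩)
    hV.card_scalars (fun h => ha1 (congrArg Subtype.val h))
  obtain ⟨k, hk⟩ := Subgroup.mem_zpowers_iff.mp h
  exact Subgroup.mem_zpowers_iff.mpr ⟨k, congrArg Subtype.val hk⟩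

lemma exists_scal_ne_one (hV : Valentiner ρ) : ∃ c, Scal ρ c ∧ c ≠ 1 := by
  obtain ⟨c, ω, hω, hc⟩ := hV.cube_scalar
  refine ⟨c, ⟨ω, hc⟩, ?_⟩
  rintro rfl
  have : ω = 1 := smul_one_inj (by rw [← hc, map_one, one_smul])
  rw [this] at hω; norm_num at hω

lemma scal_mem_sylow (hV : Valentiner ρ) (T : Sylow 3 G) {a : G} (ha : Scal ρ a) : a ∈ T := by
  have := fact_prime_three
  have hp : IsPGroup 3 (scalars ρ) := IsPGroup.of_card (n := 1) hV.card_scalars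
  have : (scalars ρ).Normal := ⟨fun n hn g => by
    have hc : g * n = n * g := (Scal.commute hV.inj hn g).symm
    rwa [hc, mul_inv_cancel_right]⟩
  have h := T.3 (hp.to_sup_of_normal_left T.2) le_sup_right
  exact (le_sup_left.trans h.le : scalars ρ ≤ (T : Subgroup G)) ha

lemma card_sylow_three (hV : Valentiner ρ) (T : Sylow 3 G) :
    Nat.card T = 27 ∧ (T : Subgroup G).index = 40 := by
  have := fact_prime_three
  have h1 := (T : Subgroup G).card_mul_index
  rw [hV.card] at h1
  have h2 := T.not_dvd_index
  obtain ⟨k, hk⟩ := IsPGroup.iff_card.mp T.2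
  rw [hk] at h1
  have h3 : k < 4 := by
    by_contra! h
    have : 3 ^ 4 ∣ 1080 := (pow_dvd_pow 3 h).trans ⟨_, h1.symm⟩
    norm_num at this
  have hk' : Nat.card T = 3 ^ k := hk
  interval_cases k <;> omega

lemma exists_sylow_mem {t : G} (ht : t ^ 27 = 1) : ∃ T : Sylow 3 G, t ∈ T := by
  have := fact_prime_three
  have hp : IsPGroup 3 (Subgroup.zpowers t) := by
    rintro ⟨x, hx⟩
    obtain ⟨k, rfl⟩ := Subgroup.mem_zpowers_iff.mp hx
    refine ⟨3, Subtype.ext ?_⟩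
    change (t ^ k) ^ (3 ^ 3) = 1
    rw [← zpow_natCast, zpow_comm, zpow_natCast]
    norm_num [ht]
  obtain ⟨T, hT⟩ := hp.exists_le_sylow
  exact ⟨T, hT (Subgroup.mem_zpowers t)⟩

lemma le_card_of_five (hV : Valentiner ρ) {K : Subgroup G} (hK5 : ∀ g : G, g ^ 5 = 1 → g ∈ K) :
    145 ≤ Nat.card K := by
  have := Fintype.ofFinite G
  rw [← card_filter_mem]
  have h1 : (insert 1 (Finset.univ.filter fun x : G => x ^ 5 = 1 ∧ x ≠ 1)).card = 145 := by
    rw [Finset.card_insert_of_notMem (by simp), hV.card_fives]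
  rw [← h1]
  apply Finset.card_le_card
  intro x hx
  rw [Finset.mem_filter]
  refine ⟨Finset.mem_univ _, ?_⟩
  rcases Finset.mem_insert.mp hx with rfl | hx
  · exact one_mem _
  · exact hK5 x (Finset.mem_filter.mp hx).2.1

/-- A subgroup in which every eighth power is scalar has order not divisible by nine. -/
lemma not_nine_dvd (hV : Valentiner ρ) {A : Subgroup G} (hA : ∀ y ∈ A, Scal ρ (y ^ 8)) :
    ¬ 9 ∣ Nat.card A := by
  intro h9
  have := fact_prime_three
  obtain ⟨S, hS⟩ := Sylow.exists_subgroup_card_pow_prime (G := A) 3 (n := 2) h9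
  have hle : S.map A.subtype ≤ scalars ρ := by
    rintro _ ⟨s, hs, rfl⟩
    have h1 : (⟨s, hs⟩ : S) ^ 9 = 1 := by
      rw [show 9 = Nat.card S from hS.symm, pow_card_eq_one']
    have h2 : (s : G) ^ 9 = 1 := congrArg (fun x : S => ((x : A) : G)) h1
    have h3 : (s : G) = ((s : G) ^ 8)⁻¹ := by
      rw [eq_inv_iff_mul_eq_one, ← pow_succ', h2]
    change (s : G) ∈ scalars ρ
    rw [h3]
    exact (scalars ρ).inv_mem (hA s s.2)
  have h1 := Subgroup.card_le_of_le hle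
  rw [hV.card_scalars, Nat.card_congr (S.equivMapOfInjective _ A.subtype_injective).symm.toEquiv,
    hS] at h1
  norm_num at h1

lemma exists_sylow_noncomm (hV : Valentiner ρ) :
    ∃ T : Sylow 3 G, ∃ x ∈ T, ∃ y ∈ T, x * y ≠ y * x := by
  by_contra! hcomm
  have := Fintype.ofFinite G
  have := fact_prime_three
  obtain ⟨c, hc, hc1⟩ := hV.exists_scal_ne_one
  obtain ⟨T⟩ : Nonempty (Sylow 3 G) := inferInstance
  have hcT := hV.scal_mem_sylow T hc
  obtain ⟨hT, hTi⟩ := hV.card_sylow_three T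
  let _ : CommGroup T := { (inferInstance : Group T) with
    mul_comm := fun a b => Subtype.ext (hcomm T a a.2 b b.2) }
  let μ : G →* T := MonoidHom.transfer (H := (T : Subgroup G)) (MonoidHom.id T)
  have hμc : μ c ≠ 1 := by
    have key : ∀ (k : ℕ) (g₀ : G), g₀⁻¹ * c ^ k * g₀ ∈ (T : Subgroup G) → g₀⁻¹ * c ^ k * g₀ = c ^ k := by
      intro k g₀ _
      have : Commute (c ^ k) g₀ := (show Commute c g₀ from hc.commute hV.inj g₀).pow_left k
      rw [mul_assoc, this.eq, inv_mul_cancel_left]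
    have h1 : μ c = ⟨c ^ (T : Subgroup G).index, _⟩ :=
      MonoidHom.transfer_eq_pow (H := (T : Subgroup G)) (MonoidHom.id T) c key
    rw [h1]
    intro h
    have h2 : c ^ (T : Subgroup G).index = 1 := congrArg Subtype.val h
    rw [hTi, show 40 = 3 * 13 + 1 from rfl, pow_succ, pow_mul, hV.pow_scalar hc, one_pow, one_mul] at h2
    exact hc1 h2
  have hscal : ∀ a, Scal ρ a → μ a = 1 → a = 1 := by
    intro a ha h
    by_contra ha1
    obtain ⟨k, rfl⟩ := Subgroup.mem_zpowers_iff.mp (hV.scal_mem_zpowers ha ha1 hc)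
    rw [map_zpow, h, _root_.one_zpow] at hμc
    exact hμc rfl
  have hK5 : ∀ g : G, g ^ 5 = 1 → μ g = 1 := by
    intro g hg
    by_cases hg1 : g = 1
    · rw [hg1, map_one]
    obtain ⟨n, hn⟩ := hV.inverting g hg hg1
    have h1 : μ g = (μ g)⁻¹ := by
      rw [← map_inv, ← hn, map_mul, map_mul, map_inv, mul_comm (μ n), mul_inv_cancel_right]
    have h2 : (μ g) ^ 2 = 1 := by rw [pow_two]; nth_rewrite 1 [h1]; exact inv_mul_cancel _
    have h5 : (μ g) ^ 5 = 1 := by rw [← map_pow, hg, map_one]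
    calc μ g = (μ g) ^ 5 * ((μ g) ^ 2)⁻¹ * ((μ g) ^ 2)⁻¹ := by group
      _ = 1 := by rw [h2, h5]; simp
  have hKcard := hV.le_card_of_five (K := μ.ker) hK5
  have hidx : μ.ker.index = 1 ∨ μ.ker.index = 3 := by
    have h1 := μ.ker.card_mul_index
    rw [hV.card] at h1
    have h2 : μ.ker.index ∣ 3 ^ 3 := by
      rw [Subgroup.index_ker, show 3 ^ 3 = Nat.card T from hT.symm]
      exact Subgroup.card_subgroup_dvd_card _
    have h3 : μ.ker.index < 8 := by
      by_contra! h; nlinarith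
    obtain ⟨k, hk, hk'⟩ := (Nat.dvd_prime_pow (by norm_num)).mp h2
    interval_cases k <;> omega
  have hcube : ∀ x, (μ x) ^ 3 = 1 := by
    intro x
    rw [← map_pow]
    rcases hidx with h | h
    · have := μ.ker.pow_index_mem x
      rw [h, pow_one] at this
      exact MonoidHom.mem_ker.mp (μ.ker.pow_mem this 3)
    · have := μ.ker.pow_index_mem x
      rw [h] at this
      exact this
  have hr : ∀ r : G, ¬ Scal ρ r → Scal ρ (r ^ 3) → Regular ρ r := by
    intro r hr hr3
    exact hV.regular_of_cube (hscal _ hr3 (by rw [map_pow, hcube])) hr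
  have H : ∀ s : G, s ^ 27 = 1 → ¬ Scal ρ s → Regular ρ s := by
    intro s hs hns
    by_cases h3 : Scal ρ (s ^ 3)
    · exact hr s hns h3
    by_cases h9 : Scal ρ (s ^ 9)
    · exact (hr (s ^ 3) h3 (by rwa [← pow_mul])).of_pow
    · refine (hr (s ^ 9) h9 ?_).of_pow
      rw [← pow_mul, hs]; exact (scalars ρ).one_mem
  obtain ⟨t, ht3, ht1, htμ⟩ : ∃ t : G, t ^ 3 = 1 ∧ t ≠ 1 ∧ μ t = 1 := by
    have h3 : 3 ∣ Nat.card μ.ker := by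
      have h1 := μ.ker.card_mul_index
      rw [hV.card] at h1
      rcases hidx with h | h <;> rw [h] at h1 <;> omega
    obtain ⟨t, ht⟩ := exists_prime_orderOf_dvd_card' (G := μ.ker) 3 h3
    refine ⟨t, ?_, ?_, t.2⟩
    · have := pow_orderOf_eq_one t
      rw [ht] at this
      exact congrArg Subtype.val this
    · intro h
      have : t = 1 := Subtype.ext h
      rw [this, orderOf_one] at ht
      norm_num at ht
  have hns : ¬ Scal ρ t := fun h => ht1 (hscal t h htμ)
  have hcc : 27 ∣ cc t := by
    obtain ⟨T', hT'⟩ := exists_sylow_mem (t := t) (by rw [show 27 = 3 * 9 from rfl, pow_mul, ht3, one_pow])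
    rw [← (hV.card_sylow_three T').1]
    exact Subgroup.card_dvd_of_le fun x hx => mem_cen.mpr (hcomm T' t hT' x hx)
  have hR := hV.regular_of_cube ht3 hns
  obtain ⟨A, hA⟩ := hV.exists_scalPart hR
  apply hV.false_of_scalPart_sum_le H ht3 hns hA
  by_cases hAs : ∀ a ∈ A, Scal ρ a
  · rw [Finset.sum_congr rfl (fun a ha => nf_scal (hAs a (Finset.mem_filter.mp ha).2)),
      Finset.sum_const, card_filter_mem, nsmul_eq_mul]
    have h1 : Nat.card A ≤ 3 := by
      rw [← hV.card_scalars]; exact Subgroup.card_le_of_le hAs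
    have h2 : 27 ≤ cc t := Nat.le_of_dvd Nat.card_pos hcc
    have : Nat.card A * 9 ≤ cc t := by omega
    exact_mod_cast this
  · push Not at hAs
    obtain ⟨a, ha, hna⟩ := hAs
    obtain ⟨P, Q, d, hPQ, hQP, hd, htd⟩ := id hR
    have hle : A ≤ Subgroup.centralizer {t} := fun y hy => mem_cen.mpr ((hA y).mp hy).1
    refine (((diagOn_centralizer (ρ := ρ) hPQ hQP hd htd).mono hle).sum_nf_le ha
      fun c hc => hna ⟨c, hc⟩).trans ?_
    have h9 := hV.not_nine_dvd (A := A) fun y hy => ((hA y).mp hy).2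
    obtain ⟨j, hj⟩ : Nat.card A ∣ cc t := Subgroup.card_dvd_of_le hle
    have hj5 : 5 ≤ j := by
      have hj0 : j ≠ 0 := by
        rintro rfl
        exact (Nat.card_pos (α := Subgroup.centralizer {t})).ne' hj
      by_contra! h
      rw [hj] at hcc
      interval_cases j <;> omega
    have : 5 * Nat.card A ≤ cc t := by rw [hj, mul_comm]; exact Nat.mul_le_mul_left _ hj5
    exact_mod_cast this

end Valentiner

namespace Valentiner
variable {G : Type*} [Group G] [Finite G] {ρ : G →* M3}

lemma sylow_noncomm (hV : Valentiner ρ) (T : Sylow 3 G) : ∃ x ∈ T, ∃ y ∈ T, x * y ≠ y * x := by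
  have := fact_prime_three
  obtain ⟨T₀, x, hx, y, hy, hxy⟩ := hV.exists_sylow_noncomm
  obtain ⟨g, rfl⟩ := MulAction.exists_smul_eq G T₀ T
  refine ⟨g * x * g⁻¹, ?_, g * y * g⁻¹, ?_, fun h => hxy ?_⟩
  · exact Subgroup.smul_mem_pointwise_smul x (MulAut.conj g) _ hx
  · exact Subgroup.smul_mem_pointwise_smul y (MulAut.conj g) _ hy
  · exact (Commute.conj_iff g).mp h

lemma inv_mul_mem_of_quotient_comm {N : Type*} [Group N] {S : Subgroup N} [S.Normal]
    (h : IsMulCommutative (N ⧸ S)) (x y : N) : (x * y)⁻¹ * (y * x) ∈ S := by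
  have := h.is_comm.comm (QuotientGroup.mk' S x) (QuotientGroup.mk' S y)
  rw [← map_mul, ← map_mul] at this
  exact QuotientGroup.eq.mp this

lemma exists_scal_commutator (hV : Valentiner ρ) {t : G} (ht : t ^ 27 = 1) (hns : ¬ Scal ρ t) :
    ∃ u a, Scal ρ a ∧ a ≠ 1 ∧ u * t * u⁻¹ = a * t := by
  have := fact_prime_three
  obtain ⟨T, htT⟩ := exists_sylow_mem ht
  obtain ⟨x, hx, y, hy, hxy⟩ := hV.sylow_noncomm T
  obtain ⟨hT, -⟩ := hV.card_sylow_three T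
  have hT' : Nat.card (T : Subgroup G) = 27 := hT
  set S : Subgroup (T : Subgroup G) := (scalars ρ).subgroupOf T with hS
  have hSle : S ≤ Subgroup.center (T : Subgroup G) := fun a ha => Subgroup.mem_center_iff.mpr
    fun b => Subtype.ext ((show Scal ρ (a : G) from ha).commute hV.inj b).symm
  have hSn : S.Normal := ⟨fun n hn g => by
    rwa [Subgroup.mem_center_iff.mp (hSle hn) g, mul_inv_cancel_right]⟩
  have hS3 : Nat.card S = 3 :=
    (Nat.card_congr (Subgroup.subgroupOfEquivOfLe
      fun a ha => hV.scal_mem_sylow T ha).toEquiv).trans hV.card_scalars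
  have hq : Nat.card ((T : Subgroup G) ⧸ S) = 3 ^ 2 := by
    have := S.card_mul_index
    rw [hS3, hT'] at this
    change S.index = 9
    omega
  have hqc := IsPGroup.isMulCommutative_of_card_eq_prime_sq hq
  obtain ⟨u, hu, hne⟩ : ∃ u ∈ T, u * t ≠ t * u := by
    by_contra! hcen
    apply hxy
    set Z := Subgroup.center (T : Subgroup G)
    have htZ : (⟨t, htT⟩ : (T : Subgroup G)) ∈ Z :=
      Subgroup.mem_center_iff.mpr fun b => Subtype.ext (hcen b b.2)
    have h1 : 3 < Nat.card Z := by
      apply lt_of_le_of_ne (hS3.symm.le.trans (Subgroup.card_le_of_le hSle))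
      intro h
      have : S = Z := Subgroup.eq_of_le_of_card_ge hSle (h.symm.trans hS3.symm).le
      rw [← this] at htZ
      exact hns htZ
    have h2 := Z.card_mul_index
    rw [hT'] at h2
    have h3 : Z.index ∣ 3 := by
      have h4 : Nat.card Z ∣ 3 ^ 3 := ⟨_, h2.symm⟩
      obtain ⟨k, hk, hk'⟩ := (Nat.dvd_prime_pow (by norm_num)).mp h4
      rw [hk'] at h1 h2
      interval_cases k
      · omega
      · omega
      · exact ⟨1, by omega⟩
      · exact ⟨3, by omega⟩
    have : IsCyclic ((T : Subgroup G) ⧸ Z) := isCyclic_of_card_dvd_prime (p := 3) h3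
    have hc := isMulCommutative_of_isCyclic_quotient_center_self (T : Subgroup G)
    exact congrArg Subtype.val (hc.is_comm.comm ⟨x, hx⟩ ⟨y, hy⟩)
  have hmem : (t * u)⁻¹ * (u * t) ∈ scalars ρ := by
    exact inv_mul_mem_of_quotient_comm hqc ⟨t, htT⟩ ⟨u, hu⟩
  have hcom := Scal.commute hV.inj hmem
  refine ⟨u, (t * u)⁻¹ * (u * t), hmem, ?_, ?_⟩
  · intro h
    exact hne (inv_mul_eq_one.mp h).symm
  · calc u * t * u⁻¹ = t * (u * ((t * u)⁻¹ * (u * t))) * u⁻¹ := by group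
      _ = t * ((t * u)⁻¹ * (u * t)) := by rw [← hcom u]; group
      _ = _ := (hcom t).symm

lemma trace_eq_zero_of_commutator {t u a : G} {c : ℂ} (hc : c ≠ 1) (ha : ρ a = c • 1)
    (h : u * t * u⁻¹ = a * t) : trace (ρ t) = 0 := by
  have h1 := trace_rho_conj ρ u t
  rw [h, map_mul, ha, smul_mul_assoc, one_mul, trace_smul, smul_eq_mul] at h1
  have : (c - 1) * trace (ρ t) = 0 := by linear_combination h1
  exact (mul_eq_zero.mp this).resolve_left (sub_ne_zero.mpr hc)

lemma three_regular (hV : Valentiner ρ) {t : G} (ht : t ^ 27 = 1) (hns : ¬ Scal ρ t) :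
    Regular ρ t ∧ trace (ρ t) = 0 ∧ t ^ 3 = 1 := by
  obtain ⟨u, a, ha, ha1, hu⟩ := hV.exists_scal_commutator ht hns
  have ha3 := hV.pow_scalar ha
  have hat : a * t = t * a := ha.commute hV.inj t
  obtain ⟨c, hc⟩ := ha
  have hc1 : c ≠ 1 := fun h => ha1 (hV.inj (by rw [hc, h, one_smul, map_one]))
  have hc3 : c ^ 3 = 1 := smul_one_inj (by rw [← smul_one_pow, ← hc, ← map_pow, ha3, map_one, one_smul])
  have hc2 : c ^ 2 ≠ 1 := fun h => hc1 (by linear_combination hc3 - c * h)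
  have h1 := trace_eq_zero_of_commutator hc1 hc hu
  have h2 : trace (ρ (t ^ 2)) = 0 := by
    apply trace_eq_zero_of_commutator (u := u) (a := a ^ 2) hc2
    · rw [map_pow, hc, smul_one_pow]
    · rw [← conj_pow, hu, (show Commute a t from hat).mul_pow]
  obtain ⟨P, Q, d, hPQ, hQP, hM, hd⟩ := exists_diagonalization (M := ρ t) (n := 27) (by norm_num)
    (by rw [← map_pow, ht, map_one])
  have hdet := det_of_diag hPQ hM
  rw [hV.det_eq] at hdet
  rw [trace_of_diag hQP hM] at h1
  rw [trace_of_diag hQP (pow_of_diag hPQ hQP hM 2)] at h2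
  have key : ∀ i, d i ^ 3 = 1 := by
    have e1 : d 0 * d 1 + d 0 * d 2 + d 1 * d 2 = 0 := by
      linear_combination ((d 0 + d 1 + d 2) * h1 - h2) / 2
    intro i
    fin_cases i
    · change d 0 ^ 3 = 1
      linear_combination (d 0 ^ 2) * h1 - d 0 * e1 - hdet
    · change d 1 ^ 3 = 1
      linear_combination (d 1 ^ 2) * h1 - d 1 * e1 - hdet
    · change d 2 ^ 3 = 1
      linear_combination (d 2 ^ 2) * h1 - d 2 * e1 - hdet
  have h3 : t ^ 3 = 1 := by
    apply hV.inj
    rw [pow_of_diag hPQ hQP hM, show (fun i => d i ^ 3) = fun _ => 1 from funext key, diagonal_one,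
      mul_one, hPQ, map_one]
  exact ⟨hV.regular_of_cube h3 hns, by rw [trace_of_diag hQP hM, h1], h3⟩

end Valentiner

/-- A matrix twisting a regular diagonal matrix by a scalar permutes its eigenlines. -/
lemma exists_shift {P Q U U' : M3} (hPQ : P * Q = 1) (hQP : Q * P = 1) (hU : U * U' = 1)
    {d : Fin 3 → ℂ} {c : ℂ}
    (h : U * (P * diagonal d * Q) = c • (P * diagonal d * Q) * U) :
    ∃ σ : Fin 3 → Fin 3, (∀ k, d (σ k) = c * d k) ∧
      ∀ e e' : Fin 3 → ℂ, U * (P * diagonal e * Q) = (P * diagonal e' * Q) * U →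
        ∀ k, e' k = e (σ k) := by
  have hV : (Q * U * P) * (Q * U' * P) = 1 := by
    calc _ = Q * (U * (P * Q) * U') * P := by simp only [mul_assoc]
      _ = 1 := by rw [hPQ, mul_one, hU, mul_one, hQP]
  have htr : ∀ e e' : Fin 3 → ℂ, U * (P * diagonal e * Q) = (P * diagonal e' * Q) * U →
      ∀ k l, (Q * U * P) k l * e l = e' k * (Q * U * P) k l := by
    intro e e' he k l
    have h1 : (Q * U * P) * diagonal e = diagonal e' * (Q * U * P) := by
      calc (Q * U * P) * diagonal e = Q * (U * (P * diagonal e * Q)) * P := by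
            simp only [mul_assoc]; rw [hQP, mul_one]
        _ = (Q * P) * diagonal e' * (Q * U * P) := by rw [he]; simp only [mul_assoc]
        _ = _ := by rw [hQP, one_mul]
    have := congrFun (congrFun h1 k) l
    rwa [mul_diagonal, diagonal_mul] at this
  have hrow : ∀ k, ∃ l, (Q * U * P) k l ≠ 0 := by
    intro k
    by_contra! h0
    have := congrFun (congrFun hV k) k
    rw [Matrix.mul_apply, one_apply_eq] at this
    simp [h0] at this
  choose σ hσ using hrow
  refine ⟨σ, fun k => ?_, fun e e' he k => ?_⟩
  · have h1 := htr d (fun i => c * d i) (by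
      rw [h, show (diagonal fun i => c * d i : M3) = c • diagonal d by
        ext i j; simp [diagonal_apply], mul_smul_comm, smul_mul_assoc, smul_mul_assoc,
        smul_mul_assoc]) k (σ k)
    rw [mul_comm] at h1
    exact mul_right_cancel₀ (hσ k) h1
  · have h1 := htr e e' he k (σ k)
    rw [mul_comm] at h1
    exact (mul_right_cancel₀ (hσ k) h1).symm

lemma eq_shift_of_no_fixed : ∀ σ : Fin 3 → Fin 3, (∀ k, σ k ≠ k) → Function.Injective σ →
    σ = ![1, 2, 0] ∨ σ = ![2, 0, 1] := by decide

namespace Valentiner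
variable {G : Type*} [Group G] [Finite G] {ρ : G →* M3}

lemma cc_three (hV : Valentiner ρ) {t : G} (ht : t ^ 27 = 1) (hns : ¬ Scal ρ t) : cc t = 9 := by
  have := Fintype.ofFinite G
  have H : ∀ s : G, s ^ 27 = 1 → ¬ Scal ρ s → Regular ρ s := fun s hs hn => (hV.three_regular hs hn).1
  obtain ⟨hR, -, ht3⟩ := hV.three_regular ht hns
  have ht1 : t ≠ 1 := fun h => hns (h ▸ (scalars ρ).one_mem)
  obtain ⟨A, hA⟩ := hV.exists_scalPart hR
  have hle : A ≤ Subgroup.centralizer {t} := fun y hy => mem_cen.mpr ((hA y).mp hy).1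
  have hord : orderOf t = 3 := by
    have := fact_prime_three
    exact orderOf_eq_prime ht3 ht1
  have hdisj : Disjoint A (Subgroup.zpowers t) := by
    rw [Subgroup.disjoint_def]
    intro x hx hxt
    have hts : ¬ Scal ρ (t ^ 16) := by
      rwa [show t ^ 16 = t from by rw [show 16 = 3 * 5 + 1 from rfl, pow_succ, pow_mul, ht3,
        one_pow, one_mul]]
    obtain ⟨k, hk, rfl⟩ := by simpa using mem_zpowers_iff_mem_range_orderOf.mp hxt
    have hk8 := ((hA _).mp hx).2
    rw [hord] at hk
    interval_cases k
    · rw [pow_zero]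
    · refine absurd ((scalars ρ).pow_mem hk8 2) ?_
      rwa [← pow_mul, ← pow_mul]
    · refine absurd hk8 ?_
      rwa [← pow_mul]
  have h3A : 3 * Nat.card A ≤ cc t := by
    rw [← hord, ← Nat.card_zpowers, mul_comm, ← Nat.card_prod]
    have hz : Subgroup.zpowers t ≤ Subgroup.centralizer {t} := by
      rw [Subgroup.zpowers_le, mem_cen]
    exact Nat.card_le_card_of_injective
      (fun p : A × Subgroup.zpowers t => (⟨p.1 * p.2,
        Subgroup.mul_mem _ (hle p.1.2) (hz p.2.2)⟩ : Subgroup.centralizer {t}))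
      fun p q h => Subgroup.mul_injective_of_disjoint hdisj (congrArg Subtype.val h)
  by_cases hsc : ∃ s ∈ A, ¬ Scal ρ s
  · exfalso
    obtain ⟨s, hs, hsn⟩ := hsc
    obtain ⟨P, Q, d, hPQ, hQP, hd, htd⟩ := id hR
    have hdiag : DiagOn ρ A P Q := (diagOn_centralizer hPQ hQP hd htd).mono hle
    obtain ⟨u, a, ha, ha1, hu⟩ := hV.exists_scal_commutator ht hns
    have hua := ha.commute hV.inj
    obtain ⟨c, hc⟩ := id ha
    have hc1 : c ≠ 1 := fun h => ha1 (hV.inj (by rw [hc, h, one_smul, map_one]))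
    have hd0 : ∀ i, d i ≠ 0 := fun i h => by
      have := pow_eq_one_of_diag hPQ hQP htd ht i
      rw [h] at this
      norm_num at this
    have hut : u * t = a * t * u := by rw [← hu]; group
    obtain ⟨σ, hσ, hσ'⟩ := exists_shift (U := ρ u) (U' := ρ u⁻¹) (c := c) hPQ hQP
      (by rw [← map_mul, mul_inv_cancel, map_one]) (d := d) (by
        rw [← htd, ← map_mul, hut, map_mul, map_mul, hc, smul_mul_assoc, one_mul])
    have hc0 : c ≠ 0 := by
      rintro rfl
      exact hd0 _ ((hσ 0).trans (zero_mul _))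
    have hshift := eq_shift_of_no_fixed σ (fun k hk => hc1 (by
        have := hσ k
        rw [hk] at this
        exact mul_right_cancel₀ (hd0 k) (by rw [← this, one_mul])))
      (fun i j hij => hd (mul_left_cancel₀ hc0 (by rw [← hσ i, ← hσ j, hij])))
    have hstab : ∀ s ∈ A, u * s * u⁻¹ ∈ A := by
      intro s hs
      obtain ⟨h1, h2⟩ := (hA s).mp hs
      refine (hA _).mpr ⟨?_, ?_⟩
      · have h3 : Commute (a * t) (u * s * u⁻¹) := by
          rw [← hu]; exact (Commute.conj_iff u).mpr h1
        have h4 : Commute a (u * s * u⁻¹) := hua _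
        have := h4.inv_left.mul_left h3
        rwa [inv_mul_cancel_left] at this
      · have := h2.commute hV.inj u
        rwa [conj_pow, ← this, mul_inv_cancel_right]
    have hsep : ∀ i j, i ≠ j → ∃ s ∈ A, ∃ e, ρ s = P * diagonal e * Q ∧ e i ≠ e j := by
      intro i j hij
      by_contra! hcon
      apply hsn
      have hall : ∀ s ∈ A, ∀ e, ρ s = P * diagonal e * Q →
          e i = e j ∧ e (σ i) = e (σ j) ∧ e (σ (σ i)) = e (σ (σ j)) := by
        have step : ∀ s ∈ A, ∀ e, ρ s = P * diagonal e * Q → ∃ e',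
            ρ (u * s * u⁻¹) = P * diagonal e' * Q ∧ ∀ k, e' k = e (σ k) := by
          intro s hs e he
          obtain ⟨e', he'⟩ := hdiag.2.2 _ (hstab s hs)
          refine ⟨e', he', hσ' e e' ?_⟩
          rw [← he, ← he', ← map_mul, ← map_mul]
          congr 1
          group
        intro s hs e he
        obtain ⟨e', he', h'⟩ := step s hs e he
        obtain ⟨e'', he'', h''⟩ := step _ (hstab s hs) e' he'
        refine ⟨hcon s hs e he, ?_, ?_⟩
        · rw [← h', ← h']
          exact hcon _ (hstab s hs) e' he'
        · rw [← h', ← h', ← h'', ← h'']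
          exact hcon _ (hstab _ (hstab s hs)) e'' he''
      obtain ⟨e, he⟩ := hdiag.2.2 s hs
      obtain ⟨h1, h2, h3⟩ := hall s hs e he
      clear hall hcon
      have : e 0 = e 1 ∧ e 1 = e 2 := by
        clear * - hij h1 h2 h3 hshift
        rcases hshift with rfl | rfl <;> fin_cases i <;> fin_cases j <;> simp_all
      exact scal_of_const hPQ he this.1 this.2
    refine hV.false_of_scalPart_sum_le H ht3 hns hA ?_
    rw [hdiag.sum_nf_separated hsep]
    exact_mod_cast h3A
  · push Not at hsc
    have hAS : A = scalars ρ := le_antisymm hsc fun x hx => (hA x).mpr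
      ⟨(Scal.commute hV.inj hx t).symm, (scalars ρ).pow_mem hx 8⟩
    have hA3 : Nat.card A = 3 := by rw [hAS]; exact hV.card_scalars
    have hlt : cc t < 27 := by
      by_contra! hge
      refine hV.false_of_scalPart_sum_le H ht3 hns hA ?_
      rw [Finset.sum_congr rfl fun x hx => nf_scal (hsc x (Finset.mem_filter.mp hx).2),
        Finset.sum_const, card_filter_mem, hA3]
      have : (27 : ℝ) ≤ cc t := by exact_mod_cast hge
      norm_num
      linarith
    have hdvd : cc t ∣ 1080 := hV.card ▸ Subgroup.card_subgroup_dvd_card _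
    have h2 : ¬ 2 ∣ cc t := by
      intro h
      obtain ⟨v, hv⟩ := exists_prime_orderOf_dvd_card' (G := Subgroup.centralizer {t}) 2 h
      have hv2 : (v : G) ^ 2 = 1 := by
        rw [← hv, ← Subgroup.orderOf_coe]; exact pow_orderOf_eq_one _
      have hvA : (v : G) ∈ A := (hA _).mpr ⟨mem_cen.mp v.2, by
        rw [show 8 = 2 * 4 from rfl, pow_mul, hv2, one_pow]; exact (scalars ρ).one_mem⟩
      have hv3 := hV.pow_scalar (hsc _ hvA)
      have : (v : G) = 1 := by
        rw [pow_succ, hv2, one_mul] at hv3; exact hv3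
      rw [← Subgroup.orderOf_coe, this, orderOf_one] at hv
      omega
    have h5 : ¬ 5 ∣ cc t := by
      intro h
      have := fact_prime_five
      obtain ⟨v, hv⟩ := exists_prime_orderOf_dvd_card' (G := Subgroup.centralizer {t}) 5 h
      have hv5 : (v : G) ^ 5 = 1 := by
        rw [← hv, ← Subgroup.orderOf_coe]; exact pow_orderOf_eq_one _
      have ht4 : t ^ 432 = 1 := by rw [show 432 = 3 * 144 from rfl, pow_mul, ht3, one_pow]
      have := pow_eq_one_of_gcd hv5 (hV.pow_of_commute ht4 hns (mem_cen.mp v.2))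
      norm_num at this
      rw [this, orderOf_one] at hv
      omega
    have h27 : cc t ∣ 27 := by
      have hco : Nat.Coprime (cc t) 40 := by
        rw [show 40 = 2 ^ 3 * 5 from rfl]
        exact Nat.Coprime.mul_right (Nat.Coprime.pow_right _
          ((Nat.Prime.coprime_iff_not_dvd Nat.prime_two).mpr h2).symm)
          ((Nat.Prime.coprime_iff_not_dvd Nat.prime_five).mpr h5).symm
      exact hco.dvd_of_dvd_mul_left (by simpa using hdvd)
    rw [hA3] at h3A
    interval_cases cc t <;> omega

end Valentiner

namespace Valentiner
variable {G : Type*} [Group G] [Finite G] {ρ : G →* M3}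

lemma sum_two_le (hV : Valentiner ρ) [Fintype G] :
    ∑ x ∈ Finset.univ.filter (fun x : G => x ^ 8 = 1), nf ρ x ≤ 144 := by
  set Z := Finset.univ.filter fun x : G => Scal ρ x with hZ
  set I := Finset.univ.filter fun x : G => x ^ 8 = 1 with hI
  have hZ3 : Z.card = 3 := by
    rw [← hV.card_scalars]; exact card_filter_mem (scalars ρ)
  have hinj : Set.InjOn (fun p : G × G => p.1 * p.2) (Z ×ˢ I : Finset (G × G)) := by
    have key : ∀ p ∈ Z ×ˢ I, (p.1 * p.2) ^ 9 = p.2 := by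
      rintro ⟨a, v⟩ h
      obtain ⟨ha, hv⟩ := Finset.mem_product.mp h
      have ha := (Finset.mem_filter.mp ha).2
      rw [(show Commute a v from ha.commute hV.inj v).mul_pow, pow_mul a 3 3, hV.pow_scalar ha,
        one_pow, one_mul, pow_succ, (Finset.mem_filter.mp hv).2, one_mul]
    rintro ⟨a, v⟩ h ⟨b, w⟩ h' e
    have h1 := key _ h
    have h2 := key _ h'
    have e : a * v = b * w := e
    have : v = w := h1.symm.trans ((congrArg (· ^ 9) e).trans h2)
    subst this
    rw [mul_right_cancel e]
  have h1 : ∑ x ∈ (Z ×ˢ I).image (fun p => p.1 * p.2), nf ρ x ≤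
      ∑ x ∈ Finset.univ.filter (fun x : G => x ^ 432 = 1), nf ρ x := by
    apply Finset.sum_le_sum_of_subset_of_nonneg
    · intro x hx
      obtain ⟨⟨a, v⟩, hp, rfl⟩ := Finset.mem_image.mp hx
      obtain ⟨ha, hv⟩ := Finset.mem_product.mp hp
      have ha := (Finset.mem_filter.mp ha).2
      rw [Finset.mem_filter, (show Commute a v from ha.commute hV.inj v).mul_pow, pow_mul a 3 144,
        hV.pow_scalar ha, pow_mul v 8 54, (Finset.mem_filter.mp hv).2]
      simp
    · intros; exact nf_nonneg _ _
  rw [Finset.sum_image hinj, Finset.sum_product,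
    Finset.sum_congr rfl (fun a (ha : a ∈ Z) => Finset.sum_congr rfl fun v _ =>
      nf_scal_mul (Finset.mem_filter.mp ha).2 v), Finset.sum_const, hZ3] at h1
  have h2 := sum_nf ρ hV.schur
  rw [← Finset.sum_filter_add_sum_filter_not _ (fun x : G => x ^ 432 = 1), hV.card] at h2
  have h3 := hV.exists_five_sum
  push_cast at h2
  simp only [nsmul_eq_mul, Nat.cast_ofNat] at h1
  linarith

lemma cc_two_dvd (hV : Valentiner ρ) {y : G} (hy : y ^ 8 = 1) (hy1 : y ≠ 1) : cc y ∣ 24 := by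
  have hdvd : cc y ∣ 1080 := hV.card ▸ Subgroup.card_subgroup_dvd_card _
  have h9 : ¬ 3 ^ 2 ∣ cc y := by
    intro h
    have := fact_prime_three
    obtain ⟨K, hK⟩ := Sylow.exists_subgroup_card_pow_prime 3 h
    obtain ⟨s, hs⟩ : ∃ s : K, ¬ Scal ρ ((s : Subgroup.centralizer {y}) : G) := by
      by_contra! hall
      have h1 : Nat.card K ≤ Nat.card (scalars ρ) := Nat.card_le_card_of_injective
        (fun s : K => (⟨((s : Subgroup.centralizer {y}) : G), hall s⟩ : scalars ρ))
        fun s s' e => Subtype.ext (Subtype.ext (congrArg (fun z : scalars ρ => (z : G)) e))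
      have h2 := hV.card_scalars
      omega
    set s' : G := ((s : Subgroup.centralizer {y}) : G)
    have hs27 : s' ^ 27 = 1 := by
      have : s ^ 9 = 1 := by rw [show 9 = Nat.card K from hK.symm, pow_card_eq_one']
      have h1 : s' ^ 9 = 1 := congrArg (fun x : K => ((x : Subgroup.centralizer {y}) : G)) this
      rw [pow_mul s' 9 3, h1, one_pow]
    have hys : y ∈ Subgroup.centralizer {s'} :=
      mem_cen.mpr (mem_cen.mp (s : Subgroup.centralizer {y}).2).symm
    have hy9 : (⟨y, hys⟩ : Subgroup.centralizer {s'}) ^ cc s' = 1 := pow_card_eq_one'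
    rw [hV.cc_three hs27 hs] at hy9
    have := pow_eq_one_of_gcd hy (congrArg Subtype.val hy9)
    norm_num at this
    exact hy1 this
  have h5 : ¬ 5 ∣ cc y := by
    intro h
    have := fact_prime_five
    obtain ⟨v, hv⟩ := exists_prime_orderOf_dvd_card' (G := Subgroup.centralizer {y}) 5 h
    have hv5 : (v : G) ^ 5 = 1 := by
      rw [← hv, ← Subgroup.orderOf_coe]; exact pow_orderOf_eq_one _
    have hv1 : (v : G) ≠ 1 := by
      intro h
      rw [← Subgroup.orderOf_coe, h, orderOf_one] at hv
      omega
    have hyv : y ∈ Subgroup.centralizer {(v : G)} := mem_cen.mpr (mem_cen.mp v.2).symm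
    have hy15 : (⟨y, hyv⟩ : Subgroup.centralizer {(v : G)}) ^ cc (v : G) = 1 := pow_card_eq_one'
    rw [hV.cc_five hv5 hv1] at hy15
    have := pow_eq_one_of_gcd hy (congrArg Subtype.val hy15)
    norm_num at this
    exact hy1 this
  have hmem : cc y ∈ Nat.divisors 1080 := Nat.mem_divisors.mpr ⟨hdvd, by norm_num⟩
  have hdec : ∀ n ∈ Nat.divisors 1080, ¬ 3 ^ 2 ∣ n → ¬ 5 ∣ n → n ∣ 24 := by
    intro n hn h h'
    have hn := (Nat.mem_divisors.mp hn).1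
    have hco : Nat.Coprime n 5 := ((Nat.Prime.coprime_iff_not_dvd Nat.prime_five).mpr h').symm
    have h216 : n ∣ 24 * 9 := hco.dvd_of_dvd_mul_right (by simpa using hn)
    rw [Nat.dvd_mul] at h216
    obtain ⟨a, b, ha, hb, rfl⟩ := h216
    by_cases hb1 : b = 1
    · rwa [hb1, mul_one]
    have h3b : 3 ∣ b := by
      have : b ≤ 9 := Nat.le_of_dvd (by norm_num) hb
      interval_cases b <;> omega
    have h3a : ¬ 3 ∣ a := fun h3a => h (by rw [sq]; exact Nat.mul_dvd_mul h3a h3b)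
    have hb9 : ¬ 9 ∣ b := fun h9b => h (Dvd.dvd.mul_left h9b a)
    have hb3 : b = 3 := by
      have : b ≤ 9 := Nat.le_of_dvd (by norm_num) hb
      interval_cases b <;> omega
    have ha8 : a ∣ 8 := (((Nat.Prime.coprime_iff_not_dvd Nat.prime_three).mpr h3a).symm).dvd_of_dvd_mul_right
      (show a ∣ 8 * 3 by simpa using ha)
    rw [hb3]
    exact Nat.mul_dvd_mul ha8 (dvd_refl 3)
  exact hdec _ hmem h9 h5

lemma card_class_two (hV : Valentiner ρ) [Fintype G] {y : G} (hy : y ^ 8 = 1) (hy1 : y ≠ 1) :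
    (Finset.univ.filter fun x => IsConj y x).card = 45 ∨
      90 ≤ (Finset.univ.filter fun x => IsConj y x).card := by
  obtain ⟨k, hk⟩ := hV.cc_two_dvd hy hy1
  have h := card_conj_class y
  rw [hV.card, show 1080 = 24 * 45 from rfl, hk, mul_comm (cc y) k, mul_assoc, mul_comm (cc y),
    ← mul_assoc] at h
  have hpos : 0 < cc y := Nat.card_pos
  have h' := Nat.eq_of_mul_eq_mul_right hpos h
  have hk0 : k ≠ 0 := by rintro rfl; omega
  rcases (show k = 1 ∨ 2 ≤ k by omega) with rfl | h2
  · left; omega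
  · right; rw [h']; omega

lemma isConj_pow_eq_one {y x : G} (h : IsConj y x) {n : ℕ} : x ^ n = 1 ↔ y ^ n = 1 := by
  obtain ⟨c, rfl⟩ := isConj_iff.mp h
  rw [conj_pow, conj_eq_one_iff]

lemma nf_isConj {y x : G} (h : IsConj y x) : nf ρ x = nf ρ y := by
  obtain ⟨c, rfl⟩ := isConj_iff.mp h
  exact nf_conj ρ c y

lemma sum_two_nontrivial_le (hV : Valentiner ρ) [Fintype G] :
    ∑ x ∈ Finset.univ.filter (fun x : G => x ^ 8 = 1 ∧ x ≠ 1), nf ρ x ≤ 135 := by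
  have h1 : Finset.univ.filter (fun x : G => x ^ 8 = 1) =
      insert 1 (Finset.univ.filter (fun x : G => x ^ 8 = 1 ∧ x ≠ 1)) := by
    ext x
    by_cases h : x = 1 <;> simp [h]
  have := hV.sum_two_le
  rw [h1, Finset.sum_insert (by simp), nf_one] at this
  linarith

/-- Disjoint classes of elements of two-power order have bounded total weight. -/
lemma sum_classes_le (hV : Valentiner ρ) [Fintype G] (R : Finset G)
    (hR : ∀ y ∈ R, y ^ 8 = 1 ∧ y ≠ 1) (hdis : ∀ y ∈ R, ∀ z ∈ R, IsConj y z → y = z) :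
    ∑ y ∈ R, 45 * nf ρ y ≤ 135 := by
  calc ∑ y ∈ R, 45 * nf ρ y
      ≤ ∑ y ∈ R, ∑ x ∈ Finset.univ.filter (fun x => IsConj y x), nf ρ x := by
        apply Finset.sum_le_sum
        intro y hy
        rw [Finset.sum_congr rfl fun x hx => nf_isConj (Finset.mem_filter.mp hx).2,
          Finset.sum_const, nsmul_eq_mul]
        apply mul_le_mul_of_nonneg_right _ (nf_nonneg _ _)
        have : 45 ≤ (Finset.univ.filter fun x => IsConj y x).card := by
          have := hV.card_class_two (hR y hy).1 (hR y hy).2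
          omega
        exact_mod_cast this
    _ = ∑ x ∈ R.biUnion fun y => Finset.univ.filter (fun x => IsConj y x), nf ρ x := by
        rw [Finset.sum_biUnion]
        intro y hy z hz hyz
        rw [Function.onFun, Finset.disjoint_left]
        intro x hx hx'
        exact hyz (hdis y hy z hz
          ((Finset.mem_filter.mp hx).2.trans (Finset.mem_filter.mp hx').2.symm))
    _ ≤ ∑ x ∈ Finset.univ.filter (fun x : G => x ^ 8 = 1 ∧ x ≠ 1), nf ρ x := by
        apply Finset.sum_le_sum_of_subset_of_nonneg
        · intro x hx
          obtain ⟨y, hy, hx⟩ := Finset.mem_biUnion.mp hx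
          have hx := (Finset.mem_filter.mp hx).2
          refine Finset.mem_filter.mpr ⟨Finset.mem_univ _, (isConj_pow_eq_one hx).mpr (hR y hy).1, ?_⟩
          rintro rfl
          exact (hR y hy).2 (isConj_one_right.mp hx.symm)
        · intros; exact nf_nonneg _ _
    _ ≤ 135 := hV.sum_two_nontrivial_le

end Valentiner

namespace Valentiner
variable {G : Type*} [Group G] [Finite G] {ρ : G →* M3}

lemma trace_sq_cube (hV : Valentiner ρ) (x : G) :
    trace (ρ (x ^ 2)) = trace (ρ x) ^ 2 - 2 * trace (ρ x⁻¹) ∧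
    trace (ρ (x ^ 3)) = trace (ρ x) ^ 3 - 3 * trace (ρ x) * trace (ρ x⁻¹) + 3 := by
  obtain ⟨P, Q, d, hPQ, hQP, hM, hd⟩ := exists_diagonalization (M := ρ x) (n := 1080) (by norm_num)
    (by rw [← map_pow, hV.pow_card, map_one])
  have hdet := det_of_diag hPQ hM
  rw [hV.det_eq] at hdet
  have hinv : ρ x⁻¹ = P * diagonal ![d 1 * d 2, d 0 * d 2, d 0 * d 1] * Q := by
    have h1 : ρ x * (P * diagonal ![d 1 * d 2, d 0 * d 2, d 0 * d 1] * Q) = 1 := by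
      rw [hM]
      calc _ = P * (diagonal d * (Q * P) * diagonal ![d 1 * d 2, d 0 * d 2, d 0 * d 1]) * Q := by
            simp only [mul_assoc]
        _ = P * Q := by
            rw [hQP, mul_one, diagonal_mul_diagonal]
            have : (fun i => d i * ![d 1 * d 2, d 0 * d 2, d 0 * d 1] i) = fun _ => 1 := by
              funext i
              fin_cases i
              · change d 0 * (d 1 * d 2) = 1
                rw [hdet]; ring
              · change d 1 * (d 0 * d 2) = 1
                rw [hdet]; ring
              · change d 2 * (d 0 * d 1) = 1
                rw [hdet]; ring
            rw [this, diagonal_one, mul_one]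
        _ = 1 := hPQ
    calc ρ x⁻¹ = ρ x⁻¹ * (ρ x * (P * diagonal ![d 1 * d 2, d 0 * d 2, d 0 * d 1] * Q)) := by
          rw [h1, mul_one]
      _ = _ := by rw [← mul_assoc, ← map_mul, inv_mul_cancel, map_one, one_mul]
  have e2 := trace_of_diag hQP hinv
  change _ = d 1 * d 2 + d 0 * d 2 + d 0 * d 1 at e2
  rw [trace_of_diag hQP hM, trace_of_diag hQP (pow_of_diag hPQ hQP hM 2),
    trace_of_diag hQP (pow_of_diag hPQ hQP hM 3), e2]
  exact ⟨by ring, by linear_combination (-3) * hdet⟩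

lemma nf_le_of_two (hV : Valentiner ρ) {y : G} (hy : y ^ 8 = 1) (hy1 : y ≠ 1) : nf ρ y ≤ 3 := by
  have := Fintype.ofFinite G
  have := hV.sum_classes_le {y} (by simpa using ⟨hy, hy1⟩) (by simp)
  rw [Finset.sum_singleton] at this
  linarith

lemma trace_order_four (hV : Valentiner ρ) {y : G} (hy : y ^ 4 = 1) (hy2 : y ^ 2 ≠ 1) :
    trace (ρ y) = 1 := by
  have hy22 : (y ^ 2) ^ 2 = 1 := by rw [← pow_mul, hy]
  have h1 := (hV.trace_sq_cube y).1
  have h2 := (hV.trace_sq_cube y⁻¹).1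
  have hi : (y⁻¹) ^ 2 = y ^ 2 := by
    rw [inv_pow]; exact inv_eq_of_mul_eq_one_left (by rw [← sq, hy22])
  rw [hi, inv_inv, hV.trace_involution hy22 hy2] at h2
  rw [hV.trace_involution hy22 hy2] at h1
  have h3 : (trace (ρ y) - trace (ρ y⁻¹)) * (trace (ρ y) + trace (ρ y⁻¹) + 2) = 0 := by
    linear_combination h2 - h1
  rcases mul_eq_zero.mp h3 with h | h
  · have : (trace (ρ y) - 1) ^ 2 = 0 := by linear_combination -2 * h - h1
    linear_combination pow_eq_zero_iff (two_ne_zero) |>.mp this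
  · exfalso
    have h8 := hV.nf_le_of_two (y := y) (by rw [pow_mul y 4 2, hy, one_pow])
      (fun h => hy2 (by rw [h, one_pow]))
    have h5 : (nf ρ y : ℂ) = 5 := by
      rw [nf_cast]
      linear_combination (trace (ρ y)) * h + h1 - 2 * h
    have h5 : nf ρ y = 5 := by exact_mod_cast h5
    linarith

lemma nf_order_four (hV : Valentiner ρ) {y : G} (hy : y ^ 4 = 1) (hy2 : y ^ 2 ≠ 1) :
    nf ρ y = 1 := by
  unfold nf; rw [hV.trace_order_four hy hy2]; simp

/-- There are no elements of order eight. -/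
lemma pow_four_eq_one (hV : Valentiner ρ) {y : G} (hy : y ^ 8 = 1) : y ^ 4 = 1 := by
  by_contra h4
  have := Fintype.ofFinite G
  have h2 : y ^ 2 ≠ 1 := fun h => h4 (by rw [pow_mul y 2 2, h, one_pow])
  have h1 : y ≠ 1 := fun h => h4 (by rw [h, one_pow])
  have ht2 : trace (ρ (y ^ 2)) = 1 := hV.trace_order_four (by rw [← pow_mul, hy])
    (by rwa [← pow_mul])
  have ht2' : trace (ρ (y⁻¹ ^ 2)) = 1 := hV.trace_order_four (by rw [← pow_mul, inv_pow, hy, inv_one])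
    (by rwa [← pow_mul, inv_pow, inv_ne_one])
  obtain ⟨a1, a2⟩ := hV.trace_sq_cube y
  obtain ⟨b1, b2⟩ := hV.trace_sq_cube y⁻¹
  rw [inv_inv] at b1 b2
  rw [ht2] at a1
  rw [ht2'] at b1
  have n1 := nf_cast ρ y
  have n3 := nf_cast ρ (y ^ 3)
  rw [a2, show (y ^ 3)⁻¹ = y⁻¹ ^ 3 by rw [inv_pow], b2] at n3
  have hsum : (nf ρ y + nf ρ (y ^ 3) : ℂ) = 6 := by
    rw [n1, n3]
    generalize trace (ρ y) = a at *
    generalize trace (ρ y⁻¹) = b at *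
    have hA : a ^ 3 - 3 * a * b + 3 = a - a * b + 3 := by linear_combination -a * a1
    have hB : b ^ 3 - 3 * b * a + 3 = b - a * b + 3 := by linear_combination -b * b1
    rw [hA, hB]
    linear_combination (2 + b - b ^ 2) * a1 + (1 + a - 2 * b) * b1
  have hsum : nf ρ y + nf ρ (y ^ 3) = 6 := by exact_mod_cast hsum
  have key : ∀ z : G, z ^ 8 = 1 → z ^ 4 ≠ 1 → nf ρ z ≤ 1 := by
    intro z hz hz4
    have hz2 : z ^ 2 ≠ 1 := fun h => hz4 (by rw [pow_mul z 2 2, h, one_pow])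
    have hz1 : z ≠ 1 := fun h => hz4 (by rw [h, one_pow])
    have hz24 : (z ^ 2) ^ 4 = 1 := by rw [← pow_mul, hz]
    have hz22 : (z ^ 2) ^ 2 ≠ 1 := by rwa [← pow_mul]
    have hz42 : (z ^ 4) ^ 2 = 1 := by rw [← pow_mul, hz]
    have hz4' : (z ^ 4) ^ 4 = 1 := by rw [← pow_mul, pow_mul z 8 2, hz, one_pow]
    have n1 : ¬ IsConj z (z ^ 2) := fun h => hz4 ((isConj_pow_eq_one h).mp hz24)
    have n2 : ¬ IsConj z (z ^ 4) := fun h => hz4 ((isConj_pow_eq_one h).mp hz4')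
    have n3 : ¬ IsConj (z ^ 2) (z ^ 4) := fun h => hz22 ((isConj_pow_eq_one h).mp hz42)
    have m1 : z ≠ z ^ 2 := fun h => n1 (h ▸ IsConj.refl _)
    have m2 : z ≠ z ^ 4 := fun h => n2 (h ▸ IsConj.refl _)
    have m3 : z ^ 2 ≠ z ^ 4 := fun h => n3 (h ▸ IsConj.refl _)
    have := hV.sum_classes_le {z, z ^ 2, z ^ 4} (by
      intro x hx
      simp only [Finset.mem_insert, Finset.mem_singleton] at hx
      rcases hx with rfl | rfl | rfl
      · exact ⟨hz, hz1⟩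
      · exact ⟨by rw [← pow_mul, pow_mul z 8 2, hz, one_pow], hz2⟩
      · exact ⟨by rw [← pow_mul, pow_mul z 8 4, hz, one_pow], hz4⟩) (by
      intro x hx w hw hxw
      simp only [Finset.mem_insert, Finset.mem_singleton] at hx hw
      rcases hx with rfl | rfl | rfl <;> rcases hw with rfl | rfl | rfl
      · rfl
      · exact absurd hxw n1
      · exact absurd hxw n2
      · exact absurd hxw.symm n1
      · rfl
      · exact absurd hxw n3
      · exact absurd hxw.symm n2
      · exact absurd hxw.symm n3
      · rfl)
    rw [Finset.sum_insert (by simp [m1, m2]), Finset.sum_insert (by simp [m3]),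
      Finset.sum_singleton, hV.nf_order_four hz24 hz22, hV.nf_involution hz42 hz4] at this
    linarith
  have k1 := key y hy h4
  have k2 := key (y ^ 3) (by rw [← pow_mul, pow_mul y 8 3, hy, one_pow]) (by
    rw [← pow_mul, show 3 * 4 = 8 + 4 from rfl, pow_add, hy, one_mul]
    exact h4)
  linarith

end Valentiner

namespace Valentiner
variable {G : Type*} [Group G] [Finite G] {ρ : G →* M3}

lemma exists_order_four (hV : Valentiner ρ) : ∃ y : G, y ^ 4 = 1 ∧ y ^ 2 ≠ 1 := by
  have := Fintype.ofFinite G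
  by_contra! hall
  have : Fact (Nat.Prime 2) := ⟨Nat.prime_two⟩
  obtain ⟨S, hS⟩ := Sylow.exists_subgroup_card_pow_prime (G := G) 2 (n := 3) (by
    rw [hV.card]; norm_num)
  have hS : Nat.card S = 8 := hS
  obtain ⟨k, hk⟩ := sum_trace (ρ.comp S.subtype)
  have h8 : Fintype.card S = 8 := by rw [← Nat.card_eq_fintype_card, hS]
  rw [← Finset.add_sum_erase _ _ (Finset.mem_univ 1), Finset.sum_congr rfl (g := fun _ => -1),
    Finset.sum_const, Finset.card_erase_of_mem (Finset.mem_univ 1), Finset.card_univ, h8, hS,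
    map_one, trace_one] at hk
  · norm_num at hk
    have h : (-1 : ℂ) = 2 * k := by linear_combination hk / 4
    have h : (-1 : ℤ) = 2 * k := by exact_mod_cast h
    omega
  · intro x hx
    have hx1 := (Finset.mem_erase.mp hx).1
    have hx8 : x ^ 8 = 1 := by rw [show 8 = Nat.card S from hS.symm, pow_card_eq_one']
    have hx8 : (x : G) ^ 8 = 1 := congrArg Subtype.val hx8
    exact hV.trace_involution (hall _ (hV.pow_four_eq_one hx8)) fun h => hx1 (Subtype.ext h)

lemma card_involutions_add_le (hV : Valentiner ρ) [Fintype G] :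
    (Finset.univ.filter fun x : G => x ^ 2 = 1 ∧ x ≠ 1).card +
      (Finset.univ.filter fun x : G => x ^ 4 = 1 ∧ x ^ 2 ≠ 1).card ≤ 135 := by
  have h := hV.sum_two_nontrivial_le
  rw [Finset.sum_congr rfl (g := fun _ => (1 : ℝ)), Finset.sum_const, nsmul_one] at h
  · rw [← Finset.card_union_of_disjoint]
    · refine le_trans (Finset.card_le_card ?_) (by exact_mod_cast h)
      intro x hx
      rw [Finset.mem_union, Finset.mem_filter, Finset.mem_filter] at hx
      refine Finset.mem_filter.mpr ⟨Finset.mem_univ _, ?_⟩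
      rcases hx with ⟨-, h, h'⟩ | ⟨-, h, h'⟩
      · exact ⟨by rw [pow_mul x 2 4, h, one_pow], h'⟩
      · exact ⟨by rw [pow_mul x 4 2, h, one_pow], fun h1 => h' (by rw [h1, one_pow])⟩
    · rw [Finset.disjoint_left]
      intro x hx hx'
      exact (Finset.mem_filter.mp hx').2.2 (Finset.mem_filter.mp hx).2.1
  · intro x hx
    obtain ⟨-, h8, h1⟩ := Finset.mem_filter.mp hx
    by_cases h2 : x ^ 2 = 1
    · exact hV.nf_involution h2 h1
    · exact hV.nf_order_four (hV.pow_four_eq_one h8) h2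

lemma even_card_of_inv {F : Finset G} (hinv : ∀ x ∈ F, x⁻¹ ∈ F) (hne : ∀ x ∈ F, x⁻¹ ≠ x) :
    Even F.card := by
  have := Finset.sum_involution (s := F) (f := fun _ => (1 : ZMod 2)) (fun x _ => x⁻¹)
    (fun _ _ => by decide) (fun x hx _ => hne x hx) hinv (fun x _ => inv_inv x)
  rw [Finset.sum_const, nsmul_one] at this
  exact (ZMod.natCast_eq_zero_iff_even).mp this

lemma le_card_class (hV : Valentiner ρ) [Fintype G] {y : G} (hy : y ^ 8 = 1) (hy1 : y ≠ 1) :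
    45 ≤ (Finset.univ.filter fun x => IsConj y x).card := by
  have := hV.card_class_two hy hy1
  omega

lemma le_card_order_four (hV : Valentiner ρ) [Fintype G] :
    90 ≤ (Finset.univ.filter fun x : G => x ^ 4 = 1 ∧ x ^ 2 ≠ 1).card := by
  set F := Finset.univ.filter fun x : G => x ^ 4 = 1 ∧ x ^ 2 ≠ 1 with hF
  have mF : ∀ {x}, x ∈ F ↔ x ^ 4 = 1 ∧ x ^ 2 ≠ 1 := by simp [hF]
  have hcl : ∀ y ∈ F, (Finset.univ.filter fun x => IsConj y x) ⊆ F := by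
    intro y hy x hx
    have hx := (Finset.mem_filter.mp hx).2
    exact mF.mpr ⟨(isConj_pow_eq_one hx).mpr (mF.mp hy).1,
      fun h => (mF.mp hy).2 ((isConj_pow_eq_one hx).mp h)⟩
  have h8 : ∀ y ∈ F, y ^ 8 = 1 ∧ y ≠ 1 := fun y hy =>
    ⟨by rw [pow_mul y 4 2, (mF.mp hy).1, one_pow], fun h1 => (mF.mp hy).2 (by rw [h1, one_pow])⟩
  obtain ⟨y, hy⟩ := hV.exists_order_four
  have hy := mF.mpr hy
  by_cases hex : ∃ z ∈ F, ¬ IsConj y z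
  · obtain ⟨z, hz, hyz⟩ := hex
    calc 90 ≤ (Finset.univ.filter fun x => IsConj y x).card +
          (Finset.univ.filter fun x => IsConj z x).card := by
          have h1 := hV.le_card_class (h8 y hy).1 (h8 y hy).2
          have h2 := hV.le_card_class (h8 z hz).1 (h8 z hz).2
          omega
      _ = ((Finset.univ.filter fun x => IsConj y x) ∪
          (Finset.univ.filter fun x => IsConj z x)).card := by
          rw [Finset.card_union_of_disjoint]
          rw [Finset.disjoint_left]
          intro x hx hx'
          exact hyz ((Finset.mem_filter.mp hx).2.trans (Finset.mem_filter.mp hx').2.symm)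
      _ ≤ F.card := Finset.card_le_card (Finset.union_subset (hcl y hy) (hcl z hz))
  · push Not at hex
    have heq : F = Finset.univ.filter fun x => IsConj y x :=
      Finset.Subset.antisymm (fun x hx => Finset.mem_filter.mpr ⟨Finset.mem_univ _, hex x hx⟩)
        (hcl y hy)
    have hev : Even F.card := by
      apply even_card_of_inv
      · intro x hx
        rw [mF, inv_pow, inv_pow, inv_eq_one, inv_ne_one]
        exact mF.mp hx
      · intro x hx h
        apply (mF.mp hx).2
        rw [sq]
        nth_rewrite 1 [← h]
        exact inv_mul_cancel x
    rw [heq] at hev ⊢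
    rcases hV.card_class_two (h8 y hy).1 (h8 y hy).2 with h | h
    · rw [h] at hev
      exact absurd hev (by decide)
    · exact h

lemma card_two_elements (hV : Valentiner ρ) [Fintype G] :
    (Finset.univ.filter fun x : G => x ^ 2 = 1 ∧ x ≠ 1).card = 45 ∧
      (Finset.univ.filter fun x : G => x ^ 4 = 1 ∧ x ^ 2 ≠ 1).card = 90 ∧
      ∀ v w : G, v ^ 2 = 1 → v ≠ 1 → w ^ 2 = 1 → w ≠ 1 → IsConj v w := by
  have h1 := hV.card_involutions_add_le
  have h2 := hV.le_card_order_four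
  have h3 : ∀ v : G, v ^ 2 = 1 → v ≠ 1 → 45 ≤ (Finset.univ.filter fun x => IsConj v x).card :=
    fun v hv hv1 => hV.le_card_class (by rw [pow_mul v 2 4, hv, one_pow]) hv1
  have h4 : ∀ v : G, v ^ 2 = 1 → v ≠ 1 → (Finset.univ.filter fun x => IsConj v x) ⊆
      Finset.univ.filter fun x : G => x ^ 2 = 1 ∧ x ≠ 1 := by
    intro v hv hv1 x hx
    have hx := (Finset.mem_filter.mp hx).2
    refine Finset.mem_filter.mpr ⟨Finset.mem_univ _, (isConj_pow_eq_one hx).mpr hv, ?_⟩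
    rintro rfl
    exact hv1 (isConj_one_right.mp hx.symm)
  obtain ⟨y, hy4, hy2⟩ := hV.exists_order_four
  have hy22 : (y ^ 2) ^ 2 = 1 := by rw [← pow_mul, hy4]
  have h5 := h3 (y ^ 2) hy22 hy2
  have h6 := Finset.card_le_card (h4 (y ^ 2) hy22 hy2)
  refine ⟨by omega, by omega, fun v w hv hv1 hw hw1 => ?_⟩
  have h7 := Finset.eq_of_subset_of_card_le (h4 v hv hv1) (by have := h3 v hv hv1; omega)
  have : w ∈ Finset.univ.filter fun x => IsConj v x := by
    rw [h7]; exact Finset.mem_filter.mpr ⟨Finset.mem_univ _, hw, hw1⟩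
  exact (Finset.mem_filter.mp this).2

lemma card_sqrt (hV : Valentiner ρ) [Fintype G] {v : G} (hv : v ^ 2 = 1) (hv1 : v ≠ 1) :
    (Finset.univ.filter fun y : G => y ^ 2 = v).card = 2 := by
  obtain ⟨hI, hF, hconj⟩ := hV.card_two_elements
  have hfib : ∀ w ∈ Finset.univ.filter (fun x : G => x ^ 2 = 1 ∧ x ≠ 1),
      ((Finset.univ.filter fun x : G => x ^ 4 = 1 ∧ x ^ 2 ≠ 1).filter fun y => y ^ 2 = w).card =
      (Finset.univ.filter fun y : G => y ^ 2 = v).card := by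
    intro w hw
    obtain ⟨-, hw, hw1⟩ := Finset.mem_filter.mp hw
    obtain ⟨c, hc⟩ := isConj_iff.mp (hconj w v hw hw1 hv hv1)
    apply Finset.card_bij (fun y _ => c * y * c⁻¹)
    · intro y hy
      rw [Finset.mem_filter, conj_pow, (Finset.mem_filter.mp hy).2, hc]
      exact ⟨Finset.mem_univ _, rfl⟩
    · intro y _ z _ h
      exact mul_left_cancel (mul_right_cancel h)
    · intro z hz
      have hz := (Finset.mem_filter.mp hz).2
      have h2 : (c⁻¹ * z * c) ^ 2 = w := by
        have := conj_pow (a := c⁻¹) (b := z) (i := 2)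
        rw [inv_inv, hz, ← hc] at this
        rw [this]; group
      refine ⟨c⁻¹ * z * c, ?_, by group⟩
      rw [Finset.mem_filter, Finset.mem_filter]
      refine ⟨⟨Finset.mem_univ _, ?_, ?_⟩, h2⟩
      · rw [pow_mul _ 2 2, h2, hw]
      · rwa [h2]
  have := Finset.card_eq_sum_card_fiberwise (f := fun y : G => y ^ 2)
    (s := Finset.univ.filter fun x : G => x ^ 4 = 1 ∧ x ^ 2 ≠ 1)
    (t := Finset.univ.filter fun x : G => x ^ 2 = 1 ∧ x ≠ 1) (by
      intro y hy
      have hy := (Finset.mem_filter.mp hy).2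
      exact Finset.mem_coe.mpr (Finset.mem_filter.mpr ⟨Finset.mem_univ _, by rw [← pow_mul, hy.1], hy.2⟩))
  rw [hF, Finset.sum_congr rfl hfib, Finset.sum_const, hI, smul_eq_mul] at this
  omega

lemma exists_sqrt (hV : Valentiner ρ) {v : G} (hv : v ^ 2 = 1) (hv1 : v ≠ 1) :
    ∃ y : G, y ^ 2 = v := by
  have := Fintype.ofFinite G
  have h : 0 < (Finset.univ.filter fun y : G => y ^ 2 = v).card := by rw [hV.card_sqrt hv hv1]; norm_num
  obtain ⟨y, hy⟩ := Finset.card_pos.mp h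
  exact ⟨y, (Finset.mem_filter.mp hy).2⟩

lemma sqrt_unique (hV : Valentiner ρ) {y z : G} (hy : y ^ 4 = 1) (hy2 : y ^ 2 ≠ 1)
    (h : z ^ 2 = y ^ 2) : z = y ∨ z = y⁻¹ := by
  have := Fintype.ofFinite G
  have h2 := hV.card_sqrt (v := y ^ 2) (by rw [← pow_mul, hy]) hy2
  have hyi : y⁻¹ ^ 2 = y ^ 2 := by
    rw [inv_pow]; exact inv_eq_of_mul_eq_one_left (by rw [← pow_add, hy])
  have hne : y ≠ y⁻¹ := fun h => hy2 (by rw [sq]; nth_rewrite 1 [h]; exact inv_mul_cancel y)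
  have h3 : ({y, y⁻¹} : Finset G) ⊆ Finset.univ.filter fun x : G => x ^ 2 = y ^ 2 := by
    intro x hx
    rw [Finset.mem_insert, Finset.mem_singleton] at hx
    rcases hx with rfl | rfl
    · simp
    · simpa using hyi
  have h4 := Finset.eq_of_subset_of_card_le h3 (by rw [h2, Finset.card_pair hne])
  have : z ∈ ({y, y⁻¹} : Finset G) := by rw [h4]; simpa using h
  simpa using this

end Valentiner

namespace Valentiner
variable {G : Type*} [Group G] [Finite G] {ρ : G →* M3}

lemma card_partners (hV : Valentiner ρ) [Fintype G] {v : G} (hv : v ^ 2 = 1) (hv1 : v ≠ 1) :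
    (Finset.univ.filter fun w : G => w ^ 2 = 1 ∧ (v * w) ^ 5 = 1 ∧ v * w ≠ 1).card = 16 := by
  obtain ⟨hI, -, hconj⟩ := hV.card_two_elements
  have h := Finset.card_eq_sum_card_fiberwise (f := fun p : G × G => p.1)
    (s := Finset.univ.filter fun p : G × G => p.1 ^ 2 = 1 ∧ p.2 ^ 2 = 1 ∧ (p.1 * p.2) ^ 5 = 1 ∧
      p.1 * p.2 ≠ 1)
    (t := Finset.univ.filter fun x : G => x ^ 2 = 1 ∧ x ≠ 1) (by
      rintro ⟨a, b⟩ hp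
      obtain ⟨-, h1, h2, h3, h4⟩ := Finset.mem_filter.mp hp
      refine Finset.mem_coe.mpr (Finset.mem_filter.mpr ⟨Finset.mem_univ _, h1, ?_⟩)
      rintro rfl
      apply h4
      change 1 * b = 1
      change (1 * b) ^ 5 = 1 at h3
      change b ^ 2 = 1 at h2
      rw [one_mul] at h3 ⊢
      simpa using pow_eq_one_of_gcd h2 h3)
  rw [hV.card_pairs, Finset.sum_congr rfl (g := fun _ =>
    (Finset.univ.filter fun w : G => w ^ 2 = 1 ∧ (v * w) ^ 5 = 1 ∧ v * w ≠ 1).card),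
    Finset.sum_const, hI, smul_eq_mul] at h
  · omega
  · intro u hu
    obtain ⟨-, hu, hu1⟩ := Finset.mem_filter.mp hu
    obtain ⟨c, hc⟩ := isConj_iff.mp (hconj v u hv hv1 hu hu1)
    symm
    apply Finset.card_bij (fun w _ => (u, c * w * c⁻¹))
    · intro w hw
      obtain ⟨-, h1, h2, h3⟩ := Finset.mem_filter.mp hw
      have hm : u * (c * w * c⁻¹) = c * (v * w) * c⁻¹ := by rw [← hc]; group
      simp only [Finset.mem_filter, Finset.mem_univ, true_and, and_true]
      rw [hm, conj_pow, conj_pow, h1, h2, hu]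
      exact ⟨rfl, by group, by group, by rwa [ne_eq, conj_eq_one_iff]⟩
    · intro w _ w' _ h
      exact mul_left_cancel (mul_right_cancel (Prod.ext_iff.mp h).2)
    · rintro ⟨a, b⟩ hp
      simp only [Finset.mem_filter, Finset.mem_univ, true_and] at hp
      obtain ⟨⟨-, h1, h2, h3⟩, rfl⟩ := hp
      refine ⟨c⁻¹ * b * c, ?_, by simp only [Prod.mk.injEq, true_and]; group⟩
      have hm : v * (c⁻¹ * b * c) = c⁻¹ * (a * b) * (c⁻¹)⁻¹ := by rw [← hc]; group
      have hm' : c⁻¹ * b * c = c⁻¹ * b * (c⁻¹)⁻¹ := by group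
      rw [Finset.mem_filter, hm, hm', conj_pow, conj_pow, h1, h2]
      exact ⟨Finset.mem_univ _, by group, by group, by rwa [ne_eq, conj_eq_one_iff]⟩

lemma scal_decomposition (hV : Valentiner ρ) (x : G) :
    (∃ a g, Scal ρ a ∧ g ^ 5 = 1 ∧ g ≠ 1 ∧ x = a * g) ∨ trace (ρ x) = 0 ∨
      ∃ a y, Scal ρ a ∧ y ^ 4 = 1 ∧ x = a * y := by
  by_cases h : x ^ 432 = 1
  · right
    by_cases hs : Scal ρ (x ^ 8)
    · right
      have hs3 := hV.pow_scalar hs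
      have hx : (x ^ 9) ^ 8 = 1 := by
        rw [← pow_mul, show 9 * 8 = 8 * 3 * 3 from rfl, pow_mul, pow_mul, hs3, one_pow]
      exact ⟨(x ^ 8)⁻¹, x ^ 9, (scalars ρ).inv_mem hs, hV.pow_four_eq_one hx, by group⟩
    · left
      have h216 : x ^ 216 = 1 := by
        simpa using pow_eq_one_of_gcd h (hV.pow_card x)
      have h27 : (x ^ 8) ^ 27 = 1 := by rw [← pow_mul, h216]
      have hmem : x ∈ Subgroup.centralizer {x ^ 8} := mem_cen.mpr (by rw [← pow_succ, ← pow_succ'])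
      have h9 : (⟨x, hmem⟩ : Subgroup.centralizer {x ^ 8}) ^ cc (x ^ 8) = 1 := pow_card_eq_one'
      rw [hV.cc_three h27 hs] at h9
      have h9 : x ^ 9 = 1 := congrArg Subtype.val h9
      exact (hV.three_regular (t := x) (by rw [pow_mul x 9 3, h9, one_pow])
        fun hx => hs ((scalars ρ).pow_mem hx 8)).2.1
  · left
    have h5 : (x ^ 432) ^ 5 = 1 := by
      rw [← pow_mul, show 432 * 5 = 1080 * 2 from rfl, pow_mul, hV.pow_card, one_pow]
    obtain ⟨k, a, -, hx, ha⟩ := hV.decompose h5 h (x := x) (by rw [← pow_succ, ← pow_succ'])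
    refine ⟨a, (x ^ 432) ^ k, ha, by rw [← pow_mul, mul_comm, pow_mul, h5, one_pow], ?_, ?_⟩
    · intro h1
      rw [h1, one_mul] at hx
      apply h
      rw [hx, pow_mul a 3 144, hV.pow_scalar ha, one_pow]
    · rw [ha.commute hV.inj, ← hx]

lemma golden_trace (hV : Valentiner ρ) {g : G} (hg : g ^ 5 = 1) (hg1 : g ≠ 1) :
    trace (ρ g) ^ 2 = trace (ρ g) + 1 ∧ trace (ρ (g ^ 2)) = 1 - trace (ρ g) ∧
      ∀ k : ℕ, trace (ρ (g ^ (k + 5))) = trace (ρ (g ^ k)) := by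
  obtain ⟨z, h5, h1, hk⟩ := (hV.five g hg hg1).trace_pow
  have hc := five_cyclotomic h5 h1
  have e1 := hk 1
  rw [pow_one] at e1
  rw [e1, hk]
  refine ⟨?_, ?_, fun k => by rw [pow_add, hg, mul_one]⟩
  · linear_combination hc + (2 + z ^ 3) * h5
  · linear_combination hc + z ^ 3 * h5

lemma trace_five (hV : Valentiner ρ) {g h : G} (hg : g ^ 5 = 1) (hg1 : g ≠ 1) (hh : h ^ 5 = 1)
    (hh1 : h ≠ 1) : trace (ρ h) = trace (ρ g) ∨ trace (ρ h) = trace (ρ (g ^ 2)) := by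
  obtain ⟨h2, h3, -⟩ := hV.golden_trace hg hg1
  have h2' := (hV.golden_trace hh hh1).1
  rw [h3]
  have : (trace (ρ h) - trace (ρ g)) * (trace (ρ h) - (1 - trace (ρ g))) = 0 := by
    linear_combination h2' - h2
  rcases mul_eq_zero.mp this with h | h
  · left; linear_combination h
  · right; linear_combination h

lemma trace_classification (hV : Valentiner ρ) {g : G} (hg : g ^ 5 = 1) (hg1 : g ≠ 1) (x : G) :
    ∃ w : ℂ, w ^ 3 = 1 ∧ (trace (ρ x) = w * trace (ρ g) ∨ trace (ρ x) = w * trace (ρ (g ^ 2)) ∨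
      trace (ρ x) = 0 ∨ (trace (ρ x) = w * 3 ∧ (w = 1 → x = 1)) ∨
      (trace (ρ x) = -w ∧ (w = 1 → x ^ 2 = 1 ∧ x ≠ 1)) ∨
      (trace (ρ x) = w ∧ (w = 1 → x ^ 4 = 1 ∧ x ^ 2 ≠ 1))) := by
  have key : ∀ a y : G, Scal ρ a → ∃ w : ℂ, w ^ 3 = 1 ∧ trace (ρ (a * y)) = w * trace (ρ y) ∧
      (w = 1 → a = 1) := by
    intro a y ha
    have ha3 := hV.pow_scalar ha
    obtain ⟨w, hw⟩ := ha
    refine ⟨w, smul_one_inj (by rw [← smul_one_pow, ← hw, ← map_pow, ha3, map_one, one_smul]), ?_, ?_⟩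
    · rw [map_mul, hw, smul_mul_assoc, one_mul, trace_smul, smul_eq_mul]
    · rintro rfl
      exact hV.inj (by rw [hw, one_smul, map_one])
  rcases hV.scal_decomposition x with ⟨a, h, ha, hh, hh1, rfl⟩ | h0 | ⟨a, y, ha, hy, rfl⟩
  · obtain ⟨w, hw, ht, -⟩ := key a h ha
    refine ⟨w, hw, ?_⟩
    rcases hV.trace_five hg hg1 hh hh1 with h | h <;> rw [ht, h] <;> simp
  · exact ⟨1, one_pow 3, by simp [h0]⟩
  · obtain ⟨w, hw, ht, h1⟩ := key a y ha
    refine ⟨w, hw, ?_⟩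
    by_cases hy1 : y = 1
    · subst hy1
      rw [map_one, trace_one] at ht
      right; right; right; left
      exact ⟨by rw [ht]; norm_num, fun h => by rw [h1 h, one_mul]⟩
    by_cases hy2 : y ^ 2 = 1
    · rw [hV.trace_involution hy2 hy1] at ht
      right; right; right; right; left
      exact ⟨by rw [ht]; ring, fun h => by rw [h1 h, one_mul]; exact ⟨hy2, hy1⟩⟩
    · rw [hV.trace_order_four hy hy2, mul_one] at ht
      right; right; right; right; right
      exact ⟨ht, fun h => by rw [h1 h, one_mul]; exact ⟨hy, hy2⟩⟩

end Valentiner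

lemma golden_independent {φ : ℂ} (h : φ ^ 2 = φ + 1) {a b : ℤ} (hab : (a : ℂ) + b * φ = 0) :
    a = 0 ∧ b = 0 := by
  have h1 : (((2 * a + b) ^ 2 - 5 * b ^ 2 : ℤ) : ℂ) = 0 := by
    push_cast
    linear_combination (4 * a + 4 * b - 4 * b * φ) * hab + 4 * b ^ 2 * h
  have h2 : (2 * a + b) ^ 2 = 5 * b ^ 2 := by
    have := Int.cast_eq_zero.mp h1
    omega
  have hb : b = 0 := by
    by_contra hb
    have h5 : IsSquare (5 : ℚ) := ⟨(2 * a + b : ℚ) / b, by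
      have : (b : ℚ) ≠ 0 := by exact_mod_cast hb
      have h3 : ((2 * a + b : ℚ)) ^ 2 = 5 * b ^ 2 := by exact_mod_cast h2
      field_simp
      linear_combination -h3⟩
    have h5 : IsSquare (5 : ℕ) := Rat.isSquare_natCast_iff.mp h5
    exact (Nat.Prime.irrational_sqrt (p := 5) (by norm_num)).ne_nat
      (Nat.sqrt 5) (by
        obtain ⟨r, hr⟩ := h5
        have : r < 3 := by nlinarith
        interval_cases r <;> omega)
  subst hb
  simpa using hab

lemma conj_cube_root {w : ℂ} (hw : w ^ 3 = 1) : (starRingEnd ℂ) w = w ^ 2 := by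
  have h0 : w ≠ 0 := by rintro rfl; norm_num at hw
  have hn : ‖w‖ = 1 := Complex.norm_eq_one_of_pow_eq_one hw (by norm_num)
  have h1 : w * (starRingEnd ℂ) w = 1 := by
    rw [Complex.mul_conj, Complex.normSq_eq_norm_sq, hn]; norm_num
  apply mul_left_cancel₀ h0
  rw [h1, ← hw]; ring

namespace Valentiner
variable {G : Type*} [Group G] [Finite G] {ρ : G →* M3}

lemma conj_trace_five (hV : Valentiner ρ) {g : G} (hg : g ^ 5 = 1) (hg1 : g ≠ 1) :
    (starRingEnd ℂ) (trace (ρ g)) = trace (ρ g) := by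
  rw [← trace_inv ρ g]
  obtain ⟨z, h5, -, hk⟩ := (hV.five g hg hg1).trace_pow
  have e1 := hk 1
  have e4 := hk 4
  have : g⁻¹ = g ^ 4 := by
    rw [inv_eq_iff_mul_eq_one, ← pow_succ', hg]
  rw [this, e4]
  rw [pow_one] at e1
  rw [e1]
  linear_combination (z ^ 11 + z ^ 6 + z) * h5

lemma trace_form (hV : Valentiner ρ) {g : G} (hg : g ^ 5 = 1) (hg1 : g ≠ 1) (x : G) :
    ∃ (w : ℂ) (a b c : ℤ), ((w = 1 ∧ c = 2) ∨ (w ^ 2 + w + 1 = 0 ∧ c = -1)) ∧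
      ((a = 0 ∧ b = 1) ∨ (a = 1 ∧ b = -1) ∨ (a = 0 ∧ b = 0) ∨ (a = 3 ∧ b = 0 ∧ (w = 1 → x = 1)) ∨
        (a = -1 ∧ b = 0 ∧ (w = 1 → x ^ 2 = 1)) ∨ (a = 1 ∧ b = 0 ∧ (w = 1 → x ^ 4 = 1 ∧ x ^ 2 ≠ 1))) ∧
      trace (ρ x) = w * (a + b * trace (ρ g)) ∧
      trace (ρ x⁻¹) = w ^ 2 * (a + b * trace (ρ g)) := by
  obtain ⟨w, hw, h⟩ := hV.trace_classification hg hg1 x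
  have hφ := hV.conj_trace_five hg hg1
  have hwc := conj_cube_root hw
  have h2 := (hV.golden_trace hg hg1).2.1
  have hc : ∃ c : ℤ, ((w = 1 ∧ c = 2) ∨ (w ^ 2 + w + 1 = 0 ∧ c = -1)) := by
    have : (w - 1) * (w ^ 2 + w + 1) = 0 := by linear_combination hw
    rcases mul_eq_zero.mp this with h | h
    · exact ⟨2, .inl ⟨by linear_combination h, rfl⟩⟩
    · exact ⟨-1, .inr ⟨h, rfl⟩⟩
  obtain ⟨c, hc⟩ := hc
  have key : ∃ a b : ℤ, ((a = 0 ∧ b = 1) ∨ (a = 1 ∧ b = -1) ∨ (a = 0 ∧ b = 0) ∨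
      (a = 3 ∧ b = 0 ∧ (w = 1 → x = 1)) ∨
        (a = -1 ∧ b = 0 ∧ (w = 1 → x ^ 2 = 1)) ∨ (a = 1 ∧ b = 0 ∧ (w = 1 → x ^ 4 = 1 ∧ x ^ 2 ≠ 1))) ∧
      trace (ρ x) = w * (a + b * trace (ρ g)) := by
    rcases h with h | h | h | h | h | h
    · exact ⟨0, 1, by simp, by rw [h]; push_cast; ring⟩
    · exact ⟨1, -1, by simp, by rw [h, h2]; push_cast; ring⟩
    · exact ⟨0, 0, by simp, by rw [h]; push_cast; ring⟩
    · exact ⟨3, 0, by simpa using h.2, by rw [h.1]; push_cast; ring⟩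
    · exact ⟨-1, 0, by simpa using fun hw => (h.2 hw).1, by rw [h.1]; push_cast; ring⟩
    · exact ⟨1, 0, by simpa using h.2, by rw [h.1]; push_cast; ring⟩
  obtain ⟨a, b, hab, ht⟩ := key
  refine ⟨w, a, b, c, hc, hab, ht, ?_⟩
  rw [trace_inv ρ x, ht, map_mul, hwc, map_add, map_mul, hφ]
  simp

lemma trace_relations (hV : Valentiner ρ) {g : G} (hg : g ^ 5 = 1) (hg1 : g ≠ 1) {v : G}
    (hv : v ^ 2 = 1) (hv1 : v ≠ 1) :
    trace (ρ (v * g ^ 2)) + trace (ρ (v * g ^ 2)⁻¹) + 2 =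
      (trace (ρ (v * g)) + trace (ρ (v * g)⁻¹) + 2) * (1 + trace (ρ g)) ∧
    trace (ρ (v * g ^ 2)) - trace (ρ (v * g ^ 2)⁻¹) =
      (trace (ρ g) - 1) * (trace (ρ (v * g)) - trace (ρ (v * g)⁻¹)) := by
  obtain ⟨P, Q, z, hPQ, hQP, h5, h1, hρ⟩ := hV.five g hg hg1
  rw [five_inv h5] at hρ
  have htr : ∀ k : ℕ, trace (ρ (v * g ^ k)) = (Q * ρ v * P) 0 0 + (Q * ρ v * P) 1 1 * z ^ k +
      (Q * ρ v * P) 2 2 * z ^ (4 * k) := by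
    intro k
    rw [map_mul, pow_of_diag hPQ hQP hρ, ← mul_assoc, ← mul_assoc, trace_mul_comm,
      ← mul_assoc, ← mul_assoc]
    simp [trace_fin_three, Matrix.mul_diagonal, ← pow_mul]
  have hinv : ∀ k j : ℕ, k + j = 5 → trace (ρ (v * g ^ k)⁻¹) = trace (ρ (v * g ^ j)) := by
    intro k j hkj
    have : (v * g ^ k)⁻¹ = g ^ j * v := by
      rw [inv_eq_iff_mul_eq_one, mul_assoc, ← mul_assoc (g ^ k), ← pow_add, hkj, hg, one_mul,
        ← pow_two, hv]
    rw [this, map_mul, trace_mul_comm, ← map_mul]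
  have h0 := htr 0
  rw [pow_zero, mul_one, hV.trace_involution hv hv1] at h0
  have hg' : trace (ρ g) = 1 + z + z ^ 4 := by
    rw [trace_of_diag hQP hρ]; simp
  have i1 := hinv 1 4 rfl
  have t1 := htr 1
  rw [pow_one] at i1 t1
  rw [hinv 2 3 rfl, i1, t1, htr 2, htr 3, htr 4, hg']
  generalize (Q * ρ v * P) 0 0 = a at *
  generalize (Q * ρ v * P) 1 1 = b at *
  generalize (Q * ρ v * P) 2 2 = c at *
  have ha : a = -1 - b - c := by linear_combination -h0
  subst ha
  have e8 : z ^ 8 = z ^ 3 := by linear_combination z ^ 3 * h5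
  have e12 : z ^ 12 = z ^ 2 := by linear_combination (z ^ 7 + z ^ 2) * h5
  have e16 : z ^ 16 = z := by linear_combination (z ^ 11 + z ^ 6 + z) * h5
  constructor <;> norm_num <;> rw [e8, e12, e16]
  · linear_combination -(b + c) * (2 + z ^ 3) * h5
  · linear_combination (b - c) * z ^ 3 * h5
end Valentiner

namespace Valentiner
variable {G : Type*} [Group G] [Finite G] {ρ : G →* M3}

lemma trace_mul_cases (hV : Valentiner ρ) {g : G} (hg : g ^ 5 = 1) (hg1 : g ≠ 1) {v : G}
    (hv : v ^ 2 = 1) (hv1 : v ≠ 1) :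
    trace (ρ (v * g)) = 0 ∨ trace (ρ (v * g)) = 1 - trace (ρ g) ∨
      (trace (ρ (v * g)) = -1 ∧ (v * g) ^ 2 = 1) ∨
      (∃ w : ℂ, w ^ 2 + w + 1 = 0 ∧ trace (ρ (v * g)) = w * trace (ρ g) ∧
        trace (ρ (v * g ^ 2)) = w) ∨
      ∃ w : ℂ, w ^ 2 + w + 1 = 0 ∧ trace (ρ (v * g)) = w ∧
        trace (ρ (v * g ^ 2)) = w ^ 2 * (1 - trace (ρ g)) := by
  obtain ⟨h1, h2⟩ := hV.trace_relations hg hg1 hv hv1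
  have hφ := (hV.golden_trace hg hg1).1
  obtain ⟨w, a, b, c, hc, hab, ht, hi⟩ := hV.trace_form hg hg1 (v * g)
  obtain ⟨w', a', b', c', hc', hab', ht', hi'⟩ := hV.trace_form hg hg1 (v * g ^ 2)
  rw [ht, hi, ht', hi'] at h1 h2
  rw [ht, ht']
  generalize trace (ρ g) = φ at *
  have hw : w + w ^ 2 = c := by
    rcases hc with ⟨rfl, rfl⟩ | ⟨h, rfl⟩
    · norm_num
    · push_cast; linear_combination h
  have hw' : w' + w' ^ 2 = c' := by
    rcases hc' with ⟨rfl, rfl⟩ | ⟨h, rfl⟩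
    · norm_num
    · push_cast; linear_combination h
  obtain ⟨e1, e2⟩ := golden_independent hφ (a := c' * a' - (c * a + c * b))
      (b := c' * b' - (c * a + 2 + 2 * c * b)) (by
    push_cast
    rw [← hw, ← hw']
    linear_combination h1 + (w + w ^ 2) * b * hφ)
  have hφ1 : φ - 1 ≠ 0 := fun h => by
    have h : φ = 1 := by linear_combination h
    rw [h] at hφ; norm_num at hφ
  rcases hab with ⟨rfl, rfl⟩ | ⟨rfl, rfl⟩ | ⟨rfl, rfl⟩ | ⟨rfl, rfl, -⟩ | ⟨rfl, rfl, hx⟩ | ⟨rfl, rfl, -⟩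
  · right; right; right; left
    rcases hc with ⟨rfl, rfl⟩ | ⟨h, rfl⟩
    · rcases hc' with ⟨rfl, rfl⟩ | ⟨h', rfl⟩ <;> omega
    · rcases hc' with ⟨rfl, rfl⟩ | ⟨h', rfl⟩
      · omega
      have ha : a' = 1 := by omega
      have hb : b' = 0 := by omega
      subst ha hb
      push_cast at h2
      have : w' = w := by linear_combination (1 / 2) * h2 + h' / 2 - h / 2 + (w - w ^ 2) / 2 * hφ
      exact ⟨w, h, by push_cast; ring, by rw [this]; push_cast; ring⟩
  · rcases hc with ⟨rfl, rfl⟩ | ⟨h, rfl⟩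
    · right; left; push_cast; ring
    · rcases hc' with ⟨rfl, rfl⟩ | ⟨h', rfl⟩ <;> omega
  · left; push_cast; ring
  · rcases hc with ⟨rfl, rfl⟩ | ⟨h, rfl⟩ <;> rcases hc' with ⟨rfl, rfl⟩ | ⟨h', rfl⟩ <;> omega
  · rcases hc with ⟨rfl, rfl⟩ | ⟨h, rfl⟩
    · right; right; left
      exact ⟨by push_cast; ring, hx rfl⟩
    · rcases hc' with ⟨rfl, rfl⟩ | ⟨h', rfl⟩ <;> omega
  · right; right; right; right
    rcases hc with ⟨rfl, rfl⟩ | ⟨h, rfl⟩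
    · rcases hc' with ⟨rfl, rfl⟩ | ⟨h', rfl⟩ <;> omega
    · rcases hc' with ⟨rfl, rfl⟩ | ⟨h', rfl⟩
      · omega
      have ha : a' = 1 := by omega
      have hb : b' = -1 := by omega
      subst ha hb
      push_cast at h2
      have h3 : (φ - 1) * (w' - w' ^ 2 + (w - w ^ 2)) = 0 := by linear_combination -h2
      have h3 := (mul_eq_zero.mp h3).resolve_left hφ1
      have : w' = w ^ 2 := by linear_combination (1 / 2) * h3 + h' / 2 - h / 2
      exact ⟨w, h, by push_cast; ring, by rw [this]; push_cast; ring⟩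

lemma sum_involution_mul (hV : Valentiner ρ) [Fintype G] (x : G) :
    ∑ v ∈ Finset.univ.filter (fun v : G => v ^ 2 = 1 ∧ v ≠ 1), trace (ρ (v * x)) =
      -15 * trace (ρ x) := by
  set M : M3 := ∑ v ∈ Finset.univ.filter (fun v : G => v ^ 2 = 1 ∧ v ≠ 1), ρ v with hM
  obtain ⟨c, hc⟩ := hV.schur M fun y => by
    rw [hM, Finset.mul_sum, Finset.sum_mul]
    simp only [← map_mul]
    apply Finset.sum_bij (fun v _ => y * v * y⁻¹)
    · intro v hv
      obtain ⟨-, h1, h2⟩ := Finset.mem_filter.mp hv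
      rw [Finset.mem_filter, conj_pow, h1]
      exact ⟨Finset.mem_univ _, by group, fun h => h2 (conj_eq_one_iff.mp h)⟩
    · intro v _ v' _ h
      exact mul_left_cancel (mul_right_cancel h)
    · intro v hv
      obtain ⟨-, h1, h2⟩ := Finset.mem_filter.mp hv
      refine ⟨y⁻¹ * v * (y⁻¹)⁻¹, ?_, by group⟩
      rw [Finset.mem_filter, conj_pow, h1]
      exact ⟨Finset.mem_univ _, by group, fun h => h2 (conj_eq_one_iff.mp h)⟩
    · intro v _
      rw [inv_mul_cancel_right]
  have ht : trace M = -45 := by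
    rw [hM, trace_sum, Finset.sum_congr rfl (g := fun _ => (-1 : ℂ)), Finset.sum_const,
      hV.card_two_elements.1]
    · norm_num
    · intro v hv
      obtain ⟨-, h1, h2⟩ := Finset.mem_filter.mp hv
      exact hV.trace_involution h1 h2
  have hc' : c = -15 := by
    rw [hc, trace_smul, trace_one] at ht
    norm_num at ht
    linear_combination ht / 3
  have h2 : ∑ v ∈ Finset.univ.filter (fun v : G => v ^ 2 = 1 ∧ v ≠ 1), trace (ρ (v * x)) =
      trace (M * ρ x) := by
    rw [hM, Finset.sum_mul, trace_sum]
    simp only [map_mul]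
  rw [h2, hc, hc', smul_mul_assoc, one_mul, trace_smul, smul_eq_mul]

lemma exists_trace_eq_omega (hV : Valentiner ρ) : ∃ (g v : G) (w : ℂ), g ^ 5 = 1 ∧ g ≠ 1 ∧
    v ^ 2 = 1 ∧ v ≠ 1 ∧ w ^ 2 + w + 1 = 0 ∧ trace (ρ (v * g)) = w * trace (ρ g) ∧
    trace (ρ (v * g ^ 2)) = w := by
  have := Fintype.ofFinite G
  obtain ⟨g, hg, hg1⟩ := exists_five (G := G) (by rw [hV.card]; norm_num)
  by_contra! hcon
  have hreal : ∀ v : G, v ^ 2 = 1 → v ≠ 1 → trace (ρ (v * g)) = 0 ∨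
      trace (ρ (v * g)) = 1 - trace (ρ g) ∨ (trace (ρ (v * g)) = -1 ∧ (v * g) ^ 2 = 1) := by
    intro v hv hv1
    rcases hV.trace_mul_cases hg hg1 hv hv1 with h | h | h | ⟨w, hw, h1, h2⟩ | ⟨w, hw, h1, h2⟩
    · exact .inl h
    · exact .inr (.inl h)
    · exact .inr (.inr h)
    · exact absurd h2 (hcon g v w hg hg1 hv hv1 hw h1)
    · have hg2 : (g ^ 2) ^ 5 = 1 := by rw [← pow_mul, mul_comm, pow_mul, hg, one_pow]
      have hg21 : g ^ 2 ≠ 1 := fun h => hg1 (by simpa using pow_eq_one_of_gcd hg h)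
      have hw2 : (w ^ 2) ^ 2 + w ^ 2 + 1 = 0 := by linear_combination (w ^ 2 - w + 1) * hw
      have := hcon (g ^ 2) v (w ^ 2) hg2 hg21 hv hv1 hw2
        (by rw [h2, (hV.golden_trace hg hg1).2.1])
      refine absurd ?_ this
      have hinv : v * (g ^ 2) ^ 2 = v * (v * g)⁻¹ * v⁻¹ := by
        have : g ^ 4 = g⁻¹ := by rw [eq_inv_iff_mul_eq_one, ← pow_succ, hg]
        rw [← pow_mul, this]
        have : v⁻¹ = v := by rw [inv_eq_iff_mul_eq_one, ← pow_two, hv]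
        rw [_root_.mul_inv_rev, this]
        simp only [mul_assoc]
        rw [← pow_two, hv, mul_one]
      rw [hinv, trace_rho_conj, trace_inv ρ, h1]
      exact conj_cube_root (by linear_combination (w - 1) * hw)
  have hsum := hV.sum_involution_mul g
  have hφ := (hV.golden_trace hg hg1).1
  have h5 := hV.card_inverting hg hg1
  have heq : ∀ v : G, v ^ 2 = 1 → ((v * g) ^ 2 = 1 ↔ v * g * v⁻¹ = g⁻¹) := by
    intro v hv
    have : v⁻¹ = v := by rw [inv_eq_iff_mul_eq_one, ← pow_two, hv]
    rw [eq_inv_iff_mul_eq_one, this, pow_two, mul_assoc (v * g)]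
  have hval : ∀ v ∈ Finset.univ.filter (fun v : G => v ^ 2 = 1 ∧ v ≠ 1), trace (ρ (v * g)) =
      (if v * g * v⁻¹ = g⁻¹ then -1 else 0) +
        (if trace (ρ (v * g)) = 1 - trace (ρ g) then 1 else 0) * (1 - trace (ρ g)) := by
    intro v hv
    obtain ⟨-, hv, hv1⟩ := Finset.mem_filter.mp hv
    have hne : (1 : ℂ) - trace (ρ g) ≠ 0 := fun h => by
      have h : trace (ρ g) = 1 := by linear_combination -h
      rw [h] at hφ; norm_num at hφ
    have hne' : (1 : ℂ) - trace (ρ g) ≠ -1 := fun h => by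
      have h : trace (ρ g) = 2 := by linear_combination -h
      rw [h] at hφ; norm_num at hφ
    have hinv : v * g * v⁻¹ = g⁻¹ → trace (ρ (v * g)) = -1 := fun h =>
      hV.trace_involution ((heq v hv).mpr h) fun h1 => by
        have : g = v := by
          rw [← inv_eq_iff_mul_eq_one.mpr h1, inv_eq_iff_mul_eq_one, ← pow_two, hv]
        rw [this] at hg
        exact hv1 (by simpa using pow_eq_one_of_gcd hv hg)
    rcases hreal v hv hv1 with h | h | h
    · rw [if_neg, if_neg, h]
      · simp
      · rw [h]; exact hne.symm
      · intro h'
        rw [hinv h'] at h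
        norm_num at h
    · rw [if_neg, if_pos h, h]
      · simp
      · intro h'
        rw [hinv h'] at h
        exact hne' h.symm
    · rw [if_pos ((heq v hv).mp h.2), if_neg, h.1]
      · simp
      · rw [h.1]; exact hne'.symm
  rw [Finset.sum_congr rfl hval, Finset.sum_add_distrib, ← Finset.sum_mul, Finset.sum_boole,
    ← Finset.sum_filter, Finset.sum_const, Finset.filter_filter] at hsum
  have hfil : (Finset.univ.filter fun v : G => (v ^ 2 = 1 ∧ v ≠ 1) ∧ v * g * v⁻¹ = g⁻¹) =
      Finset.univ.filter fun v : G => v ^ 2 = 1 ∧ v * g * v⁻¹ = g⁻¹ := by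
    ext v
    simp only [Finset.mem_filter, Finset.mem_univ, true_and]
    refine ⟨fun h => ⟨h.1.1, h.2⟩, fun h => ⟨⟨h.1, ?_⟩, h.2⟩⟩
    rintro rfl
    have h2 : g ^ 2 = 1 := by
      have := h.2
      rwa [one_mul, inv_one, mul_one, eq_inv_iff_mul_eq_one, ← pow_two] at this
    exact hg1 (by simpa using pow_eq_one_of_gcd h2 hg)
  rw [hfil, h5] at hsum
  generalize ((Finset.univ.filter fun v : G => v ^ 2 = 1 ∧ v ≠ 1).filter
    fun v => trace (ρ (v * g)) = 1 - trace (ρ g)).card = N at hsum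
  obtain ⟨e1, e2⟩ := golden_independent hφ (a := -5 + N) (b := 15 - N) (by
    push_cast
    simp only [nsmul_eq_mul] at hsum
    push_cast at hsum
    linear_combination hsum)
  omega

end Valentiner

lemma inverting_matrix {z : ℂ} (h5 : z ^ 5 = 1) (h1 : z ≠ 1) {T : M3} (hT2 : T * T = 1)
    (htr : trace T = -1)
    (hT : T * diagonal ![1, z, z ^ 4] * T = diagonal ![1, z ^ 4, z]) :
    ∃ s t : ℂ, s * t = 1 ∧ T = !![-1, 0, 0; 0, 0, s; 0, t, 0] := by
  have hz4 : z ^ 4 ≠ 1 := fun h => h1 (by linear_combination h5 - z * h)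
  have hz2 : z ^ 2 ≠ 1 := fun h => hz4 (by linear_combination (z ^ 2 + 1) * h)
  have hcomm : T * diagonal ![1, z, z ^ 4] = diagonal ![1, z ^ 4, z] * T := by
    rw [← hT, mul_assoc _ T T, hT2, mul_one]
  have e : ∀ i j, T i j * ![1, z, z ^ 4] j = ![1, z ^ 4, z] i * T i j := by
    intro i j
    have := congrFun (congrFun hcomm i) j
    rwa [Matrix.mul_diagonal, Matrix.diagonal_mul] at this
  have z0 : z ≠ 0 := by rintro rfl; norm_num at h5
  have sub {a b : ℂ} (h : a ≠ 1) (e : b * a = b) : b = 0 := by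
    have : b * (a - 1) = 0 := by linear_combination e
    exact (mul_eq_zero.mp this).resolve_right (sub_ne_zero.mpr h)
  have h01 : T 0 1 = 0 := sub h1 (by have := e 0 1; simpa using this)
  have h02 : T 0 2 = 0 := sub hz4 (by have := e 0 2; simpa using this)
  have h10 : T 1 0 = 0 := sub hz4 (by have := e 1 0; simp at this; rw [mul_comm]; exact this.symm)
  have h20 : T 2 0 = 0 := sub h1 (by have := e 2 0; simp at this; rw [mul_comm]; exact this.symm)
  have h11 : T 1 1 = 0 := sub hz2 (by
    have := e 1 1
    simp only [Matrix.cons_val_one, Matrix.cons_val_zero] at this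
    linear_combination z * this + T 1 1 * h5)
  have h22 : T 2 2 = 0 := sub hz2 (by
    have := e 2 2
    simp only [Matrix.cons_val] at this
    linear_combination -z * this + T 2 2 * h5)
  have h00 : T 0 0 = -1 := by
    rw [trace_fin_three, h11, h22] at htr
    linear_combination htr
  refine ⟨T 1 2, T 2 1, ?_, ?_⟩
  · have := congrFun (congrFun hT2 1) 1
    simp [Matrix.mul_apply, Fin.sum_univ_three, h10, h11] at this
    exact this
  · ext i j
    fin_cases i <;> fin_cases j <;> simp [*]

namespace Valentiner
variable {G : Type*} [Group G] [Finite G] {ρ : G →* M3}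

lemma inverting_conj_form (hV : Valentiner ρ) {g : G} {P Q : M3} {z : ℂ}
    (hPQ : P * Q = 1) (hQP : Q * P = 1) (h5 : z ^ 5 = 1) (h1 : z ≠ 1)
    (hρ : ρ g = P * diagonal ![1, z, z ^ 4] * Q) {u : G} (hu : u ^ 2 = 1) (hu1 : u ≠ 1)
    (hug : u * g * u⁻¹ = g⁻¹) :
    ∃ s t : ℂ, s * t = 1 ∧ Q * ρ u * P = !![-1, 0, 0; 0, 0, s; 0, t, 0] := by
  have hu' : u⁻¹ = u := by rw [inv_eq_iff_mul_eq_one, ← pow_two, hu]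
  have hg5 : g ^ 5 = 1 := by
    apply hV.inj
    rw [pow_of_diag hPQ hQP hρ, map_one, ← hPQ]
    have : (fun i => ![1, z, z ^ 4] i ^ 5) = fun _ => (1 : ℂ) := by
      ext i
      fin_cases i
      · simp
      · simpa using h5
      · change (z ^ 4) ^ 5 = 1
        rw [← pow_mul, mul_comm, pow_mul, h5, one_pow]
    rw [this, Matrix.diagonal_one, mul_one]
  apply inverting_matrix h5 h1
  · rw [show Q * ρ u * P * (Q * ρ u * P) = Q * (ρ u * (P * Q) * ρ u) * P by noncomm_ring, hPQ, mul_one,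
      ← map_mul, ← pow_two, hu, map_one, mul_one, hQP]
  · rw [trace_mul_comm, ← mul_assoc, hPQ, one_mul, hV.trace_involution hu hu1]
  · rw [show Q * ρ u * P * diagonal ![1, z, z ^ 4] * (Q * ρ u * P) =
      Q * (ρ u * (P * diagonal ![1, z, z ^ 4] * Q) * ρ u) * P by noncomm_ring, ← hρ, ← map_mul,
      ← map_mul]
    have : u * g * u = g ^ 4 := by
      nth_rw 2 [← hu']
      rw [hug, inv_eq_iff_mul_eq_one, ← pow_succ', hg5]
    rw [this, pow_of_diag hPQ hQP hρ, show ∀ D : M3, Q * (P * D * Q) * P = (Q * P) * D * (Q * P) by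
      intro D; noncomm_ring, hQP, one_mul, mul_one]
    congr 1
    ext i
    fin_cases i
    · simp
    · rfl
    · change (z ^ 4) ^ 4 = z
      linear_combination (z ^ 11 + z ^ 6 + z) * h5

lemma exists_generators (hV : Valentiner ρ) : ∃ (g v u : G) (w : ℂ), g ^ 5 = 1 ∧ g ≠ 1 ∧
    v ^ 2 = 1 ∧ v ≠ 1 ∧ u ^ 2 = 1 ∧ u ≠ 1 ∧ u * g * u⁻¹ = g⁻¹ ∧ w ^ 2 + w + 1 = 0 ∧
    trace (ρ (v * g)) = w * trace (ρ g) ∧ trace (ρ (v * g)⁻¹) = w ^ 2 * trace (ρ g) ∧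
    trace (ρ (v * u)) = trace (ρ g) := by
  obtain ⟨g, v, w, hg, hg1, hv, hv1, hw, ht, -⟩ := hV.exists_trace_eq_omega
  have hw3 : w ^ 3 = 1 := by linear_combination (w - 1) * hw
  have hti : trace (ρ (v * g)⁻¹) = w ^ 2 * trace (ρ g) := by
    rw [trace_inv ρ, ht, map_mul, hV.conj_trace_five hg hg1, conj_cube_root hw3]
  obtain ⟨u, hu, hu1, hug, -⟩ := hV.exists_inverting_involution hg hg1
  have hφ := (hV.golden_trace hg hg1).1
  have hu' : u⁻¹ = u := by rw [inv_eq_iff_mul_eq_one, ← pow_two, hu]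
  have hv' : v⁻¹ = v := by rw [inv_eq_iff_mul_eq_one, ← pow_two, hv]
  have hugk : ∀ k : ℕ, (u * g ^ k) * g * (u * g ^ k)⁻¹ = g⁻¹ := by
    intro k
    rw [← hug]
    group
  have huk : ∀ k : ℕ, (u * g ^ k) ^ 2 = 1 := by
    intro k
    have : u * g ^ k * u⁻¹ = (g ^ k)⁻¹ := by
      rw [← conj_pow, hug, inv_pow]
    rw [hu'] at this
    rw [pow_two, ← mul_assoc, this, inv_mul_cancel]
  have huk1 : ∀ k : ℕ, u * g ^ k ≠ 1 := by
    intro k h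
    have := hugk k
    rw [h, one_mul, inv_one, mul_one, eq_inv_iff_mul_eq_one, ← pow_two] at this
    exact hg1 (by simpa using pow_eq_one_of_gcd this hg)
  by_cases hex : ∃ k, trace (ρ (v * (u * g ^ k))) = trace (ρ g)
  · obtain ⟨k, hk⟩ := hex
    exact ⟨g, v, u * g ^ k, w, hg, hg1, hv, hv1, huk k, huk1 k, hugk k, hw, ht, hti, hk⟩
  exfalso
  push Not at hex
  have hform : ∀ k, ∃ a b : ℤ, trace (ρ (v * (u * g ^ k))) = a + b * trace (ρ g) ∧ b ≤ 0 := by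
    intro k
    obtain ⟨w', a, b, c, hc, hab, h1, h2⟩ := hV.trace_form hg hg1 (v * (u * g ^ k))
    have hreal : trace (ρ (v * (u * g ^ k))⁻¹) = trace (ρ (v * (u * g ^ k))) := by
      have : (u * g ^ k)⁻¹ = u * g ^ k := by rw [inv_eq_iff_mul_eq_one, ← pow_two, huk]
      rw [_root_.mul_inv_rev, hv', this, map_mul, trace_mul_comm, ← map_mul]
    have hzero : (w' - 1) * w' * ((a : ℂ) + b * trace (ρ g)) = 0 := by
      rw [hreal, h1] at h2
      linear_combination -h2
    rcases hc with ⟨rfl, rfl⟩ | ⟨hw', rfl⟩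
    · refine ⟨a, b, by rw [h1, one_mul], ?_⟩
      rcases hab with ⟨rfl, rfl⟩ | ⟨rfl, rfl⟩ | ⟨rfl, rfl⟩ | ⟨rfl, rfl, hx⟩ | ⟨rfl, rfl, hx⟩ | ⟨rfl, rfl, -⟩
      · exact absurd (by rw [h1]; push_cast; ring) (hex k)
      · norm_num
      · norm_num
      · exfalso
        have hvu : v = u * g ^ k := by
          rw [← hv', inv_eq_iff_mul_eq_one]
          exact hx rfl
        have hvg : (v * g) = u * g ^ (k + 1) := by rw [hvu, mul_assoc, pow_succ]
        rw [hvg, hV.trace_involution (huk _) (huk1 _)] at ht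
        have h3 : (w * trace (ρ g)) ^ 3 = -1 := by rw [← ht]; norm_num
        have h4 : trace (ρ g) ^ 3 = -1 := by rw [← h3, mul_pow, hw3, one_mul]
        have h5 : ((2 : ℤ) : ℂ) + (2 : ℤ) * trace (ρ g) = 0 := by
          push_cast
          linear_combination h4 - (trace (ρ g) + 1) * hφ
        exact absurd (golden_independent hφ h5).1 (by norm_num)
      · norm_num
      · norm_num
    · have hw1 : w' ≠ 1 := by rintro rfl; norm_num at hw'
      have hw0 : w' ≠ 0 := by rintro rfl; norm_num at hw'
      have h0 := (mul_eq_zero.mp hzero).resolve_left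
        (mul_ne_zero (sub_ne_zero.mpr hw1) hw0)
      exact ⟨0, 0, by rw [h1, h0]; simp, by norm_num⟩
  choose a b hab hb0 using hform
  have hsum : ∑ k ∈ Finset.range 5, trace (ρ (v * (u * g ^ k))) = 2 + trace (ρ g) := by
    obtain ⟨P, Q, z, hPQ, hQP, h5, h1, hρ⟩ := hV.five g hg hg1
    have hcy := five_cyclotomic h5 h1
    rw [five_inv h5] at hρ
    obtain ⟨s, t, -, hform⟩ := hV.inverting_conj_form hPQ hQP h5 h1 hρ hu hu1 hug
    set V := Q * ρ v * P with hVdef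
    have hu2 : ρ u = P * !![-1, 0, 0; 0, 0, s; 0, t, 0] * Q := by
      rw [← hform, show P * (Q * ρ u * P) * Q = (P * Q) * ρ u * (P * Q) by noncomm_ring, hPQ, one_mul,
        mul_one]
    have hk : ∀ k, trace (ρ (v * (u * g ^ k))) =
        -V 0 0 + V 1 2 * t * z ^ k + V 2 1 * s * z ^ (4 * k) := by
      intro k
      rw [map_mul, map_mul, pow_of_diag hPQ hQP hρ, hu2]
      rw [show ∀ T D : M3, ρ v * (P * T * Q * (P * D * Q)) = ρ v * P * (T * (Q * P) * D) * Q by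
        intro T D; noncomm_ring, hQP, mul_one, trace_mul_comm, ← mul_assoc, ← mul_assoc, ← mul_assoc,
        ← hVdef]
      simp [trace_fin_three, Matrix.mul_apply, Fin.sum_univ_three, ← pow_mul, Matrix.diagonal_apply]
    have hd : ∀ k : ℕ, trace (ρ (v * g ^ k)) = V 0 0 + V 1 1 * z ^ k + V 2 2 * z ^ (4 * k) := by
      intro k
      rw [map_mul, pow_of_diag hPQ hQP hρ, ← mul_assoc, ← mul_assoc, trace_mul_comm,
        ← mul_assoc, ← mul_assoc]
      simp [trace_fin_three, Matrix.mul_diagonal, ← pow_mul, hVdef]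
    have d0 := hd 0
    have d1 := hd 1
    have d4 := hd 4
    have hi : (v * g)⁻¹ = g ^ 4 * v := by
      rw [inv_eq_iff_mul_eq_one, mul_assoc, ← mul_assoc g, ← pow_succ', hg, one_mul, ← pow_two, hv]
    rw [hi, map_mul, trace_mul_comm, ← map_mul, d4] at hti
    rw [pow_one, ht] at d1
    rw [pow_zero, mul_one, hV.trace_involution hv hv1] at d0
    have hg' : trace (ρ g) = 1 + z + z ^ 4 := by
      rw [trace_of_diag hQP hρ]; simp
    have hV00 : -5 * V 0 0 = 2 + trace (ρ g) := by
      have hE : V 0 0 * (3 - trace (ρ g)) + 1 = 0 := by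
        linear_combination -d1 + hti + trace (ρ g) * hw + (z + z ^ 4) * d0 -
          V 2 2 * (z ^ 11 + z ^ 6 + z) * h5 - (V 0 0 + 1) * hg'
      linear_combination -(2 + trace (ρ g)) * hE - V 0 0 * hφ
    simp only [hk, Finset.sum_range_succ, Finset.sum_range_zero]
    rw [← hV00]
    norm_num
    linear_combination (V 1 2 * t + V 2 1 * s) * hcy + V 2 1 * s * (z ^ 11 + z ^ 7 + z ^ 6 + z ^ 3 + z ^ 2 + z) * h5
  simp only [hab, Finset.sum_range_succ, Finset.sum_range_zero] at hsum
  obtain ⟨e1, e2⟩ := golden_independent hφ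
    (a := a 0 + a 1 + a 2 + a 3 + a 4 - 2) (b := b 0 + b 1 + b 2 + b 3 + b 4 - 1) (by
      push_cast
      linear_combination hsum)
  have := hb0 0; have := hb0 1; have := hb0 2; have := hb0 3; have := hb0 4
  omega

end Valentiner

/-- Wiman's generator of order two of the Valentiner group, for `η ^ 2 + η = 1` and
`σ ^ 2 = 9 + 3 * η`. -/
noncomputable def wiman (η σ : ℂ) : M3 :=
  !![-(3 + η) / 5, (-3 * (2 - η) + σ * (1 + 2 * η)) / 30, (-3 * (2 - η) - σ * (1 + 2 * η)) / 30;
    (-3 * (2 - η) + σ * (1 + 2 * η)) / 10, (-2 + η - σ * (1 + 2 * η)) / 10, -(1 + 2 * η) / 5;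
    (-3 * (2 - η) - σ * (1 + 2 * η)) / 10, -(1 + 2 * η) / 5, (-2 + η + σ * (1 + 2 * η)) / 10]

lemma adjugate_of_idempotent {X : M3} (h : X * X = X) (ht : trace X = 1) :
    X 1 1 * X 2 2 = X 1 2 * X 2 1 ∧ X 0 0 * X 1 1 = X 0 1 * X 1 0 ∧
      X 0 0 * X 2 2 = X 0 2 * X 2 0 ∧ X 0 1 * X 1 2 = X 0 2 * X 1 1 ∧
      X 2 1 * X 1 0 = X 2 0 * X 1 1 := by
  have e : ∀ i j, X i 0 * X 0 j + X i 1 * X 1 j + X i 2 * X 2 j = X i j := by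
    intro i j
    have := congrFun (congrFun h i) j
    rwa [Matrix.mul_apply, Fin.sum_univ_three] at this
  rw [trace_fin_three] at ht
  refine ⟨?_, ?_, ?_, ?_, ?_⟩
  · linear_combination (1 / 2) * e 0 0 - (1 / 2) * e 1 1 - (1 / 2) * e 2 2 +
      (X 1 1 + X 2 2 - X 0 0) / 2 * ht
  · linear_combination (1 / 2) * e 2 2 - (1 / 2) * e 1 1 - (1 / 2) * e 0 0 +
      (X 1 1 + X 0 0 - X 2 2) / 2 * ht
  · linear_combination (1 / 2) * e 1 1 - (1 / 2) * e 0 0 - (1 / 2) * e 2 2 +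
      (X 0 0 + X 2 2 - X 1 1) / 2 * ht
  · linear_combination e 0 2 - X 0 2 * ht
  · linear_combination e 2 0 - X 2 0 * ht

lemma sum_sq_five {z : ℂ} (h5 : z ^ 5 = 1) (h1 : z ≠ 1) : (z + z ^ 4) ^ 2 + (z + z ^ 4) = 1 := by
  linear_combination five_cyclotomic h5 h1 + (2 + z ^ 3) * h5

lemma sigma_sq {z w : ℂ} (h5 : z ^ 5 = 1) (h1 : z ≠ 1) (hw : w ^ 2 + w + 1 = 0) :
    ((2 * w + 1) * (z - z ^ 4)) ^ 2 = 9 + 3 * (z + z ^ 4) := by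
  linear_combination 4 * (z - z ^ 4) ^ 2 * hw - 3 * five_cyclotomic h5 h1 +
    (6 - 3 * z ^ 3) * h5

lemma exists_wiman_form {z w s t : ℂ} (h5 : z ^ 5 = 1) (h1 : z ≠ 1) (hw : w ^ 2 + w + 1 = 0)
    {V : M3} (hV2 : V * V = 1) (htr : V 0 0 + V 1 1 + V 2 2 = -1)
    (ht1 : V 0 0 + V 1 1 * z + V 2 2 * z ^ 4 = w * (1 + (z + z ^ 4)))
    (ht4 : V 0 0 + V 1 1 * z ^ 4 + V 2 2 * z = w ^ 2 * (1 + (z + z ^ 4)))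
    (hst : s * t = 1) (hT : -V 0 0 - V 1 2 * t - V 2 1 * s = 1 + (z + z ^ 4)) :
    ∃ d : ℂ, d ≠ 0 ∧ ∀ i j, V i j * ![d, s, 1] j =
      ![d, s, 1] i * wiman (z + z ^ 4) ((2 * w + 1) * (z - z ^ 4)) i j := by
  have hη := sum_sq_five h5 h1
  have hσ := sigma_sq h5 h1 hw
  have hdiff : (V 1 1 - V 2 2) * (3 + (z + z ^ 4)) =
      -((2 * w + 1) * (z - z ^ 4)) * (1 + (z + z ^ 4)) := by
    linear_combination (-(z - z ^ 4)) * (ht1 - ht4) + (z - z ^ 4) * (1 + (z + z ^ 4)) * hw +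
      (V 1 1 - V 2 2) * (five_cyclotomic h5 h1 + (-2 + z ^ 3) * h5)
  have hV00 : V 0 0 = -(3 + (z + z ^ 4)) / 5 := by
    have hE : V 0 0 * (2 - (z + z ^ 4)) + 1 = 0 := by
      linear_combination ht1 + ht4 + (1 + (z + z ^ 4)) * hw - (z + z ^ 4) * htr
    linear_combination (3 + (z + z ^ 4)) / 5 * hE + V 0 0 / 5 * hη
  generalize (2 * w + 1) * (z - z ^ 4) = σ at *
  generalize z + z ^ 4 = η at *
  have hV11 : V 1 1 = (-2 + η - σ * (1 + 2 * η)) / 10 := by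
    linear_combination (2 - η) / 10 * hdiff + htr / 2 - hV00 / 2 + ((V 1 1 - V 2 2) / 10 + σ / 10) * hη
  have hV22 : V 2 2 = (-2 + η + σ * (1 + 2 * η)) / 10 := by
    linear_combination htr - hV00 - hV11
  set X : M3 := (1 / 2 : ℂ) • (V + 1) with hX
  have hXX : X * X = X := by
    rw [hX, smul_mul_smul_comm, add_mul, mul_add, hV2, mul_one, one_mul]
    rw [show (1 : M3) + V + (V + 1) = (2 : ℂ) • (V + 1) by rw [two_smul]; abel, smul_smul]
    norm_num
  have hXt : trace X = 1 := by
    rw [hX, trace_smul, trace_add, trace_one, trace_fin_three, htr]; norm_num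
  have hXd : ∀ i, X i i = (V i i + 1) / 2 := fun i => by
    simp [hX]; ring
  have hXo : ∀ i j, i ≠ j → X i j = V i j / 2 := fun i j h => by
    simp [hX, h]; ring
  obtain ⟨m1, m2, m3, m4, m5⟩ := adjugate_of_idempotent hXX hXt
  simp only [hXd, hV00, hV11, hV22] at m1 m2 m3 m4 m5
  rw [hXo 1 2 (by decide), hXo 2 1 (by decide)] at m1
  rw [hXo 0 1 (by decide), hXo 1 0 (by decide)] at m2
  rw [hXo 0 2 (by decide), hXo 2 0 (by decide)] at m3
  rw [hXo 0 1 (by decide), hXo 1 2 (by decide), hXo 0 2 (by decide)] at m4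
  rw [hXo 2 1 (by decide), hXo 1 0 (by decide), hXo 2 0 (by decide)] at m5
  have hxy : V 1 2 * t = -(1 + 2 * η) / 5 ∧ V 2 1 * s = -(1 + 2 * η) / 5 := by
    have hs : V 1 2 * t + V 2 1 * s = -2 * (1 + 2 * η) / 5 := by
      linear_combination -hT - hV00
    have hp : (V 1 2 * t) * (V 2 1 * s) = 1 / 5 := by
      linear_combination V 1 2 * V 2 1 * hst - 4 * m1 + ((-1 / 25 * η - 1 / 25 * η ^ 2 - 1 / 100) * hσ +
        (-3 / 25 * η - 7 / 20) * hη)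
    have hd : (V 1 2 * t - V 2 1 * s) ^ 2 = 0 := by
      linear_combination (V 1 2 * t + V 2 1 * s - 2 * (1 + 2 * η) / 5) * hs - 4 * hp + 16 / 25 * hη
    have hd := pow_eq_zero_iff (two_ne_zero) |>.mp hd
    exact ⟨by linear_combination (hs + hd) / 2, by linear_combination (hs - hd) / 2⟩
  have hV12 : V 1 2 = -(1 + 2 * η) / 5 * s := by linear_combination s * hxy.1 - V 1 2 * hst
  have hV21 : V 2 1 = -(1 + 2 * η) / 5 * t := by linear_combination t * hxy.2 - V 2 1 * hst
  set q : ℂ := (8 + η - σ * (1 + 2 * η)) / 20 with hq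
  set α : ℂ := (-3 * (2 - η) + σ * (1 + 2 * η)) / 60 with hα
  set β : ℂ := (-3 * (2 - η) - σ * (1 + 2 * η)) / 60 with hβ
  have hκ : (1 + 2 * η) ^ 2 = 5 := by linear_combination 4 * hη
  have hq0 : q ≠ 0 := by
    intro h
    have : q * ((8 + η + σ * (1 + 2 * η)) / 20) = 1 / 20 := by
      rw [hq]
      linear_combination (-1 / 100 * η - 1 / 100 * η ^ 2 - 1 / 400) * hσ + (-3 / 100 * η - 7 / 80) * hη
    rw [h] at this
    norm_num at this
  have hp0 : (2 - η) ≠ 0 := by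
    intro h
    have : (2 - η) * (3 + η) = 5 := by linear_combination -hη
    rw [h] at this
    norm_num at this
  have hpq : 3 * α ^ 2 = (2 - η) / 10 * q := by
    rw [hα, hq]
    linear_combination (1 / 300 * η + 1 / 300 * η ^ 2 + 1 / 1200) * hσ + (1 / 100 * η + 17 / 400) * hη
  have hβq : β * q = -(1 + 2 * η) / 10 * α := by
    rw [hα, hq, hβ]
    linear_combination (1 / 300 * η + 1 / 300 * η ^ 2 + 1 / 1200) * hσ + (1 / 100 * η + 17 / 400) * hη
  have hα0 : α ≠ 0 := by
    intro h
    rw [h] at hpq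
    have := mul_ne_zero (div_ne_zero hp0 (by norm_num : (10 : ℂ) ≠ 0)) hq0
    apply this
    rw [← hpq]
    norm_num
  have h010 : V 0 1 ≠ 0 := by
    intro h
    rw [h] at m2
    have := mul_ne_zero (div_ne_zero hp0 (by norm_num : (10 : ℂ) ≠ 0)) hq0
    apply this
    rw [hq]
    linear_combination m2
  have hs0 : s ≠ 0 := left_ne_zero_of_mul_eq_one hst
  obtain ⟨d, hd⟩ : ∃ d, d * (2 * α) = V 0 1 * s := ⟨V 0 1 * s / (2 * α), by field_simp⟩
  have hd0 : d ≠ 0 := by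
    rintro rfl
    rw [zero_mul] at hd
    exact mul_ne_zero h010 hs0 hd.symm
  have e02 : V 0 2 = d * (2 * β) := by
    apply mul_right_cancel₀ hq0
    linear_combination (-2 : ℂ) * m4 + V 0 1 / 2 * hV12 + (1 + 2 * η) / 10 * hd - 2 * d * hβq
  have e10 : V 1 0 * d = s * (6 * α) := by
    apply mul_right_cancel₀ (mul_ne_zero h010 hα0)
    linear_combination -4 * d * α * m2 - 4 * d * α * hpq + 6 * α ^ 2 * hd
  have e20 : V 2 0 * d = 6 * β := by
    apply mul_right_cancel₀ hq0
    linear_combination -2 * d * m5 + V 1 0 * d / 2 * hV21 - (1 + 2 * η) / 10 * t * e10 -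
      6 * α * (1 + 2 * η) / 10 * hst - 6 * hβq
  refine ⟨d, hd0, ?_⟩
  intro i j
  fin_cases i <;> fin_cases j <;> simp [wiman]
  · rw [hV00]; ring
  · rw [← hd, hα]; ring
  · rw [e02, hβ]; ring
  · rw [e10, hα]; ring
  · rw [hV11]; ring
  · rw [hV12]; ring
  · rw [e20, hβ]; ring
  · rw [hV21]; linear_combination -(1 + 2 * η) / 5 * hst
  · exact hV22

/-- Wiman's sextic, invariant under the Valentiner group. -/
noncomputable def wimanSextic (u : Fin 3 → ℂ) : ℂ :=
  10 * (u 1 * u 2) ^ 3 + 9 * u 0 * (u 1 ^ 5 + u 2 ^ 5) - 45 * (u 1 * u 2) ^ 2 * u 0 ^ 2 -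
    135 * (u 1 * u 2) * u 0 ^ 4 + 27 * u 0 ^ 6

lemma wimanSextic_symmetric (u : Fin 3 → ℂ) {s r : ℂ} (hs : u 1 + u 2 = s) (hr : u 1 * u 2 = r) :
    wimanSextic u = 10 * r ^ 3 + 9 * u 0 * (s ^ 5 - 5 * s ^ 3 * r + 5 * s * r ^ 2) -
      45 * r ^ 2 * u 0 ^ 2 - 135 * r * u 0 ^ 4 + 27 * u 0 ^ 6 := by
  subst hs hr
  rw [wimanSextic]
  ring

set_option maxHeartbeats 1000000 in
lemma wimanSextic_wiman {η σ : ℂ} (hη : η ^ 2 + η = 1) (hσ : σ ^ 2 = 9 + 3 * η) (u : Fin 3 → ℂ) :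
    wimanSextic (wiman η σ *ᵥ u) = wimanSextic u := by
  have h0 : (wiman η σ *ᵥ u) 0 = -(3 + η) / 5 * u 0 - (2 - η) / 10 * (u 1 + u 2) +
      σ * (1 + 2 * η) * (u 1 - u 2) / 30 := by
    simp [wiman, Matrix.mulVec, dotProduct, Fin.sum_univ_three]; ring
  have h1 : (wiman η σ *ᵥ u) 1 = (-3 * (2 - η) + σ * (1 + 2 * η)) / 10 * u 0 +
      (-2 + η - σ * (1 + 2 * η)) / 10 * u 1 - (1 + 2 * η) / 5 * u 2 := by
    simp [wiman, Matrix.mulVec, dotProduct, Fin.sum_univ_three]; ring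
  have h2 : (wiman η σ *ᵥ u) 2 = (-3 * (2 - η) - σ * (1 + 2 * η)) / 10 * u 0 -
      (1 + 2 * η) / 5 * u 1 + (-2 + η + σ * (1 + 2 * η)) / 10 * u 2 := by
    simp [wiman, Matrix.mulVec, dotProduct, Fin.sum_univ_three]; ring
  obtain ⟨δ, hδ'⟩ : ∃ δ, δ = σ * (1 + 2 * η) * (u 1 - u 2) := ⟨_, rfl⟩
  have hδ : δ ^ 2 = (45 + 15 * η) * ((u 1 + u 2) ^ 2 - 4 * (u 1 * u 2)) := by
    rw [hδ']
    linear_combination (u 1 - u 2) ^ 2 * ((1 + 2 * η) ^ 2 * hσ + 4 * (9 + 3 * η) * hη)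
  have hs : (wiman η σ *ᵥ u) 1 + (wiman η σ *ᵥ u) 2 = -3 * (2 - η) / 5 * u 0 -
      (4 + 3 * η) / 10 * (u 1 + u 2) - δ / 10 := by
    rw [h1, h2, hδ']; ring
  have hdiff : (wiman η σ *ᵥ u) 1 - (wiman η σ *ᵥ u) 2 =
      σ * (1 + 2 * η) * (u 0 / 5 - (u 1 + u 2) / 10) + η / 2 * (u 1 - u 2) := by
    rw [h1, h2]; ring
  obtain ⟨s, hs'⟩ : ∃ s, s = u 1 + u 2 := ⟨_, rfl⟩
  obtain ⟨r, hr'⟩ : ∃ r, r = u 1 * u 2 := ⟨_, rfl⟩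
  have hdiff2 : ((wiman η σ *ᵥ u) 1 - (wiman η σ *ᵥ u) 2) ^ 2 =
      (45 + 15 * η) * (u 0 / 5 - s / 10) ^ 2 + δ * η * (u 0 / 5 - s / 10) +
        η ^ 2 / 4 * (s ^ 2 - 4 * r) := by
    rw [hdiff, hδ', hs', hr']
    linear_combination (u 0 / 5 - (u 1 + u 2) / 10) ^ 2 *
      ((1 + 2 * η) ^ 2 * hσ + 4 * (9 + 3 * η) * hη)
  rw [← hs', ← hr'] at hδ
  rw [← hs'] at hs h0
  rw [← hδ'] at h0
  have hr : (wiman η σ *ᵥ u) 1 * (wiman η σ *ᵥ u) 2 = -2 / 5 * r * η - 1 / 5 * r + 3 / 5 * s * u 0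
      + 3 / 10 * s * u 0 * η + 1 / 50 * s * δ + 1 / 25 * s * δ * η + 1 / 10 * s ^ 2 * η + 3 / 50 *
      u 0 * δ - 2 / 25 * u 0 * δ * η - 3 / 5 * u 0 ^ 2 * η := by
    linear_combination ((wiman η σ *ᵥ u) 1 + (wiman η σ *ᵥ u) 2 - 3 * (2 - η) / 5 * u 0 -
      (4 + 3 * η) / 10 * s - δ / 10) / 4 * hs - hdiff2 / 4 + (1 / 400) * hδ + (1 / 4 * r - 9 / 100 * s * u 0 - 1 / 25 * s ^ 2 + 9 / 100 * u 0 ^ 2) * hη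
  rw [wimanSextic_symmetric _ hs hr, wimanSextic_symmetric u hs'.symm hr'.symm, h0]
  generalize u 0 = z at *
  clear hδ' hs hdiff hdiff2 hr h1 h2 h0
  linear_combination (-96 / 625 * r * s * z + 9 / 625 * r * s * z * η - 411 / 5000 * r * s * z *
    η ^ 2 + 12 / 625 * r * s * z * η ^ 3 + 1 / 500 * r * s * δ - 1 / 1000 * r * s * δ * η + 33 /
    1250 * r * s ^ 2 - 27 / 1250 * r * s ^ 2 * η - 793 / 15000 * r * s ^ 2 * η ^ 2 - 3 / 625 * r *
    s ^ 2 * η ^ 3 + 3 / 500 * r * z * δ - 3 / 1000 * r * z * δ * η - 54 / 625 * r * z ^ 2 + 141 /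
    625 * r * z ^ 2 * η + 993 / 2500 * r * z ^ 2 * η ^ 2 - 12 / 625 * r * z ^ 2 * η ^ 3 + 1 / 3750
    * r * δ ^ 2 - 2 / 5625 * r * δ ^ 2 * η + 2 / 125 * r ^ 2 * η - 4 / 375 * r ^ 2 * η ^ 2 - 7 /
    125 * r ^ 2 + 4 / 3125 * s * z * δ ^ 2 + 27 / 100000 * s * z * δ ^ 2 * η + 1 / 3125 * s * z *
    δ ^ 2 * η ^ 2 + 9 / 2500 * s * z ^ 2 * δ + 3 / 1250 * s * z ^ 2 * δ * η - 27 / 1250 * s * z ^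
    2 * δ * η ^ 2 + 1377 / 3125 * s * z ^ 3 - 9387 / 25000 * s * z ^ 3 * η - 2673 / 12500 * s * z
    ^ 3 * η ^ 2 + 3411 / 12500 * s * z ^ 3 * η ^ 3 + 72 / 3125 * s * z ^ 3 * η ^ 4 - 1 / 60000 * s
    * δ ^ 3 - 21 / 20000 * s ^ 2 * z * δ + 21 / 20000 * s ^ 2 * z * δ * η - 27 / 10000 * s ^ 2 * z
    * δ * η ^ 2 + 1989 / 12500 * s ^ 2 * z ^ 2 - 2277 / 50000 * s ^ 2 * z ^ 2 * η - 6771 / 50000 *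
    s ^ 2 * z ^ 2 * η ^ 2 - 1959 / 25000 * s ^ 2 * z ^ 2 * η ^ 3 - 54 / 3125 * s ^ 2 * z ^ 2 * η ^
    4 - 1 / 18750 * s ^ 2 * δ ^ 2 - 37 / 900000 * s ^ 2 * δ ^ 2 * η - 1 / 12500 * s ^ 2 * δ ^ 2 *
    η ^ 2 + 333 / 3125 * s ^ 3 * z + 6303 / 100000 * s ^ 3 * z * η + 7809 / 100000 * s ^ 3 * z * η
    ^ 2 - 879 / 50000 * s ^ 3 * z * η ^ 3 + 18 / 3125 * s ^ 3 * z * η ^ 4 - 19 / 20000 * s ^ 3 * δ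
    - 1 / 20000 * s ^ 3 * δ * η + 27 / 10000 * s ^ 3 * δ * η ^ 2 - 1021 / 100000 * s ^ 4 * η +
    1051 / 300000 * s ^ 4 * η ^ 2 + 393 / 50000 * s ^ 4 * η ^ 3 - 9 / 12500 * s ^ 4 * η ^ 4 + 9 /
    3125 * s ^ 4 - 1 / 20000 * z * δ ^ 3 + 9 / 12500 * z ^ 2 * δ ^ 2 - 1 / 50000 * z ^ 2 * δ ^ 2 *
    η - 1 / 3125 * z ^ 2 * δ ^ 2 * η ^ 2 - 27 / 5000 * z ^ 3 * δ - 9 / 2500 * z ^ 3 * δ * η + 81 /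
    2500 * z ^ 3 * δ * η ^ 2 + 5103 / 12500 * z ^ 4 * η + 1737 / 6250 * z ^ 4 * η ^ 2 - 1359 /
    6250 * z ^ 4 * η ^ 3 - 36 / 3125 * z ^ 4 * η ^ 4 + 2673 / 6250 * z ^ 4 - 1 / 337500 * δ ^ 4) *
    hδ + (27 / 25 * r * s * z ^ 2 * δ + 72 / 25 * r * s * z ^ 2 * δ * η + 8262 / 125 * r * s * z ^
    3 - 1809 / 250 * r * s * z ^ 3 * η - 2322 / 125 * r * s * z ^ 3 * η ^ 2 - 63 / 200 * r * s ^ 2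
    * z * δ + 9 / 25 * r * s ^ 2 * z * δ * η + 3591 / 125 * r * s ^ 2 * z ^ 2 + 8451 / 500 * r * s
    ^ 2 * z ^ 2 * η + 729 / 125 * r * s ^ 2 * z ^ 2 * η ^ 2 - 2547 / 125 * r * s ^ 3 * z - 2709 /
    1000 * r * s ^ 3 * z * η + 189 / 250 * r * s ^ 3 * z * η ^ 2 - 57 / 200 * r * s ^ 3 * δ - 9 /
    25 * r * s ^ 3 * δ * η - 207 / 250 * r * s ^ 4 - 2277 / 1000 * r * s ^ 4 * η - 54 / 125 * r *
    s ^ 4 * η ^ 2 - 81 / 50 * r * z ^ 3 * δ - 108 / 25 * r * z ^ 3 * δ * η - 8856 / 125 * r * z ^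
    4 + 621 / 125 * r * z ^ 4 * η + 1836 / 125 * r * z ^ 4 * η ^ 2 + 81 / 5 * r ^ 2 * s * z + 9 /
    2 * r ^ 2 * s * z * η + 3 / 10 * r ^ 2 * s * δ + 36 / 5 * r ^ 2 * s ^ 2 + 9 / 2 * r ^ 2 * s ^
    2 * η + 9 / 10 * r ^ 2 * z * δ - 306 / 5 * r ^ 2 * z ^ 2 - 27 * r ^ 2 * z ^ 2 * η + 243 / 250
    * s * z ^ 4 * δ + 567 / 250 * s * z ^ 4 * δ * η + 27 / 250 * s * z ^ 4 * δ * η ^ 2 + 28431 /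
    3125 * s * z ^ 5 + 6561 / 6250 * s * z ^ 5 * η - 1377 / 6250 * s * z ^ 5 * η ^ 2 - 81 / 6250 *
    s * z ^ 5 * η ^ 3 + 1296 / 3125 * s * z ^ 5 * η ^ 4 - 81 / 1000 * s ^ 2 * z ^ 3 * δ - 27 / 500
    * s ^ 2 * z ^ 3 * δ * η - 27 / 500 * s ^ 2 * z ^ 3 * δ * η ^ 2 + 2187 / 1250 * s ^ 2 * z ^ 4 -
    10773 / 2500 * s ^ 2 * z ^ 4 * η - 3726 / 625 * s ^ 2 * z ^ 4 * η ^ 2 - 243 / 625 * s ^ 2 * z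
    ^ 4 * η ^ 3 - 324 / 625 * s ^ 2 * z ^ 4 * η ^ 4 - 27 / 100 * s ^ 3 * z ^ 2 * δ - 18 / 25 * s ^
    3 * z ^ 2 * δ * η - 6939 / 625 * s ^ 3 * z ^ 3 + 21519 / 5000 * s ^ 3 * z ^ 3 * η + 17901 /
    2500 * s ^ 3 * z ^ 3 * η ^ 2 + 1323 / 2500 * s ^ 3 * z ^ 3 * η ^ 3 + 216 / 625 * s ^ 3 * z ^ 3
    * η ^ 4 + 333 / 4000 * s ^ 4 * z * δ + 207 / 4000 * s ^ 4 * z * δ * η + 27 / 4000 * s ^ 4 * z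
    * δ * η ^ 2 - 12069 / 2500 * s ^ 4 * z ^ 2 - 33723 / 10000 * s ^ 4 * z ^ 2 * η - 25029 / 10000
    * s ^ 4 * z ^ 2 * η ^ 2 - 2997 / 10000 * s ^ 4 * z ^ 2 * η ^ 3 - 81 / 625 * s ^ 4 * z ^ 2 * η
    ^ 4 + 13491 / 3125 * s ^ 5 * z + 48861 / 100000 * s ^ 5 * z * η - 1377 / 100000 * s ^ 5 * z *
    η ^ 2 + 8019 / 100000 * s ^ 5 * z * η ^ 3 + 81 / 3125 * s ^ 5 * z * η ^ 4 + 807 / 20000 * s ^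
    5 * δ + 1233 / 20000 * s ^ 5 * δ * η - 27 / 20000 * s ^ 5 * δ * η ^ 2 + 29097 / 100000 * s ^ 6
    * η + 10071 / 100000 * s ^ 6 * η ^ 2 - 837 / 100000 * s ^ 6 * η ^ 3 - 27 / 12500 * s ^ 6 * η ^
    4 - 468 / 3125 * s ^ 6 - 729 / 1250 * z ^ 5 * δ - 1701 / 1250 * z ^ 5 * δ * η - 81 / 1250 * z
    ^ 5 * δ * η ^ 2 + 1269 / 3125 * z ^ 6 * η + 3267 / 3125 * z ^ 6 * η ^ 2 + 351 / 3125 * z ^ 6 *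
    η ^ 3 - 432 / 3125 * z ^ 6 * η ^ 4 + 38448 / 3125 * z ^ 6) * hη

namespace Valentiner
variable {G : Type*} [Group G] [Finite G] {ρ : G →* M3}

lemma exists_wiman_basis (hV : Valentiner ρ) : ∃ (P Q : M3) (z w : ℂ) (g v u : G),
    P * Q = 1 ∧ Q * P = 1 ∧ z ^ 5 = 1 ∧ z ≠ 1 ∧ w ^ 2 + w + 1 = 0 ∧ g ^ 5 = 1 ∧ g ≠ 1 ∧
    v ^ 2 = 1 ∧ v ≠ 1 ∧ u ^ 2 = 1 ∧ u ≠ 1 ∧ u * g * u⁻¹ = g⁻¹ ∧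
    Q * ρ g * P = diagonal ![1, z, z ^ 4] ∧
    Q * ρ u * P = !![-1, 0, 0; 0, 0, -1; 0, -1, 0] ∧
    Q * ρ v * P = wiman (z + z ^ 4) ((2 * w + 1) * (z - z ^ 4)) := by
  obtain ⟨g, v, u, w, hg, hg1, hv, hv1, hu, hu1, hug, hw, ht, hti, hT⟩ := hV.exists_generators
  obtain ⟨P, Q, z, hPQ, hQP, h5, h1, hρ⟩ := hV.five g hg hg1
  rw [five_inv h5] at hρ
  obtain ⟨s, t, hst, hU⟩ := hV.inverting_conj_form hPQ hQP h5 h1 hρ hu hu1 hug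
  have hv' : v⁻¹ = v := by rw [inv_eq_iff_mul_eq_one, ← pow_two, hv]
  have htg : trace (ρ g) = 1 + (z + z ^ 4) := by
    rw [trace_of_diag hQP hρ]
    simp [add_assoc]
  have key : ∀ x, trace (ρ (v * x)) = trace (Q * ρ v * P * (Q * ρ x * P)) := by
    intro x
    rw [show Q * ρ v * P * (Q * ρ x * P) = Q * (ρ v * (P * Q) * ρ x) * P by noncomm_ring, hPQ,
      mul_one, trace_mul_comm, ← mul_assoc, hPQ, one_mul, ← map_mul]
  have hD : Q * ρ g * P = diagonal ![1, z, z ^ 4] := by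
    rw [hρ, show ∀ D : M3, Q * (P * D * Q) * P = (Q * P) * D * (Q * P) by
      intro D; noncomm_ring, hQP, one_mul, mul_one]
  have hDi : Q * ρ g⁻¹ * P = diagonal ![1, z ^ 4, z] := by
    have hgi : g⁻¹ = g ^ 4 := by rw [inv_eq_iff_mul_eq_one, ← pow_succ', hg]
    rw [hgi, pow_of_diag hPQ hQP hρ, show ∀ D : M3, Q * (P * D * Q) * P = (Q * P) * D * (Q * P) by
      intro D; noncomm_ring, hQP, one_mul, mul_one]
    congr 1
    ext i
    fin_cases i
    · simp
    · rfl
    · change (z ^ 4) ^ 4 = z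
      linear_combination (z ^ 11 + z ^ 6 + z) * h5
  have hV2 : Q * ρ v * P * (Q * ρ v * P) = 1 := by
    rw [show Q * ρ v * P * (Q * ρ v * P) = Q * (ρ v * (P * Q) * ρ v) * P by noncomm_ring, hPQ,
      mul_one, ← map_mul, ← pow_two, hv, map_one, mul_one, hQP]
  have htr : trace (Q * ρ v * P) = -1 := by
    rw [trace_mul_comm, ← mul_assoc, hPQ, one_mul, hV.trace_involution hv hv1]
  rw [key, hD, htg] at ht
  rw [_root_.mul_inv_rev, hv', map_mul, trace_mul_comm, ← map_mul, key, hDi, htg] at hti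
  rw [key, hU, htg] at hT
  obtain ⟨V, hVd⟩ : ∃ V, V = Q * ρ v * P := ⟨_, rfl⟩
  rw [← hVd] at ht hti hT hV2 htr
  rw [trace_fin_three] at ht hti hT htr
  simp only [Matrix.mul_diagonal, Matrix.cons_val, mul_one] at ht hti
  simp [Matrix.mul_apply, Fin.sum_univ_three] at hT
  obtain ⟨d, hd, hdV⟩ := exists_wiman_form (s := -s) (t := -t) h5 h1 hw hV2 htr ht hti
    (by linear_combination hst) (by linear_combination hT)
  have hs : s ≠ 0 := by rintro rfl; norm_num at hst
  have hDD : diagonal ![d, -s, 1] * diagonal ![d⁻¹, -s⁻¹, 1] = (1 : M3) := by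
    rw [diagonal_mul_diagonal, ← diagonal_one]
    congr 1
    ext i
    fin_cases i <;> simp [hd, hs]
  have hDD' : diagonal ![d⁻¹, -s⁻¹, 1] * diagonal ![d, -s, 1] = (1 : M3) := by
    rw [diagonal_mul_diagonal, ← diagonal_one]
    congr 1
    ext i
    fin_cases i <;> simp [hd, hs]
  have assoc : ∀ X : M3, diagonal ![d⁻¹, -s⁻¹, 1] * Q * X * (P * diagonal ![d, -s, 1]) =
      diagonal ![d⁻¹, -s⁻¹, 1] * (Q * X * P) * diagonal ![d, -s, 1] := by
    intro X; noncomm_ring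
  refine ⟨P * diagonal ![d, -s, 1], diagonal ![d⁻¹, -s⁻¹, 1] * Q, z, w, g, v, u, ?_, ?_, h5, h1, hw,
    hg, hg1, hv, hv1, hu, hu1, hug, ?_, ?_, ?_⟩
  · rw [mul_assoc, ← mul_assoc _ _ Q, hDD, one_mul, hPQ]
  · rw [mul_assoc, ← mul_assoc Q, hQP, one_mul, hDD']
  · rw [assoc, hD, (Matrix.commute_diagonal _ _).eq, mul_assoc, hDD', mul_one]
  · rw [assoc, hU]
    ext i j
    rw [Matrix.mul_diagonal, Matrix.diagonal_mul]
    fin_cases i <;> fin_cases j <;> simp [hd, hs]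
    linear_combination hst
  · rw [assoc, ← hVd]
    have : V * diagonal ![d, -s, 1] =
        diagonal ![d, -s, 1] * wiman (z + z ^ 4) ((2 * w + 1) * (z - z ^ 4)) := by
      ext i j
      rw [Matrix.mul_diagonal, Matrix.diagonal_mul, hdV]
    rw [mul_assoc, this, ← mul_assoc, hDD', one_mul]

end Valentiner

section
variable {G : Type*} [Group G] [Finite G] {ρ : G →* M3}

/-- The stabilizer of a function on `ℂ³` for a matrix representation. -/
def funStab (ρ : G →* M3) (P Q : M3) (hPQ : P * Q = 1) (hQP : Q * P = 1) (F : (Fin 3 → ℂ) → ℂ) :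
    Subgroup G where
  carrier := {x | ∀ u, F ((Q * ρ x * P) *ᵥ u) = F u}
  one_mem' u := by rw [map_one, mul_one, hQP, one_mulVec]
  mul_mem' {x y} hx hy u := by
    rw [show Q * ρ (x * y) * P = (Q * ρ x * P) * (Q * ρ y * P) by
      rw [map_mul, show Q * ρ x * P * (Q * ρ y * P) = Q * (ρ x * (P * Q) * ρ y) * P by noncomm_ring,
        hPQ, mul_one], ← mulVec_mulVec, hx, hy]
  inv_mem' {x} hx u := by
    have h : Q * ρ x * P * (Q * ρ x⁻¹ * P) = 1 := by
      rw [show Q * ρ x * P * (Q * ρ x⁻¹ * P) = Q * (ρ x * (P * Q) * ρ x⁻¹) * P by noncomm_ring,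
        hPQ, mul_one, ← map_mul, mul_inv_cancel, map_one, mul_one, hQP]
    rw [← hx ((Q * ρ x⁻¹ * P) *ᵥ u), mulVec_mulVec, h, one_mulVec]

end

namespace Valentiner
variable {G : Type*} [Group G] [Finite G] {ρ : G →* M3}

lemma order_four_of_trace (hV : Valentiner ρ) {g x : G} (hg : g ^ 5 = 1) (hg1 : g ≠ 1)
    (h : trace (ρ x) = 1) : x ^ 4 = 1 ∧ x ^ 2 ≠ 1 := by
  have hφ := (hV.golden_trace hg hg1).1
  obtain ⟨w, a, b, c, hw, hab, h1, h2⟩ := hV.trace_form hg hg1 x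
  rw [trace_inv ρ, h, map_one] at h2
  rw [h] at h1
  rcases hw with ⟨rfl, -⟩ | ⟨hw, -⟩
  · have h3 : ((a - 1 : ℤ) : ℂ) + b * trace (ρ g) = 0 := by push_cast; linear_combination -h1
    obtain ⟨ha, hb⟩ := golden_independent hφ h3
    rcases hab with ⟨rfl, rfl⟩ | ⟨rfl, rfl⟩ | ⟨rfl, rfl⟩ | ⟨rfl, rfl, hx⟩ | ⟨rfl, rfl, hx⟩ | ⟨rfl, rfl, hx⟩
    · norm_num at ha
    · norm_num at hb
    · norm_num at ha
    · norm_num at ha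
    · norm_num at ha
    · exact hx rfl
  · exfalso
    have : w = 1 := by linear_combination w * h1 - h2
    rw [this] at hw
    norm_num at hw

/-- A subgroup containing the normalizer of a Sylow 5-subgroup together with an involution
which does not normalize it and an element of order four inverted by it is everything. -/
lemma eq_top_of_generators (hV : Valentiner ρ) {g u v y : G} (hg : g ^ 5 = 1) (hg1 : g ≠ 1)
    (hug : u * g * u⁻¹ = g⁻¹) (hy : y ^ 4 = 1) (hy2 : y ^ 2 ≠ 1)
    (hv : v ^ 2 = 1) (hvy : v * y * v⁻¹ = y⁻¹) (H : Subgroup G) (hsc : ∀ a, Scal ρ a → a ∈ H)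
    (hgH : g ∈ H) (huH : u ∈ H) (hvH : v ∈ H) (hyH : y ∈ H) : H = ⊤ := by
  have : Fintype G := Fintype.ofFinite G
  have : Fintype H := Fintype.ofFinite H
  let g' : H := ⟨g, hgH⟩
  have hg' : g' ^ 5 = 1 := Subtype.ext hg
  have hg1' : g' ≠ 1 := fun h => hg1 (congrArg Subtype.val h)
  have hdvd : Nat.card H ∣ 1080 := hV.card ▸ Subgroup.card_subgroup_dvd_card H
  have hcc : cc g' = 15 := by
    rw [← hV.cc_five hg hg1]
    refine Nat.card_congr
      { toFun := fun x => ⟨x.1, mem_cen.mpr (congrArg Subtype.val (mem_cen.mp x.2))⟩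
        invFun := fun x => ⟨⟨x.1, ?_⟩, mem_cen.mpr (Subtype.ext (mem_cen.mp x.2))⟩
        left_inv := fun x => rfl
        right_inv := fun x => rfl }
    obtain ⟨k, a, -, hx, ha⟩ := hV.decompose hg hg1 (mem_cen.mp x.2)
    rw [hx]
    exact H.mul_mem (H.pow_mem hgH k) (hsc a ha)
  have hclass := card_conj_class g'
  rw [hcc] at hclass
  have hmod := card_modEq_commuting (p := 5) (n := 1) (g := g') (by simpa using hg')
    (Finset.univ.filter fun x => IsConj g' x) (by
      intro s hs
      simp only [Finset.mem_filter, Finset.mem_univ, true_and] at hs ⊢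
      exact hs.trans (isConj_iff.mpr ⟨g', rfl⟩))
  have hgi : g'⁻¹ ≠ g' := by
    intro h
    rw [inv_eq_iff_mul_eq_one, ← pow_two] at h
    exact (five_ne hg' hg1').1 h
  have hfix : ((Finset.univ.filter fun x => IsConj g' x).filter fun s => g' * s = s * g').card = 2 := by
    rw [Finset.card_eq_two]
    refine ⟨g', g'⁻¹, hgi.symm, ?_⟩
    ext x
    simp only [Finset.mem_filter, Finset.mem_univ, true_and, Finset.mem_insert, Finset.mem_singleton]
    constructor
    · rintro ⟨hc, hx⟩
      obtain ⟨c, hc⟩ := isConj_iff.mp hc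
      have hcG : (c : G) * g * (c : G)⁻¹ = x := congrArg Subtype.val hc
      obtain ⟨k, a, -, hxa, ha⟩ := hV.decompose hg hg1 (congrArg Subtype.val hx)
      change (x : G) = _ at hxa
      have hx5 : (x : G) ^ 5 = 1 := by rw [← hcG, conj_pow, hg, mul_one, mul_inv_cancel]
      have ha5 : a ^ 5 = 1 := by
        rw [hxa, Commute.mul_pow (ha.commute hV.inj _).symm, ← pow_mul, mul_comm k, pow_mul, hg,
          one_pow, one_mul] at hx5
        exact hx5
      have ha1 : a = 1 := by simpa using pow_eq_one_of_gcd ha5 (hV.pow_scalar ha)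
      rcases (hV.five g hg hg1).conj_eq hV.inj (x := c) (by
        rw [hcG, hxa, ha1, mul_one]; exact Subgroup.pow_mem _ (Subgroup.mem_zpowers g) k) with h | h
      · exact Or.inl (Subtype.ext (hcG.symm.trans h))
      · exact Or.inr (Subtype.ext (hcG.symm.trans h))
    · rintro (rfl | rfl)
      · exact ⟨IsConj.refl _, rfl⟩
      · exact ⟨isConj_iff.mpr ⟨⟨u, huH⟩, Subtype.ext hug⟩, by group⟩
  have hm : ∃ m, m * 15 = Nat.card H ∧ m ≡ 2 [MOD 5] := by
    refine ⟨_, hclass, ?_⟩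
    rw [← hfix]
    convert hmod
  have h8 : 8 ∣ Nat.card H := by
    have hvmem : v ∉ Subgroup.zpowers y := by
      rintro ⟨k, rfl⟩
      have : y = y⁻¹ := by
        rw [← hvy]
        group
      rw [eq_inv_iff_mul_eq_one, ← pow_two] at this
      exact hy2 this
    have hcy : Nat.card (Subgroup.zpowers y) = 4 := by
      rw [Nat.card_zpowers]
      exact orderOf_eq_prime_pow (p := 2) (n := 1) hy2 hy
    have hp : IsPGroup 2 ↥(Subgroup.zpowers v ⊔ Subgroup.zpowers y) := by
      refine IsPGroup.to_sup_of_normal_right' (IsPGroup.of_card (p := 2) (n := 1) ?_)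
        (IsPGroup.of_card (p := 2) (n := 2) ?_) ?_
      · rw [Nat.card_zpowers]
        rw [pow_one]
        exact orderOf_eq_prime hv (fun h => hvmem (h ▸ Subgroup.one_mem _))
      · rw [hcy]
        norm_num
      · rw [Subgroup.zpowers_le, Subgroup.mem_normalizer_iff]
        have hsub : ∀ h ∈ Subgroup.zpowers y, v * h * v⁻¹ ∈ Subgroup.zpowers y := by
          rintro - ⟨k, rfl⟩
          change v * y ^ k * v⁻¹ ∈ _
          rw [← conj_zpow, hvy]
          exact Subgroup.zpow_mem _ (Subgroup.inv_mem _ (Subgroup.mem_zpowers y)) k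
        refine fun h => ⟨hsub h, fun hh => ?_⟩
        have hv' : v⁻¹ = v := by rw [inv_eq_iff_mul_eq_one, ← pow_two, hv]
        have := hsub _ hh
        rwa [hv', ← mul_assoc, ← mul_assoc, ← pow_two, hv, one_mul, mul_assoc, ← pow_two, hv,
          mul_one] at this
    obtain ⟨k, hk⟩ := IsPGroup.iff_card.mp hp
    have hle : Subgroup.zpowers v ⊔ Subgroup.zpowers y ≤ H :=
      sup_le (Subgroup.zpowers_le.mpr hvH) (Subgroup.zpowers_le.mpr hyH)
    have hlt : Subgroup.zpowers y < Subgroup.zpowers v ⊔ Subgroup.zpowers y := by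
      refine lt_of_le_of_ne le_sup_right fun h => hvmem ?_
      rw [h]
      exact Subgroup.mem_sup_left (Subgroup.mem_zpowers v)
    have hlt' : 4 < 2 ^ k := by
      rw [← hk, ← hcy]
      exact Set.Finite.card_lt_card (Set.toFinite _) hlt
    have hk3 : 3 ≤ k := by
      by_contra hk3
      have : 2 ^ k ≤ 2 ^ 2 := Nat.pow_le_pow_right (by norm_num) (by omega)
      omega
    have h8k : 8 ∣ 2 ^ k := pow_dvd_pow 2 hk3
    rw [← hk] at h8k
    exact h8k.trans (Subgroup.card_dvd_of_le hle)
  have hH : Nat.card H = 1080 := by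
    obtain ⟨m, hclass, hmod⟩ := hm
    rw [← hclass] at hdvd h8 ⊢
    obtain ⟨n, rfl⟩ : 8 ∣ m := by omega
    have hn : n ∣ 9 := by
      obtain ⟨q, hq⟩ := hdvd
      exact ⟨q, by nlinarith⟩
    have hn9 := Nat.le_of_dvd (by norm_num) hn
    rw [Nat.ModEq] at hmod
    clear hclass hdvd h8
    interval_cases n <;> omega
  exact Subgroup.eq_top_of_card_eq H (hH.trans hV.card.symm)

end Valentiner

lemma wimanSextic_smul (c : ℂ) (u : Fin 3 → ℂ) : wimanSextic (c • u) = c ^ 6 * wimanSextic u := by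
  simp only [wimanSextic, Pi.smul_apply, smul_eq_mul]
  ring

lemma wimanSextic_diagonal {z : ℂ} (h5 : z ^ 5 = 1) (u : Fin 3 → ℂ) :
    wimanSextic (diagonal ![1, z, z ^ 4] *ᵥ u) = wimanSextic u := by
  simp only [wimanSextic, mulVec_diagonal, Matrix.cons_val, one_mul]
  linear_combination (9 * u 0 * u 1 ^ 5 + 9 * u 0 * u 2 ^ 5 * (1 + z ^ 5 + z ^ 10 + z ^ 15) +
    10 * (u 1 * u 2) ^ 3 * (1 + z ^ 5 + z ^ 10) - 45 * (u 1 * u 2) ^ 2 * u 0 ^ 2 * (1 + z ^ 5) -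
    135 * (u 1 * u 2) * u 0 ^ 4) * h5

lemma wimanSextic_swap (u : Fin 3 → ℂ) :
    wimanSextic (!![-1, 0, 0; 0, 0, -1; 0, -1, 0] *ᵥ u) = wimanSextic u := by
  simp [wimanSextic, Matrix.mulVec, dotProduct, Fin.sum_univ_three]
  ring

namespace Valentiner
variable {G : Type*} [Group G] [Finite G] {ρ : G →* M3}

lemma exists_invariant_sextic (hV : Valentiner ρ) : ∃ P Q : M3, P * Q = 1 ∧ Q * P = 1 ∧
    ∀ x u, wimanSextic ((Q * ρ x * P) *ᵥ u) = wimanSextic u := by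
  obtain ⟨P, Q, z, w, g, v, u, hPQ, hQP, h5, h1, hw, hg, hg1, hv, hv1, hu, hu1, hug, hD, hU, hW⟩ :=
    hV.exists_wiman_basis
  have hη : (z + z ^ 4) ^ 2 + (z + z ^ 4) = 1 := sum_sq_five h5 h1
  have hgH : g ∈ funStab ρ P Q hPQ hQP wimanSextic := fun x => by
    rw [hD, wimanSextic_diagonal h5]
  have huH : u ∈ funStab ρ P Q hPQ hQP wimanSextic := fun x => by rw [hU, wimanSextic_swap]
  have hvH : v ∈ funStab ρ P Q hPQ hQP wimanSextic := fun x => by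
    rw [hW, wimanSextic_wiman hη (sigma_sq h5 h1 hw)]
  have htr : trace (ρ (v * (u * g))) = 1 := by
    have : trace (ρ (v * (u * g))) = trace (Q * ρ v * P * (Q * ρ u * P * (Q * ρ g * P))) := by
      rw [show Q * ρ v * P * (Q * ρ u * P * (Q * ρ g * P)) =
        Q * (ρ v * (P * Q) * ρ u * (P * Q) * ρ g) * P by noncomm_ring, hPQ, mul_one, mul_one,
        trace_mul_comm, ← mul_assoc P, hPQ, one_mul, map_mul, map_mul, mul_assoc]
    have hUD : !![-1, 0, 0; 0, 0, -1; 0, -1, 0] * diagonal ![1, z, z ^ 4] =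
        (!![-1, 0, 0; 0, 0, -z ^ 4; 0, -z, 0] : M3) := by
      ext i j
      rw [Matrix.mul_diagonal]
      fin_cases i <;> fin_cases j <;> simp
    rw [this, hW, hU, hD, hUD, trace_fin_three]
    simp [wiman, Matrix.mul_apply, Fin.sum_univ_three]
    linear_combination (2 / 5) * hη
  obtain ⟨hy, hy2⟩ := hV.order_four_of_trace hg hg1 htr
  have hv' : v⁻¹ = v := by rw [inv_eq_iff_mul_eq_one, ← pow_two, hv]
  have hu' : u⁻¹ = u := by rw [inv_eq_iff_mul_eq_one, ← pow_two, hu]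
  have hvy : v * (v * (u * g)) * v⁻¹ = (v * (u * g))⁻¹ := by
    rw [_root_.mul_inv_rev, ← mul_assoc, ← pow_two, hv, one_mul, _root_.mul_inv_rev, ← hug, hu']
    congr 1
    rw [mul_assoc, mul_assoc, ← pow_two, hu, mul_one]
  have htop := hV.eq_top_of_generators hg hg1 hug hy hy2 hv hvy (funStab ρ P Q hPQ hQP wimanSextic)
    (fun a ha y => by
      have h3 := hV.pow_scalar ha
      obtain ⟨c, hc⟩ := ha
      have hc3 : c ^ 3 = 1 := by
        have := congrArg ρ h3
        rw [map_pow, hc, smul_one_pow, map_one] at this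
        exact smul_one_inj (by rw [this, one_smul])
      rw [hc, Matrix.mul_smul, mul_one, Matrix.smul_mul, hQP, Matrix.smul_mulVec, one_mulVec,
        wimanSextic_smul, show c ^ 6 = (c ^ 3) ^ 2 by ring, hc3, one_pow, one_mul])
    hgH huH hvH (Subgroup.mul_mem _ hvH (Subgroup.mul_mem _ huH hgH))
  refine ⟨P, Q, hPQ, hQP, fun x => ?_⟩
  have : x ∈ funStab ρ P Q hPQ hQP wimanSextic := htop ▸ Subgroup.mem_top x
  exact this

end Valentiner

section
variable {G : Type*} [Group G] [Finite G] {ρ : G →* M3}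

lemma exists_invariant_sextic (hρ : Function.Injective ρ) (hG : Nat.card G = 2160) (hS : Schur ρ)
    (hgen : Subgroup.closure {r | Refl (ρ r)} = ⊤) : ∃ P Q : M3, P * Q = 1 ∧ Q * P = 1 ∧
    ∀ x u, wimanSextic ((Q * ρ x * P) *ᵥ u) = wimanSextic u := by
  obtain ⟨P, Q, hPQ, hQP, h⟩ := (valentiner_evenRep hρ hG hS hgen).exists_invariant_sextic
  obtain ⟨m, hm⟩ := exists_neg_one hρ hG hS hgen
  refine ⟨P, Q, hPQ, hQP, fun x u => ?_⟩
  rcases det_sq hρ hG hS hgen x with hx | hx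
  · exact h ⟨x, mem_ker_detChar.mpr hx⟩ u
  · have hmx : det (ρ (m * x)) = 1 := by
      rw [map_mul, det_mul, hx, hm, det_neg, det_one, Fintype.card_fin]
      norm_num
    have := h ⟨m * x, mem_ker_detChar.mpr hmx⟩ u
    rw [evenRep_apply, map_mul, hm, neg_one_mul, Matrix.mul_neg, Matrix.neg_mul, neg_mulVec,
      ← neg_one_smul ℂ, wimanSextic_smul] at this
    norm_num at this
    exact this

end

/-- The eigenspace of `ρ v` for the eigenvalue `-1`, as a subspace of `ℂ³`. -/
noncomputable def negPlane {G : Type*} [Group G] (ρ : G →* M3) (v : G) : Submodule ℂ (Fin 3 → ℂ) :=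
  LinearMap.ker (Matrix.toLin' (ρ v + 1))

lemma mem_negPlane {G : Type*} [Group G] {ρ : G →* M3} {v : G} {x : Fin 3 → ℂ} :
    x ∈ negPlane ρ v ↔ ρ v *ᵥ x = -x := by
  rw [negPlane, LinearMap.mem_ker, Matrix.toLin'_apply, add_mulVec, one_mulVec, add_eq_zero_iff_eq_neg]

lemma finrank_inf_eq_one {P Q : Submodule ℂ (Fin 3 → ℂ)} (hP : finrank ℂ P = 2)
    (hQ : finrank ℂ Q = 2) (h : P ≠ Q) : finrank ℂ ↥(P ⊓ Q) = 1 := by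
  have h1 := Submodule.finrank_sup_add_finrank_inf_eq P Q
  have h2 : finrank ℂ ↥(P ⊔ Q) ≤ 3 := by
    simpa using Submodule.finrank_le (P ⊔ Q)
  have h3 : finrank ℂ P < finrank ℂ ↥(P ⊔ Q) := by
    apply Submodule.finrank_lt_finrank_of_lt
    refine lt_of_le_of_ne le_sup_left fun hPQ => h ?_
    have hle : Q ≤ P := by rw [hPQ]; exact le_sup_right
    exact (Submodule.eq_of_le_of_finrank_eq hle (hQ.trans hP.symm)).symm
  omega

lemma inf_eq_inf_of_le {P Q R : Submodule ℂ (Fin 3 → ℂ)} (hP : finrank ℂ P = 2)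
    (hQ : finrank ℂ Q = 2) (hR : finrank ℂ R = 2) (h : P ≠ Q) (h' : P ≠ R) (hle : P ⊓ Q ≤ R) :
    P ⊓ Q = P ⊓ R :=
  Submodule.eq_of_le_of_finrank_eq (le_inf inf_le_left hle)
    ((finrank_inf_eq_one hP hQ h).trans (finrank_inf_eq_one hP hR h').symm)

lemma finrank_ker_vecMulVec {a α : Fin 3 → ℂ} (h : α ⬝ᵥ a = 2) :
    finrank ℂ (LinearMap.ker (Matrix.toLin' (vecMulVec a α))) = 2 := by
  have ha : a ≠ 0 := by rintro rfl; simp at h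
  have hr : LinearMap.range (Matrix.toLin' (vecMulVec a α)) = Submodule.span ℂ {a} := by
    apply le_antisymm
    · rintro - ⟨x, rfl⟩
      rw [Matrix.toLin'_apply, vecMulVec_mulVec]
      exact Submodule.mem_span_singleton.mpr ⟨α ⬝ᵥ x, by ext i; simp [mul_comm]⟩
    · rw [Submodule.span_le, Set.singleton_subset_iff]
      refine ⟨(1 / 2 : ℂ) • a, ?_⟩
      rw [Matrix.toLin'_apply, vecMulVec_mulVec, dotProduct_smul, h]
      simp
  have h1 := LinearMap.finrank_range_add_finrank_ker (Matrix.toLin' (vecMulVec a α))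
  rw [hr, finrank_span_singleton ha, finrank_fin_fun] at h1
  omega

namespace Valentiner
variable {G : Type*} [Group G] [Finite G] {ρ : G →* M3}

lemma involution_form (hV : Valentiner ρ) {v : G} (hv : v ^ 2 = 1) (hv1 : v ≠ 1) :
    ∃ a α : Fin 3 → ℂ, ρ v + 1 = vecMulVec a α ∧ α ⬝ᵥ a = 2 := by
  have hM : ρ v ^ 2 = 1 := by rw [← map_pow, hv, map_one]
  obtain ⟨P, Q, d, hPQ, hQP, hρ, hd⟩ := exists_diagonalization (by norm_num) hM
  have htr := hV.trace_involution hv hv1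
  rw [trace_of_diag hQP hρ] at htr
  have hd' : ∀ i, d i = 1 ∨ d i = -1 := fun i => by
    exact sq_eq_one_iff.mp (hd i)
  have hex : ∃ i, ∀ j, d j + 1 = if j = i then 2 else 0 := by
    rcases hd' 0 with h0 | h0 <;> rcases hd' 1 with h1 | h1 <;> rcases hd' 2 with h2 | h2 <;>
      rw [h0, h1, h2] at htr <;> norm_num at htr
    · exact ⟨0, fun j => by fin_cases j <;> simp [*]; norm_num⟩
    · exact ⟨1, fun j => by fin_cases j <;> simp [*]; norm_num⟩
    · exact ⟨2, fun j => by fin_cases j <;> simp [*]; norm_num⟩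
  obtain ⟨i, hi⟩ := hex
  have hsum : ρ v + 1 = P * diagonal (fun j => d j + 1) * Q := by
    have : diagonal (fun j => d j + 1) = diagonal d + (1 : M3) := by
      rw [← diagonal_one, diagonal_add]
    rw [this, mul_add, add_mul, mul_one, hPQ, hρ]
  refine ⟨fun r => P r i, fun c => 2 * Q i c, ?_, ?_⟩
  · rw [hsum]
    ext r c
    rw [Matrix.mul_apply]
    simp only [Matrix.mul_diagonal, hi, vecMulVec_apply, mul_ite, mul_zero, ite_mul, zero_mul,
      Finset.sum_ite_eq', Finset.mem_univ, if_true]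
    ring
  · have := congrFun (congrFun hQP i) i
    rw [Matrix.mul_apply, Matrix.one_apply_eq] at this
    simp only [dotProduct, mul_assoc, ← Finset.mul_sum, this, mul_one]

lemma finrank_negPlane (hV : Valentiner ρ) {v : G} (hv : v ^ 2 = 1) (hv1 : v ≠ 1) :
    finrank ℂ (negPlane ρ v) = 2 := by
  obtain ⟨a, α, h, h2⟩ := hV.involution_form hv hv1
  rw [negPlane, h, finrank_ker_vecMulVec h2]

lemma negPlane_injective (hV : Valentiner ρ) {v w : G} (hv : v ^ 2 = 1) (hv1 : v ≠ 1)
    (hw : w ^ 2 = 1) (hw1 : w ≠ 1) (h : negPlane ρ v = negPlane ρ w) : v = w := by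
  obtain ⟨a, α, hva, h2⟩ := hV.involution_form hv hv1
  obtain ⟨b, β, hwb, h2'⟩ := hV.involution_form hw hw1
  have hker : ∀ x, α ⬝ᵥ x = 0 → β ⬝ᵥ x = 0 := by
    intro x hx
    have hx' : x ∈ negPlane ρ v := by
      rw [negPlane, hva, LinearMap.mem_ker, Matrix.toLin'_apply, vecMulVec_mulVec, hx]
      simp
    rw [h, negPlane, hwb, LinearMap.mem_ker, Matrix.toLin'_apply, vecMulVec_mulVec] at hx'
    have := congrArg (β ⬝ᵥ ·) hx'
    simp [h2'] at this
    exact this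
  have hβ : β = (β ⬝ᵥ a / 2) • α := by
    ext i
    have := hker (Pi.single i 1 - (α i / 2) • a) (by
      rw [dotProduct_sub, dotProduct_smul, h2, dotProduct_single]; simp)
    rw [dotProduct_sub, dotProduct_smul, dotProduct_single] at this
    simp only [Pi.smul_apply, smul_eq_mul] at this ⊢
    linear_combination this
  obtain ⟨c, hc⟩ : ∃ c, c = β ⬝ᵥ a / 2 := ⟨_, rfl⟩
  rw [← hc] at hβ
  have hαb : α ⬝ᵥ (c • b) = 2 := by
    rw [dotProduct_smul, ← smul_dotProduct, ← hβ, h2']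
  have hwb' : ρ w + 1 = vecMulVec (c • b) α := by
    rw [hwb, hβ, vecMulVec_smul, smul_vecMulVec]
  have hN2 : vecMulVec (a - c • b) α * vecMulVec (a - c • b) α = 0 := by
    rw [vecMulVec_mul_vecMulVec, dotProduct_sub, h2, hαb, sub_self]
    simp
  have hprod : ρ (v * w) = 1 + vecMulVec (a - c • b) α := by
    rw [map_mul, eq_sub_of_add_eq hva, eq_sub_of_add_eq hwb', sub_mul, mul_sub, mul_sub,
      vecMulVec_mul_vecMulVec, hαb, vecMulVec_smul, sub_vecMulVec, two_smul]
    simp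
    abel
  have hpow : ∀ n : ℕ, ρ (v * w) ^ n = 1 + (n : ℂ) • vecMulVec (a - c • b) α := by
    intro n
    induction n with
    | zero => simp
    | succ n ih =>
      rw [pow_succ, ih, hprod, add_mul, mul_add, Matrix.smul_mul, mul_add, hN2, add_zero, mul_one,
        mul_one, one_mul, Nat.cast_succ, add_smul, one_smul]
      abel
  have h0 := hpow 1080
  rw [← map_pow, hV.pow_card, map_one, left_eq_add, smul_eq_zero] at h0
  rw [h0.resolve_left (by norm_num), add_zero, ← map_one ρ] at hprod
  have hv' : v⁻¹ = v := by rw [inv_eq_iff_mul_eq_one, ← pow_two, hv]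
  rw [← inv_eq_of_mul_eq_one_right (hV.inj hprod), hv']

end Valentiner

namespace Valentiner
variable {G : Type*} [Group G] [Finite G] {ρ : G →* M3}

lemma fixes_axis (hV : Valentiner ρ) {y : G} (hy : y ^ 4 = 1) (hy2 : y ^ 2 ≠ 1)
    {x : Fin 3 → ℂ} (hx : ρ (y ^ 2) *ᵥ x = x) : ρ y *ᵥ x = x := by
  obtain ⟨a, α, h, h2⟩ := hV.involution_form (v := y ^ 2) (by rw [← pow_mul, hy]) hy2
  have hxa : (2 : ℂ) • x = (α ⬝ᵥ x) • a := by
    have : (ρ (y ^ 2) + 1) *ᵥ x = (2 : ℂ) • x := by rw [add_mulVec, hx, one_mulVec, two_smul]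
    rw [← this, h, vecMulVec_mulVec]
    ext i; simp [mul_comm]
  have hc : ρ y * vecMulVec a α = vecMulVec a α * ρ y := by
    rw [← h, mul_add, add_mul, mul_one, one_mul, ← map_mul, ← map_mul, ← pow_succ, ← pow_succ']
  have hya : (2 : ℂ) • (ρ y *ᵥ a) = (α ⬝ᵥ ρ y *ᵥ a) • a := by
    have := congrArg (· *ᵥ a) hc
    simp only [← mulVec_mulVec, vecMulVec_mulVec, h2] at this
    ext i
    have := congrFun this i
    simp [mulVec_smul] at this
    simp
    linear_combination this
  have htr : α ⬝ᵥ ρ y *ᵥ a = 2 := by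
    have h1 : trace (ρ y * (ρ (y ^ 2) + 1)) = 2 := by
      rw [mul_add, mul_one, ← map_mul, ← pow_succ', trace_add, hV.trace_order_four hy hy2,
        hV.trace_order_four (y := y ^ 3) (by rw [← pow_mul, mul_comm, pow_mul, hy, one_pow]) ?_]
      · norm_num
      · rw [← pow_mul, show 3 * 2 = 4 + 2 from rfl, pow_add, hy, one_mul]
        exact hy2
    rw [← h1, h, mul_vecMulVec, trace_vecMulVec, dotProduct_comm]
  rw [htr] at hya
  have hya' : ρ y *ᵥ a = a := smul_right_injective _ two_ne_zero hya
  refine smul_right_injective _ (two_ne_zero (α := ℂ)) ?_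
  simp only
  rw [← mulVec_smul, hxa, mulVec_smul, hya']

lemma mem_negPlane_mul_pow {v w : G} {x : Fin 3 → ℂ} (hv : v ^ 2 = 1) (hw : w ^ 2 = 1)
    (hxv : x ∈ negPlane ρ v) (hxw : x ∈ negPlane ρ w) (k : ℕ) :
    (v * (v * w) ^ k) ^ 2 = 1 ∧ x ∈ negPlane ρ (v * (v * w) ^ k) := by
  rw [mem_negPlane] at hxv hxw
  have hv' : v⁻¹ = v := by rw [inv_eq_iff_mul_eq_one, ← pow_two, hv]
  have hw' : w⁻¹ = w := by rw [inv_eq_iff_mul_eq_one, ← pow_two, hw]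
  constructor
  · have : v * (v * w) ^ k * v⁻¹ = ((v * w) ^ k)⁻¹ := by
      rw [← conj_pow, ← inv_pow, _root_.mul_inv_rev, hv', hw', ← mul_assoc, ← pow_two, hv, one_mul]
    rw [hv'] at this
    rw [pow_two, ← mul_assoc, this, inv_mul_cancel]
  · have h1 : ∀ k : ℕ, ρ ((v * w) ^ k) *ᵥ x = x := by
      intro k
      induction k with
      | zero => simp
      | succ k ih =>
        rw [pow_succ, map_mul, map_mul, ← mulVec_mulVec, ← mulVec_mulVec, hxw, mulVec_neg, hxv,
          neg_neg, ih]
    rw [mem_negPlane, map_mul, ← mulVec_mulVec, h1, hxv]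

lemma exists_third (hV : Valentiner ρ) {v w : G} (hv : v ^ 2 = 1) (hv1 : v ≠ 1)
    (hw : w ^ 2 = 1) (hw1 : w ≠ 1) (hvw : v ≠ w) :
    ∃ r, r ^ 2 = 1 ∧ r ≠ v ∧ r ≠ w ∧ negPlane ρ v ⊓ negPlane ρ w ≤ negPlane ρ r := by
  have hv' : v⁻¹ = v := by rw [inv_eq_iff_mul_eq_one, ← pow_two, hv]
  have hw' : w⁻¹ = w := by rw [inv_eq_iff_mul_eq_one, ← pow_two, hw]
  by_cases hx : (v * w) ^ 2 = 1
  · have hx1 : v * w ≠ 1 := fun h => hvw (by rw [mul_eq_one_iff_eq_inv.mp h, hw'])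
    obtain ⟨y, hy⟩ := hV.exists_sqrt hx hx1
    have hy4 : y ^ 4 = 1 := by rw [show 4 = 2 * 2 from rfl, pow_mul, hy, hx]
    have hy2 : y ^ 2 ≠ 1 := hy ▸ hx1
    have hcomm : v * w = w * v := by
      have := hx
      rw [pow_two, mul_eq_one_iff_eq_inv, _root_.mul_inv_rev, hv', hw'] at this
      exact this
    have hsq : (v * y * v⁻¹) ^ 2 = y ^ 2 := by
      rw [conj_pow, hy, hv', ← mul_assoc, ← pow_two, hv, one_mul, hcomm]
    have hvy : v * y * v⁻¹ = y⁻¹ := by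
      refine (hV.sqrt_unique hy4 hy2 hsq).resolve_left fun h => ?_
      have hc : Commute v y := mul_inv_eq_iff_eq_mul.mp h
      have h2 : (v * y) ^ 2 = y ^ 2 := by rw [hc.mul_pow, hv, one_mul]
      rcases hV.sqrt_unique hy4 hy2 h2 with h3 | h3
      · exact hv1 (mul_eq_right.mp h3)
      · apply hw1
        have h4 : v * y ^ 2 = 1 := by rw [pow_two, ← mul_assoc, h3, inv_mul_cancel]
        rw [hy, ← mul_assoc, ← pow_two, hv, one_mul] at h4
        exact h4
    refine ⟨v * y, ?_, ?_, ?_, ?_⟩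
    · rw [hv'] at hvy
      rw [pow_two, ← mul_assoc, hvy, inv_mul_cancel]
    · intro h
      rw [mul_eq_left] at h
      exact hy2 (by rw [h, one_pow])
    · intro h
      have : y = y ^ 2 := by
        rw [hy, ← h, ← mul_assoc, ← pow_two, hv, one_mul]
      rw [pow_two, left_eq_mul] at this
      exact hy2 (by rw [this, one_pow])
    · rintro x ⟨hxv, hxw⟩
      have hxv := mem_negPlane.mp hxv
      have hxw := mem_negPlane.mp hxw
      have := hV.fixes_axis hy4 hy2 (x := x) (by
        rw [hy, map_mul, ← mulVec_mulVec, hxw, mulVec_neg, hxv, neg_neg])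
      rw [mem_negPlane, map_mul, ← mulVec_mulVec, this, hxv]
  · refine ⟨v * w * v, ?_, ?_, ?_, ?_⟩
    · have := conj_pow (i := 2) (a := v) (b := w)
      rw [hv', hw, mul_one, ← pow_two, hv] at this
      exact this
    · intro h
      rw [mul_assoc, mul_eq_left, mul_eq_one_iff_eq_inv, hv'] at h
      exact hvw h.symm
    · intro h
      apply hx
      rw [pow_two, ← mul_assoc, h, ← pow_two, hw]
    · rintro x ⟨hxv, hxw⟩
      have hxv := mem_negPlane.mp hxv
      have hxw := mem_negPlane.mp hxw
      rw [mem_negPlane, map_mul, map_mul, ← mulVec_mulVec, ← mulVec_mulVec, hxv, mulVec_neg, hxw,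
        neg_neg, hxv]

lemma card_lines_le [Fintype G] (hV : Valentiner ρ) {v : G} (hv : v ^ 2 = 1) (hv1 : v ≠ 1) :
    (({w : G | w ^ 2 = 1 ∧ w ≠ 1} : Finset G).erase v |>.image
      fun w => negPlane ρ v ⊓ negPlane ρ w).card ≤ 18 := by
  set T : Finset G := ({w : G | w ^ 2 = 1 ∧ w ≠ 1} : Finset G).erase v with hT
  have hmem : ∀ w, w ∈ T ↔ w ≠ v ∧ w ^ 2 = 1 ∧ w ≠ 1 := by intro w; simp [hT]
  set L : Finset G := {w : G | w ^ 2 = 1 ∧ (v * w) ^ 5 = 1 ∧ v * w ≠ 1} with hL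
  have hLT : L ⊆ T := by
    intro w hw
    simp only [hL, Finset.mem_filter, Finset.mem_univ, true_and] at hw
    rw [hmem]
    refine ⟨fun h => hw.2.2 (by rw [h, ← pow_two, hv]), hw.1, ?_⟩
    rintro rfl
    apply hv1
    have := hw.2.1
    rw [mul_one, show 5 = 2 * 2 + 1 from rfl, pow_succ, pow_mul, hv, one_pow, one_mul] at this
    exact this
  have hcT : T.card = 44 := by
    rw [hT, Finset.card_erase_of_mem (by simp [hv, hv1])]
    have := hV.card_two_elements.1
    omega
  have hcL : L.card = 16 := hV.card_partners hv hv1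
  set f : G → Submodule ℂ (Fin 3 → ℂ) := fun w => negPlane ρ v ⊓ negPlane ρ w with hf
  set m : G → ℕ := fun w => if w ∈ L then 1 else 2 with hm
  have hsum : ∑ w ∈ T, m w = 72 := by
    have h1 : ∑ w ∈ T, m w + ∑ w ∈ T, (if w ∈ L then 1 else 0) = ∑ w ∈ T, 2 := by
      rw [← Finset.sum_add_distrib]
      refine Finset.sum_congr rfl fun w _ => ?_
      by_cases h : w ∈ L <;> simp [hm, h]
    rw [Finset.sum_ite_mem, Finset.inter_eq_right.mpr hLT] at h1
    simp only [Finset.sum_const, smul_eq_mul, hcT, hcL] at h1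
    omega
  have hkey : ∀ w ∈ T, ∀ r, r ^ 2 = 1 → r ≠ v → f w ≤ negPlane ρ r → r ∈ T ∧ f r = f w := by
    intro w hw r hr hrv hle
    obtain ⟨hwv, hw2, hw1⟩ := (hmem w).mp hw
    have hne : negPlane ρ v ≠ negPlane ρ w := fun h =>
      hwv (hV.negPlane_injective hv hv1 hw2 hw1 h).symm
    have hr1 : r ≠ 1 := by
      rintro rfl
      have h1 := finrank_inf_eq_one (hV.finrank_negPlane hv hv1) (hV.finrank_negPlane hw2 hw1) hne
      have : f w = ⊥ := by
        rw [eq_bot_iff]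
        intro x hx
        have := mem_negPlane.mp (hle hx)
        rw [map_one, one_mulVec] at this
        exact self_eq_neg.mp this
      rw [show negPlane ρ v ⊓ negPlane ρ w = ⊥ from this, finrank_bot] at h1
      omega
    refine ⟨(hmem r).mpr ⟨hrv, hr, hr1⟩, ?_⟩
    exact (inf_eq_inf_of_le (hV.finrank_negPlane hv hv1) (hV.finrank_negPlane hw2 hw1)
      (hV.finrank_negPlane hr hr1) hne
      (fun h => hrv (hV.negPlane_injective hv hv1 hr hr1 h).symm) hle).symm
  have hfib : ∀ l ∈ T.image f, 4 ≤ ∑ w ∈ T with f w = l, m w := by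
    intro l hl
    by_cases h : ∃ w ∈ L, f w = l
    · obtain ⟨w, hwL, rfl⟩ := h
      have hwT := hLT hwL
      simp only [hL, Finset.mem_filter, Finset.mem_univ, true_and] at hwL
      obtain ⟨hw, h5, h1⟩ := hwL
      have hord : orderOf (v * w) = 5 := by
        have : Fact (Nat.Prime 5) := ⟨by norm_num⟩
        exact orderOf_eq_prime h5 h1
      have hinj : Set.InjOn (fun k => v * (v * w) ^ k) (Finset.Icc 1 4 : Finset ℕ) := by
        intro i hi j hj hij
        simp only [Finset.coe_Icc, Set.mem_Icc] at hi hj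
        have := mul_left_cancel hij
        exact pow_injOn_Iio_orderOf (by simp [hord]; omega) (by simp [hord]; omega) this
      calc 4 = ((Finset.Icc 1 4).image fun k => v * (v * w) ^ k).card := by
            rw [Finset.card_image_of_injOn hinj]; rfl
        _ ≤ (T.filter fun r => f r = f w).card := by
            apply Finset.card_le_card
            intro r hr
            obtain ⟨k, hk, rfl⟩ := Finset.mem_image.mp hr
            rw [Finset.mem_filter]
            rw [Finset.mem_Icc] at hk
            refine hkey w hwT _ (mem_negPlane_mul_pow (ρ := ρ) hv hw (zero_mem _)
              (zero_mem _) k).1 ?_ fun x hx => (mem_negPlane_mul_pow hv hw hx.1 hx.2 k).2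
            intro h
            rw [mul_eq_left] at h
            have := Nat.le_of_dvd (by omega) (orderOf_dvd_of_pow_eq_one h)
            omega
        _ ≤ _ := by
            rw [Finset.card_eq_sum_ones]
            refine Finset.sum_le_sum fun r _ => ?_
            simp only [hm]
            split_ifs <;> norm_num
    · push Not at h
      obtain ⟨w, hwT, rfl⟩ := Finset.mem_image.mp hl
      obtain ⟨hwv, hw2, hw1⟩ := (hmem w).mp hwT
      obtain ⟨r, hr, hrv, hrw, hle⟩ := hV.exists_third hv hv1 hw2 hw1 hwv.symm
      obtain ⟨hrT, hrf⟩ := hkey w hwT r hr hrv hle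
      calc 4 = ∑ u ∈ {w, r}, m u := by
            rw [Finset.sum_pair hrw.symm]
            simp only [hm]
            rw [if_neg fun hw => h w hw rfl, if_neg fun hr => h r hr hrf]
        _ ≤ _ := by
            refine Finset.sum_le_sum_of_subset fun u hu => ?_
            rw [Finset.mem_filter]
            rcases Finset.mem_insert.mp hu with rfl | hu
            · exact ⟨hwT, rfl⟩
            · rw [Finset.mem_singleton.mp hu]
              exact ⟨hrT, hrf⟩
  have h1 := Finset.card_nsmul_le_sum _ _ 4 hfib
  rw [Finset.sum_fiberwise_of_maps_to fun w hw => Finset.mem_image_of_mem f hw, hsum,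
    smul_eq_mul] at h1
  omega

end Valentiner

lemma refl_of_finrank {M : M3} {n : ℕ} (hn : n ≠ 0) (h : M ^ n = 1)
    (hr : finrank ℂ (LinearMap.ker (Matrix.toLin' (M - 1))) = 2) : Refl M := by
  obtain ⟨P, Q, d, hPQ, hQP, hM, -⟩ := exists_diagonalization hn h
  have hsub : M - 1 = P * diagonal (fun j => d j - 1) * Q := by
    have : diagonal (fun j => d j - 1) = diagonal d - (1 : M3) := by
      rw [← diagonal_one, diagonal_sub]
    rw [this, mul_sub, sub_mul, mul_one, hPQ, hM]
  have hP : IsUnit P.det := (isUnit_iff_isUnit_det P).mp (IsUnit.of_mul_eq_one Q hPQ)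
  have hQ : IsUnit Q.det := (isUnit_iff_isUnit_det Q).mp (IsUnit.of_mul_eq_one P hQP)
  have hrank : (M - 1).rank = 1 := by
    have := LinearMap.finrank_range_add_finrank_ker (Matrix.toLin' (M - 1))
    rw [hr, finrank_fin_fun] at this
    rw [Matrix.rank, ← Matrix.toLin'_apply']
    omega
  rw [hsub, rank_mul_eq_left_of_isUnit_det _ _ hQ, rank_mul_eq_right_of_isUnit_det _ _ hP,
    rank_diagonal, Fintype.card_eq_one_iff] at hrank
  obtain ⟨⟨i, hi⟩, huniq⟩ := hrank
  have h1 : ∀ j, j ≠ i → d j = 1 := fun j hj => by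
    by_contra hne
    exact hj (congrArg Subtype.val (huniq ⟨j, sub_ne_zero.mpr hne⟩))
  set σ : Equiv.Perm (Fin 3) := Equiv.swap i 2
  have hσ : d ∘ σ = ![1, 1, d i] := by
    have h2 : σ 2 = i := Equiv.swap_apply_right i 2
    have h0 : ∀ j, j ≠ 2 → d (σ j) = 1 := fun j hj =>
      h1 _ fun h => hj (σ.injective (h.trans h2.symm))
    ext j
    fin_cases j
    · exact h0 0 (by decide)
    · exact h0 1 (by decide)
    · exact congrArg d h2
  refine ⟨P.submatrix id σ, Q.submatrix σ id, d i, ?_, ?_, sub_ne_zero.mp hi, ?_⟩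
  · rw [submatrix_mul_equiv, hPQ, submatrix_id_id]
  · rw [← submatrix_mul Q P σ id σ Function.bijective_id, hQP, submatrix_one_equiv]
  · rw [hM, ← hσ, ← submatrix_diagonal_equiv, submatrix_mul_equiv, submatrix_mul_equiv,
      submatrix_id_id]

lemma schur_of_irreducible {G : Type*} [Group G] {ρ : G →* M3}
    (h : ∀ U : Submodule ℂ (Fin 3 → ℂ), (∀ g, U.map (Matrix.toLin' (ρ g)) ≤ U) → U = ⊥ ∨ U = ⊤) :
    Schur ρ := by
  intro M hM
  obtain ⟨c, hc⟩ := Module.End.exists_eigenvalue (Matrix.toLin' M)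
  refine ⟨c, ?_⟩
  have htop : Module.End.eigenspace (Matrix.toLin' M) c = ⊤ := by
    refine (h _ ?_).resolve_left hc
    rintro g - ⟨x, hx, rfl⟩
    rw [SetLike.mem_coe, Module.End.mem_eigenspace_iff, Matrix.toLin'_apply] at hx
    rw [Module.End.mem_eigenspace_iff, Matrix.toLin'_apply, Matrix.toLin'_apply, mulVec_mulVec,
      ← hM, ← mulVec_mulVec, hx, mulVec_smul]
  apply Matrix.toLin'.injective
  refine LinearMap.ext fun x => ?_
  have hx : x ∈ Module.End.eigenspace (Matrix.toLin' M) c := htop ▸ Submodule.mem_top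
  rw [Module.End.mem_eigenspace_iff] at hx
  rw [hx, Matrix.toLin'_apply, smul_mulVec, one_mulVec]

section
variable {G : Type*} [Group G] [Finite G] {ρ : G →* M3}

lemma exists_involution_of_refl (hρ : Function.Injective ρ) (hG : Nat.card G = 2160) (hS : Schur ρ)
    (hgen : Subgroup.closure {r | Refl (ρ r)} = ⊤) {g : G} (hg : Refl (ρ g)) :
    ∃ v : (detChar ρ).ker, v ^ 2 = 1 ∧ v ≠ 1 ∧
      LinearMap.ker (Matrix.toLin' (ρ g - 1)) = negPlane (evenRep ρ) v := by
  obtain ⟨m, hm⟩ := exists_neg_one hρ hG hS hgen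
  obtain ⟨P, Q, δ, hPQ, hQP, hδ, hr⟩ := hg
  have hdet := refl_det hPQ hr
  have hδ' : δ = -1 := (hdet ▸ det_sq hρ hG hS hgen g).resolve_left hδ
  have hmg : ρ (m * g) = -ρ g := by rw [map_mul, hm, neg_one_mul]
  refine ⟨⟨m * g, mem_ker_detChar.mpr ?_⟩, ?_, ?_, ?_⟩
  · rw [hmg, det_neg, hdet, hδ', Fintype.card_fin]; norm_num
  · apply Subtype.ext
    apply hρ
    change ρ ((m * g) ^ 2) = ρ 1
    have h1 := refl_pow hPQ hQP hr 2
    rw [map_pow, hδ'] at h1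
    rw [map_pow, hmg, neg_sq, h1, map_one, show ((-1 : ℂ) ^ 2) = 1 by norm_num,
      show (![1, 1, 1] : Fin 3 → ℂ) = 1 by ext i; fin_cases i <;> rfl, diagonal_one', mul_one, hPQ]
  · intro h
    have h1 : ρ (m * g) = 1 := by
      rw [show m * g = 1 from congrArg Subtype.val h, map_one]
    have h2 := refl_trace hQP hr
    rw [← neg_neg (ρ g), ← hmg, h1, hδ'] at h2
    simp at h2
    norm_num at h2
  · ext x
    rw [mem_negPlane, evenRep_apply, hmg, LinearMap.mem_ker, Matrix.toLin'_apply, sub_mulVec,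
      one_mulVec, sub_eq_zero, neg_mulVec, neg_inj]

lemma exists_det_neg_one (hρ : Function.Injective ρ) (hG : Nat.card G = 2160) (hS : Schur ρ)
    (hgen : Subgroup.closure {r | Refl (ρ r)} = ⊤) (v : (detChar ρ).ker) : ∃ g, det (ρ g) = -1 ∧
      LinearMap.ker (Matrix.toLin' (ρ g - 1)) = negPlane (evenRep ρ) v := by
  obtain ⟨m, hm⟩ := exists_neg_one hρ hG hS hgen
  have hmg : ρ (m * v) = -ρ v := by rw [map_mul, hm, neg_one_mul]
  refine ⟨m * v, ?_, ?_⟩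
  · rw [hmg, det_neg, mem_ker_detChar.mp v.2, Fintype.card_fin]; norm_num
  · ext x
    rw [mem_negPlane, evenRep_apply, hmg, LinearMap.mem_ker, Matrix.toLin'_apply, sub_mulVec,
      one_mulVec, sub_eq_zero, neg_mulVec, neg_eq_iff_eq_neg]

/-- The mirrors of a group satisfying the hypotheses on `G₂₇`: each is the fixed space of an
element of determinant `-1`, there are 45 of them, and each meets the others in at most 18 lines. -/
lemma mirrors (hρ : Function.Injective ρ) (hG : Nat.card G = 2160) (hS : Schur ρ)
    (hgen : Subgroup.closure {r | Refl (ρ r)} = ⊤) {𝓗 : Finset (Submodule ℂ (Fin 3 → ℂ))}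
    (h𝓗 : ∀ H, H ∈ 𝓗 ↔ ∃ g, g ≠ 1 ∧ finrank ℂ (LinearMap.ker (Matrix.toLin' (ρ g - 1))) = 2 ∧
      H = LinearMap.ker (Matrix.toLin' (ρ g - 1))) :
    𝓗.card = 45 ∧ (∀ H ∈ 𝓗, ∃ g, det (ρ g) = -1 ∧ ∀ x, x ∈ H ↔ ρ g *ᵥ x = x) ∧
      ∀ H ∈ 𝓗, ((𝓗.erase H).image fun H' => H ⊓ H').card ≤ 18 := by
  have hV := valentiner_evenRep hρ hG hS hgen
  have := Fintype.ofFinite (detChar ρ).ker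
  have hmem : ∀ H, H ∈ 𝓗 ↔ ∃ v : (detChar ρ).ker, v ^ 2 = 1 ∧ v ≠ 1 ∧
      negPlane (evenRep ρ) v = H := by
    intro H
    rw [h𝓗]
    constructor
    · rintro ⟨g, -, hfr, rfl⟩
      obtain ⟨v, hv, hv1, h⟩ := exists_involution_of_refl hρ hG hS hgen (g := g)
        (refl_of_finrank Nat.card_pos.ne' (rho_pow_card ρ g) hfr)
      exact ⟨v, hv, hv1, h.symm⟩
    · rintro ⟨v, hv, hv1, rfl⟩
      obtain ⟨g, hg, h⟩ := exists_det_neg_one hρ hG hS hgen v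
      refine ⟨g, ?_, ?_, h.symm⟩
      · rintro rfl
        rw [map_one, det_one] at hg
        norm_num at hg
      · rw [h, hV.finrank_negPlane hv hv1]
  set I : Finset (detChar ρ).ker := {v | v ^ 2 = 1 ∧ v ≠ 1} with hI
  have hinj : ∀ v ∈ I, ∀ w ∈ I, negPlane (evenRep ρ) v = negPlane (evenRep ρ) w → v = w := by
    intro v hv w hw h
    simp only [hI, Finset.mem_filter, Finset.mem_univ, true_and] at hv hw
    exact hV.negPlane_injective hv.1 hv.2 hw.1 hw.2 h
  have h𝓗I : 𝓗 = I.image (negPlane (evenRep ρ)) := by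
    ext H
    simp only [hmem, Finset.mem_image, hI, Finset.mem_filter, Finset.mem_univ, true_and, and_assoc]
  refine ⟨?_, ?_, ?_⟩
  · rw [h𝓗I, Finset.card_image_of_injOn hinj]
    convert hV.card_two_elements.1
  · intro H hH
    obtain ⟨v, hv, hv1, rfl⟩ := (hmem H).mp hH
    obtain ⟨g, hg, h⟩ := exists_det_neg_one hρ hG hS hgen v
    refine ⟨g, hg, fun x => ?_⟩
    rw [← h, LinearMap.mem_ker, Matrix.toLin'_apply, sub_mulVec, one_mulVec, sub_eq_zero]
  · intro H hH
    obtain ⟨v, hv, hv1, rfl⟩ := (hmem H).mp hH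
    have hvI : v ∈ I := by simp [hI, hv, hv1]
    refine le_trans (Finset.card_le_card ?_) (hV.card_lines_le hv hv1)
    intro L hL
    obtain ⟨H', hH', rfl⟩ := Finset.mem_image.mp hL
    rw [Finset.mem_erase] at hH'
    obtain ⟨w, hw, hw1, rfl⟩ := (hmem H').mp hH'.2
    refine Finset.mem_image.mpr ⟨w, ?_, rfl⟩
    have hwv : w ≠ v := fun h => hH'.1 (by rw [h])
    convert Finset.mem_erase.mpr ⟨hwv, (by simp [hI, hw, hw1] : w ∈ I)⟩

end

section LinearForms
open MvPolynomial
variable {K : Type*} [Field K] {n : ℕ}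

/-- The values of a derivation of the polynomial ring, seen as a polynomial vector field. -/
noncomputable def vecAt (δ : Derivation K (MvPolynomial (Fin n) K) (MvPolynomial (Fin n) K))
    (x : Fin n → K) : Fin n → K := fun i => eval x (δ (X i))

lemma eval_linPoly (f : (Fin n → K) →ₗ[K] K) (x : Fin n → K) : eval x (linPoly f) = f x := by
  conv_rhs => rw [← Finset.univ_sum_single x, map_sum]
  rw [linPoly, map_sum]
  refine Finset.sum_congr rfl fun i _ => ?_
  have : (Pi.single i (x i) : Fin n → K) = x i • Pi.single i 1 := by
    rw [← Pi.single_smul, smul_eq_mul, mul_one]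
  rw [this, map_smul, smul_eq_mul, mul_comm]
  simp

lemma derivation_linPoly (δ : Derivation K (MvPolynomial (Fin n) K) (MvPolynomial (Fin n) K))
    (f : (Fin n → K) →ₗ[K] K) (x : Fin n → K) : eval x (δ (linPoly f)) = f (vecAt δ x) := by
  rw [← eval_linPoly, linPoly, map_sum, map_sum, map_sum]
  refine Finset.sum_congr rfl fun i _ => ?_
  rw [Derivation.leibniz, ← algebraMap_eq, Derivation.map_algebraMap]
  simp [vecAt]

lemma isHomogeneous_linPoly (f : (Fin n → K) →ₗ[K] K) : (linPoly f).IsHomogeneous 1 :=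
  IsHomogeneous.sum _ _ _ fun i _ => by
    simpa using (isHomogeneous_C (Fin n) (f (Pi.single i 1))).mul (isHomogeneous_X K i)

/-- Substitution eliminating the variable `X j` along the linear form `f`. -/
noncomputable def elim (f : (Fin n → K) →ₗ[K] K) (j : Fin n) :
    MvPolynomial (Fin n) K →ₐ[K] MvPolynomial (Fin n) K :=
  aeval fun i => if i = j then X j - C (f (Pi.single j 1))⁻¹ * linPoly f else X i

lemma linPoly_dvd_sub_elim (f : (Fin n → K) →ₗ[K] K) (j : Fin n) (p : MvPolynomial (Fin n) K) :
    linPoly f ∣ p - elim f j p := by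
  rw [← Ideal.mem_span_singleton, ← Ideal.Quotient.mk_eq_mk_iff_sub_mem]
  have : Ideal.Quotient.mkₐ K (Ideal.span {linPoly f}) =
      (Ideal.Quotient.mkₐ K (Ideal.span {linPoly f})).comp (elim f j) := by
    refine algHom_ext fun i => ?_
    rw [AlgHom.comp_apply, elim, aeval_X]
    split_ifs with h
    · subst h
      rw [Ideal.Quotient.mkₐ_eq_mk, Ideal.Quotient.mk_eq_mk_iff_sub_mem, sub_sub_cancel]
      exact Ideal.mul_mem_left _ _ (Ideal.mem_span_singleton_self _)
    · rfl
  exact DFunLike.congr_fun this p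

lemma eval_elim (f : (Fin n → K) →ₗ[K] K) (j : Fin n) (p : MvPolynomial (Fin n) K)
    (x : Fin n → K) : eval x (elim f j p) =
      eval (x - ((f (Pi.single j 1))⁻¹ * f x) • Pi.single j 1) p := by
  have : (aeval x).comp (elim f j) =
      aeval (x - ((f (Pi.single j 1))⁻¹ * f x) • (Pi.single j 1 : Fin n → K)) := by
    refine algHom_ext fun i => ?_
    rw [AlgHom.comp_apply, elim, aeval_X]
    split_ifs with h
    · subst h
      simp [aeval_eq_eval, eval_linPoly]
    · simp [h]
  exact DFunLike.congr_fun this p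

lemma exists_single_ne_zero {f : (Fin n → K) →ₗ[K] K} (hf : f ≠ 0) : ∃ j, f (Pi.single j 1) ≠ 0 := by
  by_contra! h
  exact hf (LinearMap.pi_ext' fun i => LinearMap.ext_ring (by simpa using h i))

variable [Infinite K]

lemma linPoly_dvd_iff_elim {f : (Fin n → K) →ₗ[K] K} {j : Fin n} (hj : f (Pi.single j 1) ≠ 0)
    {p : MvPolynomial (Fin n) K} : linPoly f ∣ p ↔ elim f j p = 0 := by
  constructor
  · rintro ⟨q, rfl⟩
    rw [map_mul]
    convert zero_mul _
    refine MvPolynomial.funext fun x => ?_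
    rw [eval_elim, eval_linPoly, map_sub, map_smul, smul_eq_mul, map_zero]
    field_simp
    ring
  · intro h
    simpa [h] using linPoly_dvd_sub_elim f j p

lemma linPoly_dvd_iff {f : (Fin n → K) →ₗ[K] K} (hf : f ≠ 0) {p : MvPolynomial (Fin n) K} :
    linPoly f ∣ p ↔ ∀ x ∈ LinearMap.ker f, eval x p = 0 := by
  constructor
  · rintro ⟨q, rfl⟩ x hx
    rw [map_mul, eval_linPoly, LinearMap.mem_ker.mp hx, zero_mul]
  · intro h
    obtain ⟨j, hj⟩ := exists_single_ne_zero hf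
    rw [linPoly_dvd_iff_elim hj]
    refine MvPolynomial.funext fun x => ?_
    rw [eval_elim, map_zero]
    apply h
    rw [LinearMap.mem_ker, map_sub, map_smul, smul_eq_mul]
    field_simp
    ring

lemma linPoly_ne_zero {f : (Fin n → K) →ₗ[K] K} (hf : f ≠ 0) : linPoly f ≠ 0 := by
  intro h
  apply hf
  ext1 i
  ext
  simpa [h] using (eval_linPoly f (Pi.single i 1)).symm

lemma prime_linPoly {f : (Fin n → K) →ₗ[K] K} (hf : f ≠ 0) : Prime (linPoly f) := by
  obtain ⟨j, hj⟩ := exists_single_ne_zero hf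
  refine ⟨linPoly_ne_zero hf, fun h => ?_, fun a b h => ?_⟩
  · have := (linPoly_dvd_iff hf (p := 1)).mp h.dvd 0 (zero_mem _)
    simp at this
  · rw [linPoly_dvd_iff_elim hj, map_mul, mul_eq_zero] at h
    rwa [linPoly_dvd_iff_elim hj, linPoly_dvd_iff_elim hj]

lemma ker_eq_of_linPoly_dvd {f g : (Fin n → K) →ₗ[K] K} (hf : f ≠ 0) (hg : g ≠ 0)
    (h : linPoly f ∣ linPoly g) : LinearMap.ker f = LinearMap.ker g := by
  refine Submodule.eq_of_le_of_finrank_eq (fun x hx => ?_) ?_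
  · rw [LinearMap.mem_ker, ← eval_linPoly]
    exact (linPoly_dvd_iff hf).mp h x hx
  · have h1 := Module.Dual.finrank_ker_add_one_of_ne_zero hf
    have h2 := Module.Dual.finrank_ker_add_one_of_ne_zero hg
    omega

end LinearForms

section Tangent
open MvPolynomial
variable {K : Type*} [Field K] {n : ℕ}

/-- A polynomial vector field is tangent to the subspace `H`. -/
def Tangent (δ : Derivation K (MvPolynomial (Fin n) K) (MvPolynomial (Fin n) K))
    (H : Submodule K (Fin n → K)) : Prop := ∀ x ∈ H, vecAt δ x ∈ H

lemma vecAt_smul (p : MvPolynomial (Fin n) K)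
    (δ : Derivation K (MvPolynomial (Fin n) K) (MvPolynomial (Fin n) K)) (x : Fin n → K) :
    vecAt (p • δ) x = eval x p • vecAt δ x := by
  ext i
  simp [vecAt]

lemma Tangent.smul {δ : Derivation K (MvPolynomial (Fin n) K) (MvPolynomial (Fin n) K)}
    {H : Submodule K (Fin n → K)} (h : Tangent δ H) (p : MvPolynomial (Fin n) K) :
    Tangent (p • δ) H := fun x hx => by
  rw [vecAt_smul]
  exact H.smul_mem _ (h x hx)

lemma tangent_smul_of_vanish {p : MvPolynomial (Fin n) K} {H : Submodule K (Fin n → K)}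
    (h : ∀ x ∈ H, eval x p = 0)
    (δ : Derivation K (MvPolynomial (Fin n) K) (MvPolynomial (Fin n) K)) : Tangent (p • δ) H :=
  fun x hx => by
    have h0 := h x hx
    rw [vecAt_smul, h0, zero_smul]
    exact H.zero_mem

variable [Infinite K]

lemma tangent_ker_iff {f : (Fin n → K) →ₗ[K] K} (hf : f ≠ 0)
    {δ : Derivation K (MvPolynomial (Fin n) K) (MvPolynomial (Fin n) K)} :
    Tangent δ (LinearMap.ker f) ↔ linPoly f ∣ δ (linPoly f) := by
  rw [linPoly_dvd_iff hf]
  simp only [derivation_linPoly, Tangent, LinearMap.mem_ker]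

lemma prod_linPoly_dvd_iff {s : Finset (Submodule K (Fin n → K))}
    {α : Submodule K (Fin n → K) → ((Fin n → K) →ₗ[K] K)}
    (hα : ∀ H ∈ s, α H ≠ 0 ∧ LinearMap.ker (α H) = H) {p : MvPolynomial (Fin n) K} :
    ∏ H ∈ s, linPoly (α H) ∣ p ↔ ∀ H ∈ s, linPoly (α H) ∣ p := by
  refine ⟨fun h H hH => (Finset.dvd_prod_of_mem (fun H => linPoly (α H)) hH).trans h, fun h => ?_⟩
  induction s using Finset.induction_on with
  | empty => simp
  | insert H s hH ih =>
    rw [Finset.prod_insert hH]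
    obtain ⟨q, hq⟩ := ih (fun H' h' => hα H' (Finset.mem_insert_of_mem h'))
      fun H' h' => h H' (Finset.mem_insert_of_mem h')
    have hp := prime_linPoly (hα H (Finset.mem_insert_self H s)).1
    have hd := h H (Finset.mem_insert_self H s)
    rw [hq] at hd ⊢
    rcases hp.dvd_or_dvd hd with h1 | h1
    · obtain ⟨H', h', h2⟩ := (hp.dvd_finsetProd_iff _).mp h1
      have h3 := hα H (Finset.mem_insert_self H s)
      have h4 := hα H' (Finset.mem_insert_of_mem h')
      have := ker_eq_of_linPoly_dvd h3.1 h4.1 h2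
      rw [h3.2, h4.2] at this
      exact absurd (this ▸ h') hH
    · rw [mul_comm]
      exact mul_dvd_mul_left _ h1

lemma prod_dvd_derivation_iff {s : Finset (Submodule K (Fin n → K))}
    {α : Submodule K (Fin n → K) → ((Fin n → K) →ₗ[K] K)}
    (hα : ∀ H ∈ s, α H ≠ 0 ∧ LinearMap.ker (α H) = H)
    {δ : Derivation K (MvPolynomial (Fin n) K) (MvPolynomial (Fin n) K)} :
    ∏ H ∈ s, linPoly (α H) ∣ δ (∏ H ∈ s, linPoly (α H)) ↔
      ∀ H ∈ s, linPoly (α H) ∣ δ (linPoly (α H)) := by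
  induction s using Finset.induction_on with
  | empty => simp
  | insert H s hH ih =>
    have hα' := fun H' h' => hα H' (Finset.mem_insert_of_mem h')
    have hp := prime_linPoly (hα H (Finset.mem_insert_self H s)).1
    have hnd : ¬ linPoly (α H) ∣ ∏ H ∈ s, linPoly (α H) := by
      intro h1
      obtain ⟨H', h', h2⟩ := (hp.dvd_finsetProd_iff _).mp h1
      have h3 := hα H (Finset.mem_insert_self H s)
      have h4 := hα' H' h'
      have := ker_eq_of_linPoly_dvd h3.1 h4.1 h2
      rw [h3.2, h4.2] at this
      exact hH (this ▸ h')
    rw [Finset.forall_mem_insert, ← ih hα', Finset.prod_insert hH, Derivation.leibniz, smul_eq_mul,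
      smul_eq_mul]
    constructor
    · intro h
      constructor
      · refine (hp.dvd_or_dvd ?_).resolve_left hnd
        exact (dvd_add_right (dvd_mul_right _ _)).mp ((dvd_mul_right _ _).trans h)
      · have h1 : ∏ H ∈ s, linPoly (α H) ∣ linPoly (α H) * δ (∏ H ∈ s, linPoly (α H)) :=
          (dvd_add_left (dvd_mul_right _ _)).mp ((dvd_mul_left _ _).trans h)
        rw [prod_linPoly_dvd_iff hα'] at h1 ⊢
        intro H' h'
        refine ((prime_linPoly (hα' H' h').1).dvd_or_dvd (h1 H' h')).resolve_left fun h2 => ?_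
        have h3 := hα H (Finset.mem_insert_self H s)
        have h4 := hα' H' h'
        have := ker_eq_of_linPoly_dvd h4.1 h3.1 h2
        rw [h3.2, h4.2] at this
        exact hH (this ▸ h')
    · rintro ⟨h1, h2⟩
      refine dvd_add (mul_dvd_mul_left _ h2) ?_
      rw [mul_comm]
      exact mul_dvd_mul_left _ h1

variable {A : Arrangement K n} {Q : MvPolynomial (Fin n) K}

lemma mem_derModule_iff (hQ : IsDefiningPoly A Q)
    {δ : Derivation K (MvPolynomial (Fin n) K) (MvPolynomial (Fin n) K)} :
    δ ∈ DerModule Q ↔ ∀ H ∈ A.hyperplanes, Tangent δ H := by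
  obtain ⟨α, hα, rfl⟩ := hQ
  rw [DerModule, Submodule.mem_comap, Ideal.mem_span_singleton]
  change _ ∣ δ _ ↔ _
  rw [prod_dvd_derivation_iff hα]
  refine forall₂_congr fun H hH => ?_
  rw [← tangent_ker_iff (hα H hH).1, (hα H hH).2]

lemma definingPoly_dvd_iff (hQ : IsDefiningPoly A Q) {p : MvPolynomial (Fin n) K} :
    Q ∣ p ↔ ∀ H ∈ A.hyperplanes, ∀ x ∈ H, eval x p = 0 := by
  obtain ⟨α, hα, rfl⟩ := hQ
  rw [prod_linPoly_dvd_iff hα]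
  refine forall₂_congr fun H hH => ?_
  rw [linPoly_dvd_iff (hα H hH).1, (hα H hH).2]

lemma definingPoly_ne_zero (hQ : IsDefiningPoly A Q) : Q ≠ 0 := by
  obtain ⟨α, hα, rfl⟩ := hQ
  exact Finset.prod_ne_zero_iff.mpr fun H hH => linPoly_ne_zero (hα H hH).1

lemma isHomogeneous_definingPoly (hQ : IsDefiningPoly A Q) :
    Q.IsHomogeneous A.hyperplanes.card := by
  obtain ⟨α, hα, rfl⟩ := hQ
  simpa using IsHomogeneous.prod A.hyperplanes (fun H => linPoly (α H)) (fun _ => 1)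
    fun H _ => isHomogeneous_linPoly (α H)

lemma exists_definingPoly (A : Arrangement K n) : ∃ Q, IsDefiningPoly A Q := by
  refine ⟨_, fun H => if h : H ∈ A.hyperplanes then (A.isHyp H h).choose else 0, fun H hH => ?_, rfl⟩
  simp only [dif_pos hH]
  exact ⟨(A.isHyp H hH).choose_spec.1, (A.isHyp H hH).choose_spec.2.symm⟩

end Tangent

section Saito
open MvPolynomial
variable {K : Type*} [Field K] {n : ℕ}

/-- The coefficients of a derivation of the polynomial ring. -/
noncomputable def coeffs : Derivation K (MvPolynomial (Fin n) K) (MvPolynomial (Fin n) K)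
    →ₗ[MvPolynomial (Fin n) K] (Fin n → MvPolynomial (Fin n) K) where
  toFun δ i := δ (X i)
  map_add' _ _ := rfl
  map_smul' _ _ := rfl

lemma coeffs_apply (δ : Derivation K (MvPolynomial (Fin n) K) (MvPolynomial (Fin n) K))
    (i : Fin n) : coeffs δ i = δ (X i) := rfl

lemma coeffs_injective : Function.Injective (coeffs (K := K) (n := n)) :=
  fun _ _ h => derivation_ext fun i => congrFun h i

lemma smul_derivation_cancel {p : MvPolynomial (Fin n) K} (hp : p ≠ 0)
    {δ δ' : Derivation K (MvPolynomial (Fin n) K) (MvPolynomial (Fin n) K)}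
    (h : p • δ = p • δ') : δ = δ' :=
  derivation_ext fun i => mul_left_cancel₀ hp (DFunLike.congr_fun h (X i))

/-- The coefficient matrix of a family of derivations. -/
noncomputable def coeffMat
    (θ : Fin n → Derivation K (MvPolynomial (Fin n) K) (MvPolynomial (Fin n) K)) :
    Matrix (Fin n) (Fin n) (MvPolynomial (Fin n) K) := Matrix.of fun j k => θ k (X j)

lemma isHomogeneous_det {M : Matrix (Fin n) (Fin n) (MvPolynomial (Fin n) K)} {d : Fin n → ℕ}
    (h : ∀ j k, (M j k).IsHomogeneous (d k)) : M.det.IsHomogeneous (∑ k, d k) := by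
  rw [det_apply]
  refine IsHomogeneous.sum _ _ _ fun σ _ => ?_
  rw [Units.smul_def, zsmul_eq_mul, ← zero_add (∑ k, d k)]
  refine IsHomogeneous.mul ?_ (IsHomogeneous.prod _ _ _ fun k _ => h _ k)
  simpa using isHomogeneous_C (Fin n) (((Equiv.Perm.sign σ : ℤˣ) : ℤ) : K)

lemma det_smul_derivation
    (θ : Fin n → Derivation K (MvPolynomial (Fin n) K) (MvPolynomial (Fin n) K))
    (δ : Derivation K (MvPolynomial (Fin n) K) (MvPolynomial (Fin n) K)) :
    (coeffMat θ).det • δ = ∑ k, (coeffMat (Function.update θ k δ)).det • θ k := by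
  apply coeffs_injective
  rw [map_smul, map_sum, ← mulVec_cramer]
  ext1 j
  rw [Finset.sum_apply, Matrix.mulVec, dotProduct]
  refine Finset.sum_congr rfl fun k _ => ?_
  rw [cramer_apply, map_smul, Pi.smul_apply, smul_eq_mul, mul_comm, coeffs_apply]
  congr 2
  ext i l
  by_cases h : l = k
  · subst h; simp [coeffMat, coeffs_apply]
  · simp [coeffMat, h]

lemma linearIndependent_of_det
    {θ : Fin n → Derivation K (MvPolynomial (Fin n) K) (MvPolynomial (Fin n) K)}
    (h : (coeffMat θ).det ≠ 0) : LinearIndependent (MvPolynomial (Fin n) K) θ :=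
  LinearIndependent.of_comp coeffs (linearIndependent_cols_of_det_ne_zero h)

lemma eq_zero_of_dvd_of_degree_lt {p q : MvPolynomial (Fin n) K} {a b : ℕ} (hp : p.IsHomogeneous a)
    (hq : q.IsHomogeneous b) (h : p ∣ q) (hab : b < a) : q = 0 := by
  obtain ⟨r, rfl⟩ := h
  by_contra h0
  have h1 := hq.totalDegree h0
  rw [totalDegree_mul_of_isDomain (left_ne_zero_of_mul h0) (right_ne_zero_of_mul h0),
    hp.totalDegree (left_ne_zero_of_mul h0)] at h1
  omega

lemma eq_C_mul_of_dvd {p q : MvPolynomial (Fin n) K} {a : ℕ} (hp : p.IsHomogeneous a)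
    (hq : q.IsHomogeneous a) (h : p ∣ q) (h0 : q ≠ 0) : ∃ c : K, c ≠ 0 ∧ q = C c * p := by
  obtain ⟨r, rfl⟩ := h
  have h1 := hq.totalDegree h0
  rw [totalDegree_mul_of_isDomain (left_ne_zero_of_mul h0) (right_ne_zero_of_mul h0),
    hp.totalDegree (left_ne_zero_of_mul h0), Nat.add_eq_left, totalDegree_eq_zero_iff_eq_C] at h1
  refine ⟨coeff 0 r, ?_, by rw [mul_comm, ← h1]⟩
  intro h2
  rw [h1, h2, C_0, mul_zero] at h0
  exact h0 rfl

variable [Infinite K] {A : Arrangement K n} {Q : MvPolynomial (Fin n) K}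

lemma definingPoly_dvd_det (hQ : IsDefiningPoly A Q)
    {θ : Fin n → Derivation K (MvPolynomial (Fin n) K) (MvPolynomial (Fin n) K)}
    (h : ∀ k, ∀ H ∈ A.hyperplanes, Tangent (θ k) H) : Q ∣ (coeffMat θ).det := by
  rw [definingPoly_dvd_iff hQ]
  intro H hH x hx
  obtain ⟨f, hf, rfl⟩ := A.isHyp H hH
  rw [RingHom.map_det, ← exists_vecMul_eq_zero_iff]
  refine ⟨fun i => f (Pi.single i 1), ?_, ?_⟩
  · intro h0
    obtain ⟨j, hj⟩ := exists_single_ne_zero hf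
    exact hj (congrFun h0 j)
  · ext k
    have h1 := LinearMap.mem_ker.mp (h k _ hH x hx)
    rw [← eval_linPoly, linPoly, map_sum] at h1
    simpa [Matrix.vecMul, dotProduct, coeffMat, vecAt] using h1

/-- Saito's criterion. -/
lemma exists_basis_of_det_ne_zero (hQ : IsDefiningPoly A Q)
    {θ : Fin n → Derivation K (MvPolynomial (Fin n) K) (MvPolynomial (Fin n) K)} {d : Fin n → ℕ}
    (h : ∀ k, ∀ H ∈ A.hyperplanes, Tangent (θ k) H)
    (hd : ∀ k j, (θ k (X j)).IsHomogeneous (d k)) (hcard : ∑ k, d k = A.hyperplanes.card)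
    (hdet : (coeffMat θ).det ≠ 0) :
    ∃ b : Basis (Fin n) (MvPolynomial (Fin n) K) (DerModule Q), ∀ k, (b k : Derivation K
      (MvPolynomial (Fin n) K) (MvPolynomial (Fin n) K)) = θ k := by
  obtain ⟨c, hc, hcQ⟩ := eq_C_mul_of_dvd (isHomogeneous_definingPoly hQ)
    (hcard ▸ isHomogeneous_det fun j k => hd k j) (definingPoly_dvd_det hQ h) hdet
  let θ' : Fin n → DerModule Q := fun k => ⟨θ k, (mem_derModule_iff hQ).mpr (h k)⟩
  have hli : LinearIndependent (MvPolynomial (Fin n) K) θ' :=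
    LinearIndependent.of_comp (DerModule Q).subtype (linearIndependent_of_det hdet)
  refine ⟨Basis.mk hli ?_, fun k => by rw [Basis.mk_apply]⟩
  rintro ⟨δ, hδ⟩ -
  have hdvd : ∀ k, ∃ r, (coeffMat (Function.update θ k δ)).det = Q * r := fun k => by
    refine definingPoly_dvd_det hQ fun l => ?_
    by_cases hl : l = k
    · subst hl
      rw [Function.update_self]
      exact (mem_derModule_iff hQ).mp hδ
    · rw [Function.update_of_ne hl]
      exact h l
  choose r hr using hdvd
  have hkey : δ = ∑ k, (C c⁻¹ * r k) • θ k := by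
    have h1 := det_smul_derivation θ δ
    simp only [hcQ, hr, mul_comm (C c) Q, mul_smul, ← Finset.smul_sum] at h1
    have h2 := smul_derivation_cancel (definingPoly_ne_zero hQ) h1
    simp only [mul_smul, ← Finset.smul_sum]
    rw [← h2, smul_smul, ← C_mul, inv_mul_cancel₀ hc, C_1, one_smul]
  have : (⟨δ, hδ⟩ : DerModule Q) = ∑ k, (C c⁻¹ * r k) • θ' k := by
    apply Subtype.ext
    rw [AddSubmonoidClass.coe_finsetSum]
    exact hkey
  rw [this]
  exact Submodule.sum_mem _ fun k _ => Submodule.smul_mem _ _ (Submodule.subset_span ⟨k, rfl⟩)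

end Saito

section NotInductivelyFree
open MvPolynomial
variable {K : Type*} [Field K] {n : ℕ}

/-- The Euler derivation. -/
noncomputable def eulerDer (K : Type*) [Field K] (n : ℕ) :
    Derivation K (MvPolynomial (Fin n) K) (MvPolynomial (Fin n) K) := mkDerivation K X

lemma eulerDer_X (i : Fin n) : eulerDer K n (X i) = X i := mkDerivation_X _ _ _

lemma vecAt_eulerDer (x : Fin n → K) : vecAt (eulerDer K n) x = x := by
  ext i
  rw [vecAt, eulerDer_X, eval_X]

lemma tangent_eulerDer (H : Submodule K (Fin n → K)) : Tangent (eulerDer K n) H := by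
  intro x hx
  rwa [vecAt_eulerDer]

lemma Arrgt.InductivelyFree.exists_restriction {A : Arrangement K (n + 1)}
    (h : InductivelyFree K A) (hA : A.hyperplanes.Nonempty) :
    ∃ H ∈ A.hyperplanes, ∃ B : Arrangement K n, IsRestriction A H B ∧ ∃ e' e'' : Multiset ℕ,
      HasExponents (A.delete H) e' ∧ HasExponents B e'' ∧ e'' ≤ e' := by
  cases h with
  | empty => exact absurd hA (by simp [emptyArr])
  | add A H hH B hB e' e'' h1 h2 h3 h4 h5 => exact ⟨H, hH, B, hB, e', e'', h3, h4, h5⟩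

lemma card_restriction_le {A : Arrangement K (n + 1)} {H : Submodule K (Fin (n + 1) → K)}
    {B : Arrangement K n} (h : IsRestriction A H B) :
    B.hyperplanes.card ≤ ((A.hyperplanes.erase H).image fun H' => H ⊓ H').card := by
  obtain ⟨e, he⟩ := h
  have : B.hyperplanes = ((A.hyperplanes.erase H).image fun H' => H ⊓ H').image
      fun L => Submodule.map (e : H →ₗ[K] (Fin n → K)) (L.comap H.subtype) := by
    rw [he, Finset.image_image]
    refine Finset.image_congr fun H' _ => ?_
    simp [Submodule.comap_inf]
  rw [this]
  exact Finset.card_image_le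

lemma det_coeffMat_basis_dvd {Q : MvPolynomial (Fin n) K}
    (b : Basis (Fin n) (MvPolynomial (Fin n) K) (DerModule Q))
    {θ : Fin n → Derivation K (MvPolynomial (Fin n) K) (MvPolynomial (Fin n) K)}
    (hθ : ∀ k, θ k ∈ DerModule Q) :
    (coeffMat fun i => ((b i : DerModule Q) : Derivation K (MvPolynomial (Fin n) K)
      (MvPolynomial (Fin n) K))).det ∣ (coeffMat θ).det := by
  refine ⟨(Matrix.of fun i k => b.repr ⟨θ k, hθ k⟩ i : Matrix (Fin n) (Fin n) _).det, ?_⟩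
  rw [← det_mul]
  congr 1
  ext1 j k
  have h3 := congrArg (fun δ : DerModule Q => coeffs (δ : Derivation K (MvPolynomial (Fin n) K)
    (MvPolynomial (Fin n) K)) j) (b.sum_repr ⟨θ k, hθ k⟩)
  simp only [AddSubmonoidClass.coe_finsetSum, Submodule.coe_smul] at h3
  rw [map_sum, Finset.sum_apply] at h3
  rw [Matrix.mul_apply]
  simp only [coeffMat, Matrix.of_apply]
  rw [← coeffs_apply, ← h3]
  refine Finset.sum_congr rfl fun i _ => ?_
  rw [map_smul, Pi.smul_apply, smul_eq_mul, coeffs_apply, mul_comm]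

variable [Infinite K]

lemma exists_derivations_plane {B : Arrangement K 2} {Q : MvPolynomial (Fin 2) K}
    (hQ : IsDefiningPoly B Q) (hB : B.hyperplanes.Nonempty) :
    ∃ θ : Fin 2 → Derivation K (MvPolynomial (Fin 2) K) (MvPolynomial (Fin 2) K),
      (∀ k, θ k ∈ DerModule Q) ∧ (coeffMat θ).det = Q := by
  have hQ' := hQ
  obtain ⟨α, hα, hprod⟩ := hQ
  obtain ⟨H, hH⟩ := hB
  obtain ⟨a, ha⟩ : ∃ a : Fin 2 → K, ∀ i, a i = α H (Pi.single i 1) := ⟨_, fun _ => rfl⟩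
  set R := ∏ H' ∈ B.hyperplanes.erase H, linPoly (α H') with hR
  have hQR : Q = linPoly (α H) * R := by
    rw [hprod]
    exact (Finset.mul_prod_erase B.hyperplanes (fun H => linPoly (α H)) hH).symm
  set δ : Derivation K (MvPolynomial (Fin 2) K) (MvPolynomial (Fin 2) K) :=
    mkDerivation K ![C (-a 1), C (a 0)] with hδ
  refine ⟨![eulerDer K 2, R • δ], ?_, ?_⟩
  · intro k
    rw [mem_derModule_iff hQ']
    intro H' hH'
    fin_cases k
    · exact tangent_eulerDer H'
    · by_cases h : H' = H
      · subst h
        refine Tangent.smul (fun x _ => ?_) R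
        rw [← (hα H' hH').2, LinearMap.mem_ker, ← eval_linPoly, linPoly]
        simp [Fin.sum_univ_two, vecAt, hδ, mkDerivation_X, ← ha]
        ring
      · refine tangent_smul_of_vanish (fun x hx => ?_) δ
        rw [hR, map_prod]
        refine Finset.prod_eq_zero (Finset.mem_erase.mpr ⟨h, hH'⟩) ?_
        rw [eval_linPoly]
        rwa [← (hα H' hH').2] at hx
  · rw [det_fin_two, hQR, linPoly]
    simp [coeffMat, eulerDer_X, hδ, mkDerivation_X, Fin.sum_univ_two, ← ha]
    ring

lemma length_eq_two {B : Arrangement K 2} {Q : MvPolynomial (Fin 2) K} (hQ : IsDefiningPoly B Q)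
    (hB : B.hyperplanes.Nonempty) {m : ℕ}
    (b : Basis (Fin m) (MvPolynomial (Fin 2) K) (DerModule Q)) : m = 2 := by
  obtain ⟨θ, hθ, hdet⟩ := exists_derivations_plane hQ hB
  have hfin : Module.Finite (MvPolynomial (Fin 2) K) (DerModule Q) := Module.Finite.of_basis b
  have hdet0 : (coeffMat θ).det ≠ 0 := by
    rw [hdet]
    exact definingPoly_ne_zero hQ
  apply le_antisymm
  · have hinj : Function.Injective (coeffs (K := K) (n := 2) ∘ₗ (DerModule Q).subtype) :=
      coeffs_injective.comp (DerModule Q).injective_subtype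
    have h1 := LinearMap.finrank_le_finrank_of_injective hinj
    rwa [finrank_eq_card_basis b, finrank_fin_fun, Fintype.card_fin] at h1
  · have hli0 := linearIndependent_of_det hdet0
    have hli : LinearIndependent (MvPolynomial (Fin 2) K)
        fun k => (⟨θ k, hθ k⟩ : DerModule Q) :=
      LinearIndependent.of_comp (DerModule Q).subtype hli0
    have h1 := hli.fintype_card_le_finrank
    rwa [finrank_eq_card_basis b, Fintype.card_fin, Fintype.card_fin] at h1

lemma exponents_plane {B : Arrangement K 2} {e : Multiset ℕ} (h : HasExponents B e)
    (hB : B.hyperplanes.Nonempty) : ∃ x y, e = ([x, y] : List ℕ) ∧ x + y ≤ B.hyperplanes.card := by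
  obtain ⟨Q, hQ, l, b, rfl, hb⟩ := h
  obtain ⟨x, y, rfl⟩ := List.length_eq_two.mp (length_eq_two hQ hB b)
  refine ⟨x, y, rfl, ?_⟩
  by_contra! hlt
  obtain ⟨θ, hθ, hdet⟩ := exists_derivations_plane hQ hB
  obtain ⟨b', hb'⟩ : ∃ b' : Basis (Fin 2) (MvPolynomial (Fin 2) K) (DerModule Q),
    ∀ i, IsHomogeneousDer ((b' i : DerModule Q) :
        Derivation K (MvPolynomial (Fin 2) K) (MvPolynomial (Fin 2) K)) (![x, y] i) := by
    refine ⟨b, fun i => ?_⟩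
    have := hb i
    fin_cases i <;> exact this
  have hdvd := det_coeffMat_basis_dvd b' hθ
  rw [hdet] at hdvd
  refine definingPoly_ne_zero hQ ?_
  exact eq_zero_of_dvd_of_degree_lt (isHomogeneous_det fun j k => (hb' k).2 j)
    (isHomogeneous_definingPoly hQ) hdvd (by simpa using hlt)

/-- A rank three arrangement with exponents `1, 19, 25` whose restrictions have at most 18
elements is not inductively free. -/
lemma not_inductivelyFree {A : Arrangement K 3}
    {θ₁ θ₂ : Derivation K (MvPolynomial (Fin 3) K) (MvPolynomial (Fin 3) K)}
    (h₁ : ∀ H ∈ A.hyperplanes, Tangent θ₁ H) (h₂ : ∀ H ∈ A.hyperplanes, Tangent θ₂ H)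
    (hd₁ : ∀ i, (θ₁ (X i)).IsHomogeneous 19) (hd₂ : ∀ i, (θ₂ (X i)).IsHomogeneous 25)
    (hdet : (coeffMat ![eulerDer K 3, θ₁, θ₂]).det ≠ 0) (hcard : A.hyperplanes.card = 45)
    (hres : ∀ H ∈ A.hyperplanes,
      ((A.hyperplanes.erase H).image fun H' => H ⊓ H').card ≤ 18) : ¬ InductivelyFree K A := by
  intro hA
  obtain ⟨H, hH, B, hB, e', e'', he', he'', hle⟩ :=
    hA.exists_restriction (Finset.card_pos.mp (by omega))
  have hBcard := (card_restriction_le hB).trans (hres H hH)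
  have hBne : B.hyperplanes.Nonempty := by
    obtain ⟨e, he⟩ := hB
    rw [he, Finset.image_nonempty, ← Finset.card_pos, Finset.card_erase_of_mem hH]
    omega
  obtain ⟨Q, hQ⟩ := exists_definingPoly A
  obtain ⟨f, hf, rfl⟩ := A.isHyp H hH
  set D := (coeffMat ![eulerDer K 3, θ₁, θ₂]).det with hD
  have key : ∀ (η : Derivation K (MvPolynomial (Fin 3) K) (MvPolynomial (Fin 3) K)) (x : ℕ),
      (∀ H' ∈ A.hyperplanes.erase (LinearMap.ker f), Tangent η H') →
      (∀ i, (η (X i)).IsHomogeneous x) → x ≤ 17 →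
      ∃ p : MvPolynomial (Fin 3) K, (D * linPoly f) • η = p • eulerDer K 3 := by
    intro η x hη hx hx17
    have hT : ∀ H' ∈ A.hyperplanes, Tangent (linPoly f • η) H' := by
      intro H' hH'
      by_cases h : H' = LinearMap.ker f
      · subst h
        exact tangent_smul_of_vanish (fun x hx => by
          rw [eval_linPoly, LinearMap.mem_ker.mp hx]) η
      · exact (hη H' (Finset.mem_erase.mpr ⟨h, hH'⟩)).smul _
    have hdeg : ∀ i, ((linPoly f • η) (X i)).IsHomogeneous (1 + x) :=
      fun i => (isHomogeneous_linPoly f).mul (hx i)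
    have hE : ∀ i, (eulerDer K 3 (X i)).IsHomogeneous 1 := fun i => by
      rw [eulerDer_X]
      exact isHomogeneous_X K i
    refine ⟨(coeffMat (Function.update ![eulerDer K 3, θ₁, θ₂] 0 (linPoly f • η))).det, ?_⟩
    rw [mul_smul, hD, det_smul_derivation, Fin.sum_univ_three]
    have hz1 : (coeffMat (Function.update ![eulerDer K 3, θ₁, θ₂] 1 (linPoly f • η))).det = 0 := by
      refine eq_zero_of_dvd_of_degree_lt (isHomogeneous_definingPoly hQ)
        (isHomogeneous_det (d := ![1, 1 + x, 25]) fun j k => ?_)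
        (definingPoly_dvd_det hQ fun k H' hH' => ?_) ?_
      · fin_cases k
        exacts [hE j, hdeg j, hd₂ j]
      · fin_cases k
        exacts [tangent_eulerDer H', hT H' hH', h₂ H' hH']
      · simp [Fin.sum_univ_three]; omega
    have hz2 : (coeffMat (Function.update ![eulerDer K 3, θ₁, θ₂] 2 (linPoly f • η))).det = 0 := by
      refine eq_zero_of_dvd_of_degree_lt (isHomogeneous_definingPoly hQ)
        (isHomogeneous_det (d := ![1, 19, 1 + x]) fun j k => ?_)
        (definingPoly_dvd_det hQ fun k H' hH' => ?_) ?_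
      · fin_cases k
        exacts [hE j, hd₁ j, hdeg j]
      · fin_cases k
        exacts [tangent_eulerDer H', h₁ H' hH', hT H' hH']
      · simp [Fin.sum_univ_three]; omega
    rw [hz1, hz2, zero_smul, zero_smul, add_zero, add_zero]
    rfl
  have hDf : D * linPoly f ≠ 0 := mul_ne_zero hdet (linPoly_ne_zero hf)
  have hzero : ∀ (η : Derivation K (MvPolynomial (Fin 3) K) (MvPolynomial (Fin 3) K)),
      (∀ H' ∈ A.hyperplanes.erase (LinearMap.ker f), Tangent η H') →
      (∀ i, (η (X i)).IsHomogeneous 0) → η = 0 := by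
    intro η hη hx
    obtain ⟨p, hp⟩ := key η 0 hη hx (by norm_num)
    have hc : ∀ i, ∃ c : K, η (X i) = C c := fun i => by
      by_cases h0 : η (X i) = 0
      · exact ⟨0, by rw [h0, C_0]⟩
      · exact ⟨_, totalDegree_eq_zero_iff_eq_C.mp ((hx i).totalDegree h0)⟩
    choose c hc using hc
    have hpi : ∀ i, D * linPoly f * C (c i) = p * X i := fun i => by
      have := DFunLike.congr_fun hp (X i)
      simpa [hc, eulerDer_X] using this
    have hij : ∀ i j, C (c i) * X j = (C (c j) * X i : MvPolynomial (Fin 3) K) := fun i j => by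
      apply mul_left_cancel₀ hDf
      linear_combination X j * hpi i - X i * hpi j
    have hc0 : ∀ i j, i ≠ j → c i = 0 := fun i j h => by
      have := congrArg (eval (Pi.single j (1 : K))) (hij i j)
      simpa [Pi.single_apply, h] using this
    refine derivation_ext fun i => ?_
    obtain ⟨j, hj⟩ := exists_ne i
    rw [hc, hc0 i j hj.symm, C_0]
    rfl
  obtain ⟨x, y, rfl, hxy⟩ := exponents_plane he'' hBne
  obtain ⟨Q', hQ', l, b, rfl, hb⟩ := he'
  obtain ⟨m, hm, hml⟩ := Multiset.coe_le.mp hle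
  have hml2 := hm.length_eq
  have hms := hm.sum_eq
  obtain ⟨u, v, rfl⟩ := List.length_eq_two.mp hml2
  obtain ⟨g, hg⟩ := List.sublist_iff_exists_fin_orderEmbedding_get_eq.mp hml
  set i : Fin l.length := g ⟨0, by simp⟩
  set j : Fin l.length := g ⟨1, by simp⟩
  have hij : i ≠ j := fun h => by
    have := g.injective h
    simp at this
  have hbi : ∀ k, ∀ H' ∈ A.hyperplanes.erase (LinearMap.ker f), Tangent (b k : Derivation K
      (MvPolynomial (Fin 3) K) (MvPolynomial (Fin 3) K)) H' :=
    fun k => (mem_derModule_iff hQ').mp (b k).2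
  have hi := (hb i).2
  have hj := (hb j).2
  rw [← hg] at hi hj
  simp only [List.get_eq_getElem, List.getElem_cons_succ,
    List.getElem_cons_zero] at hi hj
  have huv : u + v ≤ 18 := by simp at hms; omega
  have hu : u ≠ 0 := fun h => (hb i).1 (hzero _ (hbi i) (h ▸ hi))
  have hv : v ≠ 0 := fun h => (hb j).1 (hzero _ (hbi j) (h ▸ hj))
  obtain ⟨p, hp⟩ := key _ u (hbi i) hi (by omega)
  obtain ⟨q, hq⟩ := key _ v (hbi j) hj (by omega)
  have hrel : (q * (D * linPoly f)) • b i = (p * (D * linPoly f)) • b j := by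
    apply Subtype.ext
    rw [Submodule.coe_smul, Submodule.coe_smul, mul_smul, hp, mul_smul, hq, smul_smul, smul_smul,
      mul_comm]
  have h3 := congrArg (fun w => b.repr w j) hrel
  simp [hij.symm] at h3
  have hp0 : p = 0 := by
    rcases h3 with h3 | h3 | h3
    · exact h3
    · exact absurd h3 hdet
    · exact absurd h3 (linPoly_ne_zero hf)
  rw [hp0, zero_smul, ← smul_zero (D * linPoly f)] at hp
  exact (hb i).1 (smul_derivation_cancel hDf hp)

end NotInductivelyFree

section InvariantTheory
open MvPolynomial
variable {K : Type*} [Field K] {n : ℕ}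

/-- The polynomial function `x ↦ f (T x)`. -/
noncomputable def subst (T : Matrix (Fin n) (Fin n) K) (f : MvPolynomial (Fin n) K) :
    MvPolynomial (Fin n) K := aeval (fun j => ∑ i, C (T j i) * X i) f

lemma eval_subst (T : Matrix (Fin n) (Fin n) K) (f : MvPolynomial (Fin n) K) (x : Fin n → K) :
    eval x (subst T f) = eval (T *ᵥ x) f := by
  have : (aeval x).comp (aeval (fun j => ∑ i, C (T j i) * X i) :
      MvPolynomial (Fin n) K →ₐ[K] MvPolynomial (Fin n) K) = aeval (T *ᵥ x) := by
    refine algHom_ext fun i => ?_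
    simp [mulVec, dotProduct]
  exact DFunLike.congr_fun this f

lemma MvPolynomial.IsHomogeneous.subst {f : MvPolynomial (Fin n) K} {d : ℕ}
    (hf : f.IsHomogeneous d) (T : Matrix (Fin n) (Fin n) K) : (subst T f).IsHomogeneous d := by
  have := hf.aeval (fun j => ∑ i, C (T j i) * X i) (n := 1) fun j =>
    IsHomogeneous.sum _ _ _ fun i _ => by
      simpa using (isHomogeneous_C (Fin n) (T j i)).mul (isHomogeneous_X K i)
  rwa [one_mul] at this

lemma pderiv_subst (T : Matrix (Fin n) (Fin n) K) (f : MvPolynomial (Fin n) K) (i : Fin n) :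
    pderiv i (subst T f) = ∑ j, C (T j i) * subst T (pderiv j f) := by
  induction f using MvPolynomial.induction_on with
  | C a => simp [subst]
  | add p q hp hq =>
    simp only [subst, map_add] at hp hq ⊢
    rw [hp, hq, ← Finset.sum_add_distrib]
    exact Finset.sum_congr rfl fun j _ => (mul_add _ _ _).symm
  | mul_X p k hp =>
    simp only [subst, map_mul, aeval_X, Derivation.leibniz, smul_eq_mul, map_add] at hp ⊢
    rw [hp]
    simp only [mul_add, Finset.sum_add_distrib, Finset.mul_sum]
    congr 1
    · simp [pderiv_X, Pi.single_apply, apply_ite, mul_comm]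
    · exact Finset.sum_congr rfl fun j _ => by ring

/-- The gradient of a polynomial. -/
noncomputable def polyGrad (f : MvPolynomial (Fin n) K) : Fin n → MvPolynomial (Fin n) K :=
  fun i => pderiv i f

/-- The Hessian matrix of a polynomial. -/
noncomputable def polyHess (f : MvPolynomial (Fin n) K) :
    Matrix (Fin n) (Fin n) (MvPolynomial (Fin n) K) := Matrix.of fun i j => pderiv j (pderiv i f)

lemma eval_gradient_subst (T : Matrix (Fin n) (Fin n) K) (f : MvPolynomial (Fin n) K)
    (x : Fin n → K) : (fun i => eval x (polyGrad (subst T f) i)) =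
      Tᵀ *ᵥ fun i => eval (T *ᵥ x) (polyGrad f i) := by
  ext i
  simp [polyGrad, pderiv_subst, eval_subst, mulVec, dotProduct]

lemma eval_hessian_subst (T : Matrix (Fin n) (Fin n) K) (f : MvPolynomial (Fin n) K)
    (x : Fin n → K) : (polyHess (subst T f)).map (eval x) =
      Tᵀ * (polyHess f).map (eval (T *ᵥ x)) * T := by
  ext i k
  simp only [polyHess, Matrix.map_apply, Matrix.of_apply, pderiv_subst, map_sum, pderiv_C_mul,
    map_mul, eval_C, eval_subst, Matrix.mul_apply, Matrix.transpose_apply, Finset.mul_sum,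
    Finset.sum_mul]
  rw [Finset.sum_comm]
  exact Finset.sum_congr rfl fun _ _ => Finset.sum_congr rfl fun _ _ => by ring

lemma det_hessian_subst [Infinite K] (T : Matrix (Fin n) (Fin n) K) (f : MvPolynomial (Fin n) K) :
    (polyHess (subst T f)).det = C (T.det ^ 2) * subst T (polyHess f).det := by
  refine MvPolynomial.funext fun x => ?_
  rw [map_mul, eval_C, eval_subst, RingHom.map_det, RingHom.map_det, RingHom.mapMatrix_apply,
    RingHom.mapMatrix_apply, eval_hessian_subst, det_mul, det_mul, det_transpose]
  ring

lemma MvPolynomial.IsHomogeneous.polyHess {f : MvPolynomial (Fin n) K} {d : ℕ}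
    (hf : f.IsHomogeneous d) (i j : Fin n) : (polyHess f i j).IsHomogeneous (d - 2) :=
  hf.pderiv.pderiv

/-- The vector field obtained by applying the adjugate of the Hessian of `f` to the polyGrad
of `g`. -/
noncomputable def hessianField (f g : MvPolynomial (Fin n) K) :
    Derivation K (MvPolynomial (Fin n) K) (MvPolynomial (Fin n) K) :=
  mkDerivation K (cramer (polyHess f) (polyGrad g))

lemma isHomogeneous_hessianField {f g : MvPolynomial (Fin 3) K} {d e : ℕ}
    (hf : f.IsHomogeneous d) (hg : g.IsHomogeneous e) (i : Fin 3) :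
    (hessianField f g (X i)).IsHomogeneous (2 * (d - 2) + (e - 1)) := by
  rw [hessianField, mkDerivation_X, cramer_apply]
  have := isHomogeneous_det (M := (polyHess f).updateCol i (polyGrad g))
    (d := fun k => if k = i then e - 1 else d - 2) fun j k => by
      split_ifs with h
      · subst h
        rw [updateCol_self]
        exact hg.pderiv
      · rw [updateCol_ne h]
        exact hf.polyHess j k
  convert this using 1
  rw [Fin.sum_univ_three]
  fin_cases i <;> simp <;> ring

lemma vecAt_hessianField (f g : MvPolynomial (Fin n) K) (x : Fin n → K) :
    vecAt (hessianField f g) x =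
      ((polyHess f).map (eval x)).adjugate *ᵥ fun i => eval x (polyGrad g i) := by
  ext i
  rw [vecAt, hessianField, mkDerivation_X, cramer_eq_adjugate_mulVec, ← RingHom.mapMatrix_apply,
    ← RingHom.map_adjugate]
  simp [mulVec, dotProduct]

lemma vecAt_hessianField_subst (T : Matrix (Fin n) (Fin n) K) (f g : MvPolynomial (Fin n) K)
    (x : Fin n → K) : T *ᵥ vecAt (hessianField (subst T f) (subst T g)) x =
      T.det ^ 2 • vecAt (hessianField f g) (T *ᵥ x) := by
  rw [vecAt_hessianField, vecAt_hessianField, eval_hessian_subst, eval_gradient_subst,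
    adjugate_mul_distrib, adjugate_mul_distrib, mulVec_mulVec, mulVec_mulVec]
  have : T * (T.adjugate * (((polyHess f).map (eval (T *ᵥ x))).adjugate * Tᵀ.adjugate) * Tᵀ) =
      T.det ^ 2 • ((polyHess f).map (eval (T *ᵥ x))).adjugate := by
    calc _ = (T * T.adjugate) * ((polyHess f).map (eval (T *ᵥ x))).adjugate *
          (Tᵀ.adjugate * Tᵀ) := by simp only [Matrix.mul_assoc]
      _ = _ := by
        rw [mul_adjugate, adjugate_mul, det_transpose, Matrix.smul_mul, Matrix.one_mul,
          Matrix.mul_smul, Matrix.mul_one, smul_smul, sq]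
  rw [← smul_mulVec, ← this]
  simp only [Matrix.mul_assoc]

end InvariantTheory

section WimanSextic
open MvPolynomial

/-- A term of a polynomial in three variables. -/
noncomputable def term (a : ℂ) (i j k : ℕ) : MvPolynomial (Fin 3) ℂ :=
  C a * X 0 ^ i * X 1 ^ j * X 2 ^ k

lemma eval_term (a : ℂ) (i j k : ℕ) (x : Fin 3 → ℂ) :
    eval x (term a i j k) = a * x 0 ^ i * x 1 ^ j * x 2 ^ k := by simp [term]

lemma isHomogeneous_term (a : ℂ) (i j k : ℕ) {d : ℕ} (h : i + j + k = d) :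
    (term a i j k).IsHomogeneous d := by
  have := (((isHomogeneous_C (Fin 3) a).mul ((isHomogeneous_X ℂ (0 : Fin 3)).pow i)).mul
    ((isHomogeneous_X ℂ (1 : Fin 3)).pow j)).mul ((isHomogeneous_X ℂ (2 : Fin 3)).pow k)
  have hd : 0 + 1 * i + 1 * j + 1 * k = d := by omega
  rwa [hd] at this

lemma pderiv_zero_term (a : ℂ) (i j k : ℕ) :
    pderiv 0 (term a i j k) = term (a * i) (i - 1) j k := by
  simp [term, pderiv_X]
  ring

lemma pderiv_one_term (a : ℂ) (i j k : ℕ) :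
    pderiv 1 (term a i j k) = term (a * j) i (j - 1) k := by
  simp [term, pderiv_X]
  ring

lemma pderiv_two_term (a : ℂ) (i j k : ℕ) :
    pderiv 2 (term a i j k) = term (a * k) i j (k - 1) := by
  simp [term, pderiv_X]
  ring

/-- The Wiman sextic as a polynomial. -/
noncomputable def wimanPoly : MvPolynomial (Fin 3) ℂ :=
  term (27) 6 0 0 + term (-135) 4 1 1 + term (-45) 2 2 2 + term (9) 1 5 0 + term (9) 1 0 5 +
    term (10) 0 3 3

/-- The Hessian determinant of the Wiman sextic. -/
noncomputable def wimanHess : MvPolynomial (Fin 3) ℂ :=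
  term (-14762250) 12 0 0 + term (-88573500) 10 1 1 + term (-24603750) 8 2 2 +
    term (-59049000) 7 5 0 + term (-59049000) 7 0 5 + term (21870000) 6 3 3 + term (6561000) 5 6 1 +
    term (6561000) 5 1 6 + term (-68343750) 4 4 4 + term (-21870000) 3 7 2 +
    term (-21870000) 3 2 7 + term (182250) 2 10 0 + term (9477000) 2 5 5 + term (182250) 2 0 10 +
    term (-1822500) 1 8 3 + term (-1822500) 1 3 8 + term (-121500) 0 11 1 + term (769500) 0 6 6 +
    term (-121500) 0 1 11

lemma eval_wimanPoly (x : Fin 3 → ℂ) : eval x wimanPoly = wimanSextic x := by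
  simp only [wimanPoly, map_add, eval_term, wimanSextic]
  ring

lemma isHomogeneous_wimanPoly : wimanPoly.IsHomogeneous 6 := by
  repeat' refine IsHomogeneous.add ?_ ?_
  all_goals exact isHomogeneous_term _ _ _ _ rfl

lemma isHomogeneous_wimanHess : wimanHess.IsHomogeneous 12 := by
  repeat' refine IsHomogeneous.add ?_ ?_
  all_goals exact isHomogeneous_term _ _ _ _ rfl

lemma det_polyHess_wimanPoly : (polyHess wimanPoly).det = wimanHess := by
  refine MvPolynomial.funext fun x => ?_
  rw [det_fin_three]
  simp only [polyHess, Matrix.of_apply, wimanPoly, wimanHess, map_add, pderiv_zero_term,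
    pderiv_one_term, pderiv_two_term, map_mul, map_sub, eval_term]
  norm_num
  ring

lemma polyGrad_wimanPoly : (fun i => eval ![1, 0, 1] (polyGrad wimanPoly i)) =
    ![171, -135, 45] := by
  ext i
  fin_cases i <;> simp [polyGrad, wimanPoly, pderiv_zero_term, pderiv_one_term, pderiv_two_term,
    eval_term] <;> norm_num

lemma polyGrad_wimanHess : (fun i => eval ![1, 0, 1] (polyGrad wimanHess i)) =
    ![-590125500, -82134000, -293422500] := by
  ext i
  fin_cases i <;> simp [polyGrad, wimanHess, pderiv_zero_term, pderiv_one_term, pderiv_two_term,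
    eval_term] <;> norm_num

lemma polyHess_wimanPoly : (polyHess wimanPoly).map (eval ![1, 0, 1]) =
    !![810, -540, 45; -540, -90, -135; 45, -135, 180] := by
  ext i j
  fin_cases i <;> fin_cases j <;> simp [polyHess, wimanPoly, pderiv_zero_term, pderiv_one_term,
    pderiv_two_term, eval_term] <;> norm_num

lemma polyHess_wimanHess : (polyHess wimanHess).map (eval ![1, 0, 1]) =
    !![-4428310500, -852930000, -2063070000; -852930000, -92947500, -50544000; -2063070000, -50544000, -1164577500] := by
  ext i j
  fin_cases i <;> fin_cases j <;> simp [polyHess, wimanHess, pderiv_zero_term, pderiv_one_term,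
    pderiv_two_term, eval_term] <;> norm_num

lemma hessianField_wimanPoly : vecAt (hessianField wimanPoly wimanHess) ![1, 0, 1] =
    ![-9748251787500, -90539585662500, 54556847325000] := by
  rw [vecAt_hessianField, polyHess_wimanPoly, polyGrad_wimanHess, adjugate_fin_three_of]
  ext i
  fin_cases i <;> simp [mulVec, dotProduct, Fin.sum_univ_three] <;> norm_num

lemma hessianField_wimanHess : vecAt (hessianField wimanHess wimanPoly) ![1, 0, 1] =
    ![131402548656537750000, -204526472518541250000, -246970619140691250000] := by
  rw [vecAt_hessianField, polyHess_wimanHess, polyGrad_wimanPoly, adjugate_fin_three_of]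
  ext i
  fin_cases i <;> simp [mulVec, dotProduct, Fin.sum_univ_three] <;> norm_num

variable {s P Q : Matrix (Fin 3) (Fin 3) ℂ}

lemma subst_wimanPoly (hPQ : P * Q = 1)
    (h : ∀ u, wimanSextic ((Q * s * P) *ᵥ u) = wimanSextic u) :
    subst s (subst Q wimanPoly) = subst Q wimanPoly := by
  refine MvPolynomial.funext fun x => ?_
  rw [eval_subst, eval_subst, eval_subst, eval_wimanPoly, eval_wimanPoly, ← h (Q *ᵥ x),
    mulVec_mulVec, mulVec_mulVec, Matrix.mul_assoc, hPQ, Matrix.mul_one]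

lemma subst_wimanHess (hPQ : P * Q = 1) (hs : s.det = 1 ∨ s.det = -1)
    (h : ∀ u, wimanSextic ((Q * s * P) *ᵥ u) = wimanSextic u) :
    subst s (subst Q wimanHess) = subst Q wimanHess := by
  have hs2 : s.det ^ 2 = 1 := by rcases hs with h | h <;> simp [h]
  have h1 := det_hessian_subst Q wimanPoly
  have h2 := det_hessian_subst s (subst Q wimanPoly)
  have hQ : Q.det ^ 2 ≠ 0 := pow_ne_zero _ (det_ne_zero_of_left_inverse hPQ)
  rw [subst_wimanPoly hPQ h, h1, det_polyHess_wimanPoly, hs2, C_1, one_mul] at h2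
  have h3 : subst s (C (Q.det ^ 2) * subst Q wimanHess) =
      C (Q.det ^ 2) * subst s (subst Q wimanHess) := by
    simp [subst]
  rw [h3] at h2
  exact (mul_left_cancel₀ (by simpa using hQ) h2).symm

lemma tangent_hessianField {f g : MvPolynomial (Fin 3) ℂ} (hf : subst s f = f)
    (hg : subst s g = g) (hs : s.det = 1 ∨ s.det = -1) {H : Submodule ℂ (Fin 3 → ℂ)}
    (hH : ∀ x, x ∈ H ↔ s *ᵥ x = x) : Tangent (hessianField f g) H := by
  intro x hx
  have hs2 : s.det ^ 2 = 1 := by rcases hs with h | h <;> simp [h]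
  have := vecAt_hessianField_subst s f g x
  rwa [hf, hg, (hH x).mp hx, hs2, one_smul, ← hH] at this

lemma det_coeffMat_hessianField (hPQ : P * Q = 1) :
    (coeffMat ![eulerDer ℂ 3, hessianField (subst Q wimanPoly) (subst Q wimanHess),
      hessianField (subst Q wimanHess) (subst Q wimanPoly)]).det ≠ 0 := by
  intro h0
  have hQP : Q * P = 1 := mul_eq_one_comm.mp hPQ
  set p : Fin 3 → ℂ := ![1, 0, 1] with hp
  have hx : Q *ᵥ (P *ᵥ p) = p := by rw [mulVec_mulVec, hQP, one_mulVec]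
  have hQ : Q.det ^ 2 ≠ 0 := pow_ne_zero _ (det_ne_zero_of_left_inverse hPQ)
  have h1 := vecAt_hessianField_subst Q wimanPoly wimanHess (P *ᵥ p)
  have h2 := vecAt_hessianField_subst Q wimanHess wimanPoly (P *ᵥ p)
  have hE : Q *ᵥ vecAt (eulerDer ℂ 3) (P *ᵥ p) = p := by
    rwa [vecAt_eulerDer]
  rw [hx, hp, hessianField_wimanPoly] at h1
  rw [hx, hp, hessianField_wimanHess] at h2
  have h3 := congrArg (eval (P *ᵥ p)) h0
  rw [RingHom.map_det, map_zero] at h3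
  have h4 : (Q * (eval (P *ᵥ p)).mapMatrix (coeffMat ![eulerDer ℂ 3,
      hessianField (subst Q wimanPoly) (subst Q wimanHess),
      hessianField (subst Q wimanHess) (subst Q wimanPoly)])).det = 0 := by
    rw [det_mul, h3, mul_zero]
  have h5 : Q * (eval (P *ᵥ p)).mapMatrix (coeffMat ![eulerDer ℂ 3,
      hessianField (subst Q wimanPoly) (subst Q wimanHess),
      hessianField (subst Q wimanHess) (subst Q wimanPoly)]) =
      !![1, -9748251787500, 131402548656537750000; 0, -90539585662500, -204526472518541250000; 1, 54556847325000, -246970619140691250000] * diagonal ![1, Q.det ^ 2, Q.det ^ 2] := by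
    ext i k
    rw [mul_diagonal]
    fin_cases k
    · refine (congrFun hE i).trans ?_
      fin_cases i <;> simp [hp]
    · refine (congrFun h1 i).trans ?_
      fin_cases i <;> simp [mul_comm]
    · refine (congrFun h2 i).trans ?_
      fin_cases i <;> simp [mul_comm]
  rw [h5, det_mul, det_diagonal, Fin.prod_univ_three, det_fin_three] at h4
  refine mul_ne_zero ?_ ?_ h4
  · simp
    norm_num
  · simpa using hQ

end WimanSextic

section Assembly
open MvPolynomial

lemma hasExponents_of_fields {A : Arrangement ℂ 3}
    {θ₁ θ₂ : Derivation ℂ (MvPolynomial (Fin 3) ℂ) (MvPolynomial (Fin 3) ℂ)}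
    (h₁ : ∀ H ∈ A.hyperplanes, Tangent θ₁ H) (h₂ : ∀ H ∈ A.hyperplanes, Tangent θ₂ H)
    (hd₁ : ∀ i, (θ₁ (X i)).IsHomogeneous 19) (hd₂ : ∀ i, (θ₂ (X i)).IsHomogeneous 25)
    (hdet : (coeffMat ![eulerDer ℂ 3, θ₁, θ₂]).det ≠ 0) (hcard : A.hyperplanes.card = 45) :
    HasExponents A {1, 19, 25} := by
  obtain ⟨Q, hQ⟩ := exists_definingPoly A
  have hE : ∀ i, (eulerDer ℂ 3 (X i)).IsHomogeneous 1 := fun i => by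
    rw [eulerDer_X]
    exact isHomogeneous_X ℂ i
  obtain ⟨b, hb⟩ := exists_basis_of_det_ne_zero (d := ![1, 19, 25]) hQ
    (θ := ![eulerDer ℂ 3, θ₁, θ₂]) (fun k H hH => by
      fin_cases k
      exacts [tangent_eulerDer H, h₁ H hH, h₂ H hH])
    (fun k i => by
      fin_cases k
      exacts [hE i, hd₁ i, hd₂ i])
    (by rw [hcard, Fin.sum_univ_three]; rfl) hdet
  refine ⟨Q, hQ, [1, 19, 25], b, rfl, fun i => ⟨fun h => b.ne_zero i (Subtype.ext h), fun k => ?_⟩⟩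
  have := hb i
  rw [this]
  fin_cases i
  exacts [hE k, hd₁ k, hd₂ k]

end Assembly

/-- The reflection arrangement of the complex reflection group `G₂₇` is free with
exponents `{{1, 19, 25}}` but is not inductively free. -/
theorem G27_free_not_inductivelyFree
    (W : Subgroup (GL (Fin 3) ℂ)) (hfin : Finite W)
    (hcard : Nat.card W = 2160)
    (hrefl : W = Subgroup.closure {g : GL (Fin 3) ℂ | g ∈ W ∧ IsReflection g})
    (hirr : ∀ U : Submodule ℂ (Fin 3 → ℂ),
      (∀ g ∈ W, U.map (Matrix.toLin' (g : Matrix (Fin 3) (Fin 3) ℂ)) ≤ U) →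
        U = ⊥ ∨ U = ⊤)
    (𝓐 : Set (Submodule ℂ (Fin 3 → ℂ)))
    (h𝓐 : 𝓐 = {X | ∃ g ∈ W, IsReflection g ∧ X = fixedSp g})
    (CA : Arrangement ℂ 3) (hCA : ↑CA.hyperplanes = 𝓐) :
    HasExponents CA ({1, 19, 25} : Multiset ℕ) ∧ ¬ InductivelyFree ℂ CA := by
  let ρ : W →* M3 := (Units.coeHom M3).comp W.subtype
  have hρa : ∀ g : W, ρ g = ((g : GL (Fin 3) ℂ) : M3) := fun _ => rfl
  have hρ : Function.Injective ρ := Units.val_injective.comp W.subtype_injective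
  have hS : Schur ρ := schur_of_irreducible fun U hU => hirr U fun g hg => hU ⟨g, hg⟩
  have hR : ∀ g : W, IsReflection (g : GL (Fin 3) ℂ) → Refl (ρ g) := fun g hg =>
    refl_of_finrank (n := Nat.card W) (by omega) (rho_pow_card ρ g) hg.2
  have hgen : Subgroup.closure {r | Refl (ρ r)} = ⊤ := by
    rw [eq_top_iff]
    rintro ⟨g, hg⟩ -
    have hle : W ≤ (Subgroup.closure {r | Refl (ρ r)}).map W.subtype := by
      conv_lhs => rw [hrefl]
      rw [Subgroup.closure_le]
      rintro h ⟨hW, hh⟩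
      exact ⟨⟨h, hW⟩, Subgroup.subset_closure (hR ⟨h, hW⟩ hh), rfl⟩
    obtain ⟨g', hg', rfl⟩ := hle hg
    exact hg'
  have h𝓗 : ∀ H, H ∈ CA.hyperplanes ↔ ∃ g : W, g ≠ 1 ∧
      finrank ℂ (LinearMap.ker (toLin' (ρ g - 1))) = 2 ∧
      H = LinearMap.ker (toLin' (ρ g - 1)) := by
    intro H
    rw [← Finset.mem_coe, hCA, h𝓐]
    constructor
    · rintro ⟨g, hg, hr, rfl⟩
      exact ⟨⟨g, hg⟩, fun h => hr.1 (congrArg Subtype.val h), hr.2, rfl⟩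
    · rintro ⟨g, h1, h2, rfl⟩
      exact ⟨g, g.2, ⟨fun h => h1 (Subtype.ext h), h2⟩, rfl⟩
  obtain ⟨h45, hmir, hres⟩ := mirrors hρ hcard hS hgen h𝓗
  obtain ⟨P, Q, hPQ, hQP, hinv⟩ := exists_invariant_sextic hρ hcard hS hgen
  have hT1 : ∀ H ∈ CA.hyperplanes,
      Tangent (hessianField (subst Q wimanPoly) (subst Q wimanHess)) H := fun H hH => by
    obtain ⟨g, hg, hx⟩ := hmir H hH
    exact tangent_hessianField (subst_wimanPoly hPQ (hinv g))
      (subst_wimanHess hPQ (Or.inr hg) (hinv g)) (Or.inr hg) hx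
  have hT2 : ∀ H ∈ CA.hyperplanes,
      Tangent (hessianField (subst Q wimanHess) (subst Q wimanPoly)) H := fun H hH => by
    obtain ⟨g, hg, hx⟩ := hmir H hH
    exact tangent_hessianField (subst_wimanHess hPQ (Or.inr hg) (hinv g))
      (subst_wimanPoly hPQ (hinv g)) (Or.inr hg) hx
  have hF := isHomogeneous_wimanPoly.subst Q
  have hG := isHomogeneous_wimanHess.subst Q
  have hdet := det_coeffMat_hessianField hPQ
  exact ⟨hasExponents_of_fields hT1 hT2 (isHomogeneous_hessianField hF hG)
    (isHomogeneous_hessianField hG hF) hdet h45, not_inductivelyFree hT1 hT2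
    (isHomogeneous_hessianField hF hG) (isHomogeneous_hessianField hG hF) hdet h45 hres⟩
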